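/- Asymptotic formula in Waring's problem via the improved Hua inequality: for every integer k ≥ 2 and every integer s₀ ≥ k² + 1 − max_{1 ≤ s ≤ k} ⌈s(k−s−1)/(k−s+1)⌉ (where ⌈t⌉ is the smallest integer no smaller than t), one has R_{s₀,k}(n) = (Γ(1 + 1/k)^{s₀} / Γ(s₀/k)) · 𝔖_{s₀,k}(n) · n^{s₀/k − 1} + o(n^{s₀/k − 1}) as n → ∞. -/

import Mathlib

/-- `e t = e^{2πit}`. -/
noncomputable def e (t : ℝ) : ℂ := Complex.exp (2 * Real.pi * Complex.I * t)

/-- `R_{s,k}(n)`: the number of representations of `n` as a sum of `s` `k`-th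
powers of positive integers. -/
noncomputable def R (s k n : ℕ) : ℕ :=
  Nat.card {m : Fin s → ℕ // (∀ i, 0 < m i) ∧ ∑ i, m i ^ k = n}

/-- The singular series
`𝔖_{s,k}(n) = ∑_{q≥1} ∑_{1≤a≤q, (a,q)=1} (q⁻¹ ∑_{r=1}^q e(a r^k / q))^s e(-n a / q)`. -/
noncomputable def singularSeries (s k n : ℕ) : ℂ :=
  ∑' q : ℕ, ∑ a ∈ (Finset.Icc 1 q).filter (fun a => Nat.gcd a q = 1),
    ((q : ℂ)⁻¹ * ∑ r ∈ Finset.Icc 1 q, e ((a * r ^ k : ℕ) / (q : ℝ))) ^ s *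
      e (-((n * a : ℕ) : ℝ) / q)

namespace Waring

section

open Finset

/-- Minkowski's inequality for finitely many nonnegative functions on a finite type. -/
lemma minkowski_finset {X α : Type*} [Fintype X] (A : Finset α) (F : α → X → ℝ)
    (hF : ∀ I x, 0 ≤ F I x) {s : ℕ} (hs : 1 ≤ s) :
    (∑ x, (∑ I ∈ A, F I x) ^ s) ^ ((s : ℝ)⁻¹) ≤ ∑ I ∈ A, (∑ x, F I x ^ s) ^ ((s : ℝ)⁻¹) := by
  classical
  have hs' : (1 : ℝ) ≤ s := by exact_mod_cast hs
  induction A using Finset.induction_on with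
  | empty =>
    have h1 : (s : ℝ)⁻¹ ≠ 0 := by positivity
    have h2 : s ≠ 0 := by omega
    simp [h2, Real.zero_rpow h1]
  | insert a A ha ih =>
    rw [sum_insert ha]
    refine le_trans ?_ (add_le_add_right ih _)
    have := Real.Lp_add_le_of_nonneg (s := univ) (f := F a) (g := fun x => ∑ I ∈ A, F I x) (p := s) hs'
      (fun i _ => hF a i) (fun i _ => sum_nonneg fun I _ => hF I i)
    simp only [one_div, Real.rpow_natCast] at this
    simpa [sum_insert ha] using this

lemma minkowski_pow {X α : Type*} [Fintype X] (A : Finset α) (F : α → X → ℝ) (G : X → ℝ)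
    (hG : ∀ x, 0 ≤ G x) (hF : ∀ I x, 0 ≤ F I x) {s : ℕ} (hs : 1 ≤ s) :
    ∑ x, G x * (∑ I ∈ A, F I x) ^ s ≤ (∑ I ∈ A, (∑ x, G x * F I x ^ s) ^ ((s : ℝ)⁻¹)) ^ s := by
  have hs0 : s ≠ 0 := by omega
  have h := minkowski_finset A (fun I x => G x ^ ((s : ℝ)⁻¹) * F I x)
    (fun I x => mul_nonneg (Real.rpow_nonneg (hG x) _) (hF I x)) hs
  have e1 : ∀ x, (G x ^ ((s : ℝ)⁻¹)) ^ s = G x := fun x => Real.rpow_inv_natCast_pow (hG x) hs0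
  simp only [← mul_sum, mul_pow, e1] at h
  have h0 : 0 ≤ ∑ x, G x * (∑ I ∈ A, F I x) ^ s :=
    sum_nonneg fun x _ => mul_nonneg (hG x) (pow_nonneg (sum_nonneg fun I _ => hF I x) _)
  calc _ = ((∑ x, G x * (∑ I ∈ A, F I x) ^ s) ^ ((s : ℝ)⁻¹)) ^ s :=
        (Real.rpow_inv_natCast_pow h0 hs0).symm
    _ ≤ _ := pow_le_pow_left₀ (Real.rpow_nonneg h0 _) h s

variable {p : ℕ} [Fact p.Prime]

/-- The additive character of level `N` on the `p`-adic integers. -/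
noncomputable def chi (N : ℕ) (z : ℤ_[p]) : ℂ :=
  haveI : NeZero (p ^ N) := ⟨pow_ne_zero _ (Fact.out : p.Prime).ne_zero⟩
  ZMod.stdAddChar (PadicInt.toZModPow N z)

/-- The additive character on `ZMod (p ^ N)`. -/
noncomputable def psi (N : ℕ) (z : ZMod (p ^ N)) : ℂ :=
  haveI : NeZero (p ^ N) := ⟨pow_ne_zero _ (Fact.out : p.Prime).ne_zero⟩
  ZMod.stdAddChar z

instance neZeroPow (N : ℕ) : NeZero (p ^ N) := ⟨pow_ne_zero _ (Fact.out : p.Prime).ne_zero⟩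

lemma psi_add (N : ℕ) (x y : ZMod (p ^ N)) : psi N (x + y) = psi N x * psi N y := by
  simp [psi, AddChar.map_add_eq_mul]

lemma psi_zero (N : ℕ) : psi N (0 : ZMod (p ^ N)) = 1 := by simp [psi]

lemma norm_psi (N : ℕ) (x : ZMod (p ^ N)) : ‖psi N x‖ = 1 := by
  simp [psi, AddChar.norm_apply]

lemma psi_sum_mul (N : ℕ) (x : ZMod (p ^ N)) :
    ∑ t : ZMod (p ^ N), psi N (t * x) = if x = 0 then (p ^ N : ℂ) else 0 := by
  simp only [psi]
  have := AddChar.sum_mulShift (R := ZMod (p ^ N)) x (ψ := ZMod.stdAddChar)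
    (ZMod.isPrimitive_stdAddChar _)
  rw [this]
  simp [ZMod.card]

lemma psi_pow_mul (N M : ℕ) (h : N ≤ M) (z : ℤ_[p]) :
    psi M (PadicInt.toZModPow M ((p : ℤ_[p]) ^ (M - N) * z)) = psi N (PadicInt.toZModPow N z) := by
  -- write both through an integer representative of `z`
  obtain ⟨m, w, hm⟩ : ∃ (m : ℕ) (w : ℤ_[p]), z = m + (p : ℤ_[p]) ^ M * w := by
    have := PadicInt.appr_spec M z
    rw [Ideal.mem_span_singleton] at this
    obtain ⟨w, hw⟩ := this
    exact ⟨z.appr M, w, by rw [← hw]; ring⟩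
  have hp0 : (p : ℂ) ≠ 0 := by exact_mod_cast (Fact.out : p.Prime).ne_zero
  have z1 : ((p : ZMod (p ^ M))) ^ M = 0 := by
    have := ZMod.natCast_self (p ^ M); push_cast at this; exact this
  have z2 : ((p : ZMod (p ^ N))) ^ M = 0 := by
    have := ZMod.natCast_self (p ^ N); push_cast at this
    rw [← Nat.sub_add_cancel h, pow_add, this, mul_zero]
  have h1 : PadicInt.toZModPow M ((p : ℤ_[p]) ^ (M - N) * z) = ((p ^ (M - N) * m : ℕ) : ZMod (p ^ M)) := by
    rw [hm]; simp [mul_add, z1]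
  have h2 : PadicInt.toZModPow N z = ((m : ℕ) : ZMod (p ^ N)) := by
    rw [hm]; simp [z2]
  rw [h1, h2]
  simp only [psi]
  have e1 := ZMod.stdAddChar_coe (N := p ^ M) ((p ^ (M - N) * m : ℕ) : ℤ)
  have e2 := ZMod.stdAddChar_coe (N := p ^ N) (m : ℤ)
  rw [Int.cast_natCast] at e1 e2
  rw [e1, e2]
  congr 1
  push_cast
  have : (p : ℂ) ^ M = (p : ℂ) ^ (M - N) * (p : ℂ) ^ N := by rw [← pow_add, Nat.sub_add_cancel h]
  rw [this]
  field_simp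

end

section

open Finset Polynomial

variable {p : ℕ} [Fact p.Prime]

/-- The triangular number `k (k + 1) / 2`, half of the critical exponent of degree `k`. -/
def tri (k : ℕ) : ℕ := k * (k + 1) / 2

lemma two_tri (k : ℕ) : 2 * tri k = k * (k + 1) :=
  Nat.mul_div_cancel' (Nat.even_mul_succ_self k).two_dvd

lemma tri_succ (k : ℕ) : tri (k + 1) = tri k + (k + 1) := by
  have h1 := two_tri k
  have h2 := two_tri (k + 1)
  nlinarith

lemma tri_pos {k : ℕ} (hk : 1 ≤ k) : 1 ≤ tri k := by
  have h1 := two_tri k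
  nlinarith

/-- Curves that are congruent to the moment curve modulo `p`. -/
def NearMoment (p : ℕ) [Fact p.Prime] (k : ℕ) (φ : Fin k → ℤ_[p][X]) : Prop :=
  ∀ j, C (p : ℤ_[p]) ∣ φ j - X ^ ((j : ℕ) + 1)

/-- The phase `ψ(h · φ(z))`. -/
noncomputable def phase {k : ℕ} (N : ℕ) (h : Fin k → ZMod (p ^ N)) (φ : Fin k → ℤ_[p][X])
    (z : ℤ_[p]) : ℂ :=
  psi N (∑ j, h j * PadicInt.toZModPow N ((φ j).eval z))

/-- `Dec p k B D`: the `ℓ²L^{k(k+1)}` decoupling inequality at scale `p ^ B` holds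
with constant `D` for all curves near the moment curve. -/
def Dec (p : ℕ) [Fact p.Prime] (k B : ℕ) (D : ℝ) : Prop :=
  ∀ φ : Fin k → ℤ_[p][X], NearMoment p k φ →
  ∀ (ι : Type) (S : Finset ι) (c : ι → ℂ) (ν : ι → ℤ_[p]) (α : Type) [Fintype α] [DecidableEq α]
    (lab : ι → α),
    (∀ i ∈ S, ∀ j ∈ S, lab i = lab j ↔ (p : ℤ_[p]) ^ B ∣ ν i - ν j) →
    ∑ h : Fin k → ZMod (p ^ (k * B)), ‖∑ i ∈ S, c i * phase (k * B) h φ (ν i)‖ ^ (2 * tri k) ≤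
      D * (∑ I : α, (∑ h : Fin k → ZMod (p ^ (k * B)),
        ‖∑ i ∈ S with lab i = I, c i * phase (k * B) h φ (ν i)‖ ^ (2 * tri k)) ^
          ((tri k : ℝ)⁻¹)) ^ tri k

lemma Dec.mono {k B : ℕ} {D D' : ℝ} (h : Dec p k B D) (hD : D ≤ D') : Dec p k B D' := by
  intro φ hφ ι S c ν α _ _ lab hlab
  refine (h φ hφ ι S c ν α lab hlab).trans ?_
  gcongr

/-- Transference: decoupling for any weights on which the frequency group acts. -/
lemma Dec.ext {k B : ℕ} {D : ℝ} (hk : 1 ≤ k) (hDec : Dec p k B D) (hD : 0 ≤ D)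
    {φ : Fin k → ℤ_[p][X]} (hφ : NearMoment p k φ)
    {ι : Type} (S : Finset ι) (ν : ι → ℤ_[p]) {α : Type} [Fintype α] [DecidableEq α]
    (lab : ι → α) (hlab : ∀ i ∈ S, ∀ j ∈ S, lab i = lab j ↔ (p : ℤ_[p]) ^ B ∣ ν i - ν j)
    {X : Type} [Fintype X] (T : (Fin k → ZMod (p ^ (k * B))) → Equiv.Perm X)
    (G : X → ℝ) (hG : ∀ x, 0 ≤ G x) (hGT : ∀ h x, G (T h x) = G x)
    (w : ι → X → ℂ) (u : (Fin k → ZMod (p ^ (k * B))) → X → ℂ) (hu : ∀ h x, ‖u h x‖ = 1)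
    (hw : ∀ i ∈ S, ∀ h x, w i (T h x) = u h x * w i x * phase (k * B) h φ (ν i)) :
    ∑ x, G x * ‖∑ i ∈ S, w i x‖ ^ (2 * tri k) ≤
      D * (∑ I : α, (∑ x, G x * ‖∑ i ∈ S with lab i = I, w i x‖ ^ (2 * tri k)) ^
          ((tri k : ℝ)⁻¹)) ^ tri k := by
  classical
  set s := tri k with hs
  have hs1 : 1 ≤ s := tri_pos hk
  have hs0 : s ≠ 0 := by omega
  set F : α → X → ℝ := fun I x =>
    (∑ h : Fin k → ZMod (p ^ (k * B)), ‖∑ i ∈ S with lab i = I, w i x * phase (k * B) h φ (ν i)‖ ^ (2 * s)) ^ ((s : ℝ)⁻¹)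
    with hF
  have hF0 : ∀ I x, 0 ≤ F I x := fun I x => Real.rpow_nonneg (sum_nonneg fun _ _ => by positivity) _
  have key : ∀ S' ⊆ S, ∑ x, G x * ∑ h : Fin k → ZMod (p ^ (k * B)), ‖∑ i ∈ S', w i x * phase (k * B) h φ (ν i)‖ ^ (2 * s)
      = Fintype.card (Fin k → ZMod (p ^ (k * B))) * ∑ x, G x * ‖∑ i ∈ S', w i x‖ ^ (2 * s) := by
    intro S' hS'
    have e1 : ∀ h : Fin k → ZMod (p ^ (k * B)), ∑ x, G x * ‖∑ i ∈ S', w i x‖ ^ (2 * s)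
        = ∑ x, G x * ‖∑ i ∈ S', w i x * phase (k * B) h φ (ν i)‖ ^ (2 * s) := by
      intro h
      rw [← Equiv.sum_comp (T h)]
      refine sum_congr rfl fun x _ => ?_
      rw [hGT]
      congr 2
      have : ∑ i ∈ S', w i (T h x) = u h x * ∑ i ∈ S', w i x * phase (k * B) h φ (ν i) := by
        rw [mul_sum]
        exact sum_congr rfl fun i hi => by rw [hw i (hS' hi)]; ring
      rw [this, norm_mul, hu, one_mul]
    calc _ = ∑ h : Fin k → ZMod (p ^ (k * B)), ∑ x, G x * ‖∑ i ∈ S', w i x * phase (k * B) h φ (ν i)‖ ^ (2 * s) := by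
          rw [sum_comm]; simp only [mul_sum]
      _ = _ := by simp [← e1]
  have hcard : (0 : ℝ) < Fintype.card (Fin k → ZMod (p ^ (k * B))) := by exact_mod_cast Fintype.card_pos
  have h1 : (Fintype.card (Fin k → ZMod (p ^ (k * B))) : ℝ) * ∑ x, G x * ‖∑ i ∈ S, w i x‖ ^ (2 * s)
      ≤ Fintype.card (Fin k → ZMod (p ^ (k * B))) * (D * (∑ I : α, (∑ x, G x * ‖∑ i ∈ S with lab i = I, w i x‖ ^ (2 * s)) ^
          ((s : ℝ)⁻¹)) ^ s) := by
    rw [← key S subset_rfl]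
    calc _ ≤ ∑ x, G x * (D * (∑ I, F I x) ^ s) := by
          refine sum_le_sum fun x _ => mul_le_mul_of_nonneg_left ?_ (hG x)
          exact hDec φ hφ ι S (fun i => w i x) ν α lab hlab
      _ = D * ∑ x, G x * (∑ I, F I x) ^ s := by
          rw [mul_sum]; exact sum_congr rfl fun _ _ => by ring
      _ ≤ D * (∑ I, (∑ x, G x * F I x ^ s) ^ ((s : ℝ)⁻¹)) ^ s :=
          mul_le_mul_of_nonneg_left (minkowski_pow univ F G hG hF0 hs1) hD
      _ = D * (∑ I, ((Fintype.card (Fin k → ZMod (p ^ (k * B))) : ℝ) ^ ((s : ℝ)⁻¹) *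
            (∑ x, G x * ‖∑ i ∈ S with lab i = I, w i x‖ ^ (2 * s)) ^ ((s : ℝ)⁻¹))) ^ s := by
          congr 2
          refine sum_congr rfl fun I _ => ?_
          rw [← Real.mul_rpow hcard.le
            (sum_nonneg fun x _ => mul_nonneg (hG x) (by positivity)),
            ← key _ (filter_subset _ _)]
          congr 1
          refine sum_congr rfl fun x _ => ?_
          rw [hF]
          simp only
          rw [Real.rpow_inv_natCast_pow (sum_nonneg fun _ _ => by positivity) hs0]
      _ = _ := by
          rw [← mul_sum, mul_pow, Real.rpow_inv_natCast_pow hcard.le hs0]; ring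
  exact le_of_mul_le_mul_left h1 hcard

end

section

open Finset Polynomial

variable {p : ℕ} [Fact p.Prime]

/-- The matrix of Taylor coefficients of orders `1, …, l` of a curve at a point. -/
noncomputable def hasseMatrix {l : ℕ} (φ : Fin l → ℤ_[p][X]) (c : ℤ_[p]) :
    Matrix (Fin l) (Fin l) ℤ_[p] :=
  fun i j => (taylor c (φ i)).coeff ((j : ℕ) + 1)

lemma coeff_eq_of_coeff_lt {R : Type*} [CommRing R] (P : R[X]) (n : ℕ)
    (h : ∀ j ≤ n, P.coeff j = 0) : ∃ Q, P = X ^ (n + 1) * Q := by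
  obtain ⟨Q, hQ⟩ := X_pow_dvd_iff.mpr (fun d hd => h d (Nat.lt_succ_iff.mp hd))
  exact ⟨Q, hQ⟩

/-- Linear change of coordinates bringing a nondegenerate curve to normal form at a point. -/
lemma exists_normal_form {l : ℕ} (φ : Fin l → ℤ_[p][X]) (c : ℤ_[p])
    (h : IsUnit (hasseMatrix φ c).det) :
    ∃ (U : Matrix (Fin l) (Fin l) ℤ_[p]) (τ : Fin l → ℤ_[p][X]), ∀ i,
      ∑ j, C (U i j) * (taylor c (φ j) - C ((φ j).eval c)) =
        X ^ ((i : ℕ) + 1) + X ^ (l + 1) * τ i := by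
  set H := hasseMatrix φ c
  have hU : H⁻¹ * H = 1 := Matrix.nonsing_inv_mul H h
  have : ∀ i, ∃ τ, ∑ j, C (H⁻¹ i j) * (taylor c (φ j) - C ((φ j).eval c)) -
      X ^ ((i : ℕ) + 1) = X ^ (l + 1) * τ := by
    intro i
    apply coeff_eq_of_coeff_lt
    intro m hm
    rw [coeff_sub, finsetSum_coeff]
    simp only [coeff_C_mul, coeff_sub]
    rcases Nat.eq_zero_or_pos m with rfl | hm0
    · simp [taylor_coeff_zero]
    · obtain ⟨m, rfl⟩ : ∃ m', m = m' + 1 := ⟨m - 1, by omega⟩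
      have e1 : ∑ j, H⁻¹ i j * ((taylor c (φ j)).coeff (m + 1) - (C ((φ j).eval c)).coeff (m + 1))
          = (H⁻¹ * H) i ⟨m, by omega⟩ := by
        rw [Matrix.mul_apply]
        refine sum_congr rfl fun j _ => ?_
        rw [coeff_C_succ, sub_zero]; rfl
      rw [e1, hU, Matrix.one_apply, coeff_X_pow]
      simp only [Fin.ext_iff, add_left_inj]
      simp only [eq_comm (a := m), sub_self]
  choose τ hτ using this
  exact ⟨H⁻¹, τ, fun i => by rw [← hτ i]; ring⟩

lemma normal_form_eval {l : ℕ} {φ : Fin l → ℤ_[p][X]} {c : ℤ_[p]}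
    {U : Matrix (Fin l) (Fin l) ℤ_[p]} {τ : Fin l → ℤ_[p][X]}
    (h : ∀ i, ∑ j, C (U i j) * (taylor c (φ j) - C ((φ j).eval c)) =
        X ^ ((i : ℕ) + 1) + X ^ (l + 1) * τ i) (i : Fin l) (m : ℤ_[p]) :
    ∑ j, U i j * ((φ j).eval (c + m) - (φ j).eval c) =
      m ^ ((i : ℕ) + 1) + m ^ (l + 1) * (τ i).eval m := by
  have := congrArg (eval m) (h i)
  simp only [eval_finsetSum, eval_mul, eval_C, eval_sub, eval_add, eval_pow, eval_X,
    taylor_eval] at this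
  rw [← this]
  exact sum_congr rfl fun j _ => by rw [add_comm c m]

/-- The rescaled curve `X^(i+1) + p^(a(l-i)) X^(l+1) τ_i(p^a X)`. -/
noncomputable def rescaled {l : ℕ} (a : ℕ) (τ : Fin l → ℤ_[p][X]) (i : Fin l) : ℤ_[p][X] :=
  X ^ ((i : ℕ) + 1) +
    C ((p : ℤ_[p]) ^ (a * (l - i))) * (X ^ (l + 1) * (τ i).comp (C ((p : ℤ_[p]) ^ a) * X))

lemma rescaled_nearMoment {l a : ℕ} (ha : 1 ≤ a) (τ : Fin l → ℤ_[p][X]) :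
    NearMoment p l (rescaled a τ) := by
  intro i
  rw [rescaled, add_sub_cancel_left]
  refine Dvd.dvd.mul_right (C_dvd_iff_dvd_coeff _ _ |>.mpr fun n => ?_) _
  rw [coeff_C]
  split_ifs
  · refine dvd_pow_self _ ?_
    have := i.2
    exact Nat.mul_ne_zero (by omega) (by omega)
  · exact dvd_zero _

lemma rescaled_eval {l a : ℕ} (τ : Fin l → ℤ_[p][X]) (i : Fin l) (m : ℤ_[p]) :
    ((p : ℤ_[p]) ^ a * m) ^ ((i : ℕ) + 1) +
      ((p : ℤ_[p]) ^ a * m) ^ (l + 1) * (τ i).eval ((p : ℤ_[p]) ^ a * m) =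
    (p : ℤ_[p]) ^ (a * ((i : ℕ) + 1)) * (rescaled a τ i).eval m := by
  simp only [rescaled, eval_add, eval_mul, eval_pow, eval_X, eval_C, eval_comp]
  have : (p : ℤ_[p]) ^ (a * ((i : ℕ) + 1)) * (p : ℤ_[p]) ^ (a * (l - i)) =
      ((p : ℤ_[p]) ^ a) ^ (l + 1) := by
    rw [← pow_add, ← pow_mul, ← mul_add]
    congr 2
    have := i.2
    omega
  rw [mul_add, ← mul_assoc, this]
  ring

/-- A nondegeneracy criterion modulo `p`. -/
lemma isUnit_hasse_det {l : ℕ} (φ : Fin l → ℤ_[p][X]) (c : ℤ_[p])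
    (h : ∀ v : Fin l → ZMod p, (∀ j : Fin l, (taylor (PadicInt.toZMod c)
      (∑ i, C (v i) * (φ i).map PadicInt.toZMod)).coeff ((j : ℕ) + 1) = 0) → v = 0) :
    IsUnit (hasseMatrix φ c).det := by
  by_contra hc
  have h0 : PadicInt.toZMod (hasseMatrix φ c).det = 0 := by
    rw [← RingHom.mem_ker, PadicInt.ker_toZMod]
    exact (IsLocalRing.mem_maximalIdeal _).mpr hc
  rw [RingHom.map_det] at h0
  obtain ⟨v, hv, hv0⟩ := Matrix.exists_vecMul_eq_zero_iff.mpr h0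
  refine hv (h v fun j => ?_)
  have := congrFun hv0 j
  rw [Pi.zero_apply] at this
  rw [← this, map_sum, finsetSum_coeff]
  refine sum_congr rfl fun i _ => ?_
  simp only [taylor_mul, taylor_C, coeff_C_mul, RingHom.mapMatrix_apply, Matrix.map_apply]
  rw [← map_taylor, coeff_map]
  rfl

lemma eq_C_of_taylor_coeff {F : Type*} [Field F] {n : ℕ} (P : F[X]) (c : F)
    (hdeg : P.natDegree ≤ n) (h : ∀ j, 1 ≤ j → j ≤ n → (taylor c P).coeff j = 0) :
    ∀ j, 1 ≤ j → P.coeff j = 0 := by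
  have h1 : taylor c P = C ((taylor c P).coeff 0) := by
    ext j
    rcases Nat.eq_zero_or_pos j with rfl | hj
    · simp
    · rw [coeff_C_of_ne_zero hj.ne']
      by_cases hjn : j ≤ n
      · exact h j hj hjn
      · refine coeff_eq_zero_of_natDegree_lt ?_
        rw [natDegree_taylor]; omega
  have h2 : P = C ((taylor c P).coeff 0) := by
    have := congrArg (taylor (-c)) h1
    rwa [taylor_taylor, neg_add_cancel, taylor_zero, taylor_C] at this
  intro j hj
  rw [h2, coeff_C_of_ne_zero (by omega)]

lemma coeff_sum_C_mul_X_pow {F : Type*} [CommRing F] {l : ℕ} (d : ℕ) (v : Fin l → F) (i : Fin l) :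
    (∑ j : Fin l, C (v j) * X ^ (d + (j : ℕ))).coeff (d + (i : ℕ)) = v i := by
  simp only [finsetSum_coeff, coeff_C_mul, coeff_X_pow, add_right_inj]
  rw [sum_eq_single i]
  · simp
  · intro b _ hb
    have : ¬ (i : ℕ) = b := fun h => hb (Fin.ext h.symm)
    simp [this]
  · simp

lemma map_nearMoment {k : ℕ} {φ : Fin k → ℤ_[p][X]} (hφ : NearMoment p k φ) (i : Fin k) :
    (φ i).map PadicInt.toZMod = X ^ ((i : ℕ) + 1) := by
  obtain ⟨q, hq⟩ := hφ i
  rw [sub_eq_iff_eq_add'.mp hq]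
  simp

lemma NearMoment.isUnit_det {k : ℕ} {φ : Fin k → ℤ_[p][X]} (hφ : NearMoment p k φ) (c : ℤ_[p]) :
    IsUnit (hasseMatrix φ c).det := by
  refine isUnit_hasse_det φ c fun v hv => ?_
  simp only [map_nearMoment hφ] at hv
  have h := eq_C_of_taylor_coeff (n := k) (∑ i : Fin k, C (v i) * X ^ ((i : ℕ) + 1))
    (PadicInt.toZMod c) ?_ ?_
  · funext i
    have h1 := coeff_sum_C_mul_X_pow 1 v i
    simp only [add_comm 1] at h1
    rw [← h1]
    exact h _ (by omega)
  · refine natDegree_sum_le_of_forall_le _ _ fun i _ => ?_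
    refine (natDegree_C_mul_X_pow_le _ _).trans ?_
    have := i.2; omega
  · intro j hj hjk
    have := hv ⟨j - 1, by omega⟩
    simpa [Nat.sub_add_cancel hj] using this

/-- Normal form at a point, without rescaling, of a curve near the moment curve. -/
lemma NearMoment.normal_form {k : ℕ} {φ : Fin k → ℤ_[p][X]} (hφ : NearMoment p k φ) (c : ℤ_[p]) :
    ∃ (U : Matrix (Fin k) (Fin k) ℤ_[p]) (ρ τ : Fin k → ℤ_[p][X]), NearMoment p k ρ ∧
      (∀ i, ρ i = X ^ ((i : ℕ) + 1) + X ^ (k + 1) * τ i) ∧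
      ∀ i m, ∑ j, U i j * ((φ j).eval (c + m) - (φ j).eval c) = (ρ i).eval m := by
  obtain ⟨U, τ, hτ⟩ := exists_normal_form φ c (hφ.isUnit_det c)
  refine ⟨U, fun i => X ^ ((i : ℕ) + 1) + X ^ (k + 1) * τ i, τ, ?_, fun i => rfl, ?_⟩
  · intro i
    simp only [add_sub_cancel_left]
    rw [C_dvd_iff_dvd_coeff]
    intro n
    rw [coeff_X_pow_mul']
    split_ifs with hn
    swap
    · exact dvd_zero _
    -- reduce modulo `p`
    rw [← Ideal.mem_span_singleton, ← PadicInt.maximalIdeal_eq_span_p, ← PadicInt.ker_toZMod,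
      RingHom.mem_ker]
    have h1 := congrArg (fun P : ℤ_[p][X] => (P.map PadicInt.toZMod).coeff n) (hτ i)
    simp only [Polynomial.map_add, Polynomial.map_mul, Polynomial.map_pow, map_X, coeff_add,
      coeff_X_pow, coeff_X_pow_mul', if_pos hn, Polynomial.map_sum, finsetSum_coeff,
      Polynomial.map_sub, map_C, coeff_C_mul, coeff_sub, map_taylor, map_nearMoment hφ,
      coeff_map] at h1
    rw [if_neg (by have := i.2; omega), zero_add] at h1
    rw [← h1]
    refine sum_eq_zero fun j _ => ?_
    rw [coeff_C_of_ne_zero (by omega), sub_zero, coeff_eq_zero_of_natDegree_lt, mul_zero]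
    rw [natDegree_taylor, natDegree_X_pow]
    have := j.2; omega
  · intro i m
    rw [normal_form_eval hτ i m]
    simp

/-- Projections of curves near the moment curve are nondegenerate at units. -/
lemma NearMoment.isUnit_det_proj {k l : ℕ} (hl : l ≤ k) (hp : k < p) {φ : Fin k → ℤ_[p][X]}
    (hφ : NearMoment p k φ) (c : ℤ_[p]) (hc : PadicInt.toZMod c ≠ 0) :
    IsUnit (hasseMatrix (fun i : Fin l => φ ⟨k - l + i, by have := i.2; omega⟩) c).det := by
  refine isUnit_hasse_det _ c fun v hv => ?_
  simp only [map_nearMoment hφ] at hv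
  rcases Nat.eq_zero_or_pos l with rfl | hl0
  · exact funext fun i => i.elim0
  set P : (ZMod p)[X] := ∑ i : Fin l, C (v i) * X ^ (k - l + (i : ℕ) + 1) with hP
  set c' := PadicInt.toZMod c with hc'
  set Q : (ZMod p)[X] := ∑ i : Fin l, C (v i * ((k - l + (i : ℕ) + 1 : ℕ) : ZMod p)) * X ^ (0 + (i : ℕ))
    with hQ
  have hPQ : derivative P = X ^ (k - l) * Q := by
    rw [hP, derivative_sum, hQ, mul_sum]
    refine sum_congr rfl fun i _ => ?_
    rw [derivative_C_mul_X_pow]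
    rw [show k - l + (i : ℕ) + 1 - 1 = k - l + i by omega, pow_add, zero_add]
    ring
  have h1 : X ^ l ∣ taylor c' (derivative P) := by
    rw [X_pow_dvd_iff]
    intro d hd
    have h2 := hv ⟨d, hd⟩
    rw [taylor_coeff] at h2 ⊢
    have h3 := hasseDeriv_comp (R := ZMod p) d 1
    have h4 : (hasseDeriv d) (derivative P) = ((d + 1).choose d) • hasseDeriv (d + 1) P := by
      have := congrArg (fun f => f P) h3
      simpa [add_mul] using this
    rw [h4]
    simp only [eval_smul, h2, smul_zero]
  have h2 : (X - C c') ^ l ∣ derivative P := by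
    obtain ⟨q, hq⟩ := h1
    refine ⟨taylor (-c') q, ?_⟩
    have := congrArg (taylor (-c')) hq
    rw [taylor_taylor, neg_add_cancel, taylor_zero, taylor_mul, taylor_pow, taylor_X] at this
    rw [this, C_neg, sub_eq_add_neg]
  have h3 : (X - C c') ^ l ∣ Q := by
    rw [hPQ] at h2
    refine IsCoprime.dvd_of_dvd_mul_left ?_ h2
    refine IsCoprime.pow ?_
    have := isCoprime_X_sub_C_of_isUnit_sub (R := ZMod p) (a := c') (b := 0) (by
      rw [sub_zero]; exact hc.isUnit)
    simpa using this
  have hQ0 : Q = 0 := by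
    refine eq_zero_of_dvd_of_degree_lt h3 ?_
    rw [degree_pow, degree_X_sub_C, nsmul_one]
    refine lt_of_le_of_lt (degree_sum_le _ _) ?_
    rw [Finset.sup_lt_iff]
    · intro i _
      refine lt_of_le_of_lt (degree_C_mul_X_pow_le _ _) ?_
      have := i.2
      exact_mod_cast (by omega : 0 + (i : ℕ) < l)
    · exact WithBot.bot_lt_coe l
  funext i
  have h4 := coeff_sum_C_mul_X_pow 0 (fun i : Fin l => v i * ((k - l + (i : ℕ) + 1 : ℕ) : ZMod p)) i
  rw [← hQ, hQ0, coeff_zero] at h4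
  rcases mul_eq_zero.mp h4.symm with h5 | h5
  · exact h5
  · exfalso
    rw [ZMod.natCast_eq_zero_iff] at h5
    have := Nat.le_of_dvd (by omega) h5
    have := i.2
    omega

end

section

open Finset Polynomial

variable {p : ℕ} [Fact p.Prime]

lemma chi_add (N : ℕ) (x y : ℤ_[p]) : chi N (x + y) = chi N x * chi N y := by
  rw [chi, chi, chi, map_add, AddChar.map_add_eq_mul]

lemma chi_eq_psi (N : ℕ) (x : ℤ_[p]) : chi N x = psi N (PadicInt.toZModPow N x) := rfl

lemma norm_chi (N : ℕ) (x : ℤ_[p]) : ‖chi N x‖ = 1 := norm_psi _ _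

lemma chi_pow_mul {N M : ℕ} (h : N ≤ M) (z : ℤ_[p]) :
    chi M ((p : ℤ_[p]) ^ (M - N) * z) = chi N z := psi_pow_mul N M h z

lemma chi_eq_one_of_dvd {N : ℕ} {z : ℤ_[p]} (h : (p : ℤ_[p]) ^ N ∣ z) : chi N z = 1 := by
  have : PadicInt.toZModPow N z = 0 := by
    rw [← RingHom.mem_ker, PadicInt.ker_toZModPow, Ideal.mem_span_singleton]
    exact h
  rw [chi_eq_psi, this, psi_zero]

/-- Translation of the frequency by the reduction of a `p`-adic vector. -/
noncomputable def shift {k : ℕ} (M : ℕ) (Y : Fin k → ℤ_[p]) (x : Fin k → ZMod (p ^ M)) :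
    Fin k → ZMod (p ^ M) := fun j => x j + PadicInt.toZModPow M (Y j)

lemma phase_shift {k : ℕ} (M : ℕ) (Y : Fin k → ℤ_[p]) (x : Fin k → ZMod (p ^ M))
    (φ : Fin k → ℤ_[p][X]) (z : ℤ_[p]) :
    phase M (shift M Y x) φ z = phase M x φ z * chi M (∑ j, Y j * (φ j).eval z) := by
  simp only [phase, shift, chi_eq_psi, add_mul, sum_add_distrib, psi_add, map_sum, map_mul]

lemma phase_val {k : ℕ} (N : ℕ) (h : Fin k → ZMod (p ^ N)) (φ : Fin k → ℤ_[p][X]) (z : ℤ_[p]) :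
    phase N h φ z = chi N (∑ j, ((h j).val : ℤ_[p]) * (φ j).eval z) := by
  simp only [phase, chi_eq_psi, map_sum, map_mul, map_natCast, ZMod.natCast_zmod_val]

/-- Exponential sums over a finite family of points of a curve. -/
noncomputable def gsum {k : ℕ} (M : ℕ) (φ : Fin k → ℤ_[p][X]) {ι : Type} (c : ι → ℂ)
    (ν : ι → ℤ_[p]) (T : Finset ι) (x : Fin k → ZMod (p ^ M)) : ℂ :=
  ∑ i ∈ T, c i * phase M x φ (ν i)

/-- Decoupling along a family of translations of the frequency torus. -/
lemma Dec.shift {l B' : ℕ} {D : ℝ} (hl : 1 ≤ l) (hDec : Dec p l B' D) (hD : 0 ≤ D)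
    {ψ : Fin l → ℤ_[p][X]} (hψ : NearMoment p l ψ) {k M : ℕ} (hM : l * B' ≤ M)
    (φ : Fin k → ℤ_[p][X]) {ι : Type} (S : Finset ι) (c : ι → ℂ) (ν ν' : ι → ℤ_[p])
    {α : Type} [Fintype α] [DecidableEq α] (lab : ι → α)
    (hlab : ∀ i ∈ S, ∀ j ∈ S, lab i = lab j ↔ (p : ℤ_[p]) ^ B' ∣ ν' i - ν' j)
    (G : (Fin k → ZMod (p ^ M)) → ℝ) (hG : ∀ x, 0 ≤ G x)
    (Y : (Fin l → ZMod (p ^ (l * B'))) → Fin k → ℤ_[p])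
    (Cst : (Fin l → ZMod (p ^ (l * B'))) → ℤ_[p])
    (hY : ∀ h, ∀ i ∈ S, ∑ j, Y h j * (φ j).eval (ν i) =
      Cst h + (p : ℤ_[p]) ^ (M - l * B') * ∑ j, ((h j).val : ℤ_[p]) * (ψ j).eval (ν' i))
    (hGY : ∀ h x, G (Waring.shift M (Y h) x) = G x) :
    ∑ x, G x * ‖gsum M φ c ν S x‖ ^ (2 * tri l) ≤
      D * (∑ I : α, (∑ x, G x * ‖gsum M φ c ν {i ∈ S | lab i = I} x‖ ^ (2 * tri l)) ^
          ((tri l : ℝ)⁻¹)) ^ tri l := by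
  refine hDec.ext hl hD hψ S ν' lab hlab
    (T := fun h => Equiv.addRight (fun j => PadicInt.toZModPow M (Y h j)))
    G hG (fun h x => hGY h x) (fun i x => c i * phase M x φ (ν i)) (fun h _ => chi M (Cst h))
    (fun h x => norm_chi _ _) ?_
  intro i hi h x
  have : phase M (Equiv.addRight (fun j => PadicInt.toZModPow M (Y h j)) x) φ (ν i) =
      phase M (Waring.shift M (Y h) x) φ (ν i) := rfl
  rw [this, phase_shift, hY h i hi, chi_add, chi_pow_mul hM, ← phase_val]
  ring

/-- The square-function side of the decoupling inequality. -/
noncomputable def sarc {k : ℕ} (M : ℕ) (φ : Fin k → ℤ_[p][X]) {ι : Type} (c : ι → ℂ)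
    (ν : ι → ℤ_[p]) {α : Type} [Fintype α] [DecidableEq α] (lab : ι → α) (T : Finset ι) : ℝ :=
  ∑ I : α, (∑ x, ‖gsum M φ c ν {i ∈ T | lab i = I} x‖ ^ (2 * tri k)) ^ ((tri k : ℝ)⁻¹)

lemma sarc_nonneg {k : ℕ} (M : ℕ) (φ : Fin k → ℤ_[p][X]) {ι : Type} (c : ι → ℂ)
    (ν : ι → ℤ_[p]) {α : Type} [Fintype α] [DecidableEq α] (lab : ι → α) (T : Finset ι) :
    0 ≤ sarc M φ c ν lab T :=
  sum_nonneg fun _ _ => Real.rpow_nonneg (sum_nonneg fun _ _ => by positivity) _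

/-- Decoupling of an arc of scale `p ^ a`. -/
lemma Dec.arc {k B a : ℕ} {D : ℝ} (hk : 1 ≤ k) (ha : a ≤ B) (hDec : Dec p k (B - a) D) (hD : 0 ≤ D)
    {φ : Fin k → ℤ_[p][X]} (hφ : NearMoment p k φ) {ι : Type} (T : Finset ι) (c : ι → ℂ)
    (ν : ι → ℤ_[p]) {α : Type} [Fintype α] [DecidableEq α] (lab : ι → α)
    (hlab : ∀ i ∈ T, ∀ j ∈ T, lab i = lab j ↔ (p : ℤ_[p]) ^ B ∣ ν i - ν j)
    (hT : ∀ i ∈ T, ∀ j ∈ T, (p : ℤ_[p]) ^ a ∣ ν i - ν j) :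
    ∑ x, ‖gsum (k * B) φ c ν T x‖ ^ (2 * tri k) ≤ D * sarc (k * B) φ c ν lab T ^ tri k := by
  rcases Nat.eq_zero_or_pos a with rfl | ha0
  · exact hDec φ hφ ι T c ν α lab hlab
  rcases T.eq_empty_or_nonempty with rfl | ⟨i0, hi0⟩
  · have h1 := tri_pos hk
    have h2 : tri k ≠ 0 := by omega
    simpa [gsum, h2] using mul_nonneg hD (pow_nonneg (sarc_nonneg (k * B) φ c ν lab ∅) _)
  obtain ⟨U, τ, hτ⟩ := exists_normal_form φ (ν i0) (hφ.isUnit_det _)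
  have hm : ∀ i, ∃ m, i ∈ T → ν i = ν i0 + (p : ℤ_[p]) ^ a * m := by
    intro i
    by_cases hi : i ∈ T
    · obtain ⟨m, hm⟩ := hT i hi i0 hi0
      exact ⟨m, fun _ => by rw [← hm]; ring⟩
    · exact ⟨0, fun h => absurd h hi⟩
  choose m hm using hm
  have hp0 : (p : ℤ_[p]) ≠ 0 := by exact_mod_cast (Fact.out : p.Prime).ne_zero
  set Y : (Fin k → ZMod (p ^ (k * (B - a)))) → Fin k → ℤ_[p] := fun h j =>
    ∑ i, U i j * ((p : ℤ_[p]) ^ (k * B - k * (B - a) - a * ((i : ℕ) + 1)) * ((h i).val : ℤ_[p]))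
    with hYdef
  have := hDec.shift hk hD (rescaled_nearMoment ha0 τ) (M := k * B)
    (Nat.mul_le_mul_left _ (Nat.sub_le _ _)) φ T c ν m lab ?_ (fun _ => 1) (fun _ => zero_le_one)
    Y (fun h => ∑ j, Y h j * (φ j).eval (ν i0)) ?_ (fun _ _ => rfl)
  · simpa [sarc] using this
  · intro i hi j hj
    rw [hlab i hi j hj, hm i hi, hm j hj, add_sub_add_left_eq_sub, ← mul_sub,
      ← Nat.add_sub_cancel' ha, pow_add, Nat.add_sub_cancel_left]
    exact mul_dvd_mul_iff_left (pow_ne_zero _ hp0)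
  · intro h i hi
    rw [← sub_eq_iff_eq_add', ← sum_sub_distrib]
    have h1 : ∀ i', ∑ j, U i' j * ((φ j).eval (ν i) - (φ j).eval (ν i0)) =
        (p : ℤ_[p]) ^ (a * ((i' : ℕ) + 1)) * (rescaled a τ i').eval (m i) := by
      intro i'
      rw [hm i hi, normal_form_eval hτ, rescaled_eval]
    calc ∑ j, (Y h j * (φ j).eval (ν i) - Y h j * (φ j).eval (ν i0))
        = ∑ i' : Fin k, (p : ℤ_[p]) ^ (k * B - k * (B - a) - a * ((i' : ℕ) + 1)) * ((h i').val : ℤ_[p]) *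
            ∑ j, U i' j * ((φ j).eval (ν i) - (φ j).eval (ν i0)) := by
          simp only [hYdef, sum_mul, mul_sum, ← sum_sub_distrib]
          rw [sum_comm]
          exact sum_congr rfl fun _ _ => sum_congr rfl fun _ _ => by ring
      _ = _ := by
          rw [mul_sum]
          refine sum_congr rfl fun i' _ => ?_
          rw [h1]
          have h2 : a * ((i' : ℕ) + 1) ≤ k * B - k * (B - a) := by
            rw [← Nat.mul_sub, Nat.sub_sub_self ha, mul_comm k]
            exact Nat.mul_le_mul_left _ i'.2
          have h3 : (p : ℤ_[p]) ^ (k * B - k * (B - a)) =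
              (p : ℤ_[p]) ^ (k * B - k * (B - a) - a * ((i' : ℕ) + 1)) *
                (p : ℤ_[p]) ^ (a * ((i' : ℕ) + 1)) := by
            rw [← pow_add, Nat.sub_add_cancel h2]
          rw [h3]
          ring

end

section

open Finset Polynomial

variable {p : ℕ} [Fact p.Prime]

lemma toZMod_ne_zero_of_not_dvd {z : ℤ_[p]} (h : ¬ (p : ℤ_[p]) ∣ z) : PadicInt.toZMod z ≠ 0 := by
  rw [Ne, ← RingHom.mem_ker, PadicInt.ker_toZMod, PadicInt.maximalIdeal_eq_span_p,
    Ideal.mem_span_singleton]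
  exact h

/-- Lower degree decoupling of the first of two separated arcs, uniformly in the second. -/
lemma Dec.bilinear {k l B a b r : ℕ} {D : ℝ} (hl : 1 ≤ l) (hlk : l ≤ k) (hp : k < p) (ha : 1 ≤ a)
    (haB : l * a ≤ k * B) (hab : l * a ≤ b * (k - l + 1))
    (hDec : Dec p l (a - 1) D) (hD : 0 ≤ D)
    {φ : Fin k → ℤ_[p][X]} (hφ : NearMoment p k φ) {ι : Type} (T T' : Finset ι) (c : ι → ℂ)
    (ν : ι → ℤ_[p]) {α : Type} [Fintype α] [DecidableEq α] (lab : ι → α)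
    (hlab : ∀ i ∈ T, ∀ j ∈ T, lab i = lab j ↔ (p : ℤ_[p]) ^ a ∣ ν i - ν j)
    (hT : ∀ i ∈ T, ∀ j ∈ T, (p : ℤ_[p]) ∣ ν i - ν j)
    (hT' : ∀ i ∈ T', ∀ j ∈ T', (p : ℤ_[p]) ^ b ∣ ν i - ν j) (hne : T'.Nonempty)
    (hsep : ∀ i ∈ T, ∀ j ∈ T', ¬ (p : ℤ_[p]) ∣ ν i - ν j) :
    ∑ x, ‖gsum (k * B) φ c ν T' x‖ ^ r * ‖gsum (k * B) φ c ν T x‖ ^ (2 * tri l) ≤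
      D * (∑ I : α, (∑ x, ‖gsum (k * B) φ c ν T' x‖ ^ r *
        ‖gsum (k * B) φ c ν {i ∈ T | lab i = I} x‖ ^ (2 * tri l)) ^ ((tri l : ℝ)⁻¹)) ^ tri l := by
  rcases T.eq_empty_or_nonempty with rfl | ⟨i1, hi1⟩
  · have h1 := tri_pos hl
    have h2 : tri l ≠ 0 := by omega
    have h3 : ∀ x, ‖gsum (k * B) φ c ν ∅ x‖ = 0 := by intro x; simp [gsum]
    simp only [h3, zero_pow (Nat.mul_ne_zero two_ne_zero h2), mul_zero, sum_const_zero,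
      filter_empty]
    refine mul_nonneg hD (pow_nonneg (sum_nonneg fun _ _ => Real.rpow_nonneg le_rfl _) _)
  obtain ⟨i0, hi0⟩ := hne
  obtain ⟨U, ρ, τ, hρ, hρτ, hU⟩ := hφ.normal_form (ν i0)
  have hunit : PadicInt.toZMod (ν i1 - ν i0) ≠ 0 := toZMod_ne_zero_of_not_dvd (hsep i1 hi1 i0 hi0)
  obtain ⟨V, τ', hτ'⟩ := exists_normal_form _ _ (hρ.isUnit_det_proj hlk hp _ hunit)
  have hV := normal_form_eval hτ'
  have hm : ∀ i, ∃ m, i ∈ T → ν i = ν i0 + (ν i1 - ν i0 + (p : ℤ_[p]) ^ 1 * m) := by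
    intro i
    by_cases hi : i ∈ T
    · obtain ⟨m, hm⟩ := hT i hi i1 hi1
      exact ⟨m, fun _ => by rw [pow_one, ← hm]; ring⟩
    · exact ⟨0, fun h => absurd h hi⟩
  choose m hm using hm
  have hp0 : (p : ℤ_[p]) ≠ 0 := by exact_mod_cast (Fact.out : p.Prime).ne_zero
  have hle : l * (a - 1) + l = l * a := by
    rw [← Nat.mul_succ]; congr 1; omega
  set e : Fin l → Fin k := fun i => ⟨k - l + i, by have := i.2; omega⟩ with he
  set z : (Fin l → ZMod (p ^ (l * (a - 1)))) → Fin l → ℤ_[p] := fun h i =>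
    (p : ℤ_[p]) ^ (k * B - l * (a - 1) - 1 * ((i : ℕ) + 1)) * ((h i).val : ℤ_[p]) with hz
  set Y : (Fin l → ZMod (p ^ (l * (a - 1)))) → Fin k → ℤ_[p] := fun h j =>
    ∑ i', z h i' * ∑ i, V i' i * U (e i) j with hYdef
  have hYsum : ∀ h (w : ℤ_[p]), ∑ j, Y h j * ((φ j).eval (ν i0 + w) - (φ j).eval (ν i0)) =
      ∑ i', z h i' * ∑ i, V i' i * (ρ (e i)).eval w := by
    intro h w
    simp only [← hU, hYdef, sum_mul, mul_sum]
    rw [sum_comm]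
    refine sum_congr rfl fun i' _ => ?_
    rw [sum_comm]
    refine sum_congr rfl fun i _ => sum_congr rfl fun j _ => ?_
    ring
  refine hDec.shift hl hD (rescaled_nearMoment le_rfl τ') (M := k * B)
    (by omega) φ T c ν m lab ?_ (fun x => ‖gsum (k * B) φ c ν T' x‖ ^ r) (fun _ => by positivity)
    Y (fun h => ∑ j, Y h j * (φ j).eval (ν i0) +
      ∑ i', z h i' * ∑ i, V i' i * (ρ (e i)).eval (ν i1 - ν i0)) ?_ ?_
  · intro i hi j hj
    rw [hlab i hi j hj, hm i hi, hm j hj, add_sub_add_left_eq_sub, add_sub_add_left_eq_sub,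
      ← mul_sub]
    conv_lhs => rw [← Nat.add_sub_cancel' ha, pow_add]
    exact mul_dvd_mul_iff_left (pow_ne_zero _ hp0)
  · intro h i hi
    have h0 : ∑ j, Y h j * (φ j).eval (ν i) = ∑ j, Y h j * (φ j).eval (ν i0) +
        ∑ j, Y h j * ((φ j).eval (ν i) - (φ j).eval (ν i0)) := by
      rw [← sum_add_distrib]; exact sum_congr rfl fun _ _ => by ring
    rw [h0, add_assoc]
    congr 1
    nth_rewrite 1 [hm i hi]
    rw [hYsum, ← sub_eq_iff_eq_add', ← sum_sub_distrib, mul_sum]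
    refine sum_congr rfl fun i' _ => ?_
    rw [← mul_sub, ← sum_sub_distrib]
    simp only [← mul_sub]
    have h1 := hV i' ((p : ℤ_[p]) ^ 1 * m i)
    rw [rescaled_eval] at h1
    rw [h1, hz]
    have h2 : 1 * ((i' : ℕ) + 1) ≤ k * B - l * (a - 1) := by
      have := i'.2; omega
    have h3 : (p : ℤ_[p]) ^ (k * B - l * (a - 1)) =
        (p : ℤ_[p]) ^ (k * B - l * (a - 1) - 1 * ((i' : ℕ) + 1)) *
          (p : ℤ_[p]) ^ (1 * ((i' : ℕ) + 1)) := by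
      rw [← pow_add, Nat.sub_add_cancel h2]
    rw [h3]
    ring
  · intro h x
    have h1 : gsum (k * B) φ c ν T' (Waring.shift (k * B) (Y h) x) =
        chi (k * B) (∑ j, Y h j * (φ j).eval (ν i0)) * gsum (k * B) φ c ν T' x := by
      rw [gsum, gsum, mul_sum]
      refine sum_congr rfl fun i hi => ?_
      obtain ⟨m', hm'⟩ := hT' i hi i0 hi0
      have h0 : ∑ j, Y h j * (φ j).eval (ν i) = ∑ j, Y h j * (φ j).eval (ν i0) +
          ∑ j, Y h j * ((φ j).eval (ν i0 + (p : ℤ_[p]) ^ b * m') - (φ j).eval (ν i0)) := by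
        rw [← hm', add_sub_cancel, ← sum_add_distrib]; exact sum_congr rfl fun _ _ => by ring
      have h2 : (p : ℤ_[p]) ^ (k * B) ∣ ∑ j, Y h j *
          ((φ j).eval (ν i0 + (p : ℤ_[p]) ^ b * m') - (φ j).eval (ν i0)) := by
        rw [hYsum]
        refine dvd_sum fun i' _ => ?_
        have h3 : (p : ℤ_[p]) ^ (k * B - l * a) ∣ z h i' := by
          refine Dvd.dvd.mul_right (pow_dvd_pow _ ?_) _
          have := i'.2; omega
        have h4 : (p : ℤ_[p]) ^ (l * a) ∣
            ∑ i, V i' i * (ρ (e i)).eval ((p : ℤ_[p]) ^ b * m') := by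
          refine dvd_sum fun i _ => Dvd.dvd.mul_left ?_ _
          have h5 : ((p : ℤ_[p]) ^ b * m') ^ (k - l + 1) ∣
              (ρ (e i)).eval ((p : ℤ_[p]) ^ b * m') := by
            rw [hρτ]
            simp only [eval_add, eval_mul, eval_pow, eval_X]
            refine dvd_add (pow_dvd_pow _ ?_) (Dvd.dvd.mul_right (pow_dvd_pow _ ?_) _)
            · simp only [he]; omega
            · omega
          refine dvd_trans ?_ h5
          rw [mul_pow, ← pow_mul]
          exact Dvd.dvd.mul_right (pow_dvd_pow _ hab) _
        have := mul_dvd_mul h3 h4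
        rwa [← pow_add, Nat.sub_add_cancel haB] at this
      rw [phase_shift, h0, chi_add, chi_eq_one_of_dvd h2]
      ring
    simp only [h1, norm_mul, norm_chi, one_mul]

end

section

open Finset Polynomial

lemma sum_rpow_mul_rpow_le {X : Type*} (A : Finset X) (F G : X → ℝ) (hF : ∀ x, 0 ≤ F x)
    (hG : ∀ x, 0 ≤ G x) {θ : ℝ} (h0 : 0 < θ) (h1 : θ < 1) :
    ∑ x ∈ A, F x ^ θ * G x ^ (1 - θ) ≤ (∑ x ∈ A, F x) ^ θ * (∑ x ∈ A, G x) ^ (1 - θ) := by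
  have hpq : (θ⁻¹).HolderConjugate (1 - θ)⁻¹ := by
    rw [Real.holderConjugate_iff]
    refine ⟨(one_lt_inv₀ h0).mpr h1, ?_⟩
    rw [inv_inv, inv_inv]; ring
  have := Real.inner_le_Lp_mul_Lq_of_nonneg A hpq (f := fun x => F x ^ θ)
    (g := fun x => G x ^ (1 - θ)) (fun x _ => Real.rpow_nonneg (hF x) _)
    (fun x _ => Real.rpow_nonneg (hG x) _)
  have h2 : 1 - θ ≠ 0 := by linarith
  simpa [← Real.rpow_mul (hF _), ← Real.rpow_mul (hG _), mul_inv_cancel₀ h0.ne',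
    mul_inv_cancel₀ h2] using this

lemma rpow_interp {u : ℝ} (hu : 0 ≤ u) {a a₁ a₂ : ℕ} {θ : ℝ} (h0 : 0 ≤ θ) (h1 : θ ≤ 1)
    (ha : (a : ℝ) = θ * a₁ + (1 - θ) * a₂) :
    u ^ a = (u ^ a₁) ^ θ * (u ^ a₂) ^ (1 - θ) := by
  rw [← Real.rpow_natCast u a₁, ← Real.rpow_natCast u a₂, ← Real.rpow_mul hu, ← Real.rpow_mul hu,
    ← Real.rpow_add_of_nonneg hu (by positivity) (mul_nonneg (by positivity) (by linarith)),
    ← Real.rpow_natCast]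
  congr 1
  rw [ha]; ring

lemma holder_interp {X : Type*} (A : Finset X) (u v : X → ℝ) (hu : ∀ x, 0 ≤ u x)
    (hv : ∀ x, 0 ≤ v x) {θ : ℝ} (h0 : 0 < θ) (h1 : θ < 1) {a b a₁ b₁ a₂ b₂ : ℕ}
    (ha : (a : ℝ) = θ * a₁ + (1 - θ) * a₂) (hb : (b : ℝ) = θ * b₁ + (1 - θ) * b₂) :
    ∑ x ∈ A, u x ^ a * v x ^ b ≤
      (∑ x ∈ A, u x ^ a₁ * v x ^ b₁) ^ θ * (∑ x ∈ A, u x ^ a₂ * v x ^ b₂) ^ (1 - θ) := by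
  refine le_trans (le_of_eq ?_) (sum_rpow_mul_rpow_le A (fun x => u x ^ a₁ * v x ^ b₁)
    (fun x => u x ^ a₂ * v x ^ b₂) (fun x => mul_nonneg (pow_nonneg (hu x) _) (pow_nonneg (hv x) _))
    (fun x => mul_nonneg (pow_nonneg (hu x) _) (pow_nonneg (hv x) _)) h0 h1)
  refine sum_congr rfl fun x _ => ?_
  rw [rpow_interp (hu x) h0.le h1.le ha, rpow_interp (hv x) h0.le h1.le hb,
    Real.mul_rpow (pow_nonneg (hu x) _) (pow_nonneg (hv x) _),
    Real.mul_rpow (pow_nonneg (hu x) _) (pow_nonneg (hv x) _)]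
  ring

variable {p : ℕ} [Fact p.Prime]

lemma sarc_sum {k : ℕ} (hk : 1 ≤ k) (M : ℕ) (φ : Fin k → ℤ_[p][X]) {ι : Type} (c : ι → ℂ)
    (ν : ι → ℤ_[p]) {α : Type} [Fintype α] [DecidableEq α] (lab : ι → α) (T : Finset ι)
    {β : Type} [Fintype β] [DecidableEq β] (lab' : ι → β)
    (h : ∀ i ∈ T, ∀ j ∈ T, lab i = lab j → lab' i = lab' j) :
    ∑ I : β, sarc M φ c ν lab {i ∈ T | lab' i = I} = sarc M φ c ν lab T := by
  simp only [sarc]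
  rw [sum_comm]
  refine sum_congr rfl fun J _ => ?_
  have h2 : tri k ≠ 0 := by have := tri_pos hk; omega
  have h3 : (tri k : ℝ)⁻¹ ≠ 0 := by positivity
  have hz : ∀ A : Finset ι, A = ∅ →
      (∑ x, ‖gsum M φ c ν A x‖ ^ (2 * tri k)) ^ ((tri k : ℝ)⁻¹) = 0 := by
    rintro A rfl
    simp [gsum, h2, Real.zero_rpow h3]
  rcases Finset.eq_empty_or_nonempty {i ∈ T | lab i = J} with h0 | ⟨i0, hi0⟩
  · rw [hz _ h0]
    refine sum_eq_zero fun I _ => hz _ ?_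
    rw [filter_comm, h0, filter_empty]
  · rw [mem_filter] at hi0
    rw [sum_eq_single (lab' i0)]
    · congr 3
      funext x
      congr 3
      rw [filter_filter]
      refine filter_congr fun i hi => ⟨fun hh => hh.2, fun hh => ⟨?_, hh⟩⟩
      exact h i hi i0 hi0.1 (hh.trans hi0.2.symm)
    · intro I _ hI
      refine hz _ ?_
      rw [filter_filter, filter_eq_empty_iff]
      rintro i hi ⟨hi1, hi2⟩
      exact hI (hi1 ▸ h i hi i0 hi0.1 (hi2.trans hi0.2.symm))
    · simp

lemma sarc_mono_filter {k : ℕ} (hk : 1 ≤ k) (M : ℕ) (φ : Fin k → ℤ_[p][X]) {ι : Type} (c : ι → ℂ)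
    (ν : ι → ℤ_[p]) {α : Type} [Fintype α] [DecidableEq α] (lab : ι → α) (T : Finset ι)
    {β : Type} [Fintype β] [DecidableEq β] (lab' : ι → β)
    (h : ∀ i ∈ T, ∀ j ∈ T, lab i = lab j → lab' i = lab' j) (I : β) :
    sarc M φ c ν lab {i ∈ T | lab' i = I} ≤ sarc M φ c ν lab T := by
  rw [← sarc_sum hk M φ c ν lab T lab' h]
  exact single_le_sum (f := fun I => sarc M φ c ν lab {i ∈ T | lab' i = I})
    (fun _ _ => sarc_nonneg _ _ _ _ _ _) (mem_univ I)

/-- Bilinear decoupling for an arc of scale `p` and a separated arc of scale `p ^ b`. -/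
def Bil (p : ℕ) [Fact p.Prime] (k B l b : ℕ) (K : ℝ) : Prop :=
  ∀ φ : Fin k → ℤ_[p][X], NearMoment p k φ →
  ∀ (ι : Type) (T T' : Finset ι) (c : ι → ℂ) (ν : ι → ℤ_[p]) (α : Type) [Fintype α]
    [DecidableEq α] (lab : ι → α),
    (∀ i ∈ T, ∀ j ∈ T, lab i = lab j ↔ (p : ℤ_[p]) ^ B ∣ ν i - ν j) →
    (∀ i ∈ T', ∀ j ∈ T', lab i = lab j ↔ (p : ℤ_[p]) ^ B ∣ ν i - ν j) →
    (∀ i ∈ T, ∀ j ∈ T, (p : ℤ_[p]) ∣ ν i - ν j) →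
    (∀ i ∈ T', ∀ j ∈ T', (p : ℤ_[p]) ^ b ∣ ν i - ν j) →
    (∀ i ∈ T, ∀ j ∈ T', ¬ (p : ℤ_[p]) ∣ ν i - ν j) →
    ∑ x, (‖gsum (k * B) φ c ν T' x‖ ^ 2) ^ (tri k - tri l) *
        (‖gsum (k * B) φ c ν T x‖ ^ 2) ^ tri l ≤
      K * (sarc (k * B) φ c ν lab T' ^ (tri k - tri l) * sarc (k * B) φ c ν lab T ^ tri l)

lemma Bil.mono {k B l b : ℕ} {K K' : ℝ} (h : Bil p k B l b K) (hK : K ≤ K') :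
    Bil p k B l b K' := by
  intro φ hφ ι T T' c ν α _ _ lab h1 h2 h3 h4 h5
  refine (h φ hφ ι T T' c ν α lab h1 h2 h3 h4 h5).trans ?_
  exact mul_le_mul_of_nonneg_right hK (mul_nonneg (pow_nonneg (sarc_nonneg _ _ _ _ _ _) _)
    (pow_nonneg (sarc_nonneg _ _ _ _ _ _) _))

lemma bil_zero {k B b : ℕ} {D : ℝ} (hk : 1 ≤ k) (hb : b ≤ B) (h : Dec p k (B - b) D)
    (hD : 0 ≤ D) : Bil p k B 0 b D := by
  intro φ hφ ι T T' c ν α _ _ lab h1 h2 h3 h4 h5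
  have := h.arc hk hb hD hφ T' c ν lab h2 h4
  simpa [tri, pow_mul] using this

lemma tri_lt {l k : ℕ} (h : l < k) : tri l < tri k := by
  have h1 := two_tri k
  have h2 := two_tri l
  nlinarith

/-- The trivial bilinear bound, from Hölder's inequality. -/
lemma bil_trivial {k B l b : ℕ} {D : ℝ} (hl : 1 ≤ l) (hlk : l < k) (hb : b ≤ B) (hB : 1 ≤ B)
    (h : Dec p k (B - b) D) (h' : Dec p k (B - 1) D) (hD : 0 ≤ D) : Bil p k B l b D := by
  intro φ hφ ι T T' c ν α _ _ lab h1 h2 h3 h4 h5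
  have e1 := h.arc (by omega) hb hD hφ T' c ν lab h2 h4
  have e2 := h'.arc (by omega) hB hD hφ T c ν lab h1 (by simpa using h3)
  have ht := tri_lt hlk
  have ht1 := tri_pos hl
  have hk0 : (0 : ℝ) < tri k := by exact_mod_cast (by omega)
  have hl0 : (0 : ℝ) < tri l := by exact_mod_cast (by omega)
  have hlt : (tri l : ℝ) < tri k := by exact_mod_cast ht
  set θ : ℝ := tri l / tri k with hθ
  have hθ0 : 0 < θ := by positivity
  have hθ1 : θ < 1 := by rw [hθ, div_lt_one hk0]; exact hlt
  have ha : ((tri l : ℕ) : ℝ) = θ * (tri k : ℕ) + (1 - θ) * (0 : ℕ) := by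
    rw [hθ]; field_simp; simp
  have hb' : ((tri k - tri l : ℕ) : ℝ) = θ * (0 : ℕ) + (1 - θ) * (tri k : ℕ) := by
    rw [Nat.cast_sub ht.le, hθ]; field_simp; simp
  have := holder_interp univ (fun x => ‖gsum (k * B) φ c ν T x‖ ^ 2)
    (fun x => ‖gsum (k * B) φ c ν T' x‖ ^ 2) (fun _ => by positivity) (fun _ => by positivity)
    hθ0 hθ1 ha hb'
  simp only [pow_zero, mul_one, one_mul, ← pow_mul] at this
  have hs1 := sarc_nonneg (k * B) φ c ν lab T
  have hs2 := sarc_nonneg (k * B) φ c ν lab T'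
  calc _ = ∑ x, ‖gsum (k * B) φ c ν T x‖ ^ (2 * tri l) *
        ‖gsum (k * B) φ c ν T' x‖ ^ (2 * (tri k - tri l)) := by
        refine sum_congr rfl fun x _ => ?_
        rw [← pow_mul, ← pow_mul, mul_comm]
    _ ≤ _ := this
    _ ≤ (D * sarc (k * B) φ c ν lab T ^ tri k) ^ θ *
        (D * sarc (k * B) φ c ν lab T' ^ tri k) ^ (1 - θ) := by
        have : 0 ≤ 1 - θ := by linarith
        gcongr
    _ = _ := by
        rw [Real.mul_rpow hD (by positivity), Real.mul_rpow hD (by positivity)]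
        have h6 := rpow_interp hs1 (u := sarc (k * B) φ c ν lab T) hθ0.le hθ1.le ha
        have h7 := rpow_interp hs2 (u := sarc (k * B) φ c ν lab T') hθ0.le hθ1.le hb'
        simp only [pow_zero, Real.one_rpow, one_mul, mul_one] at h6 h7
        rw [h6, h7]
        have h8 : D = D ^ θ * D ^ (1 - θ) := by
          rw [← Real.rpow_add_of_nonneg hD hθ0.le (by linarith)]; simp
        nth_rewrite 3 [h8]
        ring

/-- The basic iteration step relating bilinear constants. -/
lemma Bil.step {k B l a b : ℕ} {D K₁ K₂ : ℝ} (hl : 1 ≤ l) (hlk : l < k) (hp : k < p) (hb : 1 ≤ b)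
    (ha : l * a = b * (k - l + 1)) (haB : a ≤ B) (hD : 0 ≤ D) (hK₁ : 0 ≤ K₁) (hK₂ : 0 ≤ K₂)
    (hDec : Dec p l (a - 1) D) (h₁ : Bil p k B (l - 1) b K₁) (h₂ : Bil p k B (k - l) a K₂) :
    Bil p k B l b (D * (K₁ ^ (((k - l : ℕ) : ℝ) / (k - l + 1 : ℕ)) *
      K₂ ^ (1 - ((k - l : ℕ) : ℝ) / (k - l + 1 : ℕ)))) := by
  intro φ hφ ι T T' c ν α _ _ lab h1 h2 h3 h4 h5
  set θ : ℝ := ((k - l : ℕ) : ℝ) / (k - l + 1 : ℕ) with hθ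
  have hkl : (0 : ℝ) < (k - l : ℕ) := by exact_mod_cast (by omega)
  have hθ0 : 0 < θ := by positivity
  have hθ1 : θ < 1 := by rw [hθ, div_lt_one (by positivity)]; push_cast; linarith
  have hθ2 : 0 ≤ 1 - θ := by linarith
  have ha1 : 1 ≤ a := by
    rcases Nat.eq_zero_or_pos a with rfl | h
    · simp at ha; omega
    · exact h
  have htl := tri_lt hlk
  have htl1 := tri_pos hl
  have hl0 : tri l ≠ 0 := by omega
  set s1 := sarc (k * B) φ c ν lab T with hs1d
  set s2 := sarc (k * B) φ c ν lab T' with hs2d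
  have hs1 : 0 ≤ s1 := sarc_nonneg (k * B) φ c ν lab T
  have hs2 : 0 ≤ s2 := sarc_nonneg (k * B) φ c ν lab T'
  set K := K₁ ^ θ * K₂ ^ (1 - θ) with hK
  have hK0 : 0 ≤ K := by positivity
  rcases T'.eq_empty_or_nonempty with rfl | hne
  · have h6 : tri k - tri l ≠ 0 := by omega
    have : 0 ≤ D * K * (s2 ^ (tri k - tri l) * s1 ^ tri l) := by positivity
    simpa [gsum, h6] using this
  -- the exponent identities
  have t1 : (tri l : ℝ) = (l : ℝ) * (l + 1) / 2 := by
    have := two_tri l; have h : (2 * tri l : ℝ) = l * (l + 1) := by exact_mod_cast this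
    linarith
  have t2 : (tri k : ℝ) = (k : ℝ) * (k + 1) / 2 := by
    have := two_tri k; have h : (2 * tri k : ℝ) = k * (k + 1) := by exact_mod_cast this
    linarith
  have t3 : (tri (l - 1) : ℝ) = ((l : ℝ) - 1) * l / 2 := by
    have := two_tri (l - 1); rw [Nat.sub_add_cancel hl] at this
    have h : (2 * tri (l - 1) : ℝ) = ((l - 1 : ℕ) : ℝ) * l := by exact_mod_cast this
    rw [Nat.cast_sub hl] at h; push_cast at h
    linarith
  have t4 : (tri (k - l) : ℝ) = ((k : ℝ) - l) * (k - l + 1) / 2 := by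
    have := two_tri (k - l)
    have h : (2 * tri (k - l) : ℝ) = ((k - l : ℕ) : ℝ) * ((k - l : ℕ) + 1) := by exact_mod_cast this
    rw [Nat.cast_sub hlk.le] at h
    linarith
  have hlk' : (l : ℝ) < k := by exact_mod_cast hlk
  have hd : (k : ℝ) - l + 1 ≠ 0 := by linarith
  have hθ' : θ = ((k : ℝ) - l) / (k - l + 1) := by
    rw [hθ]; push_cast [Nat.cast_sub hlk.le]; rfl
  have htkl : tri (k - l) < tri k := tri_lt (by omega)
  have htl' : tri (l - 1) < tri k := tri_lt (by omega)
  have i1 : ((tri l : ℕ) : ℝ) = θ * (tri (l - 1) : ℕ) + (1 - θ) * (tri k - tri (k - l) : ℕ) := by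
    rw [Nat.cast_sub htkl.le, t1, t2, t3, t4, hθ']; field_simp; ring
  have i2 : ((tri k - tri l : ℕ) : ℝ) =
      θ * (tri k - tri (l - 1) : ℕ) + (1 - θ) * (tri (k - l) : ℕ) := by
    rw [Nat.cast_sub htl.le, Nat.cast_sub htl'.le, t1, t2, t3, t4, hθ']; field_simp; ring
  set lab' : ι → ZMod (p ^ a) := fun i => PadicInt.toZModPow a (ν i) with hlab'
  have hlabiff : ∀ i j, lab' i = lab' j ↔ (p : ℤ_[p]) ^ a ∣ ν i - ν j := by
    intro i j
    rw [hlab', ← sub_eq_zero, ← map_sub, ← RingHom.mem_ker, PadicInt.ker_toZModPow,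
      Ideal.mem_span_singleton]
  have main := hDec.bilinear (B := B) (b := b) (r := 2 * (tri k - tri l)) hl hlk.le hp ha1
    (Nat.mul_le_mul hlk.le haB) ha.le hD hφ T T' c ν lab' (fun i _ j _ => hlabiff i j) h3 h4 hne h5
  simp only [pow_mul] at main
  refine main.trans ?_
  have piece : ∀ I : ZMod (p ^ a), ∑ x, (‖gsum (k * B) φ c ν T' x‖ ^ 2) ^ (tri k - tri l) *
      (‖gsum (k * B) φ c ν {i ∈ T | lab' i = I} x‖ ^ 2) ^ tri l ≤
      K * s2 ^ (tri k - tri l) * sarc (k * B) φ c ν lab {i ∈ T | lab' i = I} ^ tri l := by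
    intro I
    set TI := {i ∈ T | lab' i = I} with hTI
    have hsub : ∀ i ∈ TI, i ∈ T := fun i hi => (mem_filter.mp hi).1
    have hscale : ∀ i ∈ TI, ∀ j ∈ TI, (p : ℤ_[p]) ^ a ∣ ν i - ν j := fun i hi j hj =>
      (hlabiff i j).mp ((mem_filter.mp hi).2.trans (mem_filter.mp hj).2.symm)
    have b1 := h₁ φ hφ ι TI T' c ν α lab (fun i hi j hj => h1 i (hsub i hi) j (hsub j hj)) h2
      (fun i hi j hj => h3 i (hsub i hi) j (hsub j hj)) h4 (fun i hi j hj => h5 i (hsub i hi) j hj)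
    have b2 := h₂ φ hφ ι T' TI c ν α lab h2 (fun i hi j hj => h1 i (hsub i hi) j (hsub j hj))
      (fun i hi j hj => dvd_trans (dvd_pow_self _ (by omega)) (h4 i hi j hj)) hscale
      (fun i hi j hj hij => h5 j (hsub j hj) i hi (by rw [← dvd_neg, neg_sub]; exact hij))
    have hh := holder_interp univ (fun x => ‖gsum (k * B) φ c ν T' x‖ ^ 2)
      (fun x => ‖gsum (k * B) φ c ν TI x‖ ^ 2) (fun _ => by positivity) (fun _ => by positivity)
      hθ0 hθ1 i2 i1
    refine hh.trans ?_
    set s3 := sarc (k * B) φ c ν lab TI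
    have hs3 : 0 ≤ s3 := sarc_nonneg (k * B) φ c ν lab TI
    have b2' : ∑ x, (‖gsum (k * B) φ c ν T' x‖ ^ 2) ^ tri (k - l) *
        (‖gsum (k * B) φ c ν TI x‖ ^ 2) ^ (tri k - tri (k - l)) ≤
        K₂ * (s2 ^ tri (k - l) * s3 ^ (tri k - tri (k - l))) := by
      simpa only [mul_comm] using b2
    calc _ ≤ (K₁ * (s2 ^ (tri k - tri (l - 1)) * s3 ^ tri (l - 1))) ^ θ *
          (K₂ * (s2 ^ tri (k - l) * s3 ^ (tri k - tri (k - l)))) ^ (1 - θ) := by gcongr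
      _ = _ := by
          rw [rpow_interp hs2 hθ0.le hθ1.le i2, rpow_interp hs3 hθ0.le hθ1.le i1,
            Real.mul_rpow hK₁ (by positivity), Real.mul_rpow hK₂ (by positivity),
            Real.mul_rpow (by positivity) (by positivity),
            Real.mul_rpow (by positivity) (by positivity), hK]
          ring
  have hKs : 0 ≤ K * s2 ^ (tri k - tri l) := by positivity
  have hsum : ∑ I : ZMod (p ^ a), (∑ x, (‖gsum (k * B) φ c ν T' x‖ ^ 2) ^ (tri k - tri l) *
      (‖gsum (k * B) φ c ν {i ∈ T | lab' i = I} x‖ ^ 2) ^ tri l) ^ ((tri l : ℝ)⁻¹) ≤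
      (K * s2 ^ (tri k - tri l)) ^ ((tri l : ℝ)⁻¹) * s1 := by
    rw [hs1d, ← sarc_sum (by omega) (k * B) φ c ν lab T lab', mul_sum]
    · refine sum_le_sum fun I _ => ?_
      refine (Real.rpow_le_rpow (sum_nonneg fun _ _ => by positivity) (piece I)
        (by positivity)).trans (le_of_eq ?_)
      rw [Real.mul_rpow hKs (pow_nonneg (sarc_nonneg _ _ _ _ _ _) _),
        Real.pow_rpow_inv_natCast (sarc_nonneg _ _ _ _ _ _) hl0]
    · intro i hi j hj hij
      exact (hlabiff i j).mpr (dvd_trans (pow_dvd_pow _ haB) ((h1 i hi j hj).mp hij))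
  have hs0 : 0 ≤ ∑ I : ZMod (p ^ a), (∑ x, (‖gsum (k * B) φ c ν T' x‖ ^ 2) ^ (tri k - tri l) *
      (‖gsum (k * B) φ c ν {i ∈ T | lab' i = I} x‖ ^ 2) ^ tri l) ^ ((tri l : ℝ)⁻¹) :=
    sum_nonneg fun _ _ => Real.rpow_nonneg (sum_nonneg fun _ _ => by positivity) _
  calc _ ≤ D * ((K * s2 ^ (tri k - tri l)) ^ ((tri l : ℝ)⁻¹) * s1) ^ tri l := by gcongr
    _ = _ := by
        rw [mul_pow, Real.rpow_inv_natCast_pow hKs hl0]; ring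

end

section

open Finset Polynomial

variable {p : ℕ} [Fact p.Prime]

lemma prime_cast_pos : (0 : ℝ) < p := by exact_mod_cast (Fact.out : p.Prime).pos

lemma prime_cast_one_le : (1 : ℝ) ≤ p := by exact_mod_cast (Fact.out : p.Prime).one_lt.le

/-- One round of the iteration over all intermediate degrees. -/
lemma bil_round {k : ℕ} (hk : 2 ≤ k) (hp : k < p) {η ε μ C C₀ m : ℝ} {F : ℕ}
    (hη : 0 ≤ η) (hε : 0 ≤ ε) (hC : 0 ≤ C) (hC₀ : 0 ≤ C₀) (hμ : μ ≤ η / k ^ 2 - k * ε)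
    (hdec : ∀ n, Dec p k n (C * (p : ℝ) ^ (η * n)))
    (hlow : ∀ l, 1 ≤ l → l < k → ∀ n, Dec p l n (C * (p : ℝ) ^ (ε * n)))
    {kj : ℕ}
    (h : ∀ B l b : ℕ, 1 ≤ l → l < k → 1 ≤ b → F ∣ b → b * kj ≤ B → b ≤ B →
      Bil p k B l b (C₀ * (p : ℝ) ^ (η * B - (k - l) * l * m * b))) :
    ∃ C₁ : ℝ, 0 ≤ C₁ ∧ ∀ B l b : ℕ, 1 ≤ l → l < k → 1 ≤ b → (k.factorial * F) ∣ b →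
      b * (k * kj) ≤ B → b * k ≤ B →
      Bil p k B l b (C₁ * (p : ℝ) ^ (η * B - (k - l) * l * (m + μ) * b)) := by
  have hk0 : (0 : ℝ) < k := by exact_mod_cast (by omega)
  have hp0 : (0 : ℝ) < p := prime_cast_pos
  have hp1 : (1 : ℝ) ≤ p := prime_cast_one_le
  -- inner induction
  have inner : ∀ l : ℕ, l < k → ∃ C₁ : ℝ, 0 ≤ C₁ ∧ ∀ B b : ℕ, 1 ≤ b → (k.factorial * F) ∣ b →
      b * (k * kj) ≤ B → b * k ≤ B →
      Bil p k B l b (C₁ * (p : ℝ) ^ (η * B - (k - l) * (η / k + l * (m - k * ε)) * b)) := by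
    intro l
    induction l with
    | zero =>
      intro _
      refine ⟨C, hC, fun B b hb _ _ hbB => ?_⟩
      have hbB' : b ≤ B := le_trans (Nat.le_mul_of_pos_right b (by omega)) hbB
      refine (bil_zero (by omega) hbB' (hdec (B - b)) (by positivity)).mono (le_of_eq ?_)
      congr 2
      rw [Nat.cast_sub hbB']
      field_simp
      push_cast
      ring
    | succ l ih =>
      intro hlk
      obtain ⟨C₁, hC₁, hih⟩ := ih (by omega)
      set θ : ℝ := ((k - (l + 1) : ℕ) : ℝ) / (k - (l + 1) + 1 : ℕ) with hθ
      refine ⟨C * (C₁ ^ θ * C₀ ^ (1 - θ)), by positivity, fun B b hb hFb hbB hbk => ?_⟩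
      obtain ⟨w, hw⟩ := hFb
      obtain ⟨f, hf⟩ := Nat.dvd_factorial (Nat.succ_pos l) hlk.le
      have hbf : b = (l + 1) * (f * F * w) := by rw [hw, hf, Nat.succ_eq_add_one]; ring
      set a := f * F * w * (k - (l + 1) + 1) with ha
      have hab : (l + 1) * a = b * (k - (l + 1) + 1) := by rw [ha, hbf]; ring
      have hakb : a ≤ b * k := by
        have h1 : f * F * w ≤ b := by rw [hbf]; exact Nat.le_mul_of_pos_left _ (by omega)
        exact Nat.mul_le_mul h1 (by omega)
      have hfw : 1 ≤ f * F * w := by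
        rcases Nat.eq_zero_or_pos (f * F * w) with h0 | h0
        · rw [h0] at hbf; omega
        · exact h0
      have ha1 : 1 ≤ a := Nat.mul_pos hfw (by omega)
      have hb2 := h B (k - (l + 1)) a (by omega) (by omega) ha1
        ⟨f * w * (k - (l + 1) + 1), by rw [ha]; ring⟩
        (le_trans (Nat.mul_le_mul_right _ hakb) (by rw [mul_assoc]; exact hbB)) (hakb.trans hbk)
      have hb1 := hih B b hb ⟨w, hw⟩ hbB hbk
      have hstep := Bil.step (B := B) (b := b) (Nat.succ_pos l) hlk hp hb hab (hakb.trans hbk)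
        (by positivity) (by positivity) (by positivity) (hlow (l + 1) (by omega) hlk (a - 1))
        hb1 hb2
      refine hstep.mono ?_
      rw [← hθ]
      have hE : ∀ x : ℝ, 0 ≤ (p : ℝ) ^ x := fun x => by positivity
      rw [Real.mul_rpow hC₁ (hE _), Real.mul_rpow hC₀ (hE _), ← Real.rpow_mul hp0.le,
        ← Real.rpow_mul hp0.le]
      have hrw : ∀ e₁ e₂ e₃ : ℝ, C * (p : ℝ) ^ e₁ * (C₁ ^ θ * (p : ℝ) ^ e₂ *
          (C₀ ^ (1 - θ) * (p : ℝ) ^ e₃)) =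
          C * (C₁ ^ θ * C₀ ^ (1 - θ)) * (p : ℝ) ^ (e₁ + e₂ + e₃) := by
        intro e₁ e₂ e₃
        rw [Real.rpow_add hp0, Real.rpow_add hp0]; ring
      rw [hrw]
      refine mul_le_mul_of_nonneg_left (Real.rpow_le_rpow_of_exponent_le hp1 ?_) (by positivity)
      have hl' : ((l : ℝ) + 1) < k := by exact_mod_cast hlk
      have hl'' : (l : ℝ) + 1 + 1 ≤ k := by exact_mod_cast hlk
      have hθ' : θ = ((k : ℝ) - (l + 1)) / (k - (l + 1) + 1) := by
        rw [hθ]; push_cast [Nat.cast_sub hlk.le]; rfl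
      have hd : (0 : ℝ) < (k : ℝ) - (l + 1) + 1 := by linarith
      have hab' : ((l : ℝ) + 1) * a = b * (k - (l + 1) + 1) := by
        have h0 : (((l + 1) * a : ℕ) : ℝ) = ((b * (k - (l + 1) + 1) : ℕ) : ℝ) := by rw [hab]
        push_cast [Nat.cast_sub hlk.le] at h0
        exact h0
      have hakb' : (a : ℝ) ≤ b * k := by exact_mod_cast hakb
      have hb0 : (0 : ℝ) < b := by exact_mod_cast hb
      have hcast : ((k - (l + 1) : ℕ) : ℝ) = k - (l + 1) := by push_cast [Nat.cast_sub hlk.le]; rfl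
      rw [hcast, Nat.cast_sub ha1, hθ']
      -- the last term in closed form
      have h3 : ((k : ℝ) - (k - (l + 1))) * (k - (l + 1)) * m * a =
          (k - (l + 1)) * m * (b * (k - (l + 1) + 1)) := by
        rw [← hab']; ring
      rw [h3]
      push_cast
      have h4 : ε * ((a : ℝ) - 1) ≤ ((k : ℝ) - (l + 1)) * k * ε * b := by
        have : ε * ((a : ℝ) - 1) ≤ ε * (b * k) := mul_le_mul_of_nonneg_left (by linarith) hε
        have h6 : ε * (b * k) * 1 ≤ ε * (b * k) * (k - (l + 1)) :=
          mul_le_mul_of_nonneg_left (by linarith) (by positivity)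
        linarith
      have h5 : (η * B - (k - l) * (η / k + l * (m - k * ε)) * b) *
            (((k : ℝ) - (l + 1)) / (k - (l + 1) + 1)) +
          (η * B - (k - (l + 1)) * m * (b * (k - (l + 1) + 1))) *
            (1 - ((k : ℝ) - (l + 1)) / (k - (l + 1) + 1)) =
          η * B - (k - (l + 1)) * (η / k + l * (m - k * ε)) * b - (k - (l + 1)) * m * b := by
        field_simp
        ring
      linarith
  choose! C₁ hC₁ hin using inner
  refine ⟨∑ l ∈ range k, C₁ l, sum_nonneg fun l hl => hC₁ l (mem_range.mp hl), ?_⟩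
  intro B l b hl hlk hb hFb hbB hbk
  refine (hin l hlk B b hb hFb hbB hbk).mono ?_
  have h1 : C₁ l ≤ ∑ l ∈ range k, C₁ l :=
    single_le_sum (fun l hl => hC₁ l (mem_range.mp hl)) (mem_range.mpr hlk)
  refine mul_le_mul h1 (Real.rpow_le_rpow_of_exponent_le hp1 ?_) (by positivity)
    ((hC₁ l hlk).trans h1)
  have hl' : (l : ℝ) ≤ k := by exact_mod_cast hlk.le
  have h2 : (l : ℝ) * (m + μ) ≤ η / k + l * (m - k * ε) := by
    have h3 : (l : ℝ) * μ ≤ l * (η / k ^ 2 - k * ε) := mul_le_mul_of_nonneg_left hμ (by positivity)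
    have h4 : (l : ℝ) * (η / k ^ 2) ≤ η / k := by
      rw [show η / (k : ℝ) = k * (η / k ^ 2) by field_simp]
      exact mul_le_mul_of_nonneg_right hl' (by positivity)
    nlinarith
  have h5 : ((k : ℝ) - l) * (l * (m + μ)) * b ≤ (k - l) * (η / k + l * (m - k * ε)) * b := by
    refine mul_le_mul_of_nonneg_right (mul_le_mul_of_nonneg_left h2 (by linarith)) (by positivity)
  nlinarith

lemma bil_iterate {k : ℕ} (hk : 2 ≤ k) (hp : k < p) {η ε μ C : ℝ}
    (hη : 0 ≤ η) (hε : 0 ≤ ε) (hC : 0 ≤ C) (hμ : μ ≤ η / k ^ 2 - k * ε)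
    (hdec : ∀ n, Dec p k n (C * (p : ℝ) ^ (η * n)))
    (hlow : ∀ l, 1 ≤ l → l < k → ∀ n, Dec p l n (C * (p : ℝ) ^ (ε * n))) (j : ℕ) :
    ∃ C₀ : ℝ, 0 ≤ C₀ ∧ ∀ B l b : ℕ, 1 ≤ l → l < k → 1 ≤ b → k.factorial ^ j ∣ b →
      b * k ^ j ≤ B →
      Bil p k B l b (C₀ * (p : ℝ) ^ (η * B - (k - l) * l * (j * μ) * b)) := by
  have hp1 : (1 : ℝ) ≤ p := prime_cast_one_le
  induction j with
  | zero =>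
    refine ⟨C, hC, fun B l b hl hlk hb _ hbB => ?_⟩
    simp only [pow_zero, mul_one] at hbB
    have hle : ∀ n ≤ B, C * (p : ℝ) ^ (η * n) ≤ C * (p : ℝ) ^ (η * B) := by
      intro n hn
      refine mul_le_mul_of_nonneg_left (Real.rpow_le_rpow_of_exponent_le hp1 ?_) hC
      exact mul_le_mul_of_nonneg_left (by exact_mod_cast hn) hη
    refine (bil_trivial hl hlk hbB (by omega) ((hdec (B - b)).mono (hle _ (Nat.sub_le _ _)))
      ((hdec (B - 1)).mono (hle _ (Nat.sub_le _ _))) (by positivity)).mono (le_of_eq ?_)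
    simp
  | succ j ih =>
    obtain ⟨C₀, hC₀, h⟩ := ih
    obtain ⟨C₁, hC₁, h1⟩ := bil_round hk hp (F := k.factorial ^ j) (kj := k ^ j) (m := j * μ)
      hη hε hC hC₀ hμ hdec hlow
      (fun B l b a1 a2 a3 a4 a5 _ => h B l b a1 a2 a3 a4 a5)
    refine ⟨C₁, hC₁, fun B l b hl hlk hb hFb hbB => ?_⟩
    have := h1 B l b hl hlk hb (by rwa [pow_succ'] at hFb) (by rwa [pow_succ'] at hbB)
      (le_trans (Nat.mul_le_mul_left _ (Nat.le_self_pow (by omega) k)) hbB)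
    refine this.mono (le_of_eq ?_)
    congr 3
    push_cast
    ring

end

section

open Finset Polynomial

/-- Pointwise broad–narrow dichotomy. -/
lemma broad_narrow {α : Type*} [Fintype α] [DecidableEq α] [Nonempty α] (g : α → ℂ) {s : ℕ}
    (hs : 1 ≤ s) :
    ‖∑ I, g I‖ ^ (2 * s) ≤ 4 ^ s * ∑ I, ‖g I‖ ^ (2 * s) +
      (2 * Fintype.card α : ℝ) ^ (2 * s) *
        ∑ I, ∑ J ∈ univ.erase I, ‖g I‖ ^ 2 * ‖g J‖ ^ (2 * (s - 1)) := by
  obtain ⟨I0, -, hI0⟩ := exists_max_image univ (fun I => ‖g I‖) univ_nonempty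
  have hn1 : 0 ≤ 4 ^ s * ∑ I, ‖g I‖ ^ (2 * s) := by positivity
  have hn2 : 0 ≤ (2 * Fintype.card α : ℝ) ^ (2 * s) *
        ∑ I, ∑ J ∈ univ.erase I, ‖g I‖ ^ 2 * ‖g J‖ ^ (2 * (s - 1)) := by positivity
  by_cases h : ‖∑ I, g I‖ ≤ 2 * ‖g I0‖
  · have h1 : ‖∑ I, g I‖ ^ (2 * s) ≤ 4 ^ s * ‖g I0‖ ^ (2 * s) := by
      calc _ ≤ (2 * ‖g I0‖) ^ (2 * s) := pow_le_pow_left₀ (norm_nonneg _) h _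
        _ = _ := by rw [mul_pow, pow_mul 2 2 s]; norm_num
    have h2 : ‖g I0‖ ^ (2 * s) ≤ ∑ I, ‖g I‖ ^ (2 * s) :=
      single_le_sum (f := fun I => ‖g I‖ ^ (2 * s)) (fun _ _ => by positivity) (mem_univ I0)
    have h3 : (4 : ℝ) ^ s * ‖g I0‖ ^ (2 * s) ≤ 4 ^ s * ∑ I, ‖g I‖ ^ (2 * s) := by gcongr
    linarith
  · push Not at h
    set n : ℝ := ((Fintype.card α : ℕ) : ℝ) with hn
    have hn0 : 0 < n := by rw [hn]; exact_mod_cast Fintype.card_pos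
    obtain ⟨I, hI, hI1⟩ : ∃ I ∈ univ.erase I0, ‖∑ I, g I‖ ≤ 2 * n * ‖g I‖ := by
      by_contra! hcon
      have h1 : ‖∑ I, g I‖ ≤ ‖g I0‖ + ∑ I ∈ univ.erase I0, ‖g I‖ := by
        rw [add_sum_erase univ (fun I => ‖g I‖) (mem_univ I0)]
        exact norm_sum_le _ _
      have h2 : ∑ I ∈ univ.erase I0, 2 * n * ‖g I‖ ≤ n * ‖∑ I, g I‖ := by
        calc _ ≤ ∑ I ∈ univ.erase I0, ‖∑ I, g I‖ := sum_le_sum fun I hI => (hcon I hI).le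
          _ ≤ ∑ I : α, ‖∑ I, g I‖ := sum_le_sum_of_subset_of_nonneg (erase_subset _ _)
              (fun _ _ _ => norm_nonneg _)
          _ = _ := by simp [hn]
      rw [← mul_sum] at h2
      have h3 : 2 * ∑ I ∈ univ.erase I0, ‖g I‖ ≤ ‖∑ I, g I‖ := by
        refine le_of_mul_le_mul_left ?_ hn0; linarith
      linarith
    have hII : ‖g I‖ ≤ ‖g I0‖ := hI0 I (mem_univ I)
    have h1 : ‖∑ I, g I‖ ^ (2 * s) ≤ (2 * n) ^ (2 * s) * (‖g I‖ ^ 2 * ‖g I0‖ ^ (2 * (s - 1))) := by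
      calc _ ≤ (2 * n * ‖g I‖) ^ (2 * s) := pow_le_pow_left₀ (norm_nonneg _) hI1 _
        _ = (2 * n) ^ (2 * s) * (‖g I‖ ^ 2 * ‖g I‖ ^ (2 * (s - 1))) := by
            rw [mul_pow, ← pow_add]; congr 2; omega
        _ ≤ _ := by gcongr
    have h2 : ‖g I‖ ^ 2 * ‖g I0‖ ^ (2 * (s - 1)) ≤
        ∑ I, ∑ J ∈ univ.erase I, ‖g I‖ ^ 2 * ‖g J‖ ^ (2 * (s - 1)) := by
      refine le_trans ?_ (single_le_sum (f := fun I => ∑ J ∈ univ.erase I,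
        ‖g I‖ ^ 2 * ‖g J‖ ^ (2 * (s - 1))) (fun _ _ => by positivity) (mem_univ I))
      refine single_le_sum (f := fun J => ‖g I‖ ^ 2 * ‖g J‖ ^ (2 * (s - 1)))
        (fun _ _ => by positivity) ?_
      rw [mem_erase] at hI ⊢
      exact ⟨hI.1.symm, mem_univ _⟩
    have h3 : (2 * n) ^ (2 * s) * (‖g I‖ ^ 2 * ‖g I0‖ ^ (2 * (s - 1))) ≤ (2 * n) ^ (2 * s) *
        ∑ I, ∑ J ∈ univ.erase I, ‖g I‖ ^ 2 * ‖g J‖ ^ (2 * (s - 1)) := by gcongr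
    linarith

lemma norm_sum_pow_le {α : Type*} [Fintype α] [Nonempty α] (g : α → ℂ) (n : ℕ) :
    ‖∑ I, g I‖ ^ n ≤ (Fintype.card α : ℝ) ^ n * ∑ I, ‖g I‖ ^ n := by
  obtain ⟨I0, -, hI0⟩ := exists_max_image univ (fun I => ‖g I‖) univ_nonempty
  have h1 : ‖∑ I, g I‖ ≤ Fintype.card α * ‖g I0‖ := by
    refine (norm_sum_le _ _).trans ((sum_le_sum fun I hI => hI0 I hI).trans ?_)
    simp
  calc _ ≤ (Fintype.card α * ‖g I0‖) ^ n := pow_le_pow_left₀ (norm_nonneg _) h1 _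
    _ = (Fintype.card α : ℝ) ^ n * ‖g I0‖ ^ n := mul_pow _ _ _
    _ ≤ _ := by
        refine mul_le_mul_of_nonneg_left ?_ (by positivity)
        exact single_le_sum (f := fun I => ‖g I‖ ^ n) (fun _ _ => by positivity) (mem_univ I0)

lemma sum_pow_le_pow_sum_of_nonneg {α : Type*} (A : Finset α) (f : α → ℝ) (hf : ∀ i, 0 ≤ f i)
    {n : ℕ} (hn : 1 ≤ n) : ∑ i ∈ A, f i ^ n ≤ (∑ i ∈ A, f i) ^ n := by
  obtain ⟨n, rfl⟩ : ∃ m, n = m + 1 := ⟨n - 1, by omega⟩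
  rw [pow_succ, mul_sum]
  refine sum_le_sum fun i hi => ?_
  rw [pow_succ]
  refine mul_le_mul_of_nonneg_right (pow_le_pow_left₀ (hf i) ?_ _) (hf i)
  exact single_le_sum (fun i _ => hf i) hi

variable {p : ℕ} [Fact p.Prime]

lemma gsum_fiber {k : ℕ} (M : ℕ) (φ : Fin k → ℤ_[p][X]) {ι : Type} (c : ι → ℂ)
    (ν : ι → ℤ_[p]) (T : Finset ι) {β : Type} [Fintype β] [DecidableEq β] (lab : ι → β)
    (x : Fin k → ZMod (p ^ M)) :
    gsum M φ c ν T x = ∑ I : β, gsum M φ c ν {i ∈ T | lab i = I} x :=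
  (sum_fiberwise T lab _).symm

lemma lab_iff (a : ℕ) (x y : ℤ_[p]) :
    PadicInt.toZModPow a x = PadicInt.toZModPow a y ↔ (p : ℤ_[p]) ^ a ∣ x - y := by
  rw [← sub_eq_zero, ← map_sub, ← RingHom.mem_ker, PadicInt.ker_toZModPow,
      Ideal.mem_span_singleton]

/-- The linear decoupling constant is controlled by the previous scale and a bilinear constant. -/
lemma dec_of_bil {k B b : ℕ} {D K : ℝ} (hk : 2 ≤ k) (hb : 1 ≤ b) (hbB : b ≤ B) (hD : 0 ≤ D)
    (hK : 0 ≤ K) (hDec : Dec p k (B - 1) D) (hBil : Bil p k B 1 b K) :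
    Dec p k B (4 ^ tri k * D + (2 * p : ℝ) ^ (2 * tri k) * p ^ 2 * (p : ℝ) ^ (2 * tri k * b) * K) := by
  intro φ hφ ι S c ν α _ _ lab hlab
  have hs1 : 1 ≤ tri k := tri_pos (by omega)
  set s := tri k with hs
  set σ := sarc (k * B) φ c ν lab S with hσ
  have hσ0 : 0 ≤ σ := sarc_nonneg _ _ _ _ _ _
  change ∑ h, ‖gsum (k * B) φ c ν S h‖ ^ (2 * s) ≤ _ * σ ^ s
  set l1 : ι → ZMod (p ^ 1) := fun i => PadicInt.toZModPow 1 (ν i) with hl1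
  set lb : ι → ZMod (p ^ b) := fun i => PadicInt.toZModPow b (ν i) with hlb
  have hl1iff : ∀ i j, l1 i = l1 j ↔ (p : ℤ_[p]) ^ 1 ∣ ν i - ν j := fun i j => lab_iff 1 _ _
  have hlbiff : ∀ i j, lb i = lb j ↔ (p : ℤ_[p]) ^ b ∣ ν i - ν j := fun i j => lab_iff b _ _
  set P : ZMod (p ^ 1) → Finset ι := fun I => {i ∈ S | l1 i = I} with hP
  have hPS : ∀ I, ∀ i ∈ P I, i ∈ S := fun I i hi => (mem_filter.mp hi).1
  have hPd : ∀ I, ∀ i ∈ P I, ∀ j ∈ P I, (p : ℤ_[p]) ^ 1 ∣ ν i - ν j := fun I i hi j hj =>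
    (hl1iff i j).mp ((mem_filter.mp hi).2.trans (mem_filter.mp hj).2.symm)
  have hcompat1 : ∀ i ∈ S, ∀ j ∈ S, lab i = lab j → l1 i = l1 j := fun i hi j hj hij =>
    (hl1iff i j).mpr (dvd_trans (pow_dvd_pow _ (by omega)) ((hlab i hi j hj).mp hij))
  have hcompatb : ∀ i ∈ S, ∀ j ∈ S, lab i = lab j → lb i = lb j := fun i hi j hj hij =>
    (hlbiff i j).mpr (dvd_trans (pow_dvd_pow _ hbB) ((hlab i hi j hj).mp hij))
  -- narrow part
  have narrow : ∑ I, ∑ x, ‖gsum (k * B) φ c ν (P I) x‖ ^ (2 * s) ≤ D * σ ^ s := by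
    have h1 : ∀ I, ∑ x, ‖gsum (k * B) φ c ν (P I) x‖ ^ (2 * s) ≤
        D * sarc (k * B) φ c ν lab (P I) ^ s := fun I =>
      hDec.arc (by omega) (by omega) hD hφ (P I) c ν lab
        (fun i hi j hj => hlab i (hPS I i hi) j (hPS I j hj)) (hPd I)
    refine (sum_le_sum fun I _ => h1 I).trans ?_
    rw [← mul_sum]
    refine mul_le_mul_of_nonneg_left ?_ hD
    rw [hσ, ← sarc_sum (by omega) (k * B) φ c ν lab S l1 hcompat1]
    exact sum_pow_le_pow_sum_of_nonneg _ _ (fun I => sarc_nonneg _ _ _ _ _ _) hs1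
  -- broad part
  have hcard1 : (Fintype.card (ZMod (p ^ 1)) : ℝ) = p := by rw [ZMod.card]; simp
  have hcardb : (Fintype.card (ZMod (p ^ b)) : ℝ) = (p : ℝ) ^ b := by rw [ZMod.card]; simp
  have broad : ∀ I J, I ≠ J → ∑ x, ‖gsum (k * B) φ c ν (P I) x‖ ^ 2 *
      ‖gsum (k * B) φ c ν (P J) x‖ ^ (2 * (s - 1)) ≤
      (p : ℝ) ^ (2 * s * b) * (K * σ ^ s) := by
    intro I J hIJ
    have hpiece : ∀ J', ∑ x, ‖gsum (k * B) φ c ν (P I) x‖ ^ 2 *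
        ‖gsum (k * B) φ c ν {i ∈ P J | lb i = J'} x‖ ^ (2 * (s - 1)) ≤ K * σ ^ s := by
      intro J'
      have hb1 := hBil φ hφ ι (P I) {i ∈ P J | lb i = J'} c ν α lab
        (fun i hi j hj => hlab i (hPS I i hi) j (hPS I j hj))
        (fun i hi j hj => hlab i (hPS J i (mem_filter.mp hi).1) j (hPS J j (mem_filter.mp hj).1))
        (fun i hi j hj => by simpa using hPd I i hi j hj)
        (fun i hi j hj => (hlbiff i j).mp ((mem_filter.mp hi).2.trans (mem_filter.mp hj).2.symm))
        (fun i hi j hj hd => hIJ ?_)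
      · have ht1 : tri 1 = 1 := rfl
        rw [ht1] at hb1
        calc _ = ∑ x, (‖gsum (k * B) φ c ν {i ∈ P J | lb i = J'} x‖ ^ 2) ^ (s - 1) *
              (‖gsum (k * B) φ c ν (P I) x‖ ^ 2) ^ 1 := by
              refine sum_congr rfl fun x _ => ?_
              rw [pow_one, ← pow_mul, mul_comm]
          _ ≤ _ := hb1
          _ ≤ K * (σ ^ (s - 1) * σ ^ 1) := by
              have e1 : sarc (k * B) φ c ν lab (P I) ≤ σ :=
                sarc_mono_filter (by omega) _ _ _ _ _ _ l1 hcompat1 I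
              have e2 : sarc (k * B) φ c ν lab {i ∈ P J | lb i = J'} ≤ σ :=
                (sarc_mono_filter (by omega) _ _ _ _ _ _ lb
                  (fun i hi j hj => hcompatb i (hPS J i hi) j (hPS J j hj)) J').trans
                (sarc_mono_filter (by omega) _ _ _ _ _ _ l1 hcompat1 J)
              have e3 := sarc_nonneg (k * B) φ c ν lab (P I)
              have e4 := sarc_nonneg (k * B) φ c ν lab {i ∈ P J | lb i = J'}
              gcongr
          _ = K * σ ^ s := by rw [← pow_add]; congr 2; omega
      · rw [← (mem_filter.mp hi).2, ← (mem_filter.mp (mem_filter.mp hj).1).2, hl1iff, pow_one]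
        exact hd
    calc _ ≤ ∑ x, ‖gsum (k * B) φ c ν (P I) x‖ ^ 2 * (((p : ℝ) ^ b) ^ (2 * (s - 1)) *
          ∑ J', ‖gsum (k * B) φ c ν {i ∈ P J | lb i = J'} x‖ ^ (2 * (s - 1))) := by
          refine sum_le_sum fun x _ => mul_le_mul_of_nonneg_left ?_ (by positivity)
          rw [gsum_fiber _ _ _ _ (P J) lb, ← hcardb]
          exact norm_sum_pow_le _ _
      _ = ((p : ℝ) ^ b) ^ (2 * (s - 1)) * ∑ J', ∑ x, ‖gsum (k * B) φ c ν (P I) x‖ ^ 2 *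
          ‖gsum (k * B) φ c ν {i ∈ P J | lb i = J'} x‖ ^ (2 * (s - 1)) := by
          rw [sum_comm, mul_sum]
          refine sum_congr rfl fun x _ => ?_
          rw [mul_sum, mul_sum, mul_sum]
          exact sum_congr rfl fun _ _ => by ring
      _ ≤ ((p : ℝ) ^ b) ^ (2 * (s - 1)) * ∑ J' : ZMod (p ^ b), K * σ ^ s := by
          gcongr with J' _; exact hpiece J'
      _ = ((p : ℝ) ^ b) ^ (2 * (s - 1) + 1) * (K * σ ^ s) := by
          rw [sum_const, nsmul_eq_mul, card_univ, hcardb]; ring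
      _ ≤ _ := by
          rw [← pow_mul]
          refine mul_le_mul_of_nonneg_right (pow_le_pow_right₀ prime_cast_one_le ?_) (by positivity)
          rw [mul_comm b]
          exact Nat.mul_le_mul_right b (by omega)
  calc _ ≤ ∑ x, (4 ^ s * ∑ I, ‖gsum (k * B) φ c ν (P I) x‖ ^ (2 * s) +
      (2 * p : ℝ) ^ (2 * s) * ∑ I, ∑ J ∈ univ.erase I, ‖gsum (k * B) φ c ν (P I) x‖ ^ 2 *
        ‖gsum (k * B) φ c ν (P J) x‖ ^ (2 * (s - 1))) := by
        refine sum_le_sum fun x _ => ?_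
        rw [gsum_fiber _ _ _ _ S l1, ← hcard1]
        exact broad_narrow _ hs1
    _ = 4 ^ s * ∑ I, ∑ x, ‖gsum (k * B) φ c ν (P I) x‖ ^ (2 * s) +
      (2 * p : ℝ) ^ (2 * s) * ∑ I, ∑ J ∈ univ.erase I, ∑ x, ‖gsum (k * B) φ c ν (P I) x‖ ^ 2 *
        ‖gsum (k * B) φ c ν (P J) x‖ ^ (2 * (s - 1)) := by
        rw [sum_add_distrib, ← mul_sum, ← mul_sum, sum_comm]
        congr 2
        rw [sum_comm]
        exact sum_congr rfl fun I _ => sum_comm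
    _ ≤ 4 ^ s * (D * σ ^ s) + (2 * p : ℝ) ^ (2 * s) *
        ∑ I : ZMod (p ^ 1), ∑ J : ZMod (p ^ 1), (p : ℝ) ^ (2 * s * b) * (K * σ ^ s) := by
        gcongr with I _
        refine (sum_le_sum fun J hJ => broad I J (ne_of_mem_erase hJ).symm).trans ?_
        exact sum_le_sum_of_subset_of_nonneg (erase_subset _ _) (fun _ _ _ => by positivity)
    _ = _ := by
        simp only [sum_const, nsmul_eq_mul, card_univ, hcard1]
        ring

/-- The trivial step in the scale. -/
lemma dec_trivial_step {k B : ℕ} {D : ℝ} (hk : 1 ≤ k) (hB : 1 ≤ B) (hD : 0 ≤ D)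
    (hDec : Dec p k (B - 1) D) : Dec p k B ((p : ℝ) ^ (2 * tri k) * D) := by
  intro φ hφ ι S c ν α _ _ lab hlab
  have hs1 : 1 ≤ tri k := tri_pos hk
  set s := tri k with hs
  set σ := sarc (k * B) φ c ν lab S with hσ
  change ∑ h, ‖gsum (k * B) φ c ν S h‖ ^ (2 * s) ≤ _ * σ ^ s
  set l1 : ι → ZMod (p ^ 1) := fun i => PadicInt.toZModPow 1 (ν i) with hl1
  have hl1iff : ∀ i j, l1 i = l1 j ↔ (p : ℤ_[p]) ^ 1 ∣ ν i - ν j := fun i j => lab_iff 1 _ _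
  have hcompat1 : ∀ i ∈ S, ∀ j ∈ S, lab i = lab j → l1 i = l1 j := fun i hi j hj hij =>
    (hl1iff i j).mpr (dvd_trans (pow_dvd_pow _ (by omega)) ((hlab i hi j hj).mp hij))
  have hcard1 : (Fintype.card (ZMod (p ^ 1)) : ℝ) = p := by rw [ZMod.card]; simp
  calc _ ≤ ∑ x, (p : ℝ) ^ (2 * s) *
        ∑ I, ‖gsum (k * B) φ c ν {i ∈ S | l1 i = I} x‖ ^ (2 * s) := by
        refine sum_le_sum fun x _ => ?_
        rw [gsum_fiber _ _ _ _ S l1, ← hcard1]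
        exact norm_sum_pow_le _ _
    _ = (p : ℝ) ^ (2 * s) * ∑ I, ∑ x, ‖gsum (k * B) φ c ν {i ∈ S | l1 i = I} x‖ ^ (2 * s) := by
        rw [← mul_sum, sum_comm]
    _ ≤ (p : ℝ) ^ (2 * s) * ∑ I, D * sarc (k * B) φ c ν lab {i ∈ S | l1 i = I} ^ s := by
        gcongr with I _
        exact hDec.arc hk hB hD hφ _ c ν lab
          (fun i hi j hj => hlab i (mem_filter.mp hi).1 j (mem_filter.mp hj).1)
          (fun i hi j hj => (hl1iff i j).mp
            ((mem_filter.mp hi).2.trans (mem_filter.mp hj).2.symm))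
    _ ≤ (p : ℝ) ^ (2 * s) * (D * σ ^ s) := by
        rw [← mul_sum, hσ, ← sarc_sum hk (k * B) φ c ν lab S l1 hcompat1]
        gcongr
        exact sum_pow_le_pow_sum_of_nonneg _ _ (fun I => sarc_nonneg _ _ _ _ _ _) hs1
    _ = _ := by ring

lemma dec_zero {k : ℕ} (hk : 1 ≤ k) : Dec p k 0 1 := by
  intro φ hφ ι S c ν α _ _ lab hlab
  have h0 : tri k ≠ 0 := by have := tri_pos hk; omega
  rw [one_mul]
  rcases S.eq_empty_or_nonempty with rfl | ⟨i0, hi0⟩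
  · have h1 : (tri k : ℝ)⁻¹ ≠ 0 := by positivity
    simp [h0]
  · have h1 : {i ∈ S | lab i = lab i0} = S := by
      rw [filter_eq_self]
      intro i hi
      rw [hlab i hi i0 hi0]; simp
    set F : Finset ι → ℝ := fun A => ∑ h : Fin k → ZMod (p ^ (k * 0)),
      ‖∑ i ∈ A, c i * phase (k * 0) h φ (ν i)‖ ^ (2 * tri k) with hF
    have hF0 : ∀ A, 0 ≤ F A := fun A => sum_nonneg fun _ _ => by positivity
    change F S ≤ (∑ I, F {i ∈ S | lab i = I} ^ ((tri k : ℝ)⁻¹)) ^ tri k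
    have h2 : F S ^ ((tri k : ℝ)⁻¹) ≤ ∑ I, F {i ∈ S | lab i = I} ^ ((tri k : ℝ)⁻¹) := by
      have := single_le_sum (f := fun I => F {i ∈ S | lab i = I} ^ ((tri k : ℝ)⁻¹))
        (fun _ _ => Real.rpow_nonneg (hF0 _) _) (mem_univ (lab i0))
      simpa only [h1] using this
    calc F S = (F S ^ ((tri k : ℝ)⁻¹)) ^ tri k := (Real.rpow_inv_natCast_pow (hF0 _) h0).symm
      _ ≤ _ := pow_le_pow_left₀ (Real.rpow_nonneg (hF0 _) _) h2 _

lemma dec_trivial {k : ℕ} (hk : 1 ≤ k) (B : ℕ) : Dec p k B ((p : ℝ) ^ (2 * tri k * B)) := by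
  induction B with
  | zero => simpa using dec_zero hk
  | succ B ih =>
    have := dec_trivial_step (B := B + 1) hk (by omega) (by positivity) ih
    refine this.mono (le_of_eq ?_)
    rw [← pow_add]; congr 1; ring

end

section

open Finset Polynomial

section
variable {p : ℕ} [Fact p.Prime]

lemma dec_one (B : ℕ) : Dec p 1 B 1 := by
  intro φ hφ ι S c ν α _ _ lab hlab
  have ht : tri 1 = 1 := rfl
  simp only [ht, mul_one, one_mul, pow_one, Nat.cast_one, inv_one, Real.rpow_one]
  set E : ℤ_[p] → ZMod (p ^ (1 * B)) := fun z => PadicInt.toZModPow (1 * B) ((φ 0).eval z) with hE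
  have hinj : ∀ x y, E x = E y → (p : ℤ_[p]) ^ B ∣ x - y := by
    intro x y hxy
    rw [hE] at hxy
    simp only at hxy
    rw [lab_iff, one_mul] at hxy
    obtain ⟨q, hq⟩ := hφ 0
    have h1 : φ 0 = X + C (p : ℤ_[p]) * q := by rw [← hq]; simp
    obtain ⟨r, hr⟩ := Polynomial.sub_dvd_eval_sub x y q
    have h2 : (φ 0).eval x - (φ 0).eval y = (x - y) * (1 + p * r) := by
      rw [h1]; simp only [eval_add, eval_X, eval_mul, eval_C]
      linear_combination (p : ℤ_[p]) * hr
    rw [h2] at hxy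
    have hu : IsUnit (1 + (p : ℤ_[p]) * r) := by
      rw [PadicInt.isUnit_iff]
      by_contra hne
      have h3 : ‖1 + (p : ℤ_[p]) * r‖ < 1 := lt_of_le_of_ne (PadicInt.norm_le_one _) hne
      rw [PadicInt.norm_lt_one_iff_dvd] at h3
      have h4 : (p : ℤ_[p]) ∣ 1 := (dvd_add_left (dvd_mul_right _ _)).mp h3
      exact PadicInt.prime_p.not_dvd_one h4
    exact (hu.dvd_mul_right).mp hxy
  have horth : ∀ i ∈ S, ∀ j ∈ S, lab i ≠ lab j →
      ∑ h : Fin 1 → ZMod (p ^ (1 * B)), phase (1 * B) h φ (ν i) *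
        (starRingEnd ℂ) (phase (1 * B) h φ (ν j)) = 0 := by
    intro i hi j hj hij
    have h0 : E (ν i) - E (ν j) ≠ 0 := fun h =>
      hij ((hlab i hi j hj).mpr (hinj _ _ (sub_eq_zero.mp h)))
    have h1 : ∀ h : Fin 1 → ZMod (p ^ (1 * B)), phase (1 * B) h φ (ν i) *
        (starRingEnd ℂ) (phase (1 * B) h φ (ν j)) = psi (1 * B) (h 0 * (E (ν i) - E (ν j))) := by
      intro h
      have h2 : psi (1 * B) (h 0 * E (ν i)) =
          psi (1 * B) (h 0 * (E (ν i) - E (ν j))) * psi (1 * B) (h 0 * E (ν j)) := by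
        rw [← psi_add]; congr 1; ring
      have h3 : psi (1 * B) (h 0 * E (ν j)) * (starRingEnd ℂ) (psi (1 * B) (h 0 * E (ν j))) = 1 := by
        rw [Complex.mul_conj, Complex.normSq_eq_norm_sq, norm_psi]; simp
      simp only [phase, Fin.sum_univ_one]
      change psi (1 * B) (h 0 * E (ν i)) * (starRingEnd ℂ) (psi (1 * B) (h 0 * E (ν j))) = _
      rw [h2, mul_assoc, h3, mul_one]
    simp only [h1]
    refine (Fintype.sum_equiv (Equiv.funUnique (Fin 1) (ZMod (p ^ (1 * B)))) _
      (fun t => psi (1 * B) (t * (E (ν i) - E (ν j)))) (fun h => rfl)).trans ?_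
    rw [psi_sum_mul, if_neg h0]
  set g : α → (Fin 1 → ZMod (p ^ (1 * B))) → ℂ := fun I h =>
    ∑ i ∈ S with lab i = I, c i * phase (1 * B) h φ (ν i) with hg
  have hIJ : ∀ I J, I ≠ J → ∑ h, g I h * (starRingEnd ℂ) (g J h) = 0 := by
    intro I J hne
    have : ∀ h, g I h * (starRingEnd ℂ) (g J h) = ∑ i ∈ S with lab i = I, ∑ j ∈ S with lab j = J,
        (c i * (starRingEnd ℂ) (c j)) * (phase (1 * B) h φ (ν i) *
        (starRingEnd ℂ) (phase (1 * B) h φ (ν j))) := by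
      intro h
      rw [hg]; simp only [map_sum, map_mul, sum_mul_sum]
      exact sum_congr rfl fun i _ => sum_congr rfl fun j _ => by ring
    simp only [this]
    rw [sum_comm]
    refine sum_eq_zero fun i hi => ?_
    rw [sum_comm]
    refine sum_eq_zero fun j hj => ?_
    rw [← mul_sum, horth i (mem_filter.mp hi).1 j (mem_filter.mp hj).1, mul_zero]
    rw [(mem_filter.mp hi).2, (mem_filter.mp hj).2]; exact hne
  refine le_of_eq ?_
  have hsum : ∀ h, ∑ i ∈ S, c i * phase (1 * B) h φ (ν i) = ∑ I, g I h := fun h =>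
    (sum_fiberwise S lab _).symm
  have hC : ((∑ h, ‖∑ i ∈ S, c i * phase (1 * B) h φ (ν i)‖ ^ 2 : ℝ) : ℂ) =
      ((∑ I, ∑ h, ‖g I h‖ ^ 2 : ℝ) : ℂ) := by
    have hn : ∀ z : ℂ, ((‖z‖ ^ 2 : ℝ) : ℂ) = z * (starRingEnd ℂ) z := fun z => by
      rw [Complex.mul_conj, Complex.normSq_eq_norm_sq]
    rw [Complex.ofReal_sum, Complex.ofReal_sum]
    simp only [Complex.ofReal_sum, hn, hsum, map_sum, sum_mul_sum]
    rw [sum_comm]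
    refine sum_congr rfl fun I _ => ?_
    rw [sum_comm]
    exact sum_eq_single I (fun J _ hJ => hIJ I J hJ.symm) (fun h => absurd (mem_univ I) h)
  exact_mod_cast hC

/-- One improvement of the decoupling exponent. -/
lemma dec_improve {k : ℕ} (hk : 2 ≤ k) (hp : k < p) {η₀ η C : ℝ} (hη₀ : 0 < η₀) (hη : η₀ ≤ η)
    (hC : 0 ≤ C) (hpbig : 2 * 4 ^ tri k ≤ (p : ℝ) ^ (η₀ / 2)) {j : ℕ}
    (hj : 2 * tri k + 1 ≤ (k - 1 : ℝ) * (j * (η₀ / (2 * k ^ 2))))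
    (hdec : ∀ n, Dec p k n (C * (p : ℝ) ^ (η * n)))
    (hlow : ∀ l, 1 ≤ l → l < k → ∀ n, Dec p l n (C * (p : ℝ) ^ (η₀ / (2 * k ^ 3) * n)))
    {σ : ℝ} (hσ : 0 ≤ σ) (hσ1 : σ * k ^ j ≤ 1) (hσ2 : σ ≤ η₀ / 2) :
    ∃ C₁ : ℝ, 0 ≤ C₁ ∧ ∀ n, Dec p k n (C₁ * (p : ℝ) ^ ((η - σ) * n)) := by
  have hk0 : (0 : ℝ) < k := by exact_mod_cast (by omega : 0 < k)
  have hp1 : (1 : ℝ) ≤ p := prime_cast_one_le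
  have hp0 : (0 : ℝ) < p := prime_cast_pos
  have hη0 : 0 ≤ η := hη₀.le.trans hη
  obtain ⟨C₀, hC₀, hbil⟩ := bil_iterate hk hp (η := η) (ε := η₀ / (2 * k ^ 3))
    (μ := η₀ / (2 * k ^ 2)) hη0 (by positivity) hC (by
      have : (k : ℝ) * (η₀ / (2 * k ^ 3)) = η₀ / k ^ 2 / 2 := by field_simp
      rw [this]
      have h1 : η₀ / (2 * (k : ℝ) ^ 2) = η₀ / k ^ 2 / 2 := by field_simp
      have h2 : η₀ / (k : ℝ) ^ 2 ≤ η / k ^ 2 := by gcongr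
      linarith) hdec hlow j
  set s := tri k with hs
  set F : ℕ := k.factorial ^ j * k ^ j with hF
  set A : ℝ := (2 * p : ℝ) ^ (2 * s) * p ^ 2 * C₀ * (p : ℝ) ^ ((k.factorial : ℝ) ^ j) with hA
  have hA0 : 0 ≤ A := by positivity
  set C₁ : ℝ := (p : ℝ) ^ (2 * s * F) + 2 * A with hC₁
  have hC₁0 : 0 ≤ C₁ := by positivity
  have hση : 0 ≤ η - σ := by linarith
  refine ⟨C₁, hC₁0, fun B => ?_⟩
  induction B using Nat.strong_induction_on with
  | _ B ih =>
  rcases lt_or_ge B F with hBF | hBF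
  · refine (dec_trivial (by omega) B).mono ?_
    have h1 : (p : ℝ) ^ (2 * s * B) ≤ (p : ℝ) ^ (2 * s * F) :=
      pow_le_pow_right₀ hp1 (Nat.mul_le_mul_left _ hBF.le)
    have h2 : (1 : ℝ) ≤ (p : ℝ) ^ ((η - σ) * B) :=
      Real.one_le_rpow hp1 (by positivity)
    calc _ ≤ (p : ℝ) ^ (2 * s * F) := h1
      _ ≤ C₁ := by linarith
      _ = C₁ * 1 := by ring
      _ ≤ _ := by gcongr
  · have hFpos : 0 < F := by
      have := Nat.factorial_pos k
      have : 0 < k := by omega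
      positivity
    have hB1 : 1 ≤ B := by omega
    set b : ℕ := k.factorial ^ j * (B / F) with hb
    have hdiv : 1 ≤ B / F := (Nat.one_le_div_iff hFpos).mpr hBF
    have hb1 : 1 ≤ b := Nat.mul_pos (pow_pos (Nat.factorial_pos k) j) hdiv
    have hbk : b * k ^ j = F * (B / F) := by rw [hb, hF]; ring
    have hbk1 : b * k ^ j ≤ B := hbk ▸ Nat.mul_div_le B F
    have hkj : 1 ≤ k ^ j := Nat.one_le_pow _ _ (by omega)
    have hbB : b ≤ B := (Nat.le_mul_of_pos_right b hkj).trans hbk1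
    have h1 := hbil B 1 b le_rfl (by omega) hb1 (Dvd.intro _ rfl) hbk1
    have hD0 : 0 ≤ C₁ * (p : ℝ) ^ ((η - σ) * ((B - 1 : ℕ) : ℝ)) := by positivity
    have h2 := dec_of_bil hk hb1 hbB hD0 (by positivity) (ih (B - 1) (by omega)) h1
    refine h2.mono ?_
    have hcast : ((B - 1 : ℕ) : ℝ) = B - 1 := by push_cast [Nat.cast_sub hB1]; ring
    have e1 : 4 ^ s * (C₁ * (p : ℝ) ^ ((η - σ) * ((B - 1 : ℕ) : ℝ))) ≤
        C₁ / 2 * (p : ℝ) ^ ((η - σ) * B) := by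
      have e2 : (p : ℝ) ^ ((η - σ) * B) =
          (p : ℝ) ^ ((η - σ) * ((B - 1 : ℕ) : ℝ)) * (p : ℝ) ^ (η - σ) := by
        rw [← Real.rpow_add hp0, hcast]; congr 1; ring
      have e3 : (2 : ℝ) * 4 ^ s ≤ (p : ℝ) ^ (η - σ) :=
        hpbig.trans (Real.rpow_le_rpow_of_exponent_le hp1 (by linarith))
      rw [e2]
      have e4 : 0 ≤ C₁ * (p : ℝ) ^ ((η - σ) * ((B - 1 : ℕ) : ℝ)) := hD0
      nlinarith
    have e5 : (2 * p : ℝ) ^ (2 * s) * p ^ 2 * (p : ℝ) ^ (2 * s * b) *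
        (C₀ * (p : ℝ) ^ (η * B - ((k : ℝ) - (1 : ℕ)) * (1 : ℕ) * (j * (η₀ / (2 * k ^ 2))) * b)) ≤
        A * (p : ℝ) ^ ((η - σ) * B) := by
      have hbig : (B : ℝ) ≤ b * k ^ j + k.factorial ^ j * k ^ j := by
        have : B < F * (B / F) + F := Nat.lt_mul_div_succ B hFpos |>.trans_eq (by ring)
        have h3 : B ≤ b * k ^ j + F := by omega
        have h4 : (B : ℝ) ≤ ((b * k ^ j + F : ℕ) : ℝ) := by exact_mod_cast h3
        refine h4.trans_eq ?_
        rw [hF]; push_cast; ring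
      have hexp : (2 * s * b : ℕ) +
          (η * B - ((k : ℝ) - (1 : ℕ)) * (1 : ℕ) * (j * (η₀ / (2 * k ^ 2))) * b) ≤
          (k.factorial : ℝ) ^ j + (η - σ) * B := by
        push_cast
        have hb0 : (0 : ℝ) ≤ b := by positivity
        have h5 : (2 * s + 1) * (b : ℝ) ≤ ((k : ℝ) - 1) * (j * (η₀ / (2 * k ^ 2))) * b := by gcongr
        have h6 : σ * B ≤ b + k.factorial ^ j := by
          calc σ * B ≤ σ * (b * k ^ j + k.factorial ^ j * k ^ j) := by gcongr
            _ = (σ * k ^ j) * (b + k.factorial ^ j) := by ring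
            _ ≤ 1 * (b + k.factorial ^ j) := by gcongr
            _ = _ := one_mul _
        nlinarith
      calc _ = (2 * p : ℝ) ^ (2 * s) * p ^ 2 * C₀ * (p : ℝ) ^ (((2 * s * b : ℕ) : ℝ) +
          (η * B - ((k : ℝ) - (1 : ℕ)) * (1 : ℕ) * (j * (η₀ / (2 * k ^ 2))) * b)) := by
            rw [Real.rpow_add hp0, Real.rpow_natCast]; ring
        _ ≤ (2 * p : ℝ) ^ (2 * s) * p ^ 2 * C₀ *
            (p : ℝ) ^ ((k.factorial : ℝ) ^ j + (η - σ) * B) := by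
            gcongr
        _ = _ := by rw [Real.rpow_add hp0, hA]; ring
    have e6 : A ≤ C₁ / 2 := by
      have : 0 ≤ (p : ℝ) ^ (2 * s * F) := by positivity
      linarith
    calc _ ≤ C₁ / 2 * (p : ℝ) ^ ((η - σ) * B) + A * (p : ℝ) ^ ((η - σ) * B) := add_le_add e1 e5
      _ ≤ C₁ / 2 * (p : ℝ) ^ ((η - σ) * B) + C₁ / 2 * (p : ℝ) ^ ((η - σ) * B) := by gcongr
      _ = _ := by ring

lemma dec_of_low {k : ℕ} (hk : 2 ≤ k) (hp : k < p) {η₀ C : ℝ} (hη₀ : 0 < η₀)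
    (hC : 0 ≤ C) (hpbig : 2 * 4 ^ tri k ≤ (p : ℝ) ^ (η₀ / 2))
    (hlow : ∀ l, 1 ≤ l → l < k → ∀ n, Dec p l n (C * (p : ℝ) ^ (η₀ / (2 * k ^ 3) * n))) :
    ∃ C₁ : ℝ, 0 ≤ C₁ ∧ ∀ n, Dec p k n (C₁ * (p : ℝ) ^ (η₀ * n)) := by
  have hk0 : (0 : ℝ) < k := by exact_mod_cast (by omega : 0 < k)
  have hk1 : (1 : ℝ) ≤ k - 1 := by
    have : (2 : ℝ) ≤ k := by exact_mod_cast hk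
    linarith
  have hp1 : (1 : ℝ) ≤ p := prime_cast_one_le
  obtain ⟨j, hj⟩ := exists_nat_ge ((2 * tri k + 1) / (η₀ / (2 * (k : ℝ) ^ 2)))
  have hj' : 2 * tri k + 1 ≤ (k - 1 : ℝ) * (j * (η₀ / (2 * k ^ 2))) := by
    rw [div_le_iff₀ (by positivity)] at hj
    have : 0 ≤ (j : ℝ) * (η₀ / (2 * k ^ 2)) := by positivity
    nlinarith
  set σ : ℝ := min (((k : ℝ) ^ j)⁻¹) (η₀ / 2) with hσ
  have hσ0 : 0 < σ := lt_min (by positivity) (by positivity)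
  have hσ1 : σ * k ^ j ≤ 1 := by
    calc _ ≤ ((k : ℝ) ^ j)⁻¹ * k ^ j := by gcongr; exact min_le_left _ _
      _ = 1 := inv_mul_cancel₀ (by positivity)
  have main : ∀ i : ℕ, ∃ C₁ : ℝ, 0 ≤ C₁ ∧
      ∀ n, Dec p k n (C₁ * (p : ℝ) ^ (max η₀ (2 * tri k - i * σ) * n)) := by
    intro i
    induction i with
    | zero =>
      refine ⟨1, zero_le_one, fun n => (dec_trivial (by omega) n).mono ?_⟩
      rw [one_mul, ← Real.rpow_natCast]
      refine Real.rpow_le_rpow_of_exponent_le hp1 ?_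
      push_cast
      gcongr
      simp
    | succ i ih =>
      obtain ⟨C₁, hC₁, h1⟩ := ih
      obtain ⟨C₂, hC₂, h2⟩ := dec_improve hk hp (C := C₁ + C) hη₀ (le_max_left _ _) (by positivity) hpbig hj'
        (fun n => (h1 n).mono (by gcongr; linarith))
        (fun l hl hlk n => (hlow l hl hlk n).mono (by gcongr; linarith))
        hσ0.le hσ1 (min_le_right _ _)
      refine ⟨C₂, hC₂, fun n => (h2 n).mono ?_⟩
      gcongr
      · rw [sub_le_iff_le_add]
        refine max_le ?_ ?_
        · exact le_add_of_le_of_nonneg (le_max_left _ _) hσ0.le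
        · have := le_max_right η₀ (2 * tri k - ((i + 1 : ℕ) : ℝ) * σ)
          push_cast at this ⊢
          linarith
  obtain ⟨i, hi⟩ := exists_nat_ge ((2 * tri k) / σ)
  obtain ⟨C₁, hC₁, h1⟩ := main i
  have : max η₀ (2 * tri k - i * σ) = η₀ := by
    refine max_eq_left ?_
    rw [div_le_iff₀ hσ0] at hi
    linarith
  rw [this] at h1
  exact ⟨C₁, hC₁, h1⟩

end

/-- The main conjecture in Vinogradov's mean value theorem, in decoupling form. -/
theorem exists_dec (k : ℕ) (hk : 1 ≤ k) : ∀ η : ℝ, 0 < η → ∃ p₀ : ℕ, ∀ (p : ℕ) [Fact p.Prime],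
    p₀ ≤ p → ∃ C : ℝ, 0 ≤ C ∧ ∀ n, Dec p k n (C * (p : ℝ) ^ (η * n)) := by
  induction k using Nat.strong_induction_on with
  | _ k ih =>
  intro η hη
  rcases Nat.eq_or_lt_of_le hk with rfl | hk2
  · refine ⟨0, fun p _ _ => ⟨1, zero_le_one, fun n => (dec_one n).mono ?_⟩⟩
    rw [one_mul]
    exact Real.one_le_rpow prime_cast_one_le (by positivity)
  · have hk0 : (0 : ℝ) < k := by exact_mod_cast (by omega : 0 < k)
    have h1 : ∀ l, ∃ p₀ : ℕ, 1 ≤ l → l < k → ∀ (p : ℕ) [Fact p.Prime],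
        p₀ ≤ p → ∃ C : ℝ, 0 ≤ C ∧ ∀ n, Dec p l n (C * (p : ℝ) ^ (η / (2 * k ^ 3) * n)) := by
      intro l
      by_cases hl : 1 ≤ l ∧ l < k
      · obtain ⟨p₀, hp₀⟩ := ih l hl.2 hl.1 (η / (2 * k ^ 3)) (by positivity)
        exact ⟨p₀, fun _ _ => hp₀⟩
      · exact ⟨0, fun a b => absurd ⟨a, b⟩ hl⟩
    choose P hP using h1
    obtain ⟨m, hm⟩ := exists_nat_ge (((2 : ℝ) * 4 ^ tri k) ^ (2 / η))
    refine ⟨∑ l ∈ range k, P l + (k + 1) + m, fun p _ hp => ?_⟩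
    have h2 : ∀ l, ∃ C : ℝ, 0 ≤ C ∧ (1 ≤ l → l < k → ∀ n,
        Dec p l n (C * (p : ℝ) ^ (η / (2 * k ^ 3) * n))) := by
      intro l
      by_cases hl : 1 ≤ l ∧ l < k
      · obtain ⟨C, hC, h⟩ := hP l hl.1 hl.2 p (by
          have : P l ≤ ∑ l ∈ range k, P l := single_le_sum (fun _ _ => Nat.zero_le _)
            (mem_range.mpr hl.2)
          omega)
        exact ⟨C, hC, fun _ _ => h⟩
      · exact ⟨0, le_rfl, fun a b => absurd ⟨a, b⟩ hl⟩
    choose C hC hCd using h2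
    refine dec_of_low hk2 (by omega) (C := ∑ l ∈ range k, C l) hη (sum_nonneg fun l _ => hC l) ?_
      (fun l hl hlk n => (hCd l hl hlk n).mono ?_)
    · have h3 : ((2 : ℝ) * 4 ^ tri k) ^ (2 / η) ≤ p := hm.trans (by exact_mod_cast (by omega))
      calc (2 : ℝ) * 4 ^ tri k = (((2 : ℝ) * 4 ^ tri k) ^ (2 / η)) ^ (η / 2) := by
            rw [← Real.rpow_mul (by positivity)]
            have : 2 / η * (η / 2) = 1 := by field_simp
            rw [this, Real.rpow_one]
        _ ≤ _ := Real.rpow_le_rpow (by positivity) h3 (by positivity)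
    · gcongr
      exact single_le_sum (f := C) (fun l _ => hC l) (mem_range.mpr hlk)

end

section

open Finset Polynomial

/-- Expansion of an even moment into pairs of tuples. -/
lemma norm_sum_pow_two_mul {ι : Type*} [DecidableEq ι] (A : Finset ι) (w : ι → ℂ) (σ : ℕ) :
    ((‖∑ n ∈ A, w n‖ ^ (2 * σ) : ℝ) : ℂ) =
      ∑ v ∈ Fintype.piFinset fun _ : Fin σ => A, ∑ v' ∈ Fintype.piFinset fun _ : Fin σ => A,
        (∏ i, w (v i)) * (starRingEnd ℂ) (∏ i, w (v' i)) := by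
  have h1 : (∑ n ∈ A, w n) ^ σ = ∑ v ∈ Fintype.piFinset fun _ : Fin σ => A, ∏ i, w (v i) := by
    rw [← prod_univ_sum (fun _ : Fin σ => A) (fun _ n => w n)]; simp
  rw [← sum_mul_sum, ← map_sum, ← h1, Complex.mul_conj, Complex.normSq_eq_norm_sq, norm_pow,
    ← pow_mul, mul_comm σ]

section
variable {p : ℕ} [Fact p.Prime]

/-- The monomial curve with given exponents. -/
noncomputable def monoCurve (p : ℕ) [Fact p.Prime] {s : ℕ} (d : Fin s → ℕ) (j : Fin s) : ℤ_[p][X] :=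
  X ^ d j

lemma psi_sum {M : ℕ} {ι : Type*} (A : Finset ι) (f : ι → ZMod (p ^ M)) :
    psi M (∑ i ∈ A, f i) = ∏ i ∈ A, psi M (f i) := by
  classical
  induction A using Finset.induction_on with
  | empty => simp [psi_zero]
  | insert a A ha ih => rw [sum_insert ha, prod_insert ha, psi_add, ih]

lemma psi_mul_conj {M : ℕ} (x y : ZMod (p ^ M)) :
    psi M x * (starRingEnd ℂ) (psi M y) = psi M (x - y) := by
  have h3 : psi M y * (starRingEnd ℂ) (psi M y) = 1 := by
    rw [Complex.mul_conj, Complex.normSq_eq_norm_sq, norm_psi]; simp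
  have h2 : psi M x = psi M (x - y) * psi M y := by
    rw [← psi_add]; congr 1; ring
  rw [h2, mul_assoc, h3, mul_one]

lemma psi_sum_vec {M s : ℕ} (y : Fin s → ZMod (p ^ M)) :
    ∑ x : Fin s → ZMod (p ^ M), psi M (∑ j, x j * y j) =
      if y = 0 then ((p : ℂ) ^ M) ^ s else 0 := by
  have h1 : ∑ x : Fin s → ZMod (p ^ M), psi M (∑ j, x j * y j) =
      ∏ j : Fin s, ∑ t : ZMod (p ^ M), psi M (t * y j) := by
    rw [prod_univ_sum]
    simp [psi_sum]
  rw [h1]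
  simp only [psi_sum_mul]
  split_ifs with h
  · simp [h]
  · obtain ⟨j, hj⟩ := Function.ne_iff.mp h
    exact prod_eq_zero (mem_univ j) (if_neg hj)

/-- The character sum along a monomial curve. -/
noncomputable def cursum {s : ℕ} (M : ℕ) (d : Fin s → ℕ) (A : Finset ℕ)
    (x : Fin s → ZMod (p ^ M)) : ℂ :=
  ∑ n ∈ A, psi M (∑ j, x j * (n : ZMod (p ^ M)) ^ d j)

lemma cursum_eq_gsum {s : ℕ} (M : ℕ) (d : Fin s → ℕ) (A : Finset ℕ)
    (x : Fin s → ZMod (p ^ M)) :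
    cursum M d A x = gsum M (monoCurve p d) (fun _ => 1) (fun n : ℕ => (n : ℤ_[p])) A x := by
  simp [cursum, gsum, phase, monoCurve]

/-- The moment of a curve sum counts solutions of congruences. -/
lemma cursum_moment {s : ℕ} (M σ : ℕ) (d : Fin s → ℕ) (A : Finset ℕ) :
    ∑ x : Fin s → ZMod (p ^ M), ‖cursum M d A x‖ ^ (2 * σ) =
      ((p : ℝ) ^ M) ^ s * #{vv ∈ (Fintype.piFinset fun _ : Fin σ => A) ×ˢ
        (Fintype.piFinset fun _ : Fin σ => A) | ∀ j, ∑ i, (vv.1 i : ZMod (p ^ M)) ^ d j =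
          ∑ i, (vv.2 i : ZMod (p ^ M)) ^ d j} := by
  have h1 : ∀ x : Fin s → ZMod (p ^ M), ((‖cursum M d A x‖ ^ (2 * σ) : ℝ) : ℂ) =
      ∑ vv ∈ (Fintype.piFinset fun _ : Fin σ => A) ×ˢ (Fintype.piFinset fun _ : Fin σ => A),
        psi M (∑ j, x j * (∑ i, (vv.1 i : ZMod (p ^ M)) ^ d j -
          ∑ i, (vv.2 i : ZMod (p ^ M)) ^ d j)) := by
    intro x
    rw [cursum, norm_sum_pow_two_mul, sum_product]
    refine sum_congr rfl fun v _ => sum_congr rfl fun v' _ => ?_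
    rw [← psi_sum, ← psi_sum, psi_mul_conj]
    congr 1
    simp only [mul_sub, mul_sum, sum_sub_distrib]
    congr 1 <;> exact sum_comm
  have h2 : ((∑ x : Fin s → ZMod (p ^ M), ‖cursum M d A x‖ ^ (2 * σ) : ℝ) : ℂ) =
      (((p : ℝ) ^ M) ^ s * #{vv ∈ (Fintype.piFinset fun _ : Fin σ => A) ×ˢ
        (Fintype.piFinset fun _ : Fin σ => A) | ∀ j, ∑ i, (vv.1 i : ZMod (p ^ M)) ^ d j =
          ∑ i, (vv.2 i : ZMod (p ^ M)) ^ d j} : ℝ) := by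
    rw [Complex.ofReal_sum]
    simp only [h1]
    rw [sum_comm]
    simp only [psi_sum_vec]
    rw [← sum_filter, sum_const, nsmul_eq_mul, mul_comm]
    push_cast
    congr 3
    ext vv
    simp [funext_iff, sub_eq_zero]
  exact_mod_cast h2

/-- The moment bound on one residue class. -/
lemma cursum_arc {s : ℕ} (hs : 1 ≤ s) {B N : ℕ} {D : ℝ} (hD : 0 ≤ D) (hDec : Dec p s B D)
    (hN : N < p ^ (B + 1)) (d : Fin s → ℕ) (c : ℤ_[p])
    (hdet : IsUnit (hasseMatrix (monoCurve p d) c).det) (T : Finset ℕ) (hTN : ∀ n ∈ T, n ≤ N)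
    (hT0 : ∀ n ∈ T, 0 < n) (hT : ∀ n ∈ T, (p : ℤ_[p]) ∣ (n : ℤ_[p]) - c) :
    ∑ x : Fin s → ZMod (p ^ (s * (B + 1))), ‖cursum (s * (B + 1)) d T x‖ ^ (2 * tri s) ≤
      D * (N : ℝ) ^ tri s * ((p : ℝ) ^ (s * (B + 1))) ^ s := by
  set M := s * (B + 1) with hMdef
  have hMs : M - s * B = s := by rw [hMdef, mul_add, mul_one, Nat.add_sub_cancel_left]
  have hσ1 : 1 ≤ tri s := tri_pos hs
  have hσ0 : tri s ≠ 0 := by omega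
  have hp0 : (p : ℤ_[p]) ≠ 0 := by exact_mod_cast (Fact.out : p.Prime).ne_zero
  obtain ⟨U, τ, hτ⟩ := exists_normal_form (monoCurve p d) c hdet
  have hm : ∀ n : ℕ, ∃ m, n ∈ T → (n : ℤ_[p]) = c + (p : ℤ_[p]) ^ 1 * m := by
    intro n
    by_cases hn : n ∈ T
    · obtain ⟨m, hm⟩ := hT n hn
      exact ⟨m, fun _ => by rw [pow_one, ← hm]; ring⟩
    · exact ⟨0, fun h => absurd h hn⟩
  choose m hm using hm
  set lab : ℕ → ZMod (p ^ (B + 1)) := fun n => (n : ZMod (p ^ (B + 1))) with hlabdef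
  have hlab' : ∀ n n' : ℕ, lab n = lab n' ↔ (p : ℤ_[p]) ^ (B + 1) ∣ (n : ℤ_[p]) - n' := by
    intro n n'
    rw [← lab_iff]; simp [hlabdef]
  have hinj : ∀ n ∈ T, ∀ n' ∈ T, lab n = lab n' → n = n' := by
    intro n hn n' hn' h
    rw [hlabdef] at h
    simp only at h
    rw [ZMod.natCast_eq_natCast_iff', Nat.mod_eq_of_lt ((hTN n hn).trans_lt hN),
      Nat.mod_eq_of_lt ((hTN n' hn').trans_lt hN)] at h
    exact h
  set Y : (Fin s → ZMod (p ^ (s * B))) → Fin s → ℤ_[p] := fun h j =>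
    ∑ i, U i j * ((p : ℤ_[p]) ^ (s - ((i : ℕ) + 1)) * ((h i).val : ℤ_[p]))
    with hYdef
  have key := hDec.shift hs hD (rescaled_nearMoment le_rfl τ) (M := M)
    (by rw [hMdef]; exact Nat.mul_le_mul_left _ (Nat.le_succ _)) (monoCurve p d) T (fun _ => 1)
    (fun n : ℕ => (n : ℤ_[p])) m lab ?_ (fun _ => 1) (fun _ => zero_le_one)
    Y (fun h => ∑ j, Y h j * (monoCurve p d j).eval c) ?_ (fun _ _ => rfl)
  · simp only [one_mul, ← cursum_eq_gsum] at key
    refine key.trans ?_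
    have hX : (Fintype.card (Fin s → ZMod (p ^ M)) : ℝ) = ((p : ℝ) ^ M) ^ s := by
      simp [ZMod.card]
    have hX0 : (0 : ℝ) ≤ ((p : ℝ) ^ M) ^ s := by positivity
    have hpiece : ∀ I, (∑ x : Fin s → ZMod (p ^ M), ‖cursum M d {i ∈ T | lab i = I} x‖ ^ (2 * tri s)) ^
        ((tri s : ℝ)⁻¹) ≤ #{i ∈ T | lab i = I} * (((p : ℝ) ^ M) ^ s) ^ ((tri s : ℝ)⁻¹) := by
      intro I
      have hc : #{i ∈ T | lab i = I} ≤ 1 := by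
        rw [card_le_one]
        intro a ha b hb
        rw [mem_filter] at ha hb
        exact hinj a ha.1 b hb.1 (ha.2.trans hb.2.symm)
      rcases Nat.le_one_iff_eq_zero_or_eq_one.mp hc with h | h
      · rw [card_eq_zero] at h
        rw [h]
        have h3 : (tri s : ℝ)⁻¹ ≠ 0 := by positivity
        simp [cursum, hσ0, Real.zero_rpow h3]
      · rw [h, Nat.cast_one, one_mul]
        refine Real.rpow_le_rpow (sum_nonneg fun _ _ => by positivity) ?_ (by positivity)
        obtain ⟨a, ha⟩ := card_eq_one.mp h
        rw [ha]
        simp only [cursum, sum_singleton, norm_psi, one_pow]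
        simp [ZMod.card]
    have hTc : (#T : ℝ) ≤ N := by
      have : #T ≤ #(Icc 1 N) := card_le_card fun n hn => mem_Icc.mpr ⟨hT0 n hn, hTN n hn⟩
      rw [Nat.card_Icc, Nat.add_sub_cancel] at this
      exact_mod_cast this
    calc _ ≤ D * (∑ I, #{i ∈ T | lab i = I} * (((p : ℝ) ^ M) ^ s) ^ ((tri s : ℝ)⁻¹)) ^ tri s := by
          gcongr with I _
          exact hpiece I
      _ = D * ((#T : ℝ) ^ tri s * ((p : ℝ) ^ M) ^ s) := by
          rw [← sum_mul, ← Nat.cast_sum, ← card_eq_sum_card_fiberwise (fun _ _ => mem_univ _),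
            mul_pow, Real.rpow_inv_natCast_pow hX0 hσ0]
      _ ≤ D * ((N : ℝ) ^ tri s * ((p : ℝ) ^ M) ^ s) := by gcongr
      _ = _ := by ring
  · intro i hi j hj
    rw [hlab', hm i hi, hm j hj, add_sub_add_left_eq_sub, ← mul_sub, add_comm B 1, pow_add]
    exact mul_dvd_mul_iff_left (pow_ne_zero _ hp0)
  · intro h i hi
    rw [← sub_eq_iff_eq_add', ← sum_sub_distrib, hMs]
    have h1 : ∀ i', ∑ j, U i' j * ((monoCurve p d j).eval (i : ℤ_[p]) - (monoCurve p d j).eval c) =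
        (p : ℤ_[p]) ^ (1 * ((i' : ℕ) + 1)) * (rescaled 1 τ i').eval (m i) := by
      intro i'
      rw [hm i hi, normal_form_eval hτ, rescaled_eval]
    calc ∑ j, (Y h j * (monoCurve p d j).eval (i : ℤ_[p]) - Y h j * (monoCurve p d j).eval c)
        = ∑ i' : Fin s, (p : ℤ_[p]) ^ (s - ((i' : ℕ) + 1)) * ((h i').val : ℤ_[p]) *
            ∑ j, U i' j * ((monoCurve p d j).eval (i : ℤ_[p]) - (monoCurve p d j).eval c) := by
          simp only [hYdef, sum_mul, mul_sum, ← sum_sub_distrib]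
          rw [sum_comm]
          exact sum_congr rfl fun _ _ => sum_congr rfl fun _ _ => by ring
      _ = _ := by
          rw [mul_sum]
          refine sum_congr rfl fun i' _ => ?_
          rw [h1]
          have h2 : (i' : ℕ) + 1 ≤ s := i'.2
          have h3 : (p : ℤ_[p]) ^ s = (p : ℤ_[p]) ^ (s - ((i' : ℕ) + 1)) *
                (p : ℤ_[p]) ^ ((i' : ℕ) + 1) := by
            rw [← pow_add, Nat.sub_add_cancel h2]
          rw [h3, one_mul]
          ring

/-- Counting solutions of the congruences attached to a monomial curve. -/
lemma count_congruences {s : ℕ} (hs : 1 ≤ s) {C η : ℝ} (hC : 0 ≤ C) (hη : 0 ≤ η)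
    (hDec : ∀ n, Dec p s n (C * (p : ℝ) ^ (η * n))) (d : Fin s → ℕ) {N : ℕ} (hN : 1 ≤ N)
    (A : Finset ℕ) (hA : A ⊆ Icc 1 N)
    (hdet : ∀ n ∈ A, IsUnit (hasseMatrix (monoCurve p d) (n : ℤ_[p])).det) :
    (#{vv ∈ (Fintype.piFinset fun _ : Fin (tri s) => A) ×ˢ
        (Fintype.piFinset fun _ : Fin (tri s) => A) | ∀ j,
          ∑ i, (vv.1 i : ZMod (p ^ (s * (Nat.log p N + 1)))) ^ d j =
          ∑ i, (vv.2 i : ZMod (p ^ (s * (Nat.log p N + 1)))) ^ d j} : ℝ) ≤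
      (p : ℝ) ^ (2 * tri s + 1) * C * (N : ℝ) ^ (tri s + η) := by
  set B := Nat.log p N with hB
  set M := s * (B + 1) with hM
  have hp0 : (0 : ℝ) < p := prime_cast_pos
  have hN0 : (0 : ℝ) < N := by exact_mod_cast hN
  have hX0 : (0 : ℝ) < ((p : ℝ) ^ M) ^ s := by positivity
  refine le_of_mul_le_mul_left ?_ hX0
  rw [← cursum_moment]
  have hNlt : N < p ^ (B + 1) := Nat.lt_pow_succ_log_self (Fact.out : p.Prime).one_lt N
  have hpB : (p : ℝ) ^ (η * B) ≤ (N : ℝ) ^ η := by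
    have h1 : p ^ B ≤ N := Nat.pow_log_le_self p (by omega)
    have h2 : (p : ℝ) ^ B ≤ N := by exact_mod_cast h1
    rw [mul_comm, Real.rpow_mul hp0.le, Real.rpow_natCast]
    exact Real.rpow_le_rpow (by positivity) h2 hη
  have hcardp : (Fintype.card (ZMod p) : ℝ) = p := by rw [ZMod.card]
  set P : ZMod p → Finset ℕ := fun I => {n ∈ A | (n : ZMod p) = I} with hP
  have harc : ∀ I, ∑ x : Fin s → ZMod (p ^ M), ‖cursum M d (P I) x‖ ^ (2 * tri s) ≤
      C * (N : ℝ) ^ η * (N : ℝ) ^ tri s * ((p : ℝ) ^ M) ^ s := by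
    intro I
    rcases (P I).eq_empty_or_nonempty with h | ⟨n0, hn0⟩
    · have h2 : tri s ≠ 0 := by have := tri_pos hs; omega
      rw [h]
      have : (0 : ℝ) ≤ C * (N : ℝ) ^ η * (N : ℝ) ^ tri s * ((p : ℝ) ^ M) ^ s := by positivity
      simpa [cursum, h2] using this
    · rw [hP, mem_filter] at hn0
      refine cursum_arc hs (by positivity) ((hDec B).mono ?_) hNlt d (n0 : ℤ_[p]) (hdet n0 hn0.1)
        (P I) (fun n hn => (mem_Icc.mp (hA (mem_filter.mp hn).1)).2)
        (fun n hn => (mem_Icc.mp (hA (mem_filter.mp hn).1)).1) ?_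
      · gcongr
      · intro n hn
        have h1 : (n : ZMod p) = (n0 : ZMod p) := (mem_filter.mp hn).2.trans hn0.2.symm
        rw [← PadicInt.norm_lt_one_iff_dvd, ← PadicInt.mem_nonunits,
          ← IsLocalRing.mem_maximalIdeal, ← PadicInt.ker_toZMod, RingHom.mem_ker, map_sub,
          map_natCast, map_natCast, h1, sub_self]
  calc _ ≤ ∑ x : Fin s → ZMod (p ^ M), (p : ℝ) ^ (2 * tri s) *
        ∑ I, ‖cursum M d (P I) x‖ ^ (2 * tri s) := by
        refine sum_le_sum fun x _ => ?_
        have : cursum M d A x = ∑ I, cursum M d (P I) x := (sum_fiberwise A _ _).symm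
        rw [this, ← hcardp]
        exact norm_sum_pow_le _ _
    _ = (p : ℝ) ^ (2 * tri s) * ∑ I, ∑ x, ‖cursum M d (P I) x‖ ^ (2 * tri s) := by
        rw [← mul_sum, sum_comm]
    _ ≤ (p : ℝ) ^ (2 * tri s) * ∑ I : ZMod p,
        C * (N : ℝ) ^ η * (N : ℝ) ^ tri s * ((p : ℝ) ^ M) ^ s := by
        gcongr with I _; exact harc I
    _ = _ := by
        rw [sum_const, nsmul_eq_mul, card_univ, hcardp, Real.rpow_add hN0, Real.rpow_natCast]
        ring

lemma isUnit_det_moment (k : ℕ) (c : ℤ_[p]) :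
    IsUnit (hasseMatrix (monoCurve p fun j : Fin k => (j : ℕ) + 1) c).det :=
  NearMoment.isUnit_det (fun j => by simp [monoCurve]) c

end

end

section

open Finset Polynomial

variable {p : ℕ} [Fact p.Prime]

/-- The exponents `1, 2, …, r, k`. -/
def lacExp (k r : ℕ) (j : Fin (r + 1)) : ℕ := if (j : ℕ) < r then (j : ℕ) + 1 else k

lemma isUnit_det_lac {k r : ℕ} (hr : r + 1 ≤ k) (hp : k < p) (c : ℤ_[p])
    (hc : PadicInt.toZMod c ≠ 0) :
    IsUnit (hasseMatrix (monoCurve p (lacExp k r)) c).det := by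
  apply isUnit_hasse_det
  intro v hv
  set c' : ZMod p := PadicInt.toZMod c with hc'
  have hcoef : ∀ n, (taylor c' (∑ i, C (v i) * (monoCurve p (lacExp k r) i).map
      PadicInt.toZMod)).coeff n =
      ∑ i, v i * (c' ^ (lacExp k r i - n) * ((lacExp k r i).choose n : ZMod p)) := by
    intro n
    rw [map_sum, finsetSum_coeff]
    refine sum_congr rfl fun i _ => ?_
    rw [taylor_mul, taylor_C, coeff_C_mul, monoCurve, Polynomial.map_pow, map_X, taylor_pow,
      taylor_X, coeff_X_add_C_pow]
  have hlast : v (Fin.last r) = 0 := by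
    have h1 := hv (Fin.last r)
    rw [hcoef, Fin.sum_univ_castSucc, Finset.sum_eq_zero, zero_add] at h1
    · have h2 : lacExp k r (Fin.last r) = k := by simp [lacExp]
      rw [h2, Fin.val_last] at h1
      have h3 : ((k.choose (r + 1) : ℕ) : ZMod p) ≠ 0 := by
        rw [Ne, ZMod.natCast_eq_zero_iff]
        intro h
        have h4 : p ∣ k.factorial := by
          rw [← Nat.choose_mul_factorial_mul_factorial hr, mul_assoc]
          exact h.mul_right _
        exact absurd (((Fact.out : p.Prime).dvd_factorial).mp h4) (by omega)
      exact (mul_eq_zero.mp h1).resolve_right (mul_ne_zero (pow_ne_zero _ hc) h3)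
    · intro i _
      have h2 : lacExp k r i.castSucc = (i : ℕ) + 1 := by simp [lacExp]
      rw [h2, Nat.choose_eq_zero_of_lt]
      · simp
      · simp
  have hP : ∑ i, C (v i) * (monoCurve p (lacExp k r) i).map PadicInt.toZMod =
      ∑ i : Fin r, C (v i.castSucc) * X ^ (1 + (i : ℕ)) := by
    rw [Fin.sum_univ_castSucc, hlast, C_0, zero_mul, add_zero]
    refine sum_congr rfl fun i _ => ?_
    have h2 : lacExp k r i.castSucc = 1 + (i : ℕ) := by simp [lacExp, add_comm]
    rw [monoCurve, h2]; simp
  rw [hP] at hv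
  have hdeg : (∑ i : Fin r, C (v i.castSucc) * X ^ (1 + (i : ℕ))).natDegree ≤ r := by
    refine natDegree_sum_le_of_forall_le _ _ fun i _ => ?_
    refine (natDegree_C_mul_X_pow_le _ _).trans ?_
    have := i.2; omega
  have h0 := eq_C_of_taylor_coeff _ c' hdeg (fun j hj1 hj2 => by
    have := hv ⟨j - 1, by omega⟩
    simpa [Nat.sub_add_cancel hj1] using this)
  ext i
  refine Fin.lastCases ?_ (fun i => ?_) i
  · simpa using hlast
  · have := h0 (1 + (i : ℕ)) (by omega)
    rw [coeff_sum_C_mul_X_pow 1 (fun i : Fin r => v i.castSucc)] at this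
    simpa using this

end

section

open Finset MeasureTheory

lemma e_add (x y : ℝ) : e (x + y) = e x * e y := by
  simp only [e, Complex.ofReal_add, mul_add, Complex.exp_add]

lemma e_zero : e 0 = 1 := by simp [e]

lemma norm_e (x : ℝ) : ‖e x‖ = 1 := by
  have : 2 * (Real.pi : ℂ) * Complex.I * x = ((2 * Real.pi * x : ℝ) : ℂ) * Complex.I := by
    push_cast; ring
  rw [e, this, Complex.norm_exp_ofReal_mul_I]

lemma e_neg (x : ℝ) : e (-x) = (starRingEnd ℂ) (e x) := by
  rw [e, e, ← Complex.exp_conj]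
  congr 1
  simp only [map_mul, Complex.conj_ofReal, Complex.conj_I, map_ofNat]
  push_cast; ring

lemma e_int (n : ℤ) : e n = 1 := by
  rw [e, Complex.exp_eq_one_iff]
  exact ⟨n, by push_cast; ring⟩

lemma e_mul_conj (x y : ℝ) : e x * (starRingEnd ℂ) (e y) = e (x - y) := by
  rw [← e_neg, ← e_add, sub_eq_add_neg]

lemma e_nsmul (n : ℕ) (x : ℝ) : e (n * x) = e x ^ n := by
  rw [e, e, ← Complex.exp_nat_mul]
  congr 1; push_cast; ring

lemma e_sum {ι : Type*} (A : Finset ι) (f : ι → ℝ) : e (∑ i ∈ A, f i) = ∏ i ∈ A, e (f i) := by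
  classical
  induction A using Finset.induction_on with
  | empty => simp [e_zero]
  | insert a A ha ih => rw [sum_insert ha, prod_insert ha, e_add, ih]

@[fun_prop]
lemma continuous_e : Continuous e := by
  unfold e
  fun_prop

lemma integral_e (m : ℤ) : ∫ α in (0 : ℝ)..1, e (m * α) = if m = 0 then 1 else 0 := by
  split_ifs with h
  · simp [h, e_zero]
  · have h1 : ∀ α : ℝ, e (m * α) = Complex.exp ((2 * Real.pi * Complex.I * m) * α) := by
      intro α
      rw [e]; congr 1; push_cast; ring
    have h2 : (2 * Real.pi * Complex.I * m : ℂ) ≠ 0 := by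
      simp [h, Real.pi_ne_zero]
    simp only [h1]
    rw [integral_exp_mul_complex h2]
    have h3 := e_int m
    rw [e] at h3
    have h4 : Complex.exp (2 * Real.pi * Complex.I * m * (1 : ℝ)) = 1 := by
      rw [← h3]; congr 1; push_cast; ring
    rw [h4]; simp

/-- Parseval's identity for trigonometric polynomials. -/
lemma parseval {ι : Type*} (S : Finset ι) (c : ι → ℂ) (m : ι → ℤ) :
    ((∫ α in (0 : ℝ)..1, ‖∑ i ∈ S, c i * e (m i * α)‖ ^ 2 : ℝ) : ℂ) =
      ∑ i ∈ S, ∑ j ∈ S, if m i = m j then c i * (starRingEnd ℂ) (c j) else 0 := by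
  rw [← intervalIntegral.integral_ofReal]
  have h1 : ∀ α : ℝ, ((‖∑ i ∈ S, c i * e (m i * α)‖ ^ 2 : ℝ) : ℂ) =
      ∑ i ∈ S, ∑ j ∈ S, c i * (starRingEnd ℂ) (c j) * e ((m i - m j : ℤ) * α) := by
    intro α
    rw [← Complex.normSq_eq_norm_sq, ← Complex.mul_conj, map_sum, sum_mul_sum]
    refine sum_congr rfl fun i _ => sum_congr rfl fun j _ => ?_
    have : ((m i - m j : ℤ) : ℝ) * α = m i * α - m j * α := by push_cast; ring
    rw [map_mul, this, ← e_mul_conj]; ring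
  simp only [h1]
  rw [intervalIntegral.integral_finsetSum]
  · refine sum_congr rfl fun i _ => ?_
    rw [intervalIntegral.integral_finsetSum]
    · refine sum_congr rfl fun j _ => ?_
      rw [intervalIntegral.integral_const_mul, integral_e]
      simp only [sub_eq_zero]
      split_ifs <;> simp
    · intro j _
      exact Continuous.intervalIntegrable (by fun_prop) _ _
  · intro i _
    exact Continuous.intervalIntegrable (by fun_prop) _ _

lemma parseval_card {ι : Type*} (S : Finset ι) (m : ι → ℤ) :
    ∫ α in (0 : ℝ)..1, ‖∑ i ∈ S, e (m i * α)‖ ^ 2 =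
      #{ij ∈ S ×ˢ S | m ij.1 = m ij.2} := by
  have h := parseval S (fun _ => 1) m
  simp only [one_mul, map_one] at h
  rw [← sum_product' (f := fun i j => if m i = m j then (1 : ℂ) else 0), ← sum_filter,
    sum_const, nsmul_eq_mul, mul_one] at h
  exact_mod_cast h

/-- Cauchy–Schwarz after splitting a sum into fibres. -/
lemma norm_sq_le_card_mul_fiber {ι κ : Type*} [DecidableEq κ] (V : Finset ι) (w : ι → ℂ)
    (G : ι → κ) (Ξ : Finset κ) (hG : ∀ v ∈ V, G v ∈ Ξ) :
    ‖∑ v ∈ V, w v‖ ^ 2 ≤ #Ξ * ∑ ξ ∈ Ξ, ‖∑ v ∈ V with G v = ξ, w v‖ ^ 2 := by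
  rw [← sum_fiberwise_of_maps_to hG w]
  calc _ ≤ (∑ ξ ∈ Ξ, ‖∑ v ∈ V with G v = ξ, w v‖) ^ 2 := by
        gcongr; exact norm_sum_le _ _
    _ ≤ _ := sq_sum_le_card_mul_sum_sq

lemma card_fiber_pairs {ι κ : Type*} [DecidableEq κ] (V : Finset ι) (P : ι × ι → Prop)
    [DecidablePred P]
    (G : ι → κ) (Ξ : Finset κ) (hG : ∀ v ∈ V, G v ∈ Ξ) :
    ∑ ξ ∈ Ξ, #{ij ∈ {v ∈ V | G v = ξ} ×ˢ {v ∈ V | G v = ξ} | P ij} =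
      #{ij ∈ V ×ˢ V | G ij.1 = G ij.2 ∧ P ij} := by
  classical
  rw [card_eq_sum_card_fiberwise (f := fun ij : ι × ι => G ij.1) (t := Ξ)]
  · refine sum_congr rfl fun ξ _ => congrArg card ?_
    ext ⟨a, b⟩
    simp only [mem_filter, mem_product]
    constructor
    · rintro ⟨⟨⟨h1, rfl⟩, h2, h3⟩, h4⟩
      exact ⟨⟨⟨h1, h2⟩, h3.symm, h4⟩, rfl⟩
    · rintro ⟨⟨⟨h1, h2⟩, h3, h4⟩, rfl⟩
      exact ⟨⟨⟨h1, rfl⟩, h2, h3.symm⟩, h4⟩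
  · intro ij hij
    simp only [coe_filter, mem_product, Set.mem_ofPred_eq] at hij
    exact hG _ hij.1.1

/-- The exponential sum over `k`-th powers from a finite set. -/
noncomputable def fset (k : ℕ) (A : Finset ℕ) (α : ℝ) : ℂ := ∑ n ∈ A, e (α * n ^ k)

@[fun_prop]
lemma continuous_fset (k : ℕ) (A : Finset ℕ) : Continuous (fset k A) := by
  unfold fset; fun_prop

lemma fset_pow (k : ℕ) (A : Finset ℕ) (α : ℝ) (σ : ℕ) :
    fset k A α ^ σ = ∑ v ∈ Fintype.piFinset fun _ : Fin σ => A,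
      e (((∑ i, v i ^ k : ℕ) : ℤ) * α) := by
  have h1 : (∑ n ∈ A, e (α * n ^ k)) ^ σ =
      ∑ v ∈ Fintype.piFinset fun _ : Fin σ => A, ∏ i, e (α * (v i : ℝ) ^ k) := by
    rw [← prod_univ_sum (fun _ : Fin σ => A) (fun _ n => e (α * (n : ℝ) ^ k))]; simp
  rw [fset, h1]
  refine sum_congr rfl fun v _ => ?_
  rw [← e_sum, ← mul_sum]
  congr 1; push_cast; ring

lemma norm_fset_pow (k : ℕ) (A : Finset ℕ) (α : ℝ) (σ : ℕ) :
    ‖fset k A α‖ ^ (2 * σ) = ‖∑ v ∈ Fintype.piFinset fun _ : Fin σ => A,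
      e (((∑ i, v i ^ k : ℕ) : ℤ) * α)‖ ^ 2 := by
  rw [← fset_pow, norm_pow, ← pow_mul, mul_comm]

/-- An even moment bounded by the number of solutions of a larger system. -/
lemma integral_fset_le {κ : Type*} [DecidableEq κ] (k σ : ℕ) (A : Finset ℕ)
    (G : (Fin σ → ℕ) → κ) (Ξ : Finset κ) (hG : ∀ v ∈ Fintype.piFinset fun _ : Fin σ => A, G v ∈ Ξ) :
    ∫ α in (0 : ℝ)..1, ‖fset k A α‖ ^ (2 * σ) ≤ #Ξ *
      #{vv ∈ (Fintype.piFinset fun _ : Fin σ => A) ×ˢ (Fintype.piFinset fun _ : Fin σ => A) |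
        G vv.1 = G vv.2 ∧ ∑ i, vv.1 i ^ k = ∑ i, vv.2 i ^ k} := by
  set V := Fintype.piFinset fun _ : Fin σ => A with hV
  set m : (Fin σ → ℕ) → ℤ := fun v => ((∑ i, v i ^ k : ℕ) : ℤ) with hm
  calc _ ≤ ∫ α in (0 : ℝ)..1, (#Ξ : ℝ) * ∑ ξ ∈ Ξ, ‖∑ v ∈ V with G v = ξ, e (m v * α)‖ ^ 2 := by
        refine intervalIntegral.integral_mono_on zero_le_one
          (Continuous.intervalIntegrable (by fun_prop) _ _)
          (Continuous.intervalIntegrable (by fun_prop) _ _) fun α _ => ?_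
        rw [norm_fset_pow]
        exact norm_sq_le_card_mul_fiber V _ G Ξ hG
    _ = #Ξ * ∑ ξ ∈ Ξ, (#{ij ∈ {v ∈ V | G v = ξ} ×ˢ {v ∈ V | G v = ξ} | m ij.1 = m ij.2} : ℝ) := by
        rw [intervalIntegral.integral_const_mul, intervalIntegral.integral_finsetSum]
        · simp only [parseval_card]
        · exact fun ξ _ => Continuous.intervalIntegrable (by fun_prop) _ _
    _ = _ := by
        rw [← Nat.cast_sum, card_fiber_pairs V (fun ij => m ij.1 = m ij.2) G Ξ hG]
        congr 3
        ext ij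
        simp only [hm, mem_filter]
        norm_cast

end

section

open Finset MeasureTheory

/-- The box containing the power sums of degrees `1, …, r` of `σ` integers up to `N`. -/
def powBox (r σ N : ℕ) : Finset (Fin r → ℕ) :=
  Fintype.piFinset fun j : Fin r => range (σ * N ^ ((j : ℕ) + 1) + 1)

lemma tri_eq_sum (r : ℕ) : ∑ j : Fin r, ((j : ℕ) + 1) = tri r := by
  induction r with
  | zero => rfl
  | succ r ih => rw [Fin.sum_univ_castSucc, tri_succ, ← ih]; simp

lemma card_powBox_le (r σ : ℕ) {N : ℕ} (hN : 1 ≤ N) :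
    (#(powBox r σ N) : ℝ) ≤ (σ + 1 : ℝ) ^ r * (N : ℝ) ^ tri r := by
  rw [powBox, Fintype.card_piFinset]
  push_cast
  calc _ ≤ ∏ j : Fin r, ((σ + 1 : ℝ) * (N : ℝ) ^ ((j : ℕ) + 1)) := by
        refine prod_le_prod (fun _ _ => by positivity) fun j _ => ?_
        rw [card_range]; push_cast
        have : (1 : ℝ) ≤ (N : ℝ) ^ ((j : ℕ) + 1) := one_le_pow₀ (by exact_mod_cast hN)
        linarith
    _ = _ := by
        rw [prod_mul_distrib, prod_const, card_univ, Fintype.card_fin, prod_pow_eq_pow_sum,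
          tri_eq_sum]

lemma mem_powBox {r σ N : ℕ} {A : Finset ℕ} (hA : A ⊆ Icc 1 N) {v : Fin σ → ℕ}
    (hv : v ∈ Fintype.piFinset fun _ : Fin σ => A) :
    (fun j : Fin r => ∑ i, v i ^ ((j : ℕ) + 1)) ∈ powBox r σ N := by
  rw [powBox, Fintype.mem_piFinset]
  intro j
  rw [mem_range, Nat.lt_succ_iff]
  calc _ ≤ ∑ i : Fin σ, N ^ ((j : ℕ) + 1) := sum_le_sum fun i _ =>
        Nat.pow_le_pow_left (mem_Icc.mp (hA (Fintype.mem_piFinset.mp hv i))).2 _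
    _ = _ := by simp

lemma integral_fset_scale (k σ : ℕ) (A : Finset ℕ) {q : ℕ} (hq : 0 < q) :
    ∫ α in (0 : ℝ)..1, ‖fset k A (q * α)‖ ^ (2 * σ) =
      ∫ α in (0 : ℝ)..1, ‖fset k A α‖ ^ (2 * σ) := by
  have h1 : ∀ α : ℝ, ‖fset k A (q * α)‖ ^ (2 * σ) =
      ‖∑ v ∈ Fintype.piFinset fun _ : Fin σ => A, e (((q * ∑ i, v i ^ k : ℕ) : ℤ) * α)‖ ^ 2 := by
    intro α
    rw [norm_fset_pow]
    congr 2
    refine sum_congr rfl fun v _ => ?_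
    congr 1; push_cast; ring
  simp only [h1, norm_fset_pow]
  rw [parseval_card _ (fun v : Fin σ → ℕ => ((q * ∑ i, v i ^ k : ℕ) : ℤ)),
    parseval_card _ (fun v : Fin σ → ℕ => ((∑ i, v i ^ k : ℕ) : ℤ))]
  congr 3
  ext v
  simp only [Nat.cast_inj]
  exact Nat.mul_right_inj hq.ne'

lemma fset_split (k N : ℕ) {p : ℕ} (hp : 0 < p) (α : ℝ) :
    fset k (Icc 1 N) α = fset k {n ∈ Icc 1 N | ¬ p ∣ n} α +
      fset k (Icc 1 (N / p)) (((p ^ k : ℕ) : ℝ) * α) := by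
  rw [fset, ← sum_filter_add_sum_filter_not (Icc 1 N) (fun n => ¬ p ∣ n)]
  congr 1
  simp only [not_not]
  symm
  refine sum_nbij' (fun n => p * n) (fun n => n / p) ?_ ?_ ?_ ?_ ?_
  · intro n hn
    rw [mem_Icc, Nat.le_div_iff_mul_le hp] at hn
    rw [mem_filter, mem_Icc]
    exact ⟨⟨Nat.mul_pos hp hn.1, by linarith [mul_comm p n]⟩, dvd_mul_right _ _⟩
  · intro n hn
    rw [mem_filter, mem_Icc] at hn
    rw [mem_Icc]
    exact ⟨Nat.div_pos (Nat.le_of_dvd hn.1.1 hn.2) hp, Nat.div_le_div_right hn.1.2⟩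
  · intro n _
    exact Nat.mul_div_cancel_left n hp
  · intro n hn
    exact Nat.mul_div_cancel' (mem_filter.mp hn).2
  · intro n _
    congr 1; push_cast; ring

lemma fset_Icc_zero (k : ℕ) (α : ℝ) : fset k (Icc 1 0) α = 0 := by simp [fset]

lemma two_tri_succ_le (s : ℕ) (hs : 1 ≤ s) : 2 * 2 ^ (2 * tri s) ≤ 8 ^ (s ^ 2) := by
  rw [two_tri, ← pow_succ', show (8 : ℕ) = 2 ^ 3 from rfl, ← pow_mul]
  exact Nat.pow_le_pow_right (by norm_num) (by nlinarith)

/-- The moment bound of order `s(s+1)` with `s = r + 1 ≤ k`. -/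
theorem lacunary_moment (k r : ℕ) (hr : r + 1 ≤ k) (ε : ℝ) (hε : 0 < ε) :
    ∃ C : ℝ, 0 ≤ C ∧ ∀ N : ℕ, ∫ α in (0 : ℝ)..1, ‖fset k (Icc 1 N) α‖ ^ (2 * tri (r + 1)) ≤
      C * (N : ℝ) ^ (((r + 1) ^ 2 : ℕ) + ε) := by
  obtain ⟨p₀, hp₀⟩ := exists_dec (r + 1) (by omega) ε hε
  obtain ⟨p, hpge, hpp⟩ := Nat.exists_infinite_primes (p₀ + k + 8)
  have : Fact p.Prime := ⟨hpp⟩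
  obtain ⟨D, hD, hDec⟩ := hp₀ p (by omega)
  set σ := tri (r + 1) with hσ
  have hσ1 : 1 ≤ σ := tri_pos (by omega)
  have htri : tri r + σ = (r + 1) ^ 2 := by
    have h1 := two_tri r
    have h2 := two_tri (r + 1)
    nlinarith
  set C₁ : ℝ := (σ + 1 : ℝ) ^ r * ((p : ℝ) ^ (2 * σ + 1) * D) with hC₁
  have hC₁0 : 0 ≤ C₁ := by positivity
  set E : ℝ := ((r + 1) ^ 2 : ℕ) + ε with hE
  have hE0 : 0 < E := by positivity
  have hunit : ∀ N : ℕ, 1 ≤ N → ∫ α in (0 : ℝ)..1,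
      ‖fset k {n ∈ Icc 1 N | ¬ p ∣ n} α‖ ^ (2 * σ) ≤ C₁ * (N : ℝ) ^ E := by
    intro N hN
    have hN0 : (0 : ℝ) < N := by exact_mod_cast hN
    set A := {n ∈ Icc 1 N | ¬ p ∣ n} with hA
    have hAN : A ⊆ Icc 1 N := filter_subset _ _
    have hcount := count_congruences (s := r + 1) (by omega) hD hε.le hDec (lacExp k r) hN A hAN
      (fun n hn => isUnit_det_lac hr (by omega) _ (by
        rw [map_natCast, Ne, ZMod.natCast_eq_zero_iff]
        exact (mem_filter.mp hn).2))
    refine (integral_fset_le k σ A (fun v => fun j : Fin r => ∑ i, v i ^ ((j : ℕ) + 1))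
      (powBox r σ N) (fun v hv => mem_powBox hAN hv)).trans ?_
    have hsub : (#{vv ∈ (Fintype.piFinset fun _ : Fin σ => A) ×ˢ (Fintype.piFinset fun _ : Fin σ => A) |
        (fun j : Fin r => ∑ i, vv.1 i ^ ((j : ℕ) + 1)) = (fun j : Fin r => ∑ i, vv.2 i ^ ((j : ℕ) + 1)) ∧
          ∑ i, vv.1 i ^ k = ∑ i, vv.2 i ^ k} : ℝ) ≤
        (p : ℝ) ^ (2 * σ + 1) * D * (N : ℝ) ^ (σ + ε) := by
      refine le_trans ?_ hcount
      rw [Nat.cast_le]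
      refine card_le_card fun vv hvv => ?_
      rw [mem_filter] at hvv ⊢
      refine ⟨hvv.1, fun j => ?_⟩
      rw [lacExp]
      split_ifs with hj
      · have := congrFun hvv.2.1 ⟨j, hj⟩
        exact_mod_cast congrArg (Nat.cast : ℕ → ZMod (p ^ ((r + 1) * (Nat.log p N + 1)))) this
      · exact_mod_cast congrArg (Nat.cast : ℕ → ZMod (p ^ ((r + 1) * (Nat.log p N + 1)))) hvv.2.2
    calc _ ≤ ((σ + 1 : ℝ) ^ r * (N : ℝ) ^ tri r) *
          ((p : ℝ) ^ (2 * σ + 1) * D * (N : ℝ) ^ (σ + ε)) := by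
          gcongr
          exact card_powBox_le r σ hN
      _ = C₁ * ((N : ℝ) ^ ((tri r : ℕ) : ℝ) * (N : ℝ) ^ (σ + ε)) := by
          rw [Real.rpow_natCast, hC₁]; ring
      _ = _ := by
          rw [← Real.rpow_add hN0, hE, ← htri]; congr 2; push_cast; ring
  refine ⟨2 * 2 ^ (2 * σ) * C₁, by positivity, fun N => ?_⟩
  induction N using Nat.strong_induction_on with
  | _ N ih =>
  rcases Nat.eq_zero_or_pos N with rfl | hN
  · have h1 : 2 * σ ≠ 0 := by omega
    simp only [fset_Icc_zero, norm_zero, ne_eq, h1, not_false_eq_true, zero_pow,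
      intervalIntegral.integral_zero]
    positivity
  · have hIH := ih (N / p) (Nat.div_lt_self hN hpp.one_lt)
    have hp0 : (0 : ℝ) < p := by exact_mod_cast hpp.pos
    have hdiv : (((N / p : ℕ) : ℝ)) ^ E ≤ (N : ℝ) ^ E / (2 * 2 ^ (2 * σ)) := by
      calc (((N / p : ℕ) : ℝ)) ^ E ≤ ((N : ℝ) / p) ^ E :=
            Real.rpow_le_rpow (by positivity) Nat.cast_div_le hE0.le
        _ = (N : ℝ) ^ E / (p : ℝ) ^ E := Real.div_rpow (by positivity) hp0.le _
        _ ≤ _ := by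
            gcongr
            calc (2 : ℝ) * 2 ^ (2 * σ) ≤ (8 : ℝ) ^ ((r + 1) ^ 2) := by
                  exact_mod_cast two_tri_succ_le (r + 1) (by omega)
              _ ≤ (p : ℝ) ^ ((r + 1) ^ 2) := by
                  gcongr; exact_mod_cast (by omega : 8 ≤ p)
              _ = (p : ℝ) ^ (((r + 1) ^ 2 : ℕ) : ℝ) := (Real.rpow_natCast _ _).symm
              _ ≤ _ := Real.rpow_le_rpow_of_exponent_le (by exact_mod_cast hpp.one_lt.le)
                  (by rw [hE]; linarith)
    calc _ ≤ ∫ α in (0 : ℝ)..1, (2 : ℝ) ^ (2 * σ) * (‖fset k {n ∈ Icc 1 N | ¬ p ∣ n} α‖ ^ (2 * σ) +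
          ‖fset k (Icc 1 (N / p)) (((p ^ k : ℕ) : ℝ) * α)‖ ^ (2 * σ)) := by
          refine intervalIntegral.integral_mono_on zero_le_one
            (Continuous.intervalIntegrable (by fun_prop) _ _)
            (Continuous.intervalIntegrable (by fun_prop) _ _) fun α _ => ?_
          rw [fset_split k N hpp.pos]
          calc _ ≤ (‖fset k {n ∈ Icc 1 N | ¬ p ∣ n} α‖ +
                ‖fset k (Icc 1 (N / p)) (((p ^ k : ℕ) : ℝ) * α)‖) ^ (2 * σ) := by
                gcongr; exact norm_add_le _ _
            _ ≤ 2 ^ (2 * σ - 1) * _ := add_pow_le (norm_nonneg _) (norm_nonneg _) _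
            _ ≤ _ := by
                gcongr
                · norm_num
                · omega
      _ = 2 ^ (2 * σ) * ((∫ α in (0 : ℝ)..1, ‖fset k {n ∈ Icc 1 N | ¬ p ∣ n} α‖ ^ (2 * σ)) +
          ∫ α in (0 : ℝ)..1, ‖fset k (Icc 1 (N / p)) α‖ ^ (2 * σ)) := by
          rw [intervalIntegral.integral_const_mul, intervalIntegral.integral_add,
            integral_fset_scale k σ _ (pow_pos hpp.pos k)]
          · exact Continuous.intervalIntegrable (by fun_prop) _ _
          · exact Continuous.intervalIntegrable (by fun_prop) _ _
      _ ≤ 2 ^ (2 * σ) * (C₁ * (N : ℝ) ^ E +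
          2 * 2 ^ (2 * σ) * C₁ * ((N : ℝ) ^ E / (2 * 2 ^ (2 * σ)))) := by
          gcongr
          · exact hunit N hN
          · exact hIH.trans (by gcongr)
      _ = _ := by field_simp; ring

end

section

open Finset MeasureTheory

/-- The distance to the nearest integer. -/
noncomputable def dnint (θ : ℝ) : ℝ := |θ - round θ|

lemma dnint_nonneg (θ : ℝ) : 0 ≤ dnint θ := abs_nonneg _

lemma dnint_le (θ : ℝ) (n : ℤ) : dnint θ ≤ |θ - n| := round_le θ n

lemma dnint_add_int (θ : ℝ) (n : ℤ) : dnint (θ + n) = dnint θ := by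
  rw [dnint, dnint, round_add_intCast]; push_cast; congr 1; ring

lemma dnint_le_add (θ φ : ℝ) : dnint θ ≤ dnint φ + |θ - φ| := by
  calc dnint θ ≤ |θ - round φ| := dnint_le _ _
    _ = |(φ - round φ) + (θ - φ)| := by congr 1; ring
    _ ≤ _ := abs_add_le _ _

lemma e_add_int (x : ℝ) (n : ℤ) : e (x + n) = e x := by rw [e_add, e_int, mul_one]

lemma norm_e_sub_one (θ : ℝ) : 4 * dnint θ ≤ ‖e θ - 1‖ := by
  have h0 : e θ = e (θ - round θ) := by
    rw [← e_add_int (θ - round θ) (round θ)]; congr 1; ring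
  set t := θ - round θ with ht
  have ht2 : |t| ≤ 1 / 2 := abs_sub_round θ
  have h1 : ‖e t - 1‖ = 2 * |Real.sin (Real.pi * t)| := by
    have h2 : e t = Complex.exp (Complex.I * ((2 * Real.pi * t : ℝ) : ℂ)) := by
      rw [e]; congr 1; push_cast; ring
    rw [h2, Complex.norm_exp_I_mul_ofReal_sub_one, Real.norm_eq_abs, abs_mul, abs_two]
    congr 3; ring
  rw [h0, h1]
  have h3 : |Real.pi * t| ≤ Real.pi / 2 := by
    rw [abs_mul, abs_of_pos Real.pi_pos]
    nlinarith [Real.pi_pos]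
  have h4 := Real.mul_abs_le_abs_sin h3
  rw [abs_mul, abs_of_pos Real.pi_pos, ← mul_assoc, div_mul_cancel₀ _ Real.pi_pos.ne'] at h4
  change 4 * |t| ≤ _
  linarith

/-- The majorant of a geometric sum of length `N`. -/
noncomputable def kern (N : ℕ) (θ : ℝ) : ℝ := N / max 1 (2 * N * dnint θ)

lemma kern_nonneg (N : ℕ) (θ : ℝ) : 0 ≤ kern N θ := by
  unfold kern; positivity

lemma kern_le (N : ℕ) (θ : ℝ) : kern N θ ≤ N :=
  div_le_self (by positivity) (le_max_left _ _)

lemma kern_le_inv (N : ℕ) {θ d : ℝ} (hd : 0 < d) (h : d ≤ dnint θ) : kern N θ ≤ 1 / (2 * d) := by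
  rcases Nat.eq_zero_or_pos N with rfl | hN
  · simp [kern]; positivity
  · have hN0 : (0 : ℝ) < N := by exact_mod_cast hN
    calc kern N θ ≤ N / (2 * N * d) := by
          unfold kern
          gcongr
          exact le_max_of_le_right (by gcongr)
      _ = _ := by field_simp

lemma kern_congr {N : ℕ} {θ φ : ℝ} (h : dnint θ = dnint φ) : kern N θ = kern N φ := by
  rw [kern, kern, h]

lemma norm_geom_le (a N : ℕ) (θ : ℝ) : ‖∑ z ∈ Ioc a (a + N), e (θ * z)‖ ≤ kern N θ := by
  have htriv : ‖∑ z ∈ Ioc a (a + N), e (θ * z)‖ ≤ N := by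
    refine (norm_sum_le _ _).trans ?_
    simp [norm_e]
  unfold kern
  rcases le_total (2 * N * dnint θ) 1 with h | h
  · rw [max_eq_left h]; simpa using htriv
  · rw [max_eq_right h]
    rcases Nat.eq_zero_or_pos N with rfl | hN
    · simp
    have hN0 : (0 : ℝ) < N := by exact_mod_cast hN
    have hd : 0 < dnint θ := by
      by_contra hcon
      have : dnint θ = 0 := le_antisymm (not_lt.mp hcon) (dnint_nonneg θ)
      rw [this] at h; norm_num at h
    have h1 : (N : ℝ) / (2 * N * dnint θ) = 2 / (4 * dnint θ) := by field_simp; norm_num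
    have h4 : 4 * dnint θ ≤ ‖e θ - 1‖ := norm_e_sub_one θ
    rw [h1, le_div_iff₀ (by positivity)]
    have h2 : ∑ z ∈ Ioc a (a + N), e (θ * z) = ∑ i ∈ range N, e (θ * (a + 1)) * e θ ^ i := by
      rw [← Ico_add_one_add_one_eq_Ioc, sum_Ico_eq_sum_range]
      have : a + N + 1 - (a + 1) = N := by omega
      rw [this]
      refine sum_congr rfl fun i _ => ?_
      rw [← e_nsmul, ← e_add]; congr 1; push_cast; ring
    have h3 : (∑ z ∈ Ioc a (a + N), e (θ * z)) * (e θ - 1) = e (θ * (a + 1)) * (e θ ^ N - 1) := by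
      rw [h2, ← mul_sum, mul_assoc, geom_sum_mul]
    calc _ ≤ ‖∑ z ∈ Ioc a (a + N), e (θ * z)‖ * ‖e θ - 1‖ := by gcongr
      _ = ‖e θ ^ N - 1‖ := by rw [← norm_mul, h3, norm_mul, norm_e, one_mul]
      _ ≤ ‖e θ ^ N‖ + ‖(1 : ℂ)‖ := norm_sub_le _ _
      _ = 2 := by rw [norm_pow, norm_e]; norm_num

/-- The majorant attached to the residue `m` modulo `q`. -/
noncomputable def resKern (N q m : ℕ) : ℝ := if m ≤ 2 then N else q / (2 * (m - 2 : ℝ))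

lemma resKern_nonneg (N q m : ℕ) : 0 ≤ resKern N q m := by
  unfold resKern
  split_ifs with h
  · positivity
  · have : (2 : ℝ) < m := by exact_mod_cast not_le.mp h
    have : 0 < (m : ℝ) - 2 := by linarith
    positivity

lemma sum_resKern_le (N q n : ℕ) (hn : n ≤ q + 1) :
    ∑ m ∈ range n, resKern N q m ≤ 3 * N + q / 2 * (1 + Real.log q) := by
  have h1 : ∀ m, resKern N q m ≤ (if m < 3 then (N : ℝ) else 0) +
      (if 3 ≤ m then (q : ℝ) / 2 * ((m - 2 : ℕ) : ℝ)⁻¹ else 0) := by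
    intro m
    unfold resKern
    split_ifs with h h' h'' <;> try omega
    · simp
    · have : ((m - 2 : ℕ) : ℝ) = m - 2 := by push_cast [Nat.cast_sub (by omega : 2 ≤ m)]; ring
      rw [this, zero_add, ← div_div, div_eq_mul_inv (_ / _)]
  refine (sum_le_sum fun m _ => h1 m).trans ?_
  rw [sum_add_distrib, ← sum_filter, ← sum_filter]
  refine add_le_add ?_ ?_
  · rw [sum_const, nsmul_eq_mul]
    gcongr
    have : {m ∈ range n | m < 3} ⊆ range 3 := fun m hm => mem_range.mpr (mem_filter.mp hm).2
    exact_mod_cast (card_le_card this).trans_eq (card_range 3)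
  · rw [← mul_sum]
    gcongr
    refine le_trans ?_ (harmonic_le_one_add_log q)
    rw [harmonic_eq_sum_Icc]
    push_cast
    have himg := sum_image (s := {m ∈ range n | 3 ≤ m}) (g := fun m => m - 2)
      (f := fun m : ℕ => (m : ℝ)⁻¹) ?_
    · refine himg.symm.le.trans ?_
      refine sum_le_sum_of_subset_of_nonneg ?_ fun _ _ _ => by positivity
      intro m hm
      obtain ⟨m', hm', rfl⟩ := mem_image.mp hm
      rw [mem_filter, mem_range] at hm'
      rw [mem_Icc]; omega
    · intro x hx y hy hxy
      simp only [coe_filter, Set.mem_ofPred_eq] at hx hy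
      simp only at hxy
      omega

/-- The sum of the kernel over a complete block of multiples of `θ`. -/
lemma sum_kern_block (N : ℕ) {q : ℕ} (hq : 0 < q) {a : ℤ} (ha : IsCoprime a (q : ℤ)) {θ : ℝ}
    (hθ : |θ - a / q| ≤ 1 / (q : ℝ) ^ 2) (c : ℝ) :
    ∑ i ∈ range q, kern N (c + i * θ) ≤ 6 * N + q * (1 + Real.log q) := by
  have hq0 : (0 : ℝ) < q := by exact_mod_cast hq
  have : NeZero q := ⟨hq.ne'⟩
  set c₀ : ℤ := ⌊c * q⌋ with hc₀
  set g : ZMod q → ℝ := fun x => resKern N q x.val + resKern N q (q - x.val) with hg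
  have hpt : ∀ i ∈ range q, kern N (c + i * θ) ≤ g ((i : ZMod q) * (a : ZMod q) + (c₀ : ZMod q)) := by
    intro i hi
    rw [mem_range] at hi
    set x : ZMod q := (i : ZMod q) * (a : ZMod q) + (c₀ : ZMod q) with hx
    set m := x.val with hm
    have hmq : m < q := ZMod.val_lt x
    obtain ⟨t, ht⟩ : ∃ t : ℤ, (i : ℤ) * a + c₀ = m + q * t := by
      have h1 : (((i : ℤ) * a + c₀ - m : ℤ) : ZMod q) = 0 := by
        push_cast
        rw [hm, ZMod.natCast_zmod_val, hx, sub_self]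
      rw [ZMod.intCast_zmod_eq_zero_iff_dvd] at h1
      obtain ⟨t, ht⟩ := h1
      exact ⟨t, by linarith⟩
    have hclose : |(c + i * θ) - ((m / q : ℝ) + t)| ≤ 2 / q := by
      have h1 : (c + i * θ) - ((m / q : ℝ) + t) = (c * q - c₀) / q + i * (θ - a / q) := by
        have : ((i : ℝ) * a + c₀) = m + q * t := by exact_mod_cast ht
        field_simp
        linear_combination this
      rw [h1]
      have h2 : |(c * q - c₀) / q| ≤ 1 / q := by
        rw [abs_div, abs_of_pos hq0]
        gcongr
        rw [abs_of_nonneg (by linarith [Int.floor_le (c * q)])]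
        linarith [Int.lt_floor_add_one (c * q)]
      have h3 : |(i : ℝ) * (θ - a / q)| ≤ 1 / q := by
        rw [abs_mul, abs_of_nonneg (Nat.cast_nonneg i)]
        calc (i : ℝ) * |θ - a / q| ≤ q * (1 / (q : ℝ) ^ 2) := by
              gcongr
          _ = 1 / q := by field_simp
      calc _ ≤ 1 / (q : ℝ) + 1 / q := (abs_add_le _ _).trans (add_le_add h2 h3)
        _ = _ := by ring
    have hd1 : dnint (m / q : ℝ) ≤ dnint (c + i * θ) + 2 / q := by
      have := dnint_le_add ((m / q : ℝ) + t) (c + i * θ)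
      rw [dnint_add_int, abs_sub_comm] at this
      linarith
    -- the distance of `m / q` to the nearest integer
    have hd2 : (m : ℝ) / q ≤ dnint (m / q : ℝ) ∨ ((q : ℝ) - m) / q ≤ dnint (m / q : ℝ) := by
      have h0 : (0 : ℝ) ≤ (m : ℝ) / q := by positivity
      have h1 : (m : ℝ) / q < 1 := by
        rw [div_lt_one hq0]; exact_mod_cast hmq
      unfold dnint
      rcases le_or_gt (round ((m : ℝ) / q)) 0 with h | h
      · left
        have : (round ((m : ℝ) / q) : ℝ) ≤ 0 := by exact_mod_cast h
        exact le_trans (by linarith) (le_abs_self _)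
      · right
        have : (1 : ℝ) ≤ (round ((m : ℝ) / q) : ℝ) := by exact_mod_cast h
        have h3 : ((q : ℝ) - m) / q = 1 - m / q := by field_simp
        rw [h3, abs_sub_comm]
        exact le_trans (by linarith) (le_abs_self _)
    have hres : ∀ n : ℕ, (n : ℝ) / q ≤ dnint (m / q : ℝ) → kern N (c + i * θ) ≤ resKern N q n := by
      intro n hn
      unfold resKern
      split_ifs with h
      · exact kern_le _ _
      · have h2 : (2 : ℝ) < n := by exact_mod_cast not_le.mp h
        have h3 : 0 < ((n : ℝ) - 2) / q := by
          have : 0 < (n : ℝ) - 2 := by linarith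
          positivity
        have h4 : ((n : ℝ) - 2) / q ≤ dnint (c + i * θ) := by
          rw [sub_div]; linarith
        refine (kern_le_inv N h3 h4).trans (le_of_eq ?_)
        have : (n : ℝ) - 2 ≠ 0 := by linarith
        field_simp
    rcases hd2 with h | h
    · exact (hres m h).trans (le_add_of_nonneg_right (resKern_nonneg _ _ _))
    · refine (hres (q - m) ?_).trans (le_add_of_nonneg_left (resKern_nonneg _ _ _))
      rw [Nat.cast_sub hmq.le]; exact h
  have hau : IsUnit (a : ZMod q) := by
    obtain ⟨u, v, huv⟩ := ha
    refine IsUnit.of_mul_eq_one (u : ZMod q) ?_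
    have := congrArg (Int.cast : ℤ → ZMod q) huv
    push_cast at this
    rw [ZMod.natCast_self, mul_zero, add_zero] at this
    rw [mul_comm]; exact this
  have hrange : ∀ f : ZMod q → ℝ, ∑ i ∈ range q, f (i : ZMod q) = ∑ x, f x := by
    intro f
    refine sum_nbij' (fun i => (i : ZMod q)) (fun x => x.val) (fun _ _ => mem_univ _)
      (fun x _ => mem_range.mpr (ZMod.val_lt x)) (fun i hi => ?_) (fun x _ => ?_) (fun _ _ => rfl)
    · exact ZMod.val_cast_of_lt (mem_range.mp hi)
    · exact ZMod.natCast_zmod_val x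
  calc _ ≤ ∑ i ∈ range q, g ((i : ZMod q) * (a : ZMod q) + (c₀ : ZMod q)) := sum_le_sum hpt
    _ = ∑ x : ZMod q, g (x * (a : ZMod q) + (c₀ : ZMod q)) :=
        hrange fun x => g (x * (a : ZMod q) + (c₀ : ZMod q))
    _ = ∑ x : ZMod q, g x := by
        refine Function.Bijective.sum_comp (e := fun x : ZMod q => x * (a : ZMod q) + (c₀ : ZMod q)) ?_ g
        refine Function.Injective.bijective_of_finite ?_
        intro x y hxy
        exact hau.mul_right_cancel (add_right_cancel hxy)
    _ = ∑ i ∈ range q, g (i : ZMod q) := (hrange g).symm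
    _ = ∑ i ∈ range q, (resKern N q i + resKern N q (q - i)) := by
        refine sum_congr rfl fun i hi => ?_
        simp only [hg]
        rw [ZMod.val_cast_of_lt (mem_range.mp hi)]
    _ = ∑ i ∈ range q, resKern N q i + ∑ i ∈ range q, resKern N q (i + 1) := by
        rw [sum_add_distrib]
        congr 1
        rw [← sum_range_reflect]
        refine sum_congr rfl fun i hi => ?_
        rw [mem_range] at hi
        congr 1; omega
    _ ≤ (3 * N + q / 2 * (1 + Real.log q)) + (3 * N + q / 2 * (1 + Real.log q)) := by
        refine add_le_add (sum_resKern_le N q q (by omega)) ?_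
        refine le_trans ?_ (sum_resKern_le N q (q + 1) le_rfl)
        rw [sum_range_succ' _ q]
        exact le_add_of_nonneg_right (resKern_nonneg _ _ _)
    _ = _ := by ring

end

section

open Finset MeasureTheory

lemma dnint_neg (θ : ℝ) : dnint (-θ) = dnint θ := by
  have h : ∀ x : ℝ, dnint (-x) ≤ dnint x := by
    intro x
    refine (dnint_le (-x) (-round x)).trans_eq ?_
    rw [dnint, ← abs_neg]; congr 1; push_cast; ring
  exact le_antisymm (h θ) (by simpa using h (-θ))

lemma kern_neg (N : ℕ) (θ : ℝ) : kern N (-θ) = kern N θ := kern_congr (dnint_neg θ)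

/-- A sum of squared fibre sums as a sum over pairs. -/
lemma sum_fiber_norm_sq {ι κ : Type*} [DecidableEq κ] (V : Finset ι) (w : ι → ℂ)
    (G : ι → κ) (Ξ : Finset κ) (hG : ∀ v ∈ V, G v ∈ Ξ) :
    ((∑ ξ ∈ Ξ, ‖∑ v ∈ V with G v = ξ, w v‖ ^ 2 : ℝ) : ℂ) =
      ∑ v ∈ V, ∑ v' ∈ V, if G v = G v' then w v * (starRingEnd ℂ) (w v') else 0 := by
  push_cast
  have h1 : ∀ ξ, (‖∑ v ∈ V with G v = ξ, w v‖ : ℂ) ^ 2 =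
      ∑ v ∈ V, if G v = ξ then ∑ v' ∈ V, (if G v' = ξ then w v * (starRingEnd ℂ) (w v') else 0)
        else 0 := by
    intro ξ
    rw [← Complex.ofReal_pow, ← Complex.normSq_eq_norm_sq, ← Complex.mul_conj, map_sum,
      sum_mul_sum, sum_filter]
    refine sum_congr rfl fun v _ => ?_
    split_ifs with h
    · rw [sum_filter]
    · rfl
  simp only [h1]
  rw [sum_comm]
  refine sum_congr rfl fun v hv => ?_
  rw [sum_ite_eq, if_pos (hG v hv)]
  refine sum_congr rfl fun v' _ => ?_
  simp only [eq_comm]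

lemma norm_sq_sum_le_weighted {ι : Type*} (J : Finset ι) (c B : ι → ℂ) (κ : ι → ℝ)
    (hc : ∀ j ∈ J, ‖c j‖ ≤ κ j) :
    ‖∑ j ∈ J, c j * B j‖ ^ 2 ≤ (∑ j ∈ J, κ j) * ∑ j ∈ J, κ j * ‖B j‖ ^ 2 := by
  have h1 : ‖∑ j ∈ J, c j * B j‖ ≤ ∑ j ∈ J, κ j * ‖B j‖ :=
    (norm_sum_le _ _).trans (sum_le_sum fun j hj => by
      rw [norm_mul]; have := hc j hj; gcongr)
  have hκ : ∀ j ∈ J, 0 ≤ κ j := fun j hj => (norm_nonneg _).trans (hc j hj)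
  calc _ ≤ (∑ j ∈ J, κ j * ‖B j‖) ^ 2 := by gcongr
    _ ≤ _ := sum_sq_le_sum_mul_sum_of_sq_le_mul J hκ
        (fun j hj => mul_nonneg (hκ j hj) (by positivity)) fun j _ => le_of_eq (by ring)

/-- A discrete large sieve inequality from Schur's test. -/
lemma schur_kern (N : ℕ) (θ R : ℝ) (T : Finset ℕ) (b : ℕ → ℂ)
    (hR : ∀ t ∈ T, ∑ t' ∈ T, kern N (-(t * θ) + t' * θ) ≤ R) :
    ∑ z ∈ Ioc 0 (0 + N), ‖∑ t ∈ T, e (-(θ * z * t)) * b t‖ ^ 2 ≤ R * ∑ t ∈ T, ‖b t‖ ^ 2 := by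
  have h1 : ((∑ z ∈ Ioc 0 (0 + N), ‖∑ t ∈ T, e (-(θ * z * t)) * b t‖ ^ 2 : ℝ) : ℂ) =
      ∑ t ∈ T, ∑ t' ∈ T, b t * (starRingEnd ℂ) (b t') *
        ∑ z ∈ Ioc 0 (0 + N), e ((-(t * θ) + t' * θ) * z) := by
    push_cast
    simp only [mul_sum]
    have h2 : ∀ z : ℕ, (‖∑ t ∈ T, e (-(θ * z * t)) * b t‖ : ℂ) ^ 2 =
        ∑ t ∈ T, ∑ t' ∈ T, b t * (starRingEnd ℂ) (b t') * e ((-(t * θ) + t' * θ) * z) := by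
      intro z
      rw [← Complex.ofReal_pow, ← Complex.normSq_eq_norm_sq, ← Complex.mul_conj, map_sum,
        sum_mul_sum]
      refine sum_congr rfl fun t _ => sum_congr rfl fun t' _ => ?_
      have : (-(t * θ) + t' * θ) * z = -(θ * z * t) - -(θ * z * t') := by ring
      rw [map_mul, this, ← e_mul_conj]; ring
    simp only [h2]
    rw [sum_comm]
    refine sum_congr rfl fun t _ => ?_
    rw [sum_comm]
  have h3 : ∑ z ∈ Ioc 0 (0 + N), ‖∑ t ∈ T, e (-(θ * z * t)) * b t‖ ^ 2 ≤
      ∑ t ∈ T, ∑ t' ∈ T, ‖b t‖ * ‖b t'‖ * kern N (-(t * θ) + t' * θ) := by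
    rw [← Complex.norm_of_nonneg (sum_nonneg fun _ _ => by positivity), h1]
    refine (norm_sum_le _ _).trans (sum_le_sum fun t _ => (norm_sum_le _ _).trans
      (sum_le_sum fun t' _ => ?_))
    rw [norm_mul, norm_mul, RCLike.norm_conj]
    gcongr
    exact norm_geom_le 0 N _
  refine h3.trans ?_
  have h4 : ∑ t ∈ T, ∑ t' ∈ T, ‖b t‖ ^ 2 * kern N (-(t * θ) + t' * θ) ≤
      R * ∑ t ∈ T, ‖b t‖ ^ 2 := by
    rw [mul_sum]
    refine sum_le_sum fun t ht => ?_
    rw [← mul_sum, mul_comm]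
    have := hR t ht
    gcongr
  have h5 : ∑ t ∈ T, ∑ t' ∈ T, ‖b t'‖ ^ 2 * kern N (-(t * θ) + t' * θ) =
      ∑ t ∈ T, ∑ t' ∈ T, ‖b t‖ ^ 2 * kern N (-(t * θ) + t' * θ) := by
    rw [sum_comm]
    refine sum_congr rfl fun t _ => sum_congr rfl fun t' _ => ?_
    rw [← kern_neg]; congr 2; ring
  calc _ ≤ ∑ t ∈ T, ∑ t' ∈ T, (‖b t‖ ^ 2 * kern N (-(t * θ) + t' * θ) +
          ‖b t'‖ ^ 2 * kern N (-(t * θ) + t' * θ)) / 2 := by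
        refine sum_le_sum fun t _ => sum_le_sum fun t' _ => ?_
        have := kern_nonneg N (-(t * θ) + t' * θ)
        nlinarith [mul_nonneg this (sq_nonneg (‖b t‖ - ‖b t'‖))]
    _ = (∑ t ∈ T, ∑ t' ∈ T, ‖b t‖ ^ 2 * kern N (-(t * θ) + t' * θ) +
          ∑ t ∈ T, ∑ t' ∈ T, ‖b t'‖ ^ 2 * kern N (-(t * θ) + t' * θ)) / 2 := by
        simp only [← sum_add_distrib, ← sum_div]
    _ ≤ _ := by rw [h5]; linarith

lemma e_eq_one_iff (x : ℝ) : e x = 1 ↔ ∃ n : ℤ, x = n := by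
  constructor
  · intro h
    rw [e, Complex.exp_eq_one_iff] at h
    obtain ⟨n, hn⟩ := h
    refine ⟨n, ?_⟩
    have h2 : (2 * Real.pi * Complex.I : ℂ) ≠ 0 := by simp [Real.pi_ne_zero]
    have : (2 * Real.pi * Complex.I : ℂ) * x = (2 * Real.pi * Complex.I) * n := by
      rw [hn]; ring
    exact_mod_cast mul_left_cancel₀ h2 this
  · rintro ⟨n, rfl⟩; exact e_int n

lemma sum_e_div {L : ℕ} (hL : 0 < L) (m : ℤ) (hm : |m| < L) :
    ∑ j ∈ range L, e (j / L * m) = if m = 0 then (L : ℂ) else 0 := by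
  have hL0 : (L : ℝ) ≠ 0 := by positivity
  split_ifs with h
  · simp [h, e_zero]
  · have h1 : ∀ j : ℕ, e (j / L * m) = e (m / L) ^ j := by
      intro j
      rw [← e_nsmul]; congr 1; ring
    simp only [h1]
    have h2 : e (m / L) ≠ 1 := by
      rw [Ne, e_eq_one_iff]
      rintro ⟨n, hn⟩
      rw [div_eq_iff hL0] at hn
      have hn' : m = n * L := by exact_mod_cast hn
      rw [hn', abs_mul, Nat.abs_cast] at hm
      rcases eq_or_ne n 0 with rfl | hn0
      · simp at hn'; exact h hn'
      · have := Int.one_le_abs hn0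
        nlinarith
    have h3 := geom_sum_mul (e (m / L)) L
    rw [← e_nsmul, mul_div_cancel₀ _ hL0, e_int, sub_self] at h3
    exact (mul_eq_zero.mp h3).resolve_right (sub_ne_zero.mpr h2)

/-- Fourier coefficients of the indicator of an interval modulo `L`. -/
noncomputable def cutCoeff (L z N j : ℕ) : ℂ :=
  (L : ℂ)⁻¹ * ∑ m ∈ Ioc z (z + N), e (-(j / L) * m)

lemma sum_cutCoeff {L z N n : ℕ} (hn : n < L) (hz : z + N < L) :
    ∑ j ∈ range L, cutCoeff L z N j * e (j / L * n) = if n ∈ Ioc z (z + N) then 1 else 0 := by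
  have hL : 0 < L := by omega
  have hL0 : (L : ℂ) ≠ 0 := by exact_mod_cast hL.ne'
  have h1 : ∑ j ∈ range L, cutCoeff L z N j * e (j / L * n) =
      (L : ℂ)⁻¹ * ∑ m ∈ Ioc z (z + N), ∑ j ∈ range L, e (j / L * ((n - m : ℤ) : ℝ)) := by
    simp only [cutCoeff, mul_assoc, ← mul_sum]
    congr 1
    rw [sum_comm]
    refine sum_congr rfl fun j _ => ?_
    rw [sum_mul]
    refine sum_congr rfl fun m _ => ?_
    rw [← e_add]; congr 1; push_cast; ring
  rw [h1]
  have h2 : ∀ m ∈ Ioc z (z + N), ∑ j ∈ range L, e (j / L * ((n - m : ℤ) : ℝ)) =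
      if n = m then (L : ℂ) else 0 := by
    intro m hm
    rw [mem_Ioc] at hm
    rw [sum_e_div hL]
    · simp only [sub_eq_zero, Nat.cast_inj]
    · rw [abs_lt]; constructor <;> omega
  rw [sum_congr rfl h2, sum_ite_eq]
  split_ifs
  · exact inv_mul_cancel₀ hL0
  · simp

/-- The majorant of `cutCoeff`. -/
noncomputable def cutKern (L N j : ℕ) : ℝ := (L : ℝ)⁻¹ * kern N (0 + j * (1 / L))

lemma cutKern_nonneg (L N j : ℕ) : 0 ≤ cutKern L N j :=
  mul_nonneg (by positivity) (kern_nonneg _ _)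

lemma norm_cutCoeff_le (L z N j : ℕ) : ‖cutCoeff L z N j‖ ≤ cutKern L N j := by
  rw [cutCoeff, cutKern, norm_mul, norm_inv, Complex.norm_natCast]
  gcongr
  refine (norm_geom_le z N _).trans_eq ?_
  rw [kern_neg]; congr 1; ring

lemma sum_cutKern_le {L N : ℕ} (hL : 2 * N < L) :
    ∑ j ∈ range L, cutKern L N j ≤ 4 + Real.log L := by
  have hL0 : (0 : ℝ) < L := by exact_mod_cast (by omega : 0 < L)
  have h1 := sum_kern_block N (q := L) (by omega) (a := 1) isCoprime_one_left (θ := 1 / L)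
    (by simp) 0
  simp only [cutKern, ← mul_sum]
  have h2 : (2 * N : ℝ) ≤ L := by exact_mod_cast hL.le
  calc _ ≤ (L : ℝ)⁻¹ * (6 * N + L * (1 + Real.log L)) := by gcongr
    _ ≤ (L : ℝ)⁻¹ * (3 * L + L * (1 + Real.log L)) := by
        refine mul_le_mul_of_nonneg_left ?_ (by positivity)
        linarith
    _ = _ := by field_simp; ring

end

section

open Finset MeasureTheory

/-- The vector of the first `r` power sums. -/
def powSums (r : ℕ) {σ : ℕ} (v : Fin σ → ℕ) : Fin r → ℕ := fun j => ∑ i, v i ^ ((j : ℕ) + 1)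

lemma sum_poly_congr {r σ : ℕ} {x x' : Fin σ → ℝ}
    (h : ∀ j < r, ∑ i, x i ^ (j + 1) = ∑ i, x' i ^ (j + 1)) (c : ℕ → ℝ) {d : ℕ} (hd : d ≤ r) :
    ∑ i, ∑ m ∈ range (d + 1), x i ^ m * c m = ∑ i, ∑ m ∈ range (d + 1), x' i ^ m * c m := by
  rw [sum_comm, sum_comm (s := univ)]
  refine sum_congr rfl fun m hm => ?_
  rw [mem_range] at hm
  rw [← sum_mul, ← sum_mul]
  cases m with
  | zero => simp
  | succ m => rw [h m (by omega)]

lemma powSums_shift_real {r σ : ℕ} {x x' : Fin σ → ℝ}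
    (h : ∀ j < r, ∑ i, x i ^ (j + 1) = ∑ i, x' i ^ (j + 1)) (z : ℝ) :
    ∀ j < r, ∑ i, (x i + z) ^ (j + 1) = ∑ i, (x' i + z) ^ (j + 1) := by
  intro j hj
  simp only [add_pow, mul_assoc]
  exact sum_poly_congr h (fun m => z ^ (j + 1 - m) * ((j + 1).choose m : ℝ)) (by omega)

lemma powSums_eq_iff {r σ : ℕ} {x x' : Fin σ → ℕ} : powSums r x = powSums r x' ↔
    ∀ j < r, ∑ i, (x i : ℝ) ^ (j + 1) = ∑ i, (x' i : ℝ) ^ (j + 1) := by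
  constructor
  · intro h j hj
    have := congrFun h ⟨j, hj⟩
    simp only [powSums] at this
    exact_mod_cast this
  · intro h
    funext j
    have := h j j.2
    simp only [powSums]
    exact_mod_cast this

lemma powSums_shift {r σ : ℕ} (x x' : Fin σ → ℕ) (z : ℕ) :
    powSums r (fun i => x i + z) = powSums r (fun i => x' i + z) ↔ powSums r x = powSums r x' := by
  rw [powSums_eq_iff, powSums_eq_iff]
  push_cast
  constructor
  · intro h
    simpa using powSums_shift_real h (-z : ℝ)
  · intro h
    exact powSums_shift_real h (z : ℝ)

/-- The effect of a translation on the two leading power sums. -/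
lemma powSums_leading {r σ : ℕ} {x x' : Fin σ → ℝ}
    (h : ∀ j < r, ∑ i, x i ^ (j + 1) = ∑ i, x' i ^ (j + 1)) (z : ℝ) :
    ∑ i, (x i + z) ^ (r + 2) - (r + 2) * z * ∑ i, (x i + z) ^ (r + 1) - ∑ i, x i ^ (r + 2) =
    ∑ i, (x' i + z) ^ (r + 2) - (r + 2) * z * ∑ i, (x' i + z) ^ (r + 1) - ∑ i, x' i ^ (r + 2) := by
  have key : ∀ y : Fin σ → ℝ,
      ∑ i, (y i + z) ^ (r + 2) - (r + 2) * z * ∑ i, (y i + z) ^ (r + 1) - ∑ i, y i ^ (r + 2) =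
      ∑ i, ∑ m ∈ range (r + 1), y i ^ m * (z ^ (r + 2 - m) * ((r + 2).choose m : ℝ) -
        (r + 2) * z * (z ^ (r + 1 - m) * ((r + 1).choose m : ℝ))) := by
    intro y
    rw [mul_sum, ← sum_sub_distrib, ← sum_sub_distrib]
    refine sum_congr rfl fun i _ => ?_
    rw [add_pow, add_pow, sum_range_succ, sum_range_succ, sum_range_succ (n := r + 1)]
    simp only [mul_sub, sum_sub_distrib, mul_assoc, mul_add, mul_sum]
    have h1 : r + 2 - (r + 1) = 1 := by omega
    have h2 : ((r + 2).choose (r + 1) : ℝ) = r + 2 := by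
      rw [Nat.choose_succ_self_right]; push_cast; ring
    rw [h1, h2]
    simp only [Nat.choose_self, Nat.sub_self, pow_zero, pow_one, Nat.cast_one, mul_one]
    have h3 : ∑ m ∈ range (r + 1), y i ^ m * ((r + 2) * (z * (z ^ (r + 1 - m) *
        ((r + 1).choose m : ℝ)))) = ∑ m ∈ range (r + 1), (r + 2) * (z * (y i ^ m *
        (z ^ (r + 1 - m) * ((r + 1).choose m : ℝ)))) := sum_congr rfl fun m _ => by ring
    rw [h3]
    ring
  rw [key, key]
  exact sum_poly_congr h _ le_rfl

/-- Translation invariance of the second moment over power sum classes. -/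
lemma fiber_translate (r σ N z : ℕ) (α : ℝ) (Ξ Ξ' : Finset (Fin r → ℕ))
    (hΞ : ∀ v ∈ Fintype.piFinset fun _ : Fin σ => Icc 1 N, powSums r v ∈ Ξ)
    (hΞ' : ∀ v ∈ Fintype.piFinset fun _ : Fin σ => Ioc z (z + N), powSums r v ∈ Ξ') :
    ∑ ξ ∈ Ξ, ‖∑ v ∈ Fintype.piFinset fun _ : Fin σ => Icc 1 N with powSums r v = ξ,
      e (α * ∑ i, (v i : ℝ) ^ (r + 2))‖ ^ 2 =
    ∑ ξ ∈ Ξ', ‖∑ v ∈ Fintype.piFinset fun _ : Fin σ => Ioc z (z + N) with powSums r v = ξ,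
      e (α * (∑ i, (v i : ℝ) ^ (r + 2) - (r + 2) * z * ∑ i, (v i : ℝ) ^ (r + 1)))‖ ^ 2 := by
  apply Complex.ofReal_injective
  rw [sum_fiber_norm_sq _ _ _ _ hΞ, sum_fiber_norm_sq _ _ _ _ hΞ']
  have hbij : ∀ f : (Fin σ → ℕ) → ℂ,
      ∑ v ∈ Fintype.piFinset fun _ : Fin σ => Ioc z (z + N), f v =
      ∑ v ∈ Fintype.piFinset fun _ : Fin σ => Icc 1 N, f (fun i => v i + z) := by
    intro f
    refine (sum_nbij' (fun (v : Fin σ → ℕ) (i : Fin σ) => v i + z)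
      (fun (v : Fin σ → ℕ) (i : Fin σ) => v i - z) ?_ ?_ ?_ ?_ fun _ _ => rfl).symm
    · intro v hv
      simp only [Fintype.mem_piFinset, mem_Icc, mem_Ioc] at hv ⊢
      intro i; have := hv i; omega
    · intro v hv
      simp only [Fintype.mem_piFinset, mem_Icc, mem_Ioc] at hv ⊢
      intro i; have := hv i; omega
    · intro v hv; funext i; simp
    · intro v hv
      simp only [Fintype.mem_piFinset, mem_Ioc] at hv
      funext i; have := hv i; dsimp only; omega
  rw [hbij]
  refine sum_congr rfl fun v _ => ?_
  rw [hbij]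
  refine sum_congr rfl fun v' _ => ?_
  simp only [powSums_shift]
  split_ifs with h
  · rw [e_mul_conj, e_mul_conj]
    congr 1
    have := powSums_leading (powSums_eq_iff.mp h) (z : ℝ)
    push_cast
    linear_combination -α * this
  · rfl

end

section

open Finset MeasureTheory

/-- The sum over a class of prescribed power sums, twisted by linear phases. -/
noncomputable def classSum (r σ N L : ℕ) (j : Fin σ → ℕ) (ξ : Fin r → ℕ) (t : ℕ) (α : ℝ) : ℂ :=
  ∑ v ∈ {v ∈ Fintype.piFinset fun _ : Fin σ => Icc 1 N |
    powSums r v = ξ ∧ ∑ i, v i ^ (r + 1) = t},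
    (∏ i, e (j i / L * v i)) * e (((∑ i, v i ^ (r + 2) : ℕ) : ℤ) * α)

lemma continuous_classSum (r σ N L : ℕ) (j : Fin σ → ℕ) (ξ : Fin r → ℕ) (t : ℕ) :
    Continuous (classSum r σ N L j ξ t) := by
  unfold classSum; fun_prop

lemma sum_cut_tuple {σ L z N : ℕ} (v : Fin σ → ℕ) (hv : ∀ i, v i < L) (hz : z + N < L) :
    ∑ j ∈ Fintype.piFinset fun _ : Fin σ => range L,
      (∏ i, cutCoeff L z N (j i)) * ∏ i, e (j i / L * v i) =
      if v ∈ Fintype.piFinset fun _ : Fin σ => Ioc z (z + N) then 1 else 0 := by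
  simp only [← prod_mul_distrib]
  rw [← prod_univ_sum (fun _ : Fin σ => range L)
    (fun i j => cutCoeff L z N j * e (j / L * v i))]
  simp only [sum_cutCoeff (hv _) hz]
  split_ifs with h
  · rw [Fintype.mem_piFinset] at h
    exact prod_eq_one fun i _ => if_pos (h i)
  · rw [Fintype.mem_piFinset] at h
    push Not at h
    obtain ⟨i, hi⟩ := h
    exact prod_eq_zero (mem_univ i) (if_neg hi)

/-- Fourier expansion of the sum over a class restricted to a subinterval. -/
lemma class_interval_eq {r σ N z : ℕ} (hz : z ≤ N) (α : ℝ) (ξ : Fin r → ℕ) :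
    ∑ v ∈ Fintype.piFinset fun _ : Fin σ => Ioc z (z + N) with powSums r v = ξ,
      e (α * (∑ i, (v i : ℝ) ^ (r + 2) - (r + 2) * z * ∑ i, (v i : ℝ) ^ (r + 1))) =
    ∑ j ∈ Fintype.piFinset fun _ : Fin σ => range (2 * N + 1),
      (∏ i, cutCoeff (2 * N + 1) z N (j i)) *
        ∑ t ∈ range (σ * (2 * N) ^ (r + 1) + 1), e (-((r + 2) * α * z * t)) *
          classSum r σ (2 * N) (2 * N + 1) j ξ t α := by
  set L := 2 * N + 1 with hL
  set V := Fintype.piFinset fun _ : Fin σ => Icc 1 (2 * N) with hV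
  set W := Fintype.piFinset fun _ : Fin σ => Ioc z (z + N) with hW
  set u : (Fin σ → ℕ) → ℂ := fun v =>
    e (α * (∑ i, (v i : ℝ) ^ (r + 2) - (r + 2) * z * ∑ i, (v i : ℝ) ^ (r + 1))) with hu
  have hVlt : ∀ v ∈ V, ∀ i, v i < L := by
    intro v hv i
    have := mem_Icc.mp (Fintype.mem_piFinset.mp hv i); omega
  have hWV : W ⊆ V := by
    intro v hv
    rw [Fintype.mem_piFinset] at hv ⊢
    intro i
    have := hv i
    rw [mem_Ioc] at this
    rw [mem_Icc]; omega
  have h1 : ∑ v ∈ W with powSums r v = ξ, u v =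
      ∑ v ∈ V with powSums r v = ξ, (if v ∈ W then 1 else 0) * u v := by
    simp only [ite_mul, one_mul, zero_mul]
    rw [← sum_filter, filter_filter]
    refine sum_congr ?_ fun _ _ => rfl
    ext v
    simp only [mem_filter]
    exact ⟨fun h => ⟨hWV h.1, h.2, h.1⟩, fun h => ⟨h.2.2, h.2.1⟩⟩
  have h2 : ∀ v ∈ V.filter (fun v => powSums r v = ξ), (if v ∈ W then 1 else 0) * u v =
      ∑ j ∈ Fintype.piFinset fun _ : Fin σ => range L,
        (∏ i, cutCoeff L z N (j i)) * ((∏ i, e (j i / L * v i)) * u v) := by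
    intro v hv
    rw [← sum_cut_tuple v (hVlt v (mem_filter.mp hv).1) (by omega : z + N < L), sum_mul]
    exact sum_congr rfl fun j _ => by rw [mul_assoc]
  rw [h1, sum_congr rfl h2, sum_comm]
  refine sum_congr rfl fun j _ => ?_
  rw [← mul_sum]
  congr 1
  rw [← sum_fiberwise_of_maps_to (g := fun v : Fin σ → ℕ => ∑ i, v i ^ (r + 1))
    (t := range (σ * (2 * N) ^ (r + 1) + 1))]
  · refine sum_congr rfl fun t _ => ?_
    rw [classSum, mul_sum, filter_filter]
    refine sum_congr rfl fun v hv => ?_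
    rw [mem_filter] at hv
    have ht : (∑ i, (v i : ℝ) ^ (r + 1)) = t := by exact_mod_cast hv.2.2
    have : u v = e (-((r + 2) * α * z * t)) * e (((∑ i, v i ^ (r + 2) : ℕ) : ℤ) * α) := by
      rw [← e_add, hu]
      simp only [ht]
      congr 1; push_cast; ring
    rw [this]; ring
  · intro v hv
    rw [mem_filter] at hv
    rw [mem_range, Nat.lt_succ_iff]
    calc _ ≤ ∑ i : Fin σ, (2 * N) ^ (r + 1) := sum_le_sum fun i _ =>
          Nat.pow_le_pow_left (by have := hVlt v hv.1 i; omega) _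
      _ = _ := by simp

/-- The pointwise bound behind the minor arc moment estimate. -/
lemma pointwise_moment (r σ N : ℕ) (α R : ℝ)
    (hR : ∀ t ∈ range (σ * (2 * N) ^ (r + 1) + 1), ∑ t' ∈ range (σ * (2 * N) ^ (r + 1) + 1),
      kern N (-(t * ((r + 2) * α)) + t' * ((r + 2) * α)) ≤ R) :
    N * ‖fset (r + 2) (Icc 1 N) α‖ ^ (2 * σ) ≤ #(powBox r σ N) *
      ((∑ j ∈ range (2 * N + 1), cutKern (2 * N + 1) N j) ^ σ *
      ∑ j ∈ Fintype.piFinset fun _ : Fin σ => range (2 * N + 1),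
        (∏ i, cutKern (2 * N + 1) N (j i)) * (R * ∑ ξ ∈ powBox r σ (2 * N),
          ∑ t ∈ range (σ * (2 * N) ^ (r + 1) + 1),
            ‖classSum r σ (2 * N) (2 * N + 1) j ξ t α‖ ^ 2)) := by
  set T := range (σ * (2 * N) ^ (r + 1) + 1) with hT
  set J := Fintype.piFinset fun _ : Fin σ => range (2 * N + 1) with hJ
  set L := 2 * N + 1 with hL
  set κ : (Fin σ → ℕ) → ℝ := fun j => ∏ i, cutKern L N (j i) with hκ
  have hκ0 : ∀ j, 0 ≤ κ j := fun j => prod_nonneg fun i _ => cutKern_nonneg _ _ _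
  have hκsum : ∑ j ∈ J, κ j = (∑ j ∈ range L, cutKern L N j) ^ σ := by
    rw [hκ, hJ, ← prod_univ_sum (fun _ : Fin σ => range L) (fun _ j => cutKern L N j)]; simp
  set B : ℕ → (Fin σ → ℕ) → (Fin r → ℕ) → ℂ := fun z j ξ =>
    ∑ t ∈ T, e (-((r + 2) * α * z * t)) * classSum r σ (2 * N) L j ξ t α with hB
  have hstep : ∀ z ∈ Ioc 0 (0 + N), ‖fset (r + 2) (Icc 1 N) α‖ ^ (2 * σ) ≤ #(powBox r σ N) *
      ∑ ξ ∈ powBox r σ (2 * N), ((∑ j ∈ J, κ j) * ∑ j ∈ J, κ j * ‖B z j ξ‖ ^ 2) := by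
    intro z hz
    have hzN : z ≤ N := by have := (mem_Ioc.mp hz).2; omega
    have hf : ‖fset (r + 2) (Icc 1 N) α‖ ^ (2 * σ) =
        ‖∑ v ∈ Fintype.piFinset fun _ : Fin σ => Icc 1 N, e (α * ∑ i, (v i : ℝ) ^ (r + 2))‖ ^ 2 := by
      rw [norm_fset_pow]
      congr 2
      exact sum_congr rfl fun v _ => by congr 1; push_cast; ring
    rw [hf]
    refine (norm_sq_le_card_mul_fiber _ _ (powSums r) (powBox r σ N)
      fun v hv => mem_powBox subset_rfl hv).trans ?_
    refine mul_le_mul_of_nonneg_left ?_ (Nat.cast_nonneg _)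
    rw [fiber_translate r σ N z α (powBox r σ N) (powBox r σ (2 * N))
      (fun v hv => mem_powBox subset_rfl hv)
      (fun v hv => mem_powBox (A := Ioc z (z + N)) (fun n hn => by
        rw [mem_Ioc] at hn; rw [mem_Icc]; omega) hv)]
    refine sum_le_sum fun ξ _ => ?_
    rw [class_interval_eq hzN]
    refine norm_sq_sum_le_weighted J _ (fun j => B z j ξ) κ fun j _ => ?_
    rw [norm_prod]
    exact prod_le_prod (fun _ _ => norm_nonneg _) fun i _ => norm_cutCoeff_le _ _ _ _
  have hschur : ∀ j ξ, ∑ z ∈ Ioc 0 (0 + N), ‖B z j ξ‖ ^ 2 ≤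
      R * ∑ t ∈ T, ‖classSum r σ (2 * N) L j ξ t α‖ ^ 2 := fun j ξ =>
    schur_kern N ((r + 2) * α) R T _ hR
  calc _ = ∑ z ∈ Ioc 0 (0 + N), ‖fset (r + 2) (Icc 1 N) α‖ ^ (2 * σ) := by simp
    _ ≤ ∑ z ∈ Ioc 0 (0 + N), #(powBox r σ N) *
      ∑ ξ ∈ powBox r σ (2 * N), ((∑ j ∈ J, κ j) * ∑ j ∈ J, κ j * ‖B z j ξ‖ ^ 2) :=
        sum_le_sum hstep
    _ = #(powBox r σ N) * ((∑ j ∈ J, κ j) * ∑ j ∈ J, κ j * ∑ ξ ∈ powBox r σ (2 * N),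
          ∑ z ∈ Ioc 0 (0 + N), ‖B z j ξ‖ ^ 2) := by
        rw [← mul_sum]
        simp only [← mul_sum]
        congr 2
        simp only [mul_sum]
        rw [sum_comm' (t' := powBox r σ (2 * N)) (s' := fun _ => Ioc 0 (0 + N)) (by tauto)]
        rw [sum_congr rfl fun ξ _ => sum_comm, sum_comm]
    _ ≤ _ := by
        rw [hκsum]
        refine mul_le_mul_of_nonneg_left ?_ (Nat.cast_nonneg _)
        refine mul_le_mul_of_nonneg_left ?_
          (pow_nonneg (sum_nonneg fun j _ => cutKern_nonneg _ _ _) _)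
        refine sum_le_sum fun j _ => mul_le_mul_of_nonneg_left ?_ (hκ0 j)
        rw [mul_sum]
        exact sum_le_sum fun ξ _ => hschur j ξ

end

section

open Finset MeasureTheory

lemma norm_sum_ite_le {ι : Type*} (S : Finset ι) (c : ι → ℂ) (hc : ∀ i ∈ S, ‖c i‖ = 1) (m : ι → ℤ) :
    ∫ α in (0 : ℝ)..1, ‖∑ i ∈ S, c i * e (m i * α)‖ ^ 2 ≤ #{ij ∈ S ×ˢ S | m ij.1 = m ij.2} := by
  have h0 : 0 ≤ ∫ α in (0 : ℝ)..1, ‖∑ i ∈ S, c i * e (m i * α)‖ ^ 2 :=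
    intervalIntegral.integral_nonneg zero_le_one fun _ _ => by positivity
  rw [← Complex.norm_of_nonneg h0, parseval, ← sum_product'
    (f := fun i j => if m i = m j then c i * (starRingEnd ℂ) (c j) else 0), ← sum_filter]
  refine (norm_sum_le _ _).trans ?_
  rw [card_eq_sum_ones, Nat.cast_sum]
  refine sum_le_sum fun ij hij => ?_
  obtain ⟨h1, h2⟩ := mem_product.mp (mem_filter.mp hij).1
  rw [norm_mul, RCLike.norm_conj, hc _ h1, hc _ h2]; simp

/-- The mean square of the class sums counts solutions of the full system. -/
lemma integral_classSum_le (r σ N L T : ℕ) (j : Fin σ → ℕ) (hT : σ * N ^ (r + 1) < T) :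
    ∫ α in (0 : ℝ)..1, ∑ ξ ∈ powBox r σ N, ∑ t ∈ range T, ‖classSum r σ N L j ξ t α‖ ^ 2 ≤
      #{vv ∈ (Fintype.piFinset fun _ : Fin σ => Icc 1 N) ×ˢ
        (Fintype.piFinset fun _ : Fin σ => Icc 1 N) |
        (powSums r vv.1, ∑ i, vv.1 i ^ (r + 1)) = (powSums r vv.2, ∑ i, vv.2 i ^ (r + 1)) ∧
          ((∑ i, vv.1 i ^ (r + 2) : ℕ) : ℤ) = ((∑ i, vv.2 i ^ (r + 2) : ℕ) : ℤ)} := by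
  have hc := continuous_classSum r σ N L j
  have hprod : ∀ α, ∑ ξ ∈ powBox r σ N, ∑ t ∈ range T, ‖classSum r σ N L j ξ t α‖ ^ 2 =
      ∑ ξt ∈ powBox r σ N ×ˢ range T, ‖classSum r σ N L j ξt.1 ξt.2 α‖ ^ 2 := fun α =>
    (sum_product' (f := fun ξ t => ‖classSum r σ N L j ξ t α‖ ^ 2) ..).symm
  simp only [hprod]
  rw [intervalIntegral.integral_finsetSum]
  · rw [← card_fiber_pairs (Fintype.piFinset fun _ : Fin σ => Icc 1 N)
      (fun vv => ((∑ i, vv.1 i ^ (r + 2) : ℕ) : ℤ) = ((∑ i, vv.2 i ^ (r + 2) : ℕ) : ℤ))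
      (fun v => (powSums r v, ∑ i, v i ^ (r + 1))) (powBox r σ N ×ˢ range T), Nat.cast_sum]
    · refine sum_le_sum fun ξt _ => ?_
      unfold classSum
      refine (norm_sum_ite_le _ _ (fun v _ => ?_) _).trans_eq ?_
      · rw [norm_prod]; simp [norm_e]
      · simp only [Prod.ext_iff]
    · intro v hv
      rw [mem_product]
      refine ⟨mem_powBox subset_rfl hv, mem_range.mpr (lt_of_le_of_lt ?_ hT)⟩
      calc ∑ i, v i ^ (r + 1) ≤ ∑ i : Fin σ, N ^ (r + 1) := sum_le_sum fun i _ =>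
            Nat.pow_le_pow_left (mem_Icc.mp (Fintype.mem_piFinset.mp hv i)).2 _
        _ = _ := by simp
  · intro ξt _
    exact Continuous.intervalIntegrable (by have := hc ξt.1 ξt.2; fun_prop) _ _

/-- The Vinogradov mean value bound at the critical exponent. -/
lemma vinogradov_count (r : ℕ) (ε : ℝ) (hε : 0 < ε) : ∃ C : ℝ, 0 ≤ C ∧ ∀ N : ℕ, 1 ≤ N →
    (#{vv ∈ (Fintype.piFinset fun _ : Fin (tri (r + 2)) => Icc 1 N) ×ˢ
        (Fintype.piFinset fun _ : Fin (tri (r + 2)) => Icc 1 N) |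
        (powSums r vv.1, ∑ i, vv.1 i ^ (r + 1)) = (powSums r vv.2, ∑ i, vv.2 i ^ (r + 1)) ∧
          ((∑ i, vv.1 i ^ (r + 2) : ℕ) : ℤ) = ((∑ i, vv.2 i ^ (r + 2) : ℕ) : ℤ)} : ℝ) ≤
      C * (N : ℝ) ^ (tri (r + 2) + ε) := by
  obtain ⟨p₀, hp₀⟩ := exists_dec (r + 2) (by omega) ε hε
  obtain ⟨p, hpge, hpp⟩ := Nat.exists_infinite_primes p₀
  have : Fact p.Prime := ⟨hpp⟩
  obtain ⟨D, hD, hDec⟩ := hp₀ p hpge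
  refine ⟨(p : ℝ) ^ (2 * tri (r + 2) + 1) * D, by positivity, fun N hN => ?_⟩
  refine le_trans ?_ (count_congruences (s := r + 2) (by omega) hD hε.le hDec
    (fun j => (j : ℕ) + 1) hN (Icc 1 N) subset_rfl fun n _ => isUnit_det_moment _ _)
  rw [Nat.cast_le]
  refine card_le_card fun vv hvv => ?_
  rw [mem_filter] at hvv ⊢
  obtain ⟨h1, h2, h3⟩ := hvv
  rw [Prod.ext_iff] at h2
  refine ⟨h1, fun j => ?_⟩
  have key : ∑ i, vv.1 i ^ ((j : ℕ) + 1) = ∑ i, vv.2 i ^ ((j : ℕ) + 1) := by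
    rcases lt_or_ge (j : ℕ) r with h | h
    · exact congrFun h2.1 ⟨j, h⟩
    · rcases (show (j : ℕ) = r ∨ (j : ℕ) = r + 1 by omega) with h' | h'
      · rw [h']; exact h2.2
      · rw [h']; exact_mod_cast h3
  exact_mod_cast congrArg (Nat.cast : ℕ → ZMod (p ^ ((r + 2) * (Nat.log p N + 1)))) key

/-- The major arcs of level `Q`. -/
def majorSet (k : ℕ) (Q : ℝ) (N : ℕ) : Set ℝ :=
  {α | ∃ q : ℕ, 1 ≤ q ∧ (q : ℝ) ≤ Q ∧ ∃ a : ℤ, |q * α - a| ≤ Q / (N : ℝ) ^ k}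

lemma sum_range_mul_le {f : ℕ → ℝ} {q : ℕ} {X : ℝ}
    (h : ∀ m, ∑ i ∈ range q, f (m + i) ≤ X) (B : ℕ) : ∑ i ∈ range (q * B), f i ≤ B * X := by
  induction B with
  | zero => simp
  | succ B ih =>
    rw [mul_add, mul_one, sum_range_add]
    push_cast
    linarith [h (q * B)]

lemma sum_kern_range_le (N H : ℕ) {q : ℕ} (hq : 0 < q) {a : ℤ} (ha : IsCoprime a (q : ℤ)) {θ : ℝ}
    (hθ : |θ - a / q| ≤ 1 / (q : ℝ) ^ 2) (c : ℝ) :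
    ∑ i ∈ range (H + 1), kern N (c + i * θ) ≤
      (H / q + 1) * (6 * N + q * (1 + Real.log q)) := by
  have hq0 : (0 : ℝ) < q := by exact_mod_cast hq
  have h1 : ∑ i ∈ range (H + 1), kern N (c + i * θ) ≤
      ∑ i ∈ range (q * (H / q + 1)), kern N (c + i * θ) := by
    refine sum_le_sum_of_subset_of_nonneg ?_ fun _ _ _ => kern_nonneg _ _
    refine range_subset_range.mpr ?_
    have := Nat.lt_mul_div_succ H hq
    omega
  refine h1.trans ((sum_range_mul_le (X := 6 * N + q * (1 + Real.log q)) (fun m => ?_) _).trans ?_)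
  · refine le_trans (le_of_eq ?_) (sum_kern_block N hq ha hθ (c + m * θ))
    refine sum_congr rfl fun i _ => ?_
    congr 1; push_cast; ring
  · have : 0 ≤ Real.log q := Real.log_natCast_nonneg q
    push_cast
    gcongr
    exact Nat.cast_div_le

/-- The reciprocal sum estimate off the major arcs. -/
lemma minor_kern_sum (r σ : ℕ) {N : ℕ} (hN : 1 ≤ N) {Q : ℝ} (hQ1 : 1 ≤ Q) (hQN : Q ≤ N) {α : ℝ}
    (hα : α ∉ majorSet (r + 2) Q N) (c : ℝ) :
    ∑ t' ∈ range (σ * (2 * N) ^ (r + 1) + 1), kern N (c + t' * ((r + 2) * α)) ≤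
      (7 * σ * 2 ^ (r + 1) * (r + 2) + 7) * (1 + (r + 2) * Real.log N) *
        ((N : ℝ) ^ (r + 2) / Q) := by
  have hN0 : (1 : ℝ) ≤ N := by exact_mod_cast hN
  have hQ0 : 0 < Q := by linarith
  have hn : 0 < ⌊(N : ℝ) ^ (r + 2) / Q⌋₊ := by
    rw [Nat.floor_pos, le_div_iff₀ hQ0, one_mul]
    exact hQN.trans (le_self_pow₀ hN0 (by omega))
  obtain ⟨ρ, hρ1, hρ2⟩ := Real.exists_rat_abs_sub_le_and_den_le ((r + 2) * α) hn
  set q := ρ.den with hq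
  have hqpos : 0 < q := ρ.den_pos
  have hq0 : (1 : ℝ) ≤ q := by exact_mod_cast hqpos
  have hcast : (ρ : ℝ) = ρ.num / q := by exact_mod_cast (Rat.num_div_den ρ).symm
  rw [hcast] at hρ1
  have hlt : (N : ℝ) ^ (r + 2) / Q < ⌊(N : ℝ) ^ (r + 2) / Q⌋₊ + 1 := Nat.lt_floor_add_one _
  have hqle : (q : ℝ) ≤ (N : ℝ) ^ (r + 2) / Q :=
    le_trans (by exact_mod_cast hρ2) (Nat.floor_le (by positivity))
  have hcop : IsCoprime ρ.num (q : ℤ) := by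
    rw [Int.isCoprime_iff_nat_coprime]
    simpa using ρ.reduced
  have hθ : |(r + 2) * α - ρ.num / q| ≤ 1 / (q : ℝ) ^ 2 := by
    refine hρ1.trans ?_
    rw [sq]
    gcongr
    linarith
  have hQq : Q < (r + 2) * q := by
    by_contra hcon
    refine hα ⟨(r + 2) * q, Nat.mul_pos (by omega) hqpos, by push_cast; linarith, ρ.num, ?_⟩
    have : (((r + 2) * q : ℕ) : ℝ) * α - ρ.num = q * ((r + 2) * α - ρ.num / q) := by
      push_cast; field_simp
    rw [this, abs_mul, Nat.abs_cast]
    calc (q : ℝ) * |(r + 2) * α - ρ.num / q| ≤ q * (1 / ((⌊(N : ℝ) ^ (r + 2) / Q⌋₊ + 1) * q)) := by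
          gcongr
      _ = 1 / (⌊(N : ℝ) ^ (r + 2) / Q⌋₊ + 1) := by field_simp
      _ ≤ 1 / ((N : ℝ) ^ (r + 2) / Q) := by gcongr
      _ = _ := by rw [one_div_div]
  refine (sum_kern_range_le N _ hqpos hcop hθ c).trans ?_
  set Y : ℝ := (N : ℝ) ^ (r + 2) / Q with hY
  set ℓ : ℝ := 1 + (r + 2) * Real.log N with hℓ
  have hlogN : 0 ≤ Real.log N := Real.log_natCast_nonneg N
  have hℓ1 : 1 ≤ ℓ := by rw [hℓ]; nlinarith [Nat.cast_nonneg (α := ℝ) r]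
  have hY0 : 0 < Y := by positivity
  have hlogq : 1 + Real.log q ≤ ℓ := by
    rw [hℓ]
    have : Real.log q ≤ Real.log ((N : ℝ) ^ (r + 2)) :=
      Real.log_le_log (by linarith) (hqle.trans (div_le_self (by positivity) hQ1))
    rw [Real.log_pow] at this
    push_cast at this
    linarith
  have hNY : (N : ℝ) ^ (r + 1) ≤ Y := by
    rw [hY, le_div_iff₀ hQ0, pow_succ _ (r + 1)]
    gcongr
  have hNY' : (N : ℝ) ≤ Y := (le_self_pow₀ hN0 (by omega)).trans hNY
  have hNq : (N : ℝ) ^ (r + 2) / q ≤ (r + 2) * Y := by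
    rw [hY, div_le_iff₀ (by linarith), ← mul_div_assoc, div_mul_eq_mul_div, le_div_iff₀ hQ0]
    nlinarith [pow_pos (by linarith : (0 : ℝ) < N) (r + 2)]
  set h : ℝ := σ * 2 ^ (r + 1) with hh
  have hh0 : 0 ≤ h := by positivity
  have hH : ((σ * (2 * N) ^ (r + 1) : ℕ) : ℝ) = h * (N : ℝ) ^ (r + 1) := by
    push_cast; rw [mul_pow, hh]; ring
  rw [hH]
  have hlq0 : 0 ≤ 1 + Real.log q := by have := Real.log_natCast_nonneg q; linarith
  calc (h * (N : ℝ) ^ (r + 1) / q + 1) * (6 * N + q * (1 + Real.log q))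
      = 6 * h * ((N : ℝ) ^ (r + 2) / q) + h * ((N : ℝ) ^ (r + 1) * (1 + Real.log q)) + 6 * N +
        q * (1 + Real.log q) := by field_simp; ring
    _ ≤ 6 * h * ((r + 2) * Y) + h * (Y * ℓ) + 6 * Y + Y * ℓ := by gcongr
    _ ≤ 6 * h * ((r + 2) * (ℓ * Y)) + h * ((r + 2) * (ℓ * Y)) + 6 * (ℓ * Y) + ℓ * Y := by
        have h1 : Y ≤ ℓ * Y := le_mul_of_one_le_left hY0.le hℓ1
        have h2 : Y * ℓ ≤ (r + 2) * (ℓ * Y) := by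
          rw [mul_comm Y]
          exact le_mul_of_one_le_left (by positivity) (by linarith [Nat.cast_nonneg (α := ℝ) r])
        have h3 : Y * ℓ = ℓ * Y := mul_comm _ _
        rw [← h3] at h1 ⊢
        rw [← h3] at h2
        gcongr
    _ = _ := by rw [hh]; ring

end

section

open Finset MeasureTheory

lemma log_pow_le (m k : ℕ) (hm : 1 ≤ m) (ε : ℝ) (hε : 0 < ε) : ∃ C : ℝ, 0 ≤ C ∧ ∀ N : ℕ, 1 ≤ N →
    (4 + Real.log (2 * N + 1 : ℕ)) ^ m * (1 + k * Real.log N) ≤ C * (N : ℝ) ^ ε := by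
  set δ := ε / (m + 1) with hδ
  have hδ0 : 0 < δ := by positivity
  refine ⟨(4 + 3 ^ δ / δ) ^ m * (1 + k * (1 / δ)), by positivity, fun N hN => ?_⟩
  have hN1 : (1 : ℝ) ≤ N := by exact_mod_cast hN
  have hlog0 : 0 ≤ Real.log (2 * N + 1 : ℕ) := Real.log_natCast_nonneg _
  have hlogN : 0 ≤ Real.log N := Real.log_natCast_nonneg _
  have hN1δ : 1 ≤ (N : ℝ) ^ δ := Real.one_le_rpow hN1 hδ0.le
  have h1 : 4 + Real.log (2 * N + 1 : ℕ) ≤ (4 + 3 ^ δ / δ) * (N : ℝ) ^ δ := by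
    have h2 : Real.log (2 * N + 1 : ℕ) ≤ ((2 * N + 1 : ℕ) : ℝ) ^ δ / δ :=
      Real.log_le_rpow_div (by positivity) hδ0
    have h3 : ((2 * N + 1 : ℕ) : ℝ) ^ δ ≤ 3 ^ δ * (N : ℝ) ^ δ := by
      rw [← Real.mul_rpow (by norm_num) (by positivity)]
      refine Real.rpow_le_rpow (by positivity) ?_ hδ0.le
      push_cast; linarith
    calc _ ≤ 4 * (N : ℝ) ^ δ + 3 ^ δ * (N : ℝ) ^ δ / δ := by
          refine add_le_add (by linarith) (h2.trans (by gcongr))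
      _ = _ := by ring
  have h2 : 1 + k * Real.log N ≤ (1 + k * (1 / δ)) * (N : ℝ) ^ δ := by
    have h3 : Real.log N ≤ (N : ℝ) ^ δ / δ := Real.log_le_rpow_div (by positivity) hδ0
    calc _ ≤ (N : ℝ) ^ δ + k * ((N : ℝ) ^ δ / δ) := by gcongr
      _ = _ := by ring
  calc _ ≤ ((4 + 3 ^ δ / δ) * (N : ℝ) ^ δ) ^ m * ((1 + k * (1 / δ)) * (N : ℝ) ^ δ) := by
        gcongr
    _ = (4 + 3 ^ δ / δ) ^ m * (1 + k * (1 / δ)) * (((N : ℝ) ^ δ) ^ m * (N : ℝ) ^ δ) := by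
        rw [mul_pow]; ring
    _ = _ := by
        rw [← pow_succ, ← Real.rpow_mul_natCast (by positivity)]
        congr 2; rw [hδ]; push_cast; field_simp

/-- The moment of order `k(k+1)` over the minor arcs of level `Q`. -/
theorem minor_moment (k : ℕ) (hk : 2 ≤ k) (ε : ℝ) (hε : 0 < ε) : ∃ C : ℝ, 0 ≤ C ∧
    ∀ N : ℕ, 1 ≤ N → ∀ Q : ℝ, 1 ≤ Q → Q ≤ N → ∀ S : Set ℝ, MeasurableSet S →
      S ⊆ Set.Ioc 0 1 → Disjoint S (majorSet k Q N) →
      ∫ α in S, ‖fset k (Icc 1 N) α‖ ^ (2 * tri k) ≤ C * (N : ℝ) ^ ((k ^ 2 : ℕ) + ε) / Q := by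
  obtain ⟨r, rfl⟩ : ∃ r, k = r + 2 := ⟨k - 2, by omega⟩
  set σ := tri (r + 2) with hσ
  have hσ1 : 1 ≤ σ := tri_pos (by omega)
  obtain ⟨C₁, hC₁, hlog⟩ := log_pow_le (2 * σ) (r + 2) (by omega) (ε / 2) (by positivity)
  obtain ⟨C₂, hC₂, hcount⟩ := vinogradov_count r (ε / 2) (by positivity)
  set A : ℝ := 7 * σ * 2 ^ (r + 1) * (r + 2) + 7 with hA
  refine ⟨(σ + 1) ^ r * A * C₁ * (C₂ * 2 ^ (σ + ε / 2)), by positivity,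
    fun N hN Q hQ1 hQN S hS hS01 hdis => ?_⟩
  have hN1 : (1 : ℝ) ≤ N := by exact_mod_cast hN
  have hN0 : (0 : ℝ) < N := by linarith
  have hQ0 : 0 < Q := by linarith
  set R : ℝ := A * (1 + (r + 2) * Real.log N) * ((N : ℝ) ^ (r + 2) / Q) with hR
  have hlogN : 0 ≤ Real.log N := Real.log_natCast_nonneg _
  have hR0 : 0 ≤ R := by positivity
  set K : ℝ := ∑ j ∈ range (2 * N + 1), cutKern (2 * N + 1) N j with hK
  have hK0 : 0 ≤ K := sum_nonneg fun j _ => cutKern_nonneg _ _ _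
  have hKle : K ≤ 4 + Real.log (2 * N + 1 : ℕ) := sum_cutKern_le (by omega)
  set J := Fintype.piFinset fun _ : Fin σ => range (2 * N + 1) with hJ
  set κ : (Fin σ → ℕ) → ℝ := fun j => ∏ i, cutKern (2 * N + 1) N (j i) with hκ
  have hκ0 : ∀ j, 0 ≤ κ j := fun j => prod_nonneg fun i _ => cutKern_nonneg _ _ _
  have hκsum : ∑ j ∈ J, κ j = K ^ σ := by
    rw [hκ, hJ, ← prod_univ_sum (fun _ : Fin σ => range (2 * N + 1))
      (fun _ j => cutKern (2 * N + 1) N j)]; simp [hK]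
  set T := σ * (2 * N) ^ (r + 1) + 1 with hT
  set Φ : (Fin σ → ℕ) → ℝ → ℝ := fun j α => ∑ ξ ∈ powBox r σ (2 * N), ∑ t ∈ range T,
    ‖classSum r σ (2 * N) (2 * N + 1) j ξ t α‖ ^ 2 with hΦ
  have hΦc : ∀ j, Continuous (Φ j) := fun j => by
    have := continuous_classSum r σ (2 * N) (2 * N + 1) j
    rw [hΦ]; fun_prop
  have hΦ0 : ∀ j α, 0 ≤ Φ j α := fun j α =>
    sum_nonneg fun _ _ => sum_nonneg fun _ _ => by positivity
  set M : ℝ := C₂ * ((2 * N : ℕ) : ℝ) ^ (σ + ε / 2) with hM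
  have hM0 : 0 ≤ M := by positivity
  have hΦint : ∀ j, ∫ α in (0 : ℝ)..1, Φ j α ≤ M := fun j =>
    (integral_classSum_le r σ (2 * N) (2 * N + 1) T j (by omega)).trans (hcount (2 * N) (by omega))
  set P : ℝ := ((#(powBox r σ N) : ℕ) : ℝ) with hP
  set Ψ : ℝ → ℝ := fun α => P * (K ^ σ * ∑ j ∈ J, κ j * (R * Φ j α)) with hΨ
  have hΨc : Continuous Ψ := by rw [hΨ]; fun_prop
  have hΨ0 : ∀ α, 0 ≤ Ψ α := fun α => mul_nonneg (Nat.cast_nonneg _) (mul_nonneg (by positivity)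
    (sum_nonneg fun j _ => mul_nonneg (hκ0 j) (mul_nonneg hR0 (hΦ0 j α))))
  have hint : ∀ f : ℝ → ℝ, Continuous f → IntegrableOn f (Set.Ioc 0 1) := fun f hf =>
    (hf.integrableOn_Icc (a := 0) (b := 1)).mono_set Set.Ioc_subset_Icc_self
  have hpt : ∀ α ∈ S, N * ‖fset (r + 2) (Icc 1 N) α‖ ^ (2 * σ) ≤ Ψ α := by
    intro α hα
    refine pointwise_moment r σ N α R fun t _ => ?_
    exact minor_kern_sum r σ hN hQ1 hQN (Set.disjoint_left.mp hdis hα) _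
  have h1 : N * ∫ α in S, ‖fset (r + 2) (Icc 1 N) α‖ ^ (2 * σ) ≤ P * (K ^ σ * (K ^ σ * (R * M))) := by
    calc _ = ∫ α in S, N * ‖fset (r + 2) (Icc 1 N) α‖ ^ (2 * σ) := by rw [integral_const_mul]
      _ ≤ ∫ α in S, Ψ α := by
          refine setIntegral_mono_on ?_ ?_ hS hpt
          · exact (hint _ (by fun_prop)).mono_set hS01
          · exact (hint _ hΨc).mono_set hS01
      _ ≤ ∫ α in Set.Ioc 0 1, Ψ α := by
          refine setIntegral_mono_set (hint _ hΨc) ?_ (Filter.Eventually.of_forall hS01)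
          exact Filter.Eventually.of_forall fun α => hΨ0 α
      _ = P * (K ^ σ * ∑ j ∈ J, κ j * (R * ∫ α in (0 : ℝ)..1, Φ j α)) := by
          rw [← intervalIntegral.integral_of_le zero_le_one]
          simp only [hΨ, intervalIntegral.integral_const_mul]
          rw [intervalIntegral.integral_finsetSum]
          · simp only [intervalIntegral.integral_const_mul]
          · intro j _
            exact Continuous.intervalIntegrable (by fun_prop) _ _
      _ ≤ P * (K ^ σ * ∑ j ∈ J, κ j * (R * M)) := by
          refine mul_le_mul_of_nonneg_left (mul_le_mul_of_nonneg_left (sum_le_sum fun j _ => ?_)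
            (by positivity)) (Nat.cast_nonneg _)
          exact mul_le_mul_of_nonneg_left (mul_le_mul_of_nonneg_left (hΦint j) hR0) (hκ0 j)
      _ = _ := by rw [← sum_mul, hκsum]
  have hPle : P ≤ (σ + 1) ^ r * (N : ℝ) ^ tri r := card_powBox_le r σ hN
  have hKlog : K ^ (2 * σ) * (1 + (r + 2) * Real.log N) ≤ C₁ * (N : ℝ) ^ (ε / 2) := by
    refine le_trans ?_ (hlog N hN)
    push_cast
    push_cast at hKle
    gcongr
  have hMe : M = C₂ * 2 ^ (σ + ε / 2) * (N : ℝ) ^ (σ + ε / 2) := by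
    rw [hM]; push_cast; rw [Real.mul_rpow (by norm_num) hN0.le]; ring
  have htri : tri r + (r + 2) + σ = (r + 2) ^ 2 + 1 := by
    have h1 := two_tri r
    have h2 := two_tri (r + 2)
    nlinarith
  have h2 : N * ∫ α in S, ‖fset (r + 2) (Icc 1 N) α‖ ^ (2 * σ) ≤
      N * ((σ + 1) ^ r * A * C₁ * (C₂ * 2 ^ (σ + ε / 2)) * (N : ℝ) ^ (((r + 2) ^ 2 : ℕ) + ε) / Q) := by
    calc _ ≤ _ := h1
      _ = P * (K ^ (2 * σ) * (1 + (r + 2) * Real.log N)) * (A * ((N : ℝ) ^ (r + 2) / Q) * M) := by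
          rw [hR]; ring
      _ ≤ ((σ + 1) ^ r * (N : ℝ) ^ tri r) * (C₁ * (N : ℝ) ^ (ε / 2)) *
          (A * ((N : ℝ) ^ (r + 2) / Q) * M) := by
          have : 0 ≤ K ^ (2 * σ) * (1 + (r + 2) * Real.log N) := by positivity
          gcongr
      _ = (σ + 1) ^ r * A * C₁ * (C₂ * 2 ^ (σ + ε / 2)) *
          ((N : ℝ) ^ tri r * (N : ℝ) ^ (r + 2) * ((N : ℝ) ^ (ε / 2) * (N : ℝ) ^ (σ + ε / 2))) / Q := by
          rw [hMe]; ring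
      _ = (σ + 1) ^ r * A * C₁ * (C₂ * 2 ^ (σ + ε / 2)) *
          ((N : ℝ) ^ ((((r + 2) ^ 2 : ℕ) + ε) + 1)) / Q := by
          congr 2
          rw [← pow_add, ← Real.rpow_natCast, ← Real.rpow_add hN0, ← Real.rpow_add hN0]
          congr 1
          have : ((tri r : ℕ) : ℝ) + (r + 2) + σ = ((r + 2) ^ 2 : ℕ) + 1 := by exact_mod_cast htri
          push_cast at this ⊢
          linarith
      _ = _ := by rw [Real.rpow_add_one hN0.ne']; ring
  exact le_of_mul_le_mul_left h2 hN0

end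

section

open Finset MeasureTheory

lemma memLp_of_continuous {S : Set ℝ} (hS01 : S ⊆ Set.Ioc 0 1) (hS : MeasurableSet S)
    {G : ℝ → ℝ} (hG : Continuous G) (p : ENNReal) : MemLp G p (volume.restrict S) := by
  have hfin : IsFiniteMeasure (volume.restrict S) :=
    ⟨by
      rw [Measure.restrict_apply_univ]
      exact (measure_mono hS01).trans_lt (by simp)⟩
  obtain ⟨C, hC⟩ := (isCompact_Icc (a := (0 : ℝ)) (b := 1)).exists_bound_of_continuousOn
    hG.continuousOn
  refine MemLp.of_bound hG.aestronglyMeasurable C ?_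
  rw [ae_restrict_iff' hS]
  exact Filter.Eventually.of_forall fun x hx => hC x (Set.Ioc_subset_Icc_self (hS01 hx))

lemma setIntegral_holder {S : Set ℝ} (hS01 : S ⊆ Set.Ioc 0 1) (hS : MeasurableSet S)
    {G H : ℝ → ℝ} (hG : Continuous G) (hH : Continuous H) (hG0 : ∀ x, 0 ≤ G x)
    (hH0 : ∀ x, 0 ≤ H x) {θ : ℝ} (h0 : 0 < θ) (h1 : θ < 1) :
    ∫ x in S, G x ^ θ * H x ^ (1 - θ) ≤ (∫ x in S, G x) ^ θ * (∫ x in S, H x) ^ (1 - θ) := by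
  have h1' : 0 < 1 - θ := by linarith
  have hpq : Real.HolderConjugate (1 / θ) (1 / (1 - θ)) := by
    rw [Real.holderConjugate_iff]
    refine ⟨by rw [lt_div_iff₀ h0]; linarith, by simp⟩
  have := integral_mul_le_Lp_mul_Lq_of_nonneg hpq (μ := volume.restrict S)
    (f := fun x => G x ^ θ) (g := fun x => H x ^ (1 - θ))
    (Filter.Eventually.of_forall fun x => Real.rpow_nonneg (hG0 x) _)
    (Filter.Eventually.of_forall fun x => Real.rpow_nonneg (hH0 x) _)
    (memLp_of_continuous hS01 hS (hG.rpow_const fun _ => Or.inr h0.le) _)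
    (memLp_of_continuous hS01 hS (hH.rpow_const fun _ => Or.inr h1'.le) _)
  refine this.trans_eq ?_
  simp only [one_div_one_div]
  congr 3 <;> funext x
  · rw [← Real.rpow_mul (hG0 x), mul_one_div_cancel h0.ne', Real.rpow_one]
  · rw [← Real.rpow_mul (hH0 x), mul_one_div_cancel h1'.ne', Real.rpow_one]

lemma majorSet_mono {k N : ℕ} {Q Q' : ℝ} (h : Q ≤ Q') : majorSet k Q N ⊆ majorSet k Q' N := by
  rintro α ⟨q, hq1, hq2, a, ha⟩
  exact ⟨q, hq1, hq2.trans h, a, ha.trans (by gcongr)⟩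

lemma measurableSet_majorSet (k N : ℕ) (Q : ℝ) : MeasurableSet (majorSet k Q N) := by
  have : majorSet k Q N = ⋃ (q : ℕ) (_ : 1 ≤ q) (_ : (q : ℝ) ≤ Q) (a : ℤ),
      {α : ℝ | |q * α - a| ≤ Q / (N : ℝ) ^ k} := by
    ext α
    simp only [majorSet, Set.mem_iUnion, Set.mem_ofPred_eq, exists_prop]
  rw [this]
  refine MeasurableSet.iUnion fun q => MeasurableSet.iUnion fun _ => MeasurableSet.iUnion fun _ =>
    MeasurableSet.iUnion fun a => ?_
  exact (isClosed_le (by fun_prop) continuous_const).measurableSet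

/-- The measure of the major arcs. -/
lemma volume_majorSet_le {k N : ℕ} (hk : 1 ≤ k) (hN : 1 ≤ N) {Q : ℝ} (hQ : 1 ≤ Q)
    (hQN : Q ≤ 2 * N) :
    (volume (Set.Ioc 0 1 ∩ majorSet k Q N)).toReal ≤ 12 * Q ^ 2 / (N : ℝ) ^ k := by
  have hN1 : (1 : ℝ) ≤ N := by exact_mod_cast hN
  have hNk : (0 : ℝ) < (N : ℝ) ^ k := by positivity
  have hQ0 : 0 < Q := by linarith
  have hle2 : Q / (N : ℝ) ^ k ≤ 2 := by
    rw [div_le_iff₀ hNk]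
    linarith [le_self_pow₀ hN1 (by omega : k ≠ 0)]
  set I : ℕ → ℤ → Set ℝ := fun q a =>
    Set.Icc (a / q - Q / (q * (N : ℝ) ^ k)) (a / q + Q / (q * (N : ℝ) ^ k)) with hI
  have hsub : Set.Ioc 0 1 ∩ majorSet k Q N ⊆
      ⋃ q ∈ Icc 1 ⌊Q⌋₊, ⋃ a ∈ Icc (-2 : ℤ) (q + 2), I q a := by
    rintro α ⟨⟨h0, h1⟩, q, hq1, hqQ, a, ha⟩
    have hq0 : (1 : ℝ) ≤ q := by exact_mod_cast hq1
    have ha' := abs_le.mp ha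
    have ha1 : (-2 : ℤ) ≤ a := by
      have : (-3 : ℝ) < a := by nlinarith
      have : (-3 : ℤ) < a := by exact_mod_cast this
      omega
    have ha2 : a ≤ q + 2 := by
      have : (a : ℝ) ≤ q + 2 := by nlinarith
      exact_mod_cast this
    simp only [Set.mem_iUnion]
    refine ⟨q, mem_Icc.mpr ⟨hq1, Nat.le_floor hqQ⟩, a, mem_Icc.mpr ⟨ha1, ha2⟩, ?_⟩
    have h3 : |α - a / q| ≤ Q / (q * (N : ℝ) ^ k) := by
      have : α - a / q = (q * α - a) / q := by field_simp
      rw [this, abs_div, Nat.abs_cast, mul_comm (q : ℝ) (_ ^ _), ← div_div]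
      gcongr
    have := abs_le.mp h3
    exact ⟨by linarith, by linarith⟩
  have hI1 : ∀ q ∈ Icc 1 ⌊Q⌋₊, volume.real (⋃ a ∈ Icc (-2 : ℤ) (q + 2), I q a) ≤
      12 * Q / (N : ℝ) ^ k := by
    intro q hq
    have hq0 : (1 : ℝ) ≤ q := by exact_mod_cast (mem_Icc.mp hq).1
    refine (measureReal_biUnion_finset_le _ _).trans ?_
    have : ∀ a ∈ Icc (-2 : ℤ) (q + 2), volume.real (I q a) ≤ 2 * (Q / (q * (N : ℝ) ^ k)) := by
      intro a _
      rw [hI, Real.volume_real_Icc, max_le_iff]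
      exact ⟨by linarith, by positivity⟩
    refine (sum_le_sum this).trans ?_
    rw [sum_const, nsmul_eq_mul, Int.card_Icc]
    have h5 : (((q : ℤ) + 2 + 1 - -2).toNat : ℝ) ≤ 6 * q := by
      have : ((q : ℤ) + 2 + 1 - -2).toNat = q + 5 := by omega
      rw [this]; push_cast; linarith
    calc _ ≤ 6 * q * (2 * (Q / (q * (N : ℝ) ^ k))) := by gcongr
      _ = _ := by field_simp; ring
  have hfin : volume (⋃ q ∈ Icc 1 ⌊Q⌋₊, ⋃ a ∈ Icc (-2 : ℤ) (q + 2), I q a) ≠ ⊤ := by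
    refine ((measure_biUnion_finset_le _ _).trans_lt ?_).ne
    refine ENNReal.sum_lt_top.mpr fun q _ => (measure_biUnion_finset_le _ _).trans_lt ?_
    exact ENNReal.sum_lt_top.mpr fun a _ => by simp [hI]
  calc _ ≤ volume.real (⋃ q ∈ Icc 1 ⌊Q⌋₊, ⋃ a ∈ Icc (-2 : ℤ) (q + 2), I q a) :=
        measureReal_mono hsub hfin
    _ ≤ ∑ q ∈ Icc 1 ⌊Q⌋₊, 12 * Q / (N : ℝ) ^ k :=
        (measureReal_biUnion_finset_le _ _).trans (sum_le_sum hI1)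
    _ = ⌊Q⌋₊ * (12 * Q / (N : ℝ) ^ k) := by simp
    _ ≤ Q * (12 * Q / (N : ℝ) ^ k) := by gcongr; exact Nat.floor_le hQ0.le
    _ = _ := by ring

end

section

open Finset MeasureTheory

lemma exponent_conditions {k s₀ : ℕ} (hk : 2 ≤ k) (hne : (Finset.Icc 1 k).Nonempty)
    (hs₀ : (k : ℤ) ^ 2 + 1 -
        (Finset.Icc 1 k).sup' hne
          (fun s : ℕ => ⌈(s : ℚ) * ((k : ℚ) - s - 1) / ((k : ℚ) - s + 1)⌉)
      ≤ (s₀ : ℤ)) :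
    (∃ s : ℕ, 1 ≤ s ∧ s + 1 ≤ k ∧
      (k : ℝ) ^ 2 * (k - s + 1) - s * (k - s - 1) < s₀ * (k - s + 1)) ∧ k ^ 2 + 3 ≤ s₀ + k := by
  set g : ℕ → ℤ := fun s : ℕ => ⌈(s : ℚ) * ((k : ℚ) - s - 1) / ((k : ℚ) - s + 1)⌉ with hg
  obtain ⟨s, hs, hM⟩ := Finset.exists_mem_eq_sup' hne g
  have hle : g (k - 1) ≤ g s := by
    rw [← hM]
    exact Finset.le_sup' g (mem_Icc.mpr ⟨by omega, by omega⟩)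
  rw [hM] at hs₀
  obtain ⟨hs1, hs2⟩ := mem_Icc.mp hs
  have hk1 : g (k - 1) = 0 := by
    simp [hg, Nat.cast_sub (by omega : 1 ≤ k)]
  rw [hk1] at hle
  have hsk : s ≠ k := by
    rintro rfl
    have : g s = -s := by
      simp only [hg]
      rw [show (s : ℚ) * ((s : ℚ) - s - 1) / ((s : ℚ) - s + 1) = ((-s : ℤ) : ℚ) by
        push_cast; ring, Int.ceil_intCast]
    omega
  obtain ⟨d, rfl⟩ : ∃ d, k = s + 1 + d := ⟨k - s - 1, by omega⟩
  have hd : (0 : ℚ) < ((s + 1 + d : ℕ) : ℚ) - s + 1 := by push_cast; linarith [(d.cast_nonneg : (0 : ℚ) ≤ d)]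
  have hs1' : (1 : ℚ) ≤ s := by exact_mod_cast hs1
  constructor
  · refine ⟨s, hs1, by omega, ?_⟩
    have h1 : (g s : ℚ) < (s : ℚ) * (((s + 1 + d : ℕ) : ℚ) - s - 1) / (((s + 1 + d : ℕ) : ℚ) - s + 1) + 1 :=
      Int.ceil_lt_add_one _
    have h2 : ((s + 1 + d : ℕ) : ℚ) ^ 2 + 1 - g s ≤ s₀ := by exact_mod_cast hs₀
    have h3 : ((s + 1 + d : ℕ) : ℚ) ^ 2 - s₀ <
      (s : ℚ) * (((s + 1 + d : ℕ) : ℚ) - s - 1) / (((s + 1 + d : ℕ) : ℚ) - s + 1) := by linarith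
    rw [lt_div_iff₀ hd] at h3
    have h4 : ((s + 1 + d : ℕ) : ℚ) ^ 2 * (((s + 1 + d : ℕ) : ℚ) - s + 1) -
      s * (((s + 1 + d : ℕ) : ℚ) - s - 1) < s₀ * (((s + 1 + d : ℕ) : ℚ) - s + 1) := by linarith
    exact_mod_cast h4
  · have h1 : g s ≤ s + d - 1 := by
      apply Int.ceil_le.mpr
      rw [div_le_iff₀ hd]
      push_cast
      nlinarith [(d.cast_nonneg : (0 : ℚ) ≤ d)]
    zify
    push_cast at *
    linarith

lemma norm_fset_Icc_le (k N : ℕ) (α : ℝ) : ‖fset k (Icc 1 N) α‖ ≤ N := by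
  refine (norm_sum_le _ _).trans ?_
  simp [norm_e]

lemma setIntegral_le_interval {S : Set ℝ} (hS01 : S ⊆ Set.Ioc 0 1)
    {G : ℝ → ℝ} (hG : Continuous G) (hG0 : ∀ x, 0 ≤ G x) :
    ∫ x in S, G x ≤ ∫ x in (0 : ℝ)..1, G x := by
  rw [intervalIntegral.integral_of_le zero_le_one]
  exact setIntegral_mono_set (hG.integrableOn_Ioc) (Filter.Eventually.of_forall hG0)
    (Filter.Eventually.of_forall hS01)

lemma interpolate_power {S : Set ℝ} (hS01 : S ⊆ Set.Ioc 0 1) (hS : MeasurableSet S)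
    {F : ℝ → ℝ} (hF : Continuous F) (hF0 : ∀ x, 0 ≤ F x) {p q t : ℕ} (hqt : q < t) (htp : t < p) :
    ∫ x in S, F x ^ t ≤ (∫ x in S, F x ^ p) ^ (((t : ℝ) - q) / (p - q)) *
      (∫ x in S, F x ^ q) ^ (1 - ((t : ℝ) - q) / (p - q)) := by
  have h1 : (q : ℝ) < t := by exact_mod_cast hqt
  have h2 : (t : ℝ) < p := by exact_mod_cast htp
  have h3 : (0 : ℝ) < p - q := by linarith
  set θ : ℝ := ((t : ℝ) - q) / (p - q) with hθ
  have hθ0 : 0 < θ := div_pos (by linarith) h3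
  have hθ1 : θ < 1 := by rw [hθ, div_lt_one h3]; linarith
  refine le_trans (le_of_eq ?_) (setIntegral_holder hS01 hS (hF.pow p) (hF.pow q)
    (fun x => pow_nonneg (hF0 x) _) (fun x => pow_nonneg (hF0 x) _) hθ0 hθ1)
  congr 1
  funext x
  simp only [Pi.pow_apply]
  rcases (hF0 x).eq_or_lt with h | h
  · rw [← h, zero_pow (by omega), zero_pow (by omega), Real.zero_rpow hθ0.ne', zero_mul]
  · simp only [← Real.rpow_natCast]
    rw [← Real.rpow_mul h.le, ← Real.rpow_mul h.le, ← Real.rpow_add h]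
    congr 1
    have : θ * (p - q) = t - q := by rw [hθ]; field_simp
    linarith

end

section

open Finset MeasureTheory

lemma minor_power_large {k s₀ : ℕ} (hk : 2 ≤ k) (h : 2 * tri k ≤ s₀) :
    ∃ c : ℝ, 0 < c ∧ ∃ C : ℝ, 0 ≤ C ∧ ∀ N : ℕ, 1 ≤ N → ∀ S : Set ℝ, MeasurableSet S →
      S ⊆ Set.Ioc 0 1 → Disjoint S (majorSet k ((N : ℝ) ^ (1 / 6 : ℝ)) N) →
      ∫ α in S, ‖fset k (Icc 1 N) α‖ ^ s₀ ≤ C * (N : ℝ) ^ ((s₀ : ℝ) - k - c) := by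
  obtain ⟨C, hC, hmin⟩ := minor_moment k hk (1 / 12) (by norm_num)
  refine ⟨1 / 12, by norm_num, C, hC, fun N hN S hS hS01 hdis => ?_⟩
  have hN1 : (1 : ℝ) ≤ N := by exact_mod_cast hN
  have hN0 : (0 : ℝ) < N := by linarith
  have hQ1 : (1 : ℝ) ≤ (N : ℝ) ^ (1 / 6 : ℝ) := Real.one_le_rpow hN1 (by norm_num)
  have hQN : (N : ℝ) ^ (1 / 6 : ℝ) ≤ N := by
    simpa using Real.rpow_le_rpow_of_exponent_le hN1 (by norm_num : (1 / 6 : ℝ) ≤ 1)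
  have hm := hmin N hN _ hQ1 hQN S hS hS01 hdis
  have hcont : Continuous fun α => ‖fset k (Icc 1 N) α‖ := (continuous_fset _ _).norm
  have hint : ∀ m : ℕ, IntegrableOn (fun α => ‖fset k (Icc 1 N) α‖ ^ m) S := fun m =>
    ((hcont.pow m).integrableOn_Ioc (a := 0) (b := 1)).mono_set hS01
  obtain ⟨r, rfl⟩ : ∃ r, s₀ = r + 2 * tri k := ⟨s₀ - 2 * tri k, by omega⟩
  calc _ ≤ ∫ α in S, (N : ℝ) ^ r * ‖fset k (Icc 1 N) α‖ ^ (2 * tri k) := by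
        refine setIntegral_mono (hint _) ((hint _).const_mul _) fun α => ?_
        simp only [pow_add]
        gcongr
        exact norm_fset_Icc_le k N α
    _ = (N : ℝ) ^ r * ∫ α in S, ‖fset k (Icc 1 N) α‖ ^ (2 * tri k) := integral_const_mul _ _
    _ ≤ (N : ℝ) ^ r * (C * (N : ℝ) ^ ((k ^ 2 : ℕ) + (1 / 12 : ℝ)) / (N : ℝ) ^ (1 / 6 : ℝ)) := by gcongr
    _ = C * ((N : ℝ) ^ (r : ℝ) * (N : ℝ) ^ ((k ^ 2 : ℕ) + (1 / 12 : ℝ)) *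
          (N : ℝ) ^ (-(1 / 6) : ℝ)) := by
        rw [Real.rpow_natCast, Real.rpow_neg hN0.le]; ring
    _ = _ := by
        rw [← Real.rpow_add hN0, ← Real.rpow_add hN0, two_tri]
        congr 2
        push_cast
        ring

lemma minor_power_deep {k s₀ s : ℕ} (hk : 2 ≤ k) (h : s₀ < 2 * tri k) (hs1 : 1 ≤ s)
    (hsk : s + 1 ≤ k) (hs : (k : ℝ) ^ 2 * (k - s + 1) - s * (k - s - 1) < s₀ * (k - s + 1))
    (hs0 : k ^ 2 + 3 ≤ s₀ + k) :
    ∃ c : ℝ, 0 < c ∧ ∃ C : ℝ, 0 ≤ C ∧ ∀ N : ℕ, 1 ≤ N → ∀ S : Set ℝ, MeasurableSet S →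
      S ⊆ Set.Ioc 0 1 → Disjoint S (majorSet k N N) →
      ∫ α in S, ‖fset k (Icc 1 N) α‖ ^ s₀ ≤ C * (N : ℝ) ^ ((s₀ : ℝ) - k - c) := by
  have hps : 2 * tri s = s * (s + 1) := two_tri s
  have hpk : 2 * tri k = k * (k + 1) := two_tri k
  have hss : s * (s + 1) < s₀ := by
    obtain ⟨d, rfl⟩ : ∃ d, k = s + 1 + d := ⟨k - s - 1, by omega⟩
    nlinarith
  have hsR : (s : ℝ) * (s + 1) < s₀ := by exact_mod_cast hss
  have hkR : (s₀ : ℝ) < k * (k + 1) := by rw [hpk] at h; exact_mod_cast h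
  have hskR : (s : ℝ) + 1 ≤ k := by exact_mod_cast hsk
  set P : ℝ := (k : ℝ) * (k + 1) - s * (s + 1) with hP
  have hP0 : 0 < P := by linarith
  set θ : ℝ := ((s₀ : ℝ) - s * (s + 1)) / P with hθ
  have hθP : θ * P = s₀ - s * (s + 1) := by rw [hθ]; field_simp
  have hθ0 : 0 < θ := div_pos (by linarith) hP0
  have hθ1 : θ < 1 := by rw [hθ, div_lt_one hP0]; linarith
  set c : ℝ := θ * (k - s + 1) - (k - s) with hc
  have hc0 : 0 < c := by
    have : 0 < c * P := by
      have : c * P = (s₀ - s * (s + 1)) * (k - s + 1) - (k - s) * P := by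
        rw [hc, sub_mul, mul_right_comm, hθP]
      rw [this, hP]
      nlinarith
    exact pos_of_mul_pos_left this hP0.le
  obtain ⟨C₁, hC₁, h₁⟩ := minor_moment k hk (c / 2) (by positivity)
  obtain ⟨C₂, hC₂, h₂⟩ := lacunary_moment k (s - 1) (by omega) (c / 2) (by positivity)
  rw [Nat.sub_add_cancel hs1] at h₂
  refine ⟨c / 2, by positivity, C₁ ^ θ * C₂ ^ (1 - θ), by positivity,
    fun N hN S hS hS01 hdis => ?_⟩
  have hN1 : (1 : ℝ) ≤ N := by exact_mod_cast hN
  have hN0 : (0 : ℝ) < N := by linarith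
  have hcont : Continuous fun α => ‖fset k (Icc 1 N) α‖ := (continuous_fset _ _).norm
  have hm := h₁ N hN N hN1 le_rfl S hS hS01 hdis
  have hl := (setIntegral_le_interval hS01 (hcont.pow (2 * tri s))
    (fun α => by simp only [Pi.pow_apply]; positivity)).trans (h₂ N)
  have hI := interpolate_power hS01 hS hcont (fun α => norm_nonneg _)
    (p := 2 * tri k) (q := 2 * tri s) (t := s₀) (by omega) h
  have hθ' : ((s₀ : ℝ) - (2 * tri s : ℕ)) / ((2 * tri k : ℕ) - (2 * tri s : ℕ)) = θ := by
    rw [hps, hpk, hθ, hP]; push_cast; rfl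
  rw [hθ'] at hI
  have h1θ : 0 ≤ 1 - θ := by linarith
  have hnn : ∀ m : ℕ, 0 ≤ ∫ α in S, ‖fset k (Icc 1 N) α‖ ^ m := fun m =>
    integral_nonneg fun α => by positivity
  calc _ ≤ _ := hI
    _ ≤ (C₁ * (N : ℝ) ^ ((k ^ 2 : ℕ) + c / 2) / N) ^ θ *
          (C₂ * (N : ℝ) ^ ((s ^ 2 : ℕ) + c / 2)) ^ (1 - θ) := by
        gcongr
        exact hl
    _ = (C₁ * (N : ℝ) ^ ((k ^ 2 : ℕ) + c / 2 - 1)) ^ θ *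
          (C₂ * (N : ℝ) ^ ((s ^ 2 : ℕ) + c / 2)) ^ (1 - θ) := by
        rw [Real.rpow_sub hN0 _ 1, Real.rpow_one, mul_div_assoc]
    _ = C₁ ^ θ * C₂ ^ (1 - θ) * ((N : ℝ) ^ (((k ^ 2 : ℕ) + c / 2 - 1) * θ) *
          (N : ℝ) ^ (((s ^ 2 : ℕ) + c / 2) * (1 - θ))) := by
        rw [Real.mul_rpow hC₁ (by positivity), Real.mul_rpow hC₂ (by positivity),
          ← Real.rpow_mul hN0.le, ← Real.rpow_mul hN0.le]
        ring
    _ = _ := by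
        rw [← Real.rpow_add hN0]
        congr 2
        have : (s₀ : ℝ) = θ * P + s * (s + 1) := by linarith
        rw [this, hP]
        have hc' : c = θ * (k - s + 1) - (k - s) := hc
        push_cast
        linear_combination -hc'

lemma minor_power_layer {k s₀ : ℕ} (hk : 2 ≤ k) (h : s₀ < 2 * tri k)
    (hs0 : k ^ 2 + 3 ≤ s₀ + k) :
    ∃ c : ℝ, 0 < c ∧ ∃ C : ℝ, 0 ≤ C ∧ ∀ N : ℕ, 1 ≤ N → ∀ Q Q' : ℝ,
      (N : ℝ) ^ (1 / 6 : ℝ) ≤ Q → Q ≤ N → 1 ≤ Q' → Q' ≤ 2 * Q → ∀ S : Set ℝ, MeasurableSet S →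
      S ⊆ Set.Ioc 0 1 ∩ majorSet k Q' N → Disjoint S (majorSet k Q N) →
      ∫ α in S, ‖fset k (Icc 1 N) α‖ ^ s₀ ≤ C * (N : ℝ) ^ ((s₀ : ℝ) - k - c) := by
  have hpk : 2 * tri k = k * (k + 1) := two_tri k
  have hkR : (s₀ : ℝ) < k * (k + 1) := by rw [hpk] at h; exact_mod_cast h
  have hs₀1 : 0 < s₀ := by nlinarith
  have hP0 : (0 : ℝ) < k * (k + 1) := by positivity
  set w : ℝ := s₀ / (k * (k + 1)) with hw
  have hwP : w * (k * (k + 1)) = s₀ := by rw [hw]; field_simp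
  have hw0 : 0 < w := by positivity
  have hw1 : w < 1 := by rw [hw, div_lt_one hP0]; exact hkR
  have hw3 : 2 < 3 * w := by
    rw [hw, ← mul_div_assoc, lt_div_iff₀ hP0]
    have : (k : ℝ) ^ 2 + 3 ≤ s₀ + k := by exact_mod_cast hs0
    nlinarith [sq_nonneg ((k : ℝ) - 5 / 2)]
  set c : ℝ := (3 * w - 2) / 6 with hc
  have hc0 : 0 < c := by rw [hc]; linarith
  obtain ⟨C₁, hC₁, h₁⟩ := minor_moment k hk (c / 2) (by positivity)
  refine ⟨c / 2, by positivity, C₁ ^ w * 48 ^ (1 - w), by positivity,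
    fun N hN Q Q' hNQ hQN hQ'1 hQ' S hS hS01' hdis => ?_⟩
  have hN1 : (1 : ℝ) ≤ N := by exact_mod_cast hN
  have hN0 : (0 : ℝ) < N := by linarith
  have hQ1 : 1 ≤ Q := (Real.one_le_rpow hN1 (by norm_num)).trans hNQ
  have hQ0 : 0 < Q := by linarith
  have hS01 : S ⊆ Set.Ioc 0 1 := hS01'.trans Set.inter_subset_left
  have hcont : Continuous fun α => ‖fset k (Icc 1 N) α‖ := (continuous_fset _ _).norm
  have hm := h₁ N hN Q hQ1 hQN S hS hS01 hdis
  have hI := interpolate_power hS01 hS hcont (fun α => norm_nonneg _)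
    (p := 2 * tri k) (q := 0) (t := s₀) hs₀1 h
  have hvol : ∫ α in S, ‖fset k (Icc 1 N) α‖ ^ 0 ≤ 48 * Q ^ 2 / (N : ℝ) ^ k := by
    simp only [pow_zero, setIntegral_const, smul_eq_mul, mul_one]
    have h2 : volume.real S ≤ volume.real (Set.Ioc 0 1 ∩ majorSet k Q' N) := by
      refine measureReal_mono hS01' ?_
      exact ((measure_mono Set.inter_subset_left).trans_lt (by simp)).ne
    refine h2.trans ((volume_majorSet_le (by omega) hN hQ'1 (by linarith)).trans ?_)
    refine div_le_div_of_nonneg_right ?_ (by positivity)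
    nlinarith
  have hw' : ((s₀ : ℝ) - (0 : ℕ)) / ((2 * tri k : ℕ) - (0 : ℕ)) = w := by
    rw [hpk, hw]; push_cast; simp
  rw [hw'] at hI
  have h1w : 0 ≤ 1 - w := by linarith
  have hnn : ∀ m : ℕ, 0 ≤ ∫ α in S, ‖fset k (Icc 1 N) α‖ ^ m := fun m =>
    integral_nonneg fun α => by positivity
  calc _ ≤ _ := hI
    _ ≤ (C₁ * (N : ℝ) ^ ((k ^ 2 : ℕ) + c / 2) / Q) ^ w *
          (48 * Q ^ 2 / (N : ℝ) ^ k) ^ (1 - w) := by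
        gcongr
    _ = (C₁ * (N : ℝ) ^ ((k ^ 2 : ℕ) + c / 2) * Q ^ (-1 : ℝ)) ^ w *
          (48 * Q ^ (2 : ℝ) * (N : ℝ) ^ (-(k : ℝ))) ^ (1 - w) := by
        rw [Real.rpow_neg_one, Real.rpow_neg hN0.le, Real.rpow_natCast, Real.rpow_two,
          ← div_eq_mul_inv, ← div_eq_mul_inv]
    _ = C₁ ^ w * 48 ^ (1 - w) * ((N : ℝ) ^ (((k ^ 2 : ℕ) + c / 2) * w) *
          (N : ℝ) ^ (-(k : ℝ) * (1 - w))) * (Q ^ (-1 * w) * Q ^ (2 * (1 - w))) := by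
        rw [Real.mul_rpow (by positivity) (by positivity), Real.mul_rpow hC₁ (by positivity),
          Real.mul_rpow (by positivity) (by positivity), Real.mul_rpow (by positivity)
          (by positivity), ← Real.rpow_mul hN0.le, ← Real.rpow_mul hN0.le,
          ← Real.rpow_mul hQ0.le, ← Real.rpow_mul hQ0.le]
        ring
    _ = C₁ ^ w * 48 ^ (1 - w) * (N : ℝ) ^ ((s₀ : ℝ) - k + c / 2 * w) * Q ^ (-(6 * c)) := by
        rw [← Real.rpow_add hN0, ← Real.rpow_add hQ0]
        congr 3
        · rw [← hwP]; push_cast; ring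
        · rw [hc]; ring
    _ ≤ C₁ ^ w * 48 ^ (1 - w) * (N : ℝ) ^ ((s₀ : ℝ) - k + c / 2) *
          ((N : ℝ) ^ (1 / 6 : ℝ)) ^ (-(6 * c)) := by
        gcongr ?_ * ?_
        · gcongr
          nlinarith
        · exact Real.rpow_le_rpow_of_nonpos (by positivity) hNQ (by linarith)
    _ = _ := by
        rw [← Real.rpow_mul hN0.le, mul_assoc, ← Real.rpow_add hN0]
        congr 2
        ring

lemma log_two_le {ε : ℝ} (hε : 0 < ε) {N : ℕ} (hN : 1 ≤ N) :
    ((Nat.log 2 N + 1 : ℕ) : ℝ) ≤ (2 / ε + 1) * (N : ℝ) ^ ε := by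
  have hN1 : (1 : ℝ) ≤ N := by exact_mod_cast hN
  have h1 : ((2 : ℝ)) ^ (Nat.log 2 N) ≤ N := by exact_mod_cast Nat.pow_log_le_self 2 (by omega)
  have h2 := Real.log_le_log (by positivity) h1
  rw [Real.log_pow] at h2
  have h3 := Real.log_le_rpow_div (x := N) (by linarith) hε
  have h4 : (1 / 2 : ℝ) ≤ Real.log 2 := by linarith [Real.log_two_gt_d9]
  have h5 : (1 : ℝ) ≤ (N : ℝ) ^ ε := Real.one_le_rpow hN1 hε.le
  have h6 : (Nat.log 2 N : ℝ) * (1 / 2) ≤ Nat.log 2 N * Real.log 2 := by gcongr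
  push_cast
  have : (2 / ε + 1) * (N : ℝ) ^ ε = 2 * ((N : ℝ) ^ ε / ε) + (N : ℝ) ^ ε := by ring
  linarith

/-- Power saving on the minor arcs for the improved number of variables. -/
theorem minor_power {k s₀ s : ℕ} (hk : 2 ≤ k) (hs1 : 1 ≤ s)
    (hsk : s + 1 ≤ k) (hs : (k : ℝ) ^ 2 * (k - s + 1) - s * (k - s - 1) < s₀ * (k - s + 1))
    (hs0 : k ^ 2 + 3 ≤ s₀ + k) :
    ∃ c : ℝ, 0 < c ∧ ∃ C : ℝ, 0 ≤ C ∧ ∀ N : ℕ, 1 ≤ N → ∀ S : Set ℝ, MeasurableSet S →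
      S ⊆ Set.Ioc 0 1 → Disjoint S (majorSet k ((N : ℝ) ^ (1 / 6 : ℝ)) N) →
      ∫ α in S, ‖fset k (Icc 1 N) α‖ ^ s₀ ≤ C * (N : ℝ) ^ ((s₀ : ℝ) - k - c) := by
  rcases le_or_gt (2 * tri k) s₀ with hbig | hsmall
  · exact minor_power_large hk hbig
  obtain ⟨c₁, hc₁, C₁, hC₁, h₁⟩ := minor_power_deep hk hsmall hs1 hsk hs hs0
  obtain ⟨c₂, hc₂, C₂, hC₂, h₂⟩ := minor_power_layer hk hsmall hs0
  set c : ℝ := min c₁ (c₂ / 2) with hc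
  have hcc₁ : c ≤ c₁ := min_le_left _ _
  have hcc₂ : c ≤ c₂ / 2 := min_le_right _ _
  refine ⟨c, by positivity, C₁ + (2 / (c₂ / 2) + 1) * C₂, by positivity,
    fun N hN S hS hS01 hdis => ?_⟩
  have hN1 : (1 : ℝ) ≤ N := by exact_mod_cast hN
  have hN0 : (0 : ℝ) < N := by linarith
  have hcont : Continuous fun α => ‖fset k (Icc 1 N) α‖ := (continuous_fset _ _).norm
  have hint : IntegrableOn (fun α => ‖fset k (Icc 1 N) α‖ ^ s₀) S :=
    ((hcont.pow s₀).integrableOn_Ioc (a := 0) (b := 1)).mono_set hS01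
  set q : ℕ → ℝ := fun i => min ((N : ℝ) ^ (1 / 6 : ℝ) * 2 ^ i) N with hq
  have hQ1 : (1 : ℝ) ≤ (N : ℝ) ^ (1 / 6 : ℝ) := Real.one_le_rpow hN1 (by norm_num)
  have hQN : (N : ℝ) ^ (1 / 6 : ℝ) ≤ N := by
    simpa using Real.rpow_le_rpow_of_exponent_le hN1 (by norm_num : (1 / 6 : ℝ) ≤ 1)
  have hqlow : ∀ i, (N : ℝ) ^ (1 / 6 : ℝ) ≤ q i := fun i =>
    le_min (le_mul_of_one_le_right (by positivity) (one_le_pow₀ (by norm_num))) hQN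
  have hqN : ∀ i, q i ≤ N := fun i => min_le_right _ _
  have hqs : ∀ i, q (i + 1) ≤ 2 * q i := by
    intro i
    simp only [hq]
    rw [mul_min_of_nonneg _ _ (by norm_num : (0 : ℝ) ≤ 2)]
    refine min_le_min ?_ (by linarith)
    rw [pow_succ]; linarith
  have hmaj : ∀ i, MeasurableSet (S ∩ majorSet k (q i) N) := fun i =>
    hS.inter (measurableSet_majorSet k N (q i))
  have hlayers : ∀ i : ℕ, ∫ α in S ∩ majorSet k (q i) N, ‖fset k (Icc 1 N) α‖ ^ s₀ ≤
      i * (C₂ * (N : ℝ) ^ ((s₀ : ℝ) - k - c₂)) := by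
    intro i
    induction i with
    | zero =>
      have : S ∩ majorSet k (q 0) N = ∅ := by
        have h0 : q 0 = (N : ℝ) ^ (1 / 6 : ℝ) := by simpa [hq] using hQN
        rw [h0]
        exact hdis.inter_eq
      simp [this]
    | succ i ih =>
      have hsplit := integral_inter_add_sdiff (μ := volume) (s := S ∩ majorSet k (q (i + 1)) N)
        (measurableSet_majorSet k N (q i)) (hint.mono_set Set.inter_subset_left)
      have he : S ∩ majorSet k (q (i + 1)) N ∩ majorSet k (q i) N = S ∩ majorSet k (q i) N := by
        rw [Set.inter_assoc]
        congr 1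
        refine Set.inter_eq_self_of_subset_right (majorSet_mono ?_)
        simp only [hq]
        gcongr
        · norm_num
        · omega
      rw [he] at hsplit
      have hlay := h₂ N hN (q i) (q (i + 1)) (hqlow i) (hqN i) (hQ1.trans (hqlow _)) (hqs i)
        ((S ∩ majorSet k (q (i + 1)) N) \ majorSet k (q i) N)
        ((hmaj _).diff (measurableSet_majorSet k N (q i)))
        (Set.sdiff_subset.trans (Set.inter_subset_inter_left _ hS01))
        Set.disjoint_sdiff_left
      rw [← hsplit]
      push_cast
      linarith
  set J := Nat.log 2 N + 1 with hJ
  have hqJ : q J = N := by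
    refine min_eq_right ?_
    have : (N : ℝ) < 2 ^ J := by exact_mod_cast Nat.lt_pow_succ_log_self (by norm_num) N
    nlinarith
  have hsplit := integral_inter_add_sdiff (μ := volume) (s := S)
    (measurableSet_majorSet k N (q J)) hint
  have hdeep := h₁ N hN (S \ majorSet k (q J) N) (hS.diff (measurableSet_majorSet k N (q J)))
    (Set.sdiff_subset.trans hS01) (by rw [hqJ]; exact Set.disjoint_sdiff_left)
  have hJle := log_two_le (ε := c₂ / 2) (by positivity) hN
  rw [← hsplit]
  calc _ ≤ (J : ℝ) * (C₂ * (N : ℝ) ^ ((s₀ : ℝ) - k - c₂)) +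
        C₁ * (N : ℝ) ^ ((s₀ : ℝ) - k - c₁) := add_le_add (hlayers J) hdeep
    _ ≤ (2 / (c₂ / 2) + 1) * (N : ℝ) ^ (c₂ / 2) * (C₂ * (N : ℝ) ^ ((s₀ : ℝ) - k - c₂)) +
        C₁ * (N : ℝ) ^ ((s₀ : ℝ) - k - c) := by
        gcongr
    _ = (2 / (c₂ / 2) + 1) * C₂ * (N : ℝ) ^ ((s₀ : ℝ) - k - c₂ / 2) +
        C₁ * (N : ℝ) ^ ((s₀ : ℝ) - k - c) := by
        have : (N : ℝ) ^ ((s₀ : ℝ) - k - c₂ / 2) =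
            (N : ℝ) ^ (c₂ / 2) * (N : ℝ) ^ ((s₀ : ℝ) - k - c₂) := by
          rw [← Real.rpow_add hN0]; congr 1; ring
        rw [this]; ring
    _ ≤ (2 / (c₂ / 2) + 1) * C₂ * (N : ℝ) ^ ((s₀ : ℝ) - k - c) +
        C₁ * (N : ℝ) ^ ((s₀ : ℝ) - k - c) := by
        gcongr
    _ = _ := by ring

end

section

open Finset Filter Topology

/-- The Taylor coefficients of `(1 - z)^(-b)`. -/
noncomputable def dcoef (b : ℝ) : ℕ → ℝ
  | 0 => 1
  | m + 1 => dcoef b m * ((m + b) / (m + 1))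

@[simp] lemma dcoef_zero (b : ℝ) : dcoef b 0 = 1 := rfl

lemma dcoef_succ (b : ℝ) (m : ℕ) : dcoef b (m + 1) = dcoef b m * ((m + b) / (m + 1)) := rfl

lemma dcoef_succ_mul (b : ℝ) (m : ℕ) : (m + 1) * dcoef b (m + 1) = (m + b) * dcoef b m := by
  rw [dcoef_succ]
  field_simp

lemma dcoef_pos {b : ℝ} (hb : 0 < b) : ∀ m, 0 < dcoef b m
  | 0 => one_pos
  | m + 1 => mul_pos (dcoef_pos hb m) (by positivity)

lemma dcoef_one : ∀ m, dcoef 1 m = 1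
  | 0 => rfl
  | m + 1 => by
    rw [dcoef_succ, dcoef_one m, div_self (by positivity), one_mul]

lemma dcoef_conv (a b : ℝ) (n : ℕ) :
    ∑ p ∈ antidiagonal n, dcoef a p.1 * dcoef b p.2 = dcoef (a + b) n := by
  induction n with
  | zero => simp
  | succ n ih =>
    have hn : ((n : ℝ) + 1) ≠ 0 := by positivity
    apply mul_left_cancel₀ hn
    rw [dcoef_succ_mul, ← ih]
    have h1 : ((n : ℝ) + 1) * ∑ p ∈ antidiagonal (n + 1), dcoef a p.1 * dcoef b p.2 =
        (∑ p ∈ antidiagonal (n + 1), p.1 * dcoef a p.1 * dcoef b p.2) +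
        ∑ p ∈ antidiagonal (n + 1), dcoef a p.1 * (p.2 * dcoef b p.2) := by
      rw [mul_sum, ← sum_add_distrib]
      refine sum_congr rfl fun p hp => ?_
      have : (p.1 : ℝ) + p.2 = n + 1 := by exact_mod_cast mem_antidiagonal.mp hp
      rw [← this]
      ring
    rw [h1, Finset.Nat.sum_antidiagonal_succ, Finset.Nat.sum_antidiagonal_succ']
    simp only [Nat.cast_zero, zero_mul, mul_zero, Nat.cast_add, Nat.cast_one, dcoef_succ_mul,
      zero_add]
    rw [mul_sum, ← sum_add_distrib]
    refine sum_congr rfl fun p hp => ?_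
    have : (p.1 : ℝ) + p.2 = n := by exact_mod_cast mem_antidiagonal.mp hp
    rw [← this]
    ring

lemma sum_dcoef (a : ℝ) (n : ℕ) : ∑ m ∈ range (n + 1), dcoef a m = dcoef (a + 1) n := by
  rw [← dcoef_conv, Finset.Nat.sum_antidiagonal_eq_sum_range_succ
    (f := fun i j => dcoef a i * dcoef 1 j)]
  simp [dcoef_one]

lemma dcoef_eq_prod (b : ℝ) (n : ℕ) : dcoef b n * n.factorial = ∏ j ∈ range n, (b + j) := by
  induction n with
  | zero => simp
  | succ n ih =>
    rw [prod_range_succ, ← ih, dcoef_succ, Nat.factorial_succ]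
    push_cast
    field_simp
    ring

lemma tendsto_dcoef {b : ℝ} (hb : 0 < b) :
    Tendsto (fun n : ℕ => dcoef b n / (n : ℝ) ^ (b - 1)) atTop (𝓝 (1 / Real.Gamma b)) := by
  have h1 : Tendsto (fun n : ℕ => (n : ℝ) / (n + b)) atTop (𝓝 1) :=
    tendsto_natCast_div_add_atTop b
  have h2 := h1.div (Real.GammaSeq_tendsto_Gamma b) (Real.Gamma_pos_of_pos hb).ne'
  refine h2.congr' ?_
  filter_upwards [eventually_ge_atTop 1] with n hn
  have hn0 : (0 : ℝ) < n := by exact_mod_cast hn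
  have hprod : 0 < ∏ j ∈ range n, (b + j) := prod_pos fun j _ => by positivity
  simp only [Pi.div_apply]
  rw [Real.GammaSeq, prod_range_succ, Real.rpow_sub hn0, Real.rpow_one]
  have hf : (n.factorial : ℝ) ≠ 0 := by positivity
  have hd : dcoef b n = (∏ j ∈ range n, (b + j)) / n.factorial := by
    rw [← dcoef_eq_prod]; field_simp
  rw [hd]
  have : (0 : ℝ) < (n : ℝ) ^ b := by positivity
  field_simp
  ring

/-- The summatory function of the coefficients of `(1-z)^(-a)`, normalised to be `∼ u^a`. -/
noncomputable def dsum (a : ℝ) (u : ℕ) : ℝ := Real.Gamma (1 + a) * dcoef (a + 1) u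

lemma dsum_pos {a : ℝ} (ha : 0 < a) (u : ℕ) : 0 < dsum a u :=
  mul_pos (Real.Gamma_pos_of_pos (by linarith)) (dcoef_pos (by linarith) u)

lemma tendsto_dsum {a : ℝ} (ha : 0 < a) :
    Tendsto (fun u : ℕ => dsum a u / (u : ℝ) ^ a) atTop (𝓝 1) := by
  have h := (tendsto_dcoef (by linarith : 0 < a + 1)).const_mul (Real.Gamma (1 + a))
  have hG := (Real.Gamma_pos_of_pos (by linarith : 0 < 1 + a)).ne'
  rw [add_comm a 1, mul_one_div_cancel hG] at h
  refine h.congr fun n => ?_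
  rw [dsum, add_sub_cancel_left, mul_div_assoc, add_comm a 1]

lemma dsum_succ (a : ℝ) (u : ℕ) : dsum a (u + 1) = dsum a u * (1 + a / (u + 1)) := by
  rw [dsum, dsum, dcoef_succ]
  field_simp
  ring

lemma le_dsum {a : ℝ} (ha : 0 < a) (ha1 : a ≤ 1) (u : ℕ) : (u : ℝ) ^ a ≤ dsum a u := by
  rcases Nat.eq_zero_or_pos u with rfl | hu
  · rw [Nat.cast_zero, Real.zero_rpow ha.ne']
    exact (dsum_pos ha 0).le
  have hanti : Antitone fun m : ℕ => dsum a (m + 1) / ((m + 1 : ℕ) : ℝ) ^ a := by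
    refine antitone_nat_of_succ_le fun m => ?_
    rw [div_le_div_iff₀ (by positivity) (by positivity), dsum_succ a (m + 1), mul_assoc]
    refine mul_le_mul_of_nonneg_left ?_ (dsum_pos ha _).le
    have hB := rpow_one_add_le_one_add_mul_self (s := -(1 / ((m : ℝ) + 2)))
      (by rw [neg_le_neg_iff, div_le_one (by positivity)]; linarith [(m.cast_nonneg : (0 : ℝ) ≤ m)])
      ha.le ha1
    have h1 : ((m + 1 : ℕ) : ℝ) = (1 + -(1 / ((m : ℝ) + 2))) * ((m + 1 + 1 : ℕ) : ℝ) := by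
      push_cast; field_simp; ring
    have h0 : 0 ≤ 1 + -(1 / ((m : ℝ) + 2)) := by
      have : 1 / ((m : ℝ) + 2) ≤ 1 := by
        rw [div_le_one (by positivity)]; linarith [(m.cast_nonneg : (0 : ℝ) ≤ m)]
      linarith
    have h2 : a / ((m + 1 : ℕ) + 1 : ℝ) = a * (1 / ((m : ℝ) + 2)) := by push_cast; ring
    rw [h2, h1, Real.mul_rpow h0 (by positivity), ← mul_assoc]
    refine (mul_le_mul_of_nonneg_right ?_ (by positivity)).trans_eq (one_mul _)
    set x := a * (1 / ((m : ℝ) + 2)) with hx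
    have hx0 : 0 ≤ x := by positivity
    calc _ ≤ (1 + x) * (1 + a * -(1 / ((m : ℝ) + 2))) := by gcongr
      _ = 1 - x ^ 2 := by rw [hx]; ring
      _ ≤ 1 := by nlinarith
  have h := hanti.le_of_tendsto ((tendsto_add_atTop_iff_nat 1).mpr (tendsto_dsum ha)) (u - 1)
  rw [Nat.sub_add_cancel hu, one_le_div (by positivity)] at h
  exact h

lemma dsum_le {a : ℝ} (ha : 0 < a) (ha1 : a ≤ 1) (u : ℕ) : dsum a u ≤ ((u : ℝ) + 1) ^ a := by
  have hmono : Monotone fun m : ℕ => dsum a m / ((m : ℝ) + 1) ^ a := by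
    refine monotone_nat_of_le_succ fun m => ?_
    rw [div_le_div_iff₀ (by positivity) (by positivity), dsum_succ, mul_assoc]
    refine mul_le_mul_of_nonneg_left ?_ (dsum_pos ha _).le
    have hB := rpow_one_add_le_one_add_mul_self (s := 1 / ((m : ℝ) + 1))
      (le_trans (by norm_num) (by positivity : (0 : ℝ) ≤ 1 / ((m : ℝ) + 1))) ha.le ha1
    have h1 : ((m + 1 : ℕ) : ℝ) + 1 = (1 + 1 / ((m : ℝ) + 1)) * ((m : ℝ) + 1) := by
      push_cast; field_simp
    rw [h1, Real.mul_rpow (by positivity) (by positivity)]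
    refine mul_le_mul_of_nonneg_right (hB.trans_eq ?_) (by positivity)
    ring
  have hlim : Tendsto (fun m : ℕ => dsum a m / ((m : ℝ) + 1) ^ a) atTop (𝓝 1) := by
    have h1 : Tendsto (fun m : ℕ => ((m : ℝ) / (m + 1)) ^ a) atTop (𝓝 1) := by
      have := (tendsto_natCast_div_add_atTop (1 : ℝ)).rpow_const (p := a) (Or.inl one_ne_zero)
      simpa using this
    have := (tendsto_dsum ha).mul h1
    rw [one_mul] at this
    refine this.congr' ?_
    filter_upwards [eventually_ge_atTop 1] with m hm
    have hm0 : (0 : ℝ) < m := by exact_mod_cast hm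
    rw [Real.div_rpow (by positivity) (by positivity)]
    have : (0 : ℝ) < (m : ℝ) ^ a := by positivity
    field_simp
  have h := hmono.ge_of_tendsto hlim u
  rwa [div_le_one (by positivity)] at h

lemma dcoef_antitone {a : ℝ} (ha : 0 < a) (ha1 : a ≤ 1) : Antitone (dcoef a) := by
  refine antitone_nat_of_succ_le fun m => ?_
  rw [dcoef_succ]
  refine mul_le_of_le_one_right (dcoef_pos ha m).le ?_
  rw [div_le_one (by positivity)]
  linarith

lemma gamma_mul_dcoef_le {a : ℝ} (ha : 0 < a) (ha1 : a ≤ 1) (u : ℕ) :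
    Real.Gamma (1 + a) * dcoef a u ≤ ((u : ℝ) + 1) ^ (a - 1) := by
  have hG := Real.Gamma_pos_of_pos (by linarith : 0 < 1 + a)
  have h1 : ((u : ℝ) + 1) * dcoef a u ≤ dcoef (a + 1) u := by
    rw [← sum_dcoef]
    have : ∑ m ∈ range (u + 1), dcoef a u ≤ ∑ m ∈ range (u + 1), dcoef a m :=
      sum_le_sum fun m hm => dcoef_antitone ha ha1 (by simpa [Nat.lt_succ_iff] using hm)
    simpa using this
  rw [Real.rpow_sub (by positivity), Real.rpow_one, le_div_iff₀ (by positivity)]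
  calc _ = Real.Gamma (1 + a) * (((u : ℝ) + 1) * dcoef a u) := by ring
    _ ≤ dsum a u := by rw [dsum]; gcongr
    _ ≤ _ := dsum_le ha ha1 u

end

section

open Finset MeasureTheory

/-- The generating function approximating the Weyl sum near the origin. -/
noncomputable def vsum (a : ℝ) (n : ℕ) (β : ℝ) : ℂ :=
  ∑ m ∈ range (n + 1), ((Real.Gamma (1 + a) * dcoef a m : ℝ) : ℂ) * e (m * β)

@[fun_prop]
lemma continuous_vsum (a : ℝ) (n : ℕ) : Continuous (vsum a n) := by
  have := continuous_e
  unfold vsum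
  fun_prop

lemma vsum_add_int (a : ℝ) (n : ℕ) (β : ℝ) (j : ℤ) : vsum a n (β + j) = vsum a n β := by
  refine sum_congr rfl fun m _ => ?_
  have : (m : ℝ) * (β + j) = m * β + ((m * j : ℤ) : ℝ) := by push_cast; ring
  rw [this, e_add_int]

open Polynomial in
lemma integral_vsum_pow (a : ℝ) (n s : ℕ) :
    ∫ β in (0 : ℝ)..1, vsum a n β ^ s * e (-(n * β)) =
      ((Real.Gamma (1 + a) ^ s * dcoef (s * a) n : ℝ) : ℂ) := by
  set G := Real.Gamma (1 + a) with hG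
  set p : ℂ[X] := ∑ m ∈ range (n + 1), C ((dcoef a m : ℝ) : ℂ) * X ^ m with hp
  have hcoef : ∀ m ≤ n, p.coeff m = dcoef a m := by
    intro m hm
    rw [hp, finsetSum_coeff]
    simp only [coeff_C_mul_X_pow]
    rw [sum_ite_eq (range (n + 1)) m, if_pos (by simpa [Nat.lt_succ_iff] using hm)]
  have hpow : ∀ s : ℕ, ∀ m ≤ n, (p ^ s).coeff m = ((dcoef (s * a) m : ℝ) : ℂ) := by
    intro s
    induction s with
    | zero =>
      intro m _
      rw [pow_zero, coeff_one, Nat.cast_zero, zero_mul]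
      rcases m with _ | m
      · simp
      · have : ∀ m, dcoef 0 (m + 1) = 0 := by
          intro m
          induction m with
          | zero => simp [dcoef_succ]
          | succ m ih => rw [dcoef_succ, ih, zero_mul]
        simp [this]
    | succ s ih =>
      intro m hm
      have : ((s + 1 : ℕ) : ℝ) * a = s * a + a := by push_cast; ring
      rw [pow_succ, coeff_mul, this, ← dcoef_conv, Complex.ofReal_sum]
      refine sum_congr rfl fun x hx => ?_
      have hx' := mem_antidiagonal.mp hx
      rw [ih _ (by omega), hcoef _ (by omega)]
      push_cast; rfl
  have hv : ∀ β : ℝ, vsum a n β = (G : ℂ) * p.eval (e β) := by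
    intro β
    rw [hp, eval_finsetSum, mul_sum]
    refine sum_congr rfl fun m _ => ?_
    rw [eval_mul, eval_C, eval_pow, eval_X, e_nsmul, ← hG]
    push_cast; ring
  have hI : ∀ β : ℝ, vsum a n β ^ s * e (-(n * β)) =
      ∑ m ∈ range ((p ^ s).natDegree + 1), (G : ℂ) ^ s * (p ^ s).coeff m *
        e (((m : ℤ) - n : ℤ) * β) := by
    intro β
    rw [hv, mul_pow, ← eval_pow, eval_eq_sum_range, mul_sum, sum_mul]
    refine sum_congr rfl fun m _ => ?_
    have : (((m : ℤ) - n : ℤ) : ℝ) * β = m * β + -(n * β) := by push_cast; ring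
    rw [this, e_add, e_nsmul]
    ring
  simp only [hI]
  have hc : ∀ m : ℤ, Continuous fun β : ℝ => e (m * β) := fun m => by
    have := continuous_e
    fun_prop
  rw [intervalIntegral.integral_finsetSum fun m _ =>
    ((hc _).const_mul _).intervalIntegrable _ _]
  simp only [intervalIntegral.integral_const_mul, integral_e]
  have : ∀ m : ℕ, ((m : ℤ) - n = 0) ↔ m = n := fun m => by omega
  simp only [this, mul_ite, mul_one, mul_zero]
  rw [sum_ite_eq' (range _) n]
  split_ifs with h
  · rw [hpow s n le_rfl]; push_cast; rfl
  · have : (p ^ s).coeff n = 0 := by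
      apply coeff_eq_zero_of_natDegree_lt
      simp only [mem_range, not_lt] at h
      omega
    rw [hpow s n le_rfl] at this
    rw [Complex.ofReal_mul, this, mul_zero]

lemma dnint_of_abs_le {β : ℝ} (h : |β| ≤ 1 / 2) : dnint β = |β| := by
  refine le_antisymm (by simpa using dnint_le β 0) ?_
  rw [dnint]
  rcases eq_or_ne (round β) 0 with h0 | h0
  · simp [h0]
  · have h1 : (1 : ℝ) ≤ |(round β : ℝ)| := by exact_mod_cast Int.one_le_abs h0
    have h2 := abs_sub_abs_le_abs_sub (round β : ℝ) β
    rw [abs_sub_comm] at h2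
    linarith

lemma norm_one_sub_e_le (β : ℝ) : ‖1 - e β‖ ≤ 7 * |β| := by
  have h := Real.norm_exp_I_mul_ofReal_sub_one_le (x := 2 * Real.pi * β)
  have h2 : e β = Complex.exp (Complex.I * ((2 * Real.pi * β : ℝ) : ℂ)) := by
    rw [e]; congr 1; push_cast; ring
  rw [norm_sub_rev, h2]
  refine h.trans ?_
  rw [Real.norm_eq_abs, abs_mul, abs_of_pos (by positivity)]
  gcongr
  linarith [Real.pi_lt_d2]

lemma norm_vsum_le {a : ℝ} (ha : 0 < a) (ha1 : a ≤ 1) (n : ℕ) (β : ℝ) :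
    ‖vsum a n β‖ ≤ ((n : ℝ) + 1) ^ a := by
  refine le_trans ?_ (dsum_le ha ha1 n)
  rw [dsum, ← sum_dcoef, mul_sum]
  refine (norm_sum_le _ _).trans (sum_le_sum fun m _ => ?_)
  rw [norm_mul, norm_e, mul_one, Complex.norm_real, Real.norm_of_nonneg]
  exact mul_nonneg (Real.Gamma_pos_of_pos (by linarith)).le (dcoef_pos ha m).le

lemma norm_antitone_sum_le {d : ℕ → ℝ} (hd : Antitone d) (hd0 : ∀ m, 0 ≤ d m) {z : ℂ}
    (hz : ‖z‖ = 1) {p n : ℕ} (hpn : p ≤ n) :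
    ‖(1 - z) * ∑ m ∈ Ico p n, (d m : ℂ) * z ^ m‖ ≤ 2 * d p := by
  have key : ‖(1 - z) * ∑ m ∈ Ico p n, (d m : ℂ) * z ^ m + d n * z ^ n‖ ≤ 2 * d p - d n := by
    induction n, hpn using Nat.le_induction with
    | base =>
      simp only [Ico_self, sum_empty, mul_zero, zero_add, norm_mul, norm_pow, hz, one_pow, mul_one,
        Complex.norm_real, Real.norm_of_nonneg (hd0 p)]
      linarith
    | succ n hn ih =>
      have : (1 - z) * ∑ m ∈ Ico p (n + 1), (d m : ℂ) * z ^ m + d (n + 1) * z ^ (n + 1) =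
          ((1 - z) * ∑ m ∈ Ico p n, (d m : ℂ) * z ^ m + d n * z ^ n) -
            ((d n - d (n + 1) : ℝ) : ℂ) * z ^ (n + 1) := by
        rw [sum_Ico_succ_top hn]; push_cast; ring
      rw [this]
      refine (norm_sub_le _ _).trans ?_
      rw [norm_mul, norm_pow, hz, one_pow, mul_one, Complex.norm_real,
        Real.norm_of_nonneg (sub_nonneg.mpr (hd n.le_succ))]
      linarith
  have h2 : ‖(d n : ℂ) * z ^ n‖ = d n := by
    rw [norm_mul, norm_pow, hz, one_pow, mul_one, Complex.norm_real, Real.norm_of_nonneg (hd0 n)]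
  have h3 := norm_sub_le ((1 - z) * ∑ m ∈ Ico p n, (d m : ℂ) * z ^ m + d n * z ^ n) (d n * z ^ n)
  rw [add_sub_cancel_right] at h3
  linarith

lemma norm_vsum_le_rpow {a : ℝ} (ha : 0 < a) (ha1 : a ≤ 1) (n : ℕ) {β : ℝ} (hβ0 : β ≠ 0)
    (hβ : |β| ≤ 1 / 2) : ‖vsum a n β‖ ≤ 2 * |β| ^ (-a) := by
  have hb : 0 < |β| := abs_pos.mpr hβ0
  have hG := Real.Gamma_pos_of_pos (by linarith : 0 < 1 + a)
  set U := ⌊1 / |β|⌋₊ with hU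
  have hUle : (U : ℝ) ≤ 1 / |β| := Nat.floor_le (by positivity)
  have hUlt : 1 / |β| < U + 1 := Nat.lt_floor_add_one _
  have hpow : |β| ^ (-a) = (1 / |β|) ^ a := by
    rw [Real.rpow_neg hb.le, one_div, Real.inv_rpow hb.le]
  have hU1 : 1 ≤ U := by
    rw [hU, Nat.one_le_floor_iff, le_div_iff₀ hb]; linarith
  have hsmall : ∀ m : ℕ, m < U → ‖vsum a m β‖ ≤ |β| ^ (-a) := by
    intro m hm
    refine (norm_vsum_le ha ha1 m β).trans ?_
    rw [hpow]
    have : (m : ℝ) + 1 ≤ U := by exact_mod_cast hm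
    gcongr
    linarith
  rcases lt_or_ge n U with h | h
  · have := hsmall n h
    have : 0 ≤ |β| ^ (-a) := by positivity
    linarith [hsmall n h]
  have hsplit : vsum a n β = vsum a (U - 1) β +
      Real.Gamma (1 + a) * ∑ m ∈ Ico U (n + 1), (dcoef a m : ℂ) * e β ^ m := by
    rw [vsum, vsum, Nat.sub_add_cancel hU1, mul_sum,
      ← sum_range_add_sum_Ico _ (by omega : U ≤ n + 1)]
    congr 1
    refine sum_congr rfl fun m _ => ?_
    rw [e_nsmul]; push_cast; ring
  have htail := norm_antitone_sum_le (dcoef_antitone ha ha1) (fun m => (dcoef_pos ha m).le)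
    (norm_e β) (by omega : U ≤ n + 1)
  have hden : 4 * |β| ≤ ‖1 - e β‖ := by
    rw [norm_sub_rev, ← dnint_of_abs_le hβ]; exact norm_e_sub_one β
  rw [norm_mul] at htail
  set T := ‖∑ m ∈ Ico U (n + 1), (dcoef a m : ℂ) * e β ^ m‖ with hT
  have h1 : 4 * |β| * T ≤ 2 * dcoef a U :=
    (mul_le_mul_of_nonneg_right hden (norm_nonneg _)).trans htail
  have h2 : Real.Gamma (1 + a) * dcoef a U ≤ (1 / |β|) ^ (a - 1) :=
    (gamma_mul_dcoef_le ha ha1 U).trans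
      (Real.rpow_le_rpow_of_nonpos (by positivity) hUlt.le (by linarith))
  have h3 : (1 / |β|) ^ (a - 1) = |β| ^ (-a) * |β| := by
    rw [hpow, Real.rpow_sub (by positivity), Real.rpow_one]
    field_simp
  have h4 : Real.Gamma (1 + a) * T ≤ |β| ^ (-a) := by
    have h5 : Real.Gamma (1 + a) * T * (2 * |β|) ≤ |β| ^ (-a) * |β| := by
      calc _ = Real.Gamma (1 + a) * (4 * |β| * T) / 2 := by ring
        _ ≤ Real.Gamma (1 + a) * (2 * dcoef a U) / 2 := by gcongr
        _ = Real.Gamma (1 + a) * dcoef a U := by ring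
        _ ≤ _ := h2.trans_eq h3
    have h6 : 0 ≤ Real.Gamma (1 + a) * T := mul_nonneg hG.le (norm_nonneg _)
    have h7 : 0 < |β| ^ (-a) := by positivity
    nlinarith
  rw [hsplit]
  refine (norm_add_le _ _).trans ?_
  rw [norm_mul, Complex.norm_real, Real.norm_of_nonneg hG.le, ← hT]
  linarith [hsmall (U - 1) (by omega)]

end

section

open Finset MeasureTheory

lemma norm_abel_le {b : ℕ → ℂ} {z : ℂ} (hz : ‖z‖ = 1) {K : ℝ} {n : ℕ}
    (hb : ∀ u ≤ n, ‖∑ m ∈ range (u + 1), b m‖ ≤ K) :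
    ‖∑ u ∈ range (n + 1), b u * z ^ u‖ ≤ K * (1 + n * ‖1 - z‖) := by
  have h1 : ∀ n : ℕ, ∑ u ∈ range (n + 1), b u * z ^ u = (∑ m ∈ range (n + 1), b m) * z ^ n +
      ∑ u ∈ range n, (∑ m ∈ range (u + 1), b m) * (z ^ u * (1 - z)) := by
    intro n
    induction n with
    | zero => simp
    | succ n ih =>
      rw [sum_range_succ, ih, sum_range_succ b (n + 1),
        sum_range_succ (fun u => (∑ m ∈ range (u + 1), b m) * (z ^ u * (1 - z))) n]
      ring
  rw [h1]
  refine (norm_add_le _ _).trans ?_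
  have h2 : ‖(∑ m ∈ range (n + 1), b m) * z ^ n‖ ≤ K := by
    rw [norm_mul, norm_pow, hz, one_pow, mul_one]; exact hb n le_rfl
  have h3 : ‖∑ u ∈ range n, (∑ m ∈ range (u + 1), b m) * (z ^ u * (1 - z))‖ ≤
      ∑ u ∈ range n, K * ‖1 - z‖ := by
    refine (norm_sum_le _ _).trans (sum_le_sum fun u hu => ?_)
    rw [norm_mul, norm_mul, norm_pow, hz, one_pow, one_mul]
    gcongr
    exact hb u (mem_range.mp hu).le
  rw [sum_const, card_range, nsmul_eq_mul] at h3
  linarith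

/-- The complete exponential sum of `k`-th powers. -/
noncomputable def gaussSum (k q a : ℕ) : ℂ := ∑ r ∈ Icc 1 q, e ((a * r ^ k : ℕ) / (q : ℝ))

lemma norm_gaussSum_le (k q a : ℕ) : ‖gaussSum k q a‖ ≤ q := by
  refine (norm_sum_le _ _).trans ?_
  simp [norm_e]

lemma norm_sum_sub_gaussSum_le (k a X : ℕ) {q : ℕ} (hq : 1 ≤ q) :
    ‖∑ x ∈ Icc 1 X, e ((a * x ^ k : ℕ) / (q : ℝ)) - (X / q : ℝ) * gaussSum k q a‖ ≤ 2 * q := by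
  have hq0 : (0 : ℝ) < q := by exact_mod_cast hq
  set g : ℕ → ℂ := fun x => e ((a * x ^ k : ℕ) / (q : ℝ)) with hg
  have hper : ∀ x, g (x + q) = g x := by
    intro x
    have hmod : a * x ^ k ≡ a * (x + q) ^ k [MOD q] :=
      Nat.ModEq.mul_left a (Nat.ModEq.pow k (by simp [Nat.ModEq]))
    obtain ⟨t, ht⟩ := (Nat.modEq_iff_dvd.mp hmod)
    have : ((a * (x + q) ^ k : ℕ) : ℝ) = (a * x ^ k : ℕ) + q * (t : ℤ) := by
      have : ((a * (x + q) ^ k : ℕ) : ℤ) = (a * x ^ k : ℕ) + q * t := by linarith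
      exact_mod_cast this
    simp only [hg]
    rw [this, add_div, mul_div_cancel_left₀ _ hq0.ne', e_add_int]
  have hblock : ∀ t : ℕ, ∑ x ∈ Icc 1 (q * t), g x = t * gaussSum k q a := by
    intro t
    have hI : ∀ m, ∑ x ∈ Icc 1 m, g x = ∑ x ∈ range m, g (x + 1) := by
      intro m
      induction m with
      | zero => simp
      | succ m ih => rw [sum_Icc_succ_top (by omega), ih, sum_range_succ]
    have hg0 : gaussSum k q a = ∑ x ∈ range q, g (x + 1) := (hI q).symm ▸ rfl
    rw [hI]
    induction t with
    | zero => simp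
    | succ t ih =>
      rw [mul_add, mul_one, sum_range_add, ih, hg0]
      have : ∀ x, g (q * t + x + 1) = g (x + 1) := by
        intro x
        clear ih
        induction t with
        | zero => simp
        | succ t ih => rw [← ih, ← hper (q * t + x + 1)]; congr 1; ring
      simp only [this]
      push_cast; ring
  set t := X / q with ht
  have hX : q * t + X % q = X := Nat.div_add_mod X q
  have hr : X % q < q := Nat.mod_lt _ (by omega)
  have hsplit : ∑ x ∈ Icc 1 X, g x = t * gaussSum k q a + ∑ x ∈ Ioc (q * t) X, g x := by
    have h01 : ∀ m, Icc 1 m = Ioc 0 m := fun m => by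
      ext x; simp only [mem_Icc, mem_Ioc]; omega
    rw [← hblock t, h01, h01]
    exact (sum_Ioc_consecutive g (by omega) (by omega)).symm
  rw [hsplit]
  have h1 : ‖∑ x ∈ Ioc (q * t) X, g x‖ ≤ q := by
    refine (norm_sum_le _ _).trans ?_
    simp only [hg, norm_e, sum_const, Nat.card_Ioc, nsmul_eq_mul, mul_one]
    exact_mod_cast (by omega : X - q * t ≤ q)
  have h2 : ‖((t - X / q : ℝ) : ℂ) * gaussSum k q a‖ ≤ q := by
    rw [norm_mul, Complex.norm_real]
    refine (mul_le_of_le_one_left (norm_nonneg _) ?_).trans (norm_gaussSum_le k q a)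
    rw [Real.norm_eq_abs, abs_le]
    have hXR : (q : ℝ) * t + (X % q : ℕ) = X := by exact_mod_cast hX
    have hrR : ((X % q : ℕ) : ℝ) ≤ q := by exact_mod_cast hr.le
    have hr0 : (0 : ℝ) ≤ ((X % q : ℕ) : ℝ) := by positivity
    have : (t : ℝ) - X / q = -((X % q : ℕ) / q) := by rw [← hXR]; field_simp; ring
    rw [this]
    have h3 : ((X % q : ℕ) : ℝ) / q ≤ 1 := by rw [div_le_one hq0]; exact hrR
    have h4 : 0 ≤ ((X % q : ℕ) : ℝ) / q := by positivity
    exact ⟨by linarith, by linarith⟩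
  have : (t : ℂ) * gaussSum k q a + ∑ x ∈ Ioc (q * t) X, g x - (X / q : ℝ) * gaussSum k q a =
      ((t - X / q : ℝ) : ℂ) * gaussSum k q a + ∑ x ∈ Ioc (q * t) X, g x := by
    push_cast; ring
  rw [this]
  refine (norm_add_le _ _).trans ?_
  linarith

lemma exists_root {k : ℕ} (hk : 1 ≤ k) (u : ℕ) : ∃ X : ℕ, X ^ k ≤ u ∧ u < (X + 1) ^ k := by
  classical
  have hex : ∃ X : ℕ, u < (X + 1) ^ k := ⟨u, lt_of_lt_of_le u.lt_succ_self
    (Nat.le_self_pow (by omega) _)⟩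
  refine ⟨Nat.find hex, ?_, Nat.find_spec hex⟩
  rcases h : Nat.find hex with _ | X
  · simp [zero_pow (by omega : k ≠ 0)]
  · exact not_lt.mp (Nat.find_min hex (by omega))

/-- Approximation of the Weyl sum near a rational point. -/
lemma norm_fset_sub_le {k : ℕ} (hk : 1 ≤ k) {q : ℕ} (hq : 1 ≤ q) (a : ℕ) {n N : ℕ}
    (hN : n < (N + 1) ^ k) (hN' : N ^ k ≤ n) (β : ℝ) :
    ‖fset k (Icc 1 N) (a / q + β) - (q : ℂ)⁻¹ * gaussSum k q a * vsum (1 / k) n β‖ ≤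
      3 * q * (1 + 7 * n * |β|) := by
  have hq0 : (0 : ℝ) < q := by exact_mod_cast hq
  have hk0 : (0 : ℝ) < k := by exact_mod_cast hk
  have ha0 : (0 : ℝ) < 1 / k := by positivity
  have ha1 : (1 : ℝ) / k ≤ 1 := by rw [div_le_one hk0]; exact_mod_cast hk
  set S := gaussSum k q a with hS
  set b : ℕ → ℂ := fun u => (∑ x ∈ Icc 1 N with x ^ k = u, e ((a * x ^ k : ℕ) / (q : ℝ))) -
    (q : ℂ)⁻¹ * S * ((Real.Gamma (1 + 1 / k) * dcoef (1 / k) u : ℝ) : ℂ) with hb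
  have hf : fset k (Icc 1 N) (a / q + β) = ∑ u ∈ range (n + 1),
      (∑ x ∈ Icc 1 N with x ^ k = u, e ((a * x ^ k : ℕ) / (q : ℝ))) * e β ^ u := by
    have hmaps : ∀ x ∈ Icc 1 N, x ^ k ∈ range (n + 1) := by
      intro x hx
      have := Nat.pow_le_pow_left (mem_Icc.mp hx).2 k
      simp only [mem_range]; omega
    rw [fset, ← sum_fiberwise_of_maps_to hmaps]
    refine sum_congr rfl fun u _ => ?_
    rw [sum_mul]
    refine sum_congr rfl fun x hx => ?_
    rw [← e_nsmul, ← e_add, ← (mem_filter.mp hx).2]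
    congr 1
    push_cast
    field_simp
  have hdiff : fset k (Icc 1 N) (a / q + β) - (q : ℂ)⁻¹ * S * vsum (1 / k) n β =
      ∑ u ∈ range (n + 1), b u * e β ^ u := by
    rw [hf, vsum, mul_sum, ← sum_sub_distrib]
    refine sum_congr rfl fun u _ => ?_
    rw [hb, e_nsmul]
    ring
  rw [hdiff]
  have hB : ∀ u ≤ n, ‖∑ m ∈ range (u + 1), b m‖ ≤ 3 * q := by
    intro u hu
    obtain ⟨X, hX1, hX2⟩ := exists_root hk u
    have hXN : X ≤ N := by
      by_contra hcon
      push Not at hcon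
      have := Nat.pow_le_pow_left (by omega : N + 1 ≤ X) k
      omega
    have h1 : ∑ m ∈ range (u + 1), ∑ x ∈ Icc 1 N with x ^ k = m, e ((a * x ^ k : ℕ) / (q : ℝ)) =
        ∑ x ∈ Icc 1 X, e ((a * x ^ k : ℕ) / (q : ℝ)) := by
      have hset : Icc 1 X = {x ∈ Icc 1 N | x ^ k ≤ u} := by
        ext x
        simp only [mem_Icc, mem_filter]
        constructor
        · rintro ⟨h1, h2⟩
          exact ⟨⟨h1, h2.trans hXN⟩, (Nat.pow_le_pow_left h2 k).trans hX1⟩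
        · rintro ⟨⟨h1, _⟩, h2⟩
          refine ⟨h1, ?_⟩
          by_contra hcon
          push Not at hcon
          have := Nat.pow_le_pow_left (by omega : X + 1 ≤ x) k
          omega
      have hmaps : ∀ x ∈ Icc 1 X, x ^ k ∈ range (u + 1) := by
        intro x hx
        rw [hset, mem_filter] at hx
        simp only [mem_range]; omega
      rw [← sum_fiberwise_of_maps_to hmaps]
      refine sum_congr rfl fun m hm => ?_
      congr 1
      rw [hset]
      ext x
      simp only [mem_filter, mem_range] at hm ⊢
      constructor
      · rintro ⟨h1, h2⟩; exact ⟨⟨h1, by omega⟩, h2⟩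
      · rintro ⟨⟨h1, _⟩, h2⟩; exact ⟨h1, h2⟩
    have h2 : ∑ m ∈ range (u + 1), b m = (∑ x ∈ Icc 1 X, e ((a * x ^ k : ℕ) / (q : ℝ)) -
        (X / q : ℝ) * S) + ((X - dsum (1 / k) u : ℝ) : ℂ) * ((q : ℂ)⁻¹ * S) := by
      rw [hb, sum_sub_distrib, h1, ← mul_sum, ← Complex.ofReal_sum, ← mul_sum, sum_dcoef, dsum]
      push_cast
      ring
    rw [h2]
    refine (norm_add_le _ _).trans ?_
    have h3 := norm_sum_sub_gaussSum_le k a X hq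
    have hlow : (X : ℝ) ≤ dsum (1 / k) u := by
      refine le_trans ?_ (le_dsum ha0 ha1 u)
      rw [one_div, Real.le_rpow_inv_iff_of_pos (by positivity) (by positivity) hk0,
        Real.rpow_natCast]
      exact_mod_cast hX1
    have hhigh : dsum (1 / k) u ≤ X + 1 := by
      refine (dsum_le ha0 ha1 u).trans ?_
      rw [one_div, Real.rpow_inv_le_iff_of_pos (by positivity) (by positivity) hk0,
        Real.rpow_natCast]
      exact_mod_cast hX2
    have h4 : ‖((X - dsum (1 / k) u : ℝ) : ℂ) * ((q : ℂ)⁻¹ * S)‖ ≤ 1 := by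
      rw [norm_mul, Complex.norm_real, norm_mul, norm_inv, Complex.norm_natCast]
      have h5 : (q : ℝ)⁻¹ * ‖S‖ ≤ 1 := by
        rw [inv_mul_le_iff₀ hq0, mul_one]; exact norm_gaussSum_le k q a
      have h6 : ‖(X : ℝ) - dsum (1 / k) u‖ ≤ 1 := by
        rw [Real.norm_eq_abs, abs_le]; exact ⟨by linarith, by linarith⟩
      exact mul_le_one₀ h6 (by positivity) h5
    have h7 : (1 : ℝ) ≤ q := by exact_mod_cast hq
    linarith
  refine (norm_abel_le (norm_e β) hB).trans ?_
  have h8 := norm_one_sub_e_le β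
  have : (n : ℝ) * ‖1 - e β‖ ≤ n * (7 * |β|) := by gcongr
  have : 1 + (n : ℝ) * ‖1 - e β‖ ≤ 1 + 7 * n * |β| := by linarith
  gcongr

end

section

open Finset MeasureTheory

lemma norm_vsum_ge {a : ℝ} (ha : 0 < a) (ha1 : a ≤ 1) (n : ℕ) {β : ℝ}
    (hβ : 14 * (n * |β|) ≤ 1) : (n : ℝ) ^ a ≤ 2 * ‖vsum a n β‖ := by
  have hG := Real.Gamma_pos_of_pos (by linarith : 0 < 1 + a)
  have h1 : ‖((dsum a n : ℝ) : ℂ) - vsum a n β‖ ≤ dsum a n * (1 / 2) := by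
    rw [dsum, ← sum_dcoef, mul_sum, Complex.ofReal_sum, vsum, ← sum_sub_distrib, sum_mul]
    refine (norm_sum_le _ _).trans (sum_le_sum fun m hm => ?_)
    rw [← mul_one_sub, norm_mul, Complex.norm_real,
      Real.norm_of_nonneg (mul_nonneg hG.le (dcoef_pos ha m).le)]
    refine mul_le_mul_of_nonneg_left ?_ (mul_nonneg hG.le (dcoef_pos ha m).le)
    refine (norm_one_sub_e_le _).trans ?_
    rw [abs_mul, Nat.abs_cast]
    have : (m : ℝ) * |β| ≤ n * |β| := by
      gcongr
      simpa [Nat.lt_succ_iff] using hm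
    linarith
  have h2 := norm_sub_norm_le ((dsum a n : ℝ) : ℂ) (vsum a n β)
  rw [Complex.norm_real, Real.norm_of_nonneg (dsum_pos ha n).le] at h2
  linarith [le_dsum ha ha1 n]

/-- Pairs `(q, a)` with `q ∈ A`, `1 ≤ a ≤ q` and `(a, q) = 1`. -/
def fracs (A : Finset ℕ) : Finset (Σ _ : ℕ, ℕ) :=
  A.sigma fun q => {a ∈ Icc 1 q | Nat.gcd a q = 1}

lemma mem_fracs {A : Finset ℕ} {p : Σ _ : ℕ, ℕ} :
    p ∈ fracs A ↔ p.1 ∈ A ∧ (1 ≤ p.2 ∧ p.2 ≤ p.1) ∧ Nat.gcd p.2 p.1 = 1 := by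
  simp [fracs]

lemma card_fracs_le {A : Finset ℕ} {M : ℕ} (hA : ∀ q ∈ A, q ≤ M) : #(fracs A) ≤ #A * M := by
  rw [fracs, card_sigma]
  refine sum_le_card_nsmul _ _ _ fun q hq => ?_
  exact (card_filter_le _ _).trans (by simpa using hA q hq)

lemma fracs_sep {A : Finset ℕ} {p p' : Σ _ : ℕ, ℕ} (hp : p ∈ fracs A) (hp' : p' ∈ fracs A)
    (hne : p ≠ p') : 1 ≤ (p.1 : ℝ) * p'.1 * |(p.2 : ℝ) / p.1 - p'.2 / p'.1| := by
  obtain ⟨q, a⟩ := p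
  obtain ⟨q', a'⟩ := p'
  obtain ⟨_, ⟨ha1, ha2⟩, hg⟩ := mem_fracs.mp hp
  obtain ⟨_, ⟨ha1', ha2'⟩, hg'⟩ := mem_fracs.mp hp'
  dsimp only at *
  have hq : (0 : ℝ) < q := by exact_mod_cast (by omega : 0 < q)
  have hq' : (0 : ℝ) < q' := by exact_mod_cast (by omega : 0 < q')
  have h1 : (q : ℝ) * q' * |(a : ℝ) / q - a' / q'| = |((a * q' - a' * q : ℤ) : ℝ)| := by
    conv_lhs => rw [← abs_of_pos (mul_pos hq hq'), ← abs_mul]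
    congr 1
    push_cast
    field_simp
  rw [h1]
  have h2 : (a * q' - a' * q : ℤ) ≠ 0 := by
    intro h0
    have h3 : a * q' = a' * q := by zify; linarith
    have h4 : q ∣ q' := (Nat.Coprime.symm hg).dvd_of_dvd_mul_left ⟨a', by rw [h3, mul_comm]⟩
    have h5 : q' ∣ q := (Nat.Coprime.symm hg').dvd_of_dvd_mul_left ⟨a, by rw [← h3, mul_comm]⟩
    have h6 := Nat.dvd_antisymm h4 h5
    subst h6
    have h7 := Nat.eq_of_mul_eq_mul_right (by omega : 0 < q) h3
    subst h7
    exact hne rfl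
  exact_mod_cast Int.one_le_abs h2

/-- The arc of half-length `δ` around a fraction. -/
def arc (δ : ℝ) (p : Σ _ : ℕ, ℕ) : Set ℝ :=
  Set.Icc ((p.2 : ℝ) / p.1 - δ) ((p.2 : ℝ) / p.1 + δ)

lemma mem_arc {δ : ℝ} {p : Σ _ : ℕ, ℕ} {α : ℝ} : α ∈ arc δ p ↔ |α - (p.2 : ℝ) / p.1| ≤ δ := by
  rw [arc, Set.mem_Icc, abs_le]
  constructor <;> rintro ⟨h1, h2⟩ <;> constructor <;> linarith

lemma arc_disjoint {A : Finset ℕ} {M : ℝ} (hA : ∀ q ∈ A, (q : ℝ) ≤ M) {δ : ℝ}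
    (h : M ^ 2 * (2 * δ) < 1) : Set.PairwiseDisjoint (fracs A : Set (Σ _ : ℕ, ℕ)) (arc δ) := by
  intro p hp p' hp' hne
  rw [Function.onFun, Set.disjoint_left]
  intro α h1 h2
  rw [mem_arc] at h1 h2
  have hs := fracs_sep hp hp' hne
  have h3 : |(p.2 : ℝ) / p.1 - p'.2 / p'.1| ≤ 2 * δ := by
    have := abs_sub_le ((p.2 : ℝ) / p.1) α (p'.2 / p'.1)
    rw [abs_sub_comm _ α] at this
    linarith
  have h4 := hA p.1 (mem_fracs.mp hp).1
  have h5 := hA p'.1 (mem_fracs.mp hp').1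
  have h6 : (p.1 : ℝ) * p'.1 * |(p.2 : ℝ) / p.1 - p'.2 / p'.1| ≤ M * M * (2 * δ) := by
    have hM : 0 ≤ M := (Nat.cast_nonneg _).trans h4
    exact mul_le_mul (mul_le_mul h4 h5 (Nat.cast_nonneg _) hM) h3 (abs_nonneg _) (by positivity)
  nlinarith

/-- The `q`-th term of the majorant of the singular series. -/
noncomputable def sterm (k s q : ℕ) : ℝ :=
  ∑ a ∈ Icc 1 q with Nat.gcd a q = 1, (‖gaussSum k q a‖ / q) ^ s

lemma sterm_nonneg (k s q : ℕ) : 0 ≤ sterm k s q := sum_nonneg fun _ _ => by positivity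

lemma sum_fracs_eq (k s : ℕ) (A : Finset ℕ) :
    ∑ p ∈ fracs A, (‖gaussSum k p.1 p.2‖ / p.1) ^ s = ∑ q ∈ A, sterm k s q := by
  rw [fracs, sum_sigma]
  rfl

lemma sterm_dyadic {k s₀ : ℕ} (hk : 2 ≤ k) (hs : 1 ≤ s₀) {c C : ℝ} (hC : 0 ≤ C)
    (H : ∀ N : ℕ, 1 ≤ N → ∀ S : Set ℝ, MeasurableSet S →
      S ⊆ Set.Ioc 0 1 → Disjoint S (majorSet k ((N : ℝ) ^ (1 / 6 : ℝ)) N) →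
      ∫ α in S, ‖fset k (Icc 1 N) α‖ ^ s₀ ≤ C * (N : ℝ) ^ ((s₀ : ℝ) - k - c))
    {Q : ℕ} (hQ : 2 ≤ Q) :
    ∑ q ∈ Ioc Q (2 * Q), sterm k s₀ q ≤
      (8 * 4 ^ s₀ * C + 2 * 36 ^ s₀) * (Q : ℝ) ^ (-min (6 * c) 1) := by
  have hQR : (2 : ℝ) ≤ Q := by exact_mod_cast hQ
  have hQ0 : (0 : ℝ) < Q := by linarith
  set N := Q ^ 6 with hN
  have hN1 : 1 ≤ N := Nat.one_le_pow _ _ (by omega)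
  have hNR : (N : ℝ) = (Q : ℝ) ^ 6 := by rw [hN]; push_cast; rfl
  have hN0 : (0 : ℝ) < N := by exact_mod_cast hN1
  have hroot : (N : ℝ) ^ (1 / 6 : ℝ) = Q := by
    rw [hNR, ← Real.rpow_natCast, ← Real.rpow_mul hQ0.le]; norm_num
  have hNk : (Q : ℝ) ^ 12 ≤ (N : ℝ) ^ k := by
    rw [hNR, ← pow_mul]
    exact pow_le_pow_right₀ (by linarith) (by omega)
  have hQ12 : 1024 * (Q : ℝ) ^ 2 ≤ (Q : ℝ) ^ 12 := by
    have : (2 : ℝ) ^ 10 ≤ (Q : ℝ) ^ 10 := pow_le_pow_left₀ (by norm_num) hQR 10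
    nlinarith [sq_nonneg (Q : ℝ)]
  have hNk0 : (0 : ℝ) < (N : ℝ) ^ k := by positivity
  set δ : ℝ := 1 / (16 * (N : ℝ) ^ k) with hδ
  have hδ0 : 0 < δ := by positivity
  have hδN : δ * (16 * (N : ℝ) ^ k) = 1 := by rw [hδ]; field_simp
  have hδQ : 16384 * (Q : ℝ) ^ 2 * δ ≤ 1 := by
    rw [← hδN]
    nlinarith
  set A := Ioc Q (2 * Q) with hA
  have hAM : ∀ q ∈ A, (q : ℝ) ≤ 2 * Q := fun q hq => by exact_mod_cast (mem_Ioc.mp hq).2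
  have hdisj := arc_disjoint (δ := δ) hAM (by nlinarith)
  have hAq : ∀ p ∈ fracs A, (Q : ℝ) + 1 ≤ p.1 ∧ (p.1 : ℝ) ≤ 2 * Q ∧ 1 ≤ p.2 ∧ p.2 + 1 ≤ p.1 ∧
      Nat.gcd p.2 p.1 = 1 := by
    intro p hp
    obtain ⟨h1, ⟨h2, h3⟩, h4⟩ := mem_fracs.mp hp
    have h5 := mem_Ioc.mp h1
    refine ⟨by exact_mod_cast h5.1, hAM _ h1, h2, ?_, h4⟩
    rcases h3.lt_or_eq with h | h
    · exact h
    · rw [h, Nat.gcd_self] at h4; omega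
  set S := ⋃ p ∈ fracs A, arc δ p with hS
  have hmeas : ∀ p, MeasurableSet (arc δ p) := fun p => measurableSet_Icc
  have hSm : MeasurableSet S := Finset.measurableSet_biUnion _ fun p _ => hmeas p
  have hS01 : S ⊆ Set.Ioc 0 1 := by
    intro α hα
    simp only [hS, Set.mem_iUnion] at hα
    obtain ⟨p, hp, hα⟩ := hα
    obtain ⟨h1, h2, h3, h4, _⟩ := hAq p hp
    have hq0 : (0 : ℝ) < p.1 := by linarith
    rw [mem_arc, abs_le] at hα
    have h5 : 1 / (p.1 : ℝ) ≤ (p.2 : ℝ) / p.1 := by gcongr; exact_mod_cast h3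
    have h6 : (p.2 : ℝ) / p.1 ≤ 1 - 1 / p.1 := by
      rw [le_sub_iff_add_le, ← add_div, div_le_one hq0]; exact_mod_cast h4
    have h7 : δ < 1 / (p.1 : ℝ) := by
      rw [lt_div_iff₀ hq0]
      nlinarith
    exact ⟨by linarith, by linarith⟩
  have hSdis : Disjoint S (majorSet k ((N : ℝ) ^ (1 / 6 : ℝ)) N) := by
    rw [hroot, Set.disjoint_left]
    rintro α hα ⟨q', hq'1, hq'Q, a', ha'⟩
    simp only [hS, Set.mem_iUnion] at hα
    obtain ⟨⟨q, a⟩, hp, hα⟩ := hα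
    obtain ⟨h1, h2, h3, h4, h5⟩ := hAq _ hp
    rw [mem_arc] at hα
    dsimp only at *
    have hq0 : (0 : ℝ) < q := by linarith
    have hq'0 : (0 : ℝ) < q' := by exact_mod_cast hq'1
    have hne : (a * q' - a' * q : ℤ) ≠ 0 := by
      intro h0
      have h6 : (q : ℤ) ∣ a * q' := ⟨a', by linarith⟩
      have h7 : (q : ℤ) ∣ q' := by
        refine IsCoprime.dvd_of_dvd_mul_left ?_ h6
        exact Nat.isCoprime_iff_coprime.mpr (Nat.Coprime.symm h5)
      have h8 : q ≤ q' := Nat.le_of_dvd (by omega) (by exact_mod_cast h7)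
      have : (q : ℝ) ≤ q' := by exact_mod_cast h8
      linarith
    have h6 : (1 : ℝ) ≤ |((a * q' - a' * q : ℤ) : ℝ)| := by exact_mod_cast Int.one_le_abs hne
    have h7 : ((a * q' - a' * q : ℤ) : ℝ) = q * (q' * α - a') - q' * q * (α - a / q) := by
      push_cast; field_simp; ring
    rw [h7] at h6
    have h8 := abs_sub ((q : ℝ) * (q' * α - a')) (q' * q * (α - a / q))
    rw [abs_mul, abs_mul, abs_mul, Nat.abs_cast, Nat.abs_cast] at h8
    have h9 : (Q : ℝ) / (N : ℝ) ^ k = 16 * Q * δ := by rw [hδ]; field_simp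
    have h10 : (q : ℝ) * |q' * α - a'| ≤ 2 * Q * (16 * Q * δ) := by
      rw [← h9]; gcongr
    have h11 : (q' : ℝ) * q * |α - a / q| ≤ Q * (2 * Q) * δ := by gcongr
    nlinarith
  have hcont : Continuous fun α => ‖fset k (Icc 1 N) α‖ := (continuous_fset _ _).norm
  have hint : ∀ p, IntegrableOn (fun α => ‖fset k (Icc 1 N) α‖ ^ s₀) (arc δ p) := fun p =>
    (hcont.pow s₀).integrableOn_Icc
  have hk0 : (0 : ℝ) < k := by exact_mod_cast (by omega : 0 < k)
  have hpt : ∀ p ∈ fracs A, ∀ α ∈ arc δ p, (‖gaussSum k p.1 p.2‖ / p.1) ^ s₀ ≤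
      (4 / (N : ℝ)) ^ s₀ * (‖fset k (Icc 1 N) α‖ ^ s₀ + (9 * Q) ^ s₀) := by
    intro p hp α hα
    obtain ⟨h1, h2, h3, h4, h5⟩ := hAq p hp
    have hq0 : (0 : ℝ) < p.1 := by linarith
    rw [mem_arc] at hα
    set β := α - (p.2 : ℝ) / p.1 with hβ
    have hαβ : α = (p.2 : ℝ) / p.1 + β := by rw [hβ]; ring
    have hn : N ^ k < (N + 1) ^ k := Nat.pow_lt_pow_left (by omega) (by omega)
    have happ := norm_fset_sub_le (by omega : 1 ≤ k) (by exact_mod_cast hq0 : 1 ≤ p.1) p.2 hn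
      le_rfl β
    rw [← hαβ] at happ
    have hNβ : ((N ^ k : ℕ) : ℝ) * |β| ≤ 1 / 16 := by
      push_cast
      calc (N : ℝ) ^ k * |β| ≤ (N : ℝ) ^ k * δ := by gcongr
        _ = 1 / 16 := by rw [hδ]; field_simp
    have hv := norm_vsum_ge (a := 1 / k) (by positivity)
      (by rw [div_le_one hk0]; exact_mod_cast (by omega : 1 ≤ k)) (N ^ k) (β := β) (by linarith)
    have hNroot : ((N ^ k : ℕ) : ℝ) ^ (1 / k : ℝ) = N := by
      push_cast
      rw [← Real.rpow_natCast, ← Real.rpow_mul hN0.le, mul_one_div_cancel hk0.ne', Real.rpow_one]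
    rw [hNroot] at hv
    have herr : 3 * (p.1 : ℝ) * (1 + 7 * ((N ^ k : ℕ) : ℝ) * |β|) ≤ 9 * Q := by
      have : 1 + 7 * ((N ^ k : ℕ) : ℝ) * |β| ≤ 3 / 2 := by linarith
      calc _ ≤ 3 * (2 * (Q : ℝ)) * (3 / 2) := by gcongr
        _ = _ := by ring
    have h6 : ‖(p.1 : ℂ)⁻¹ * gaussSum k p.1 p.2 * vsum (1 / k) (N ^ k) β‖ ≤
        ‖fset k (Icc 1 N) α‖ + 9 * Q := by
      have := norm_sub_norm_le ((p.1 : ℂ)⁻¹ * gaussSum k p.1 p.2 * vsum (1 / k) (N ^ k) β)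
        (fset k (Icc 1 N) α)
      rw [norm_sub_rev] at this
      linarith
    rw [norm_mul, norm_mul, norm_inv, Complex.norm_natCast, inv_mul_eq_div] at h6
    have h7 : ‖gaussSum k p.1 p.2‖ / p.1 ≤ 2 / N * (‖fset k (Icc 1 N) α‖ + 9 * Q) := by
      rw [div_mul_eq_mul_div, le_div_iff₀ hN0]
      calc _ ≤ ‖gaussSum k p.1 p.2‖ / p.1 * (2 * ‖vsum (1 / k) (N ^ k) β‖) := by gcongr
        _ ≤ _ := by linarith
    calc _ ≤ (2 / N * (‖fset k (Icc 1 N) α‖ + 9 * Q)) ^ s₀ := by gcongr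
      _ = (2 / N) ^ s₀ * (‖fset k (Icc 1 N) α‖ + 9 * Q) ^ s₀ := mul_pow _ _ _
      _ ≤ (2 / N) ^ s₀ * (2 ^ (s₀ - 1) * (‖fset k (Icc 1 N) α‖ ^ s₀ + (9 * Q) ^ s₀)) := by
          gcongr
          exact add_pow_le (norm_nonneg _) (by positivity) s₀
      _ ≤ (2 / N) ^ s₀ * (2 ^ s₀ * (‖fset k (Icc 1 N) α‖ ^ s₀ + (9 * Q) ^ s₀)) := by
          gcongr
          · norm_num
          · omega
      _ = _ := by
          rw [← mul_assoc, ← mul_pow]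
          congr 2
          ring
  have hvol : ∀ p, volume.real (arc δ p) = 2 * δ := by
    intro p
    rw [arc, Real.volume_real_Icc, max_eq_left (by linarith)]
    ring
  have hparc : ∀ p ∈ fracs A, (‖gaussSum k p.1 p.2‖ / p.1) ^ s₀ * (2 * δ) ≤
      (4 / (N : ℝ)) ^ s₀ * ((∫ α in arc δ p, ‖fset k (Icc 1 N) α‖ ^ s₀) +
        (9 * Q) ^ s₀ * (2 * δ)) := by
    intro p hp
    have hfin : volume (arc δ p) ≠ ⊤ := by simp [arc]
    have h1 : ∫ _ in arc δ p, (‖gaussSum k p.1 p.2‖ / p.1) ^ s₀ ≤ ∫ α in arc δ p,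
        (4 / (N : ℝ)) ^ s₀ * (‖fset k (Icc 1 N) α‖ ^ s₀ + (9 * Q) ^ s₀) := by
      refine setIntegral_mono_on (integrableOn_const hfin) ?_ (hmeas p) (hpt p hp)
      exact ((hint p).add (integrableOn_const hfin)).const_mul _
    rw [integral_const_mul, integral_add (hint p) (integrableOn_const hfin), setIntegral_const,
      setIntegral_const, hvol, smul_eq_mul, smul_eq_mul] at h1
    calc _ = 2 * δ * (‖gaussSum k p.1 p.2‖ / p.1) ^ s₀ := by ring
      _ ≤ _ := h1
      _ = _ := by ring
  have hsum := sum_le_sum hparc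
  rw [← sum_mul, ← mul_sum, sum_add_distrib, sum_const, nsmul_eq_mul,
    ← integral_biUnion_finset _ (fun p _ => hmeas p) hdisj (fun p _ => hint p),
    sum_fracs_eq] at hsum
  have hSint := H N hN1 S hSm hS01 hSdis
  have hcard : (#(fracs A) : ℝ) ≤ 2 * (Q : ℝ) ^ 2 := by
    have h1 := card_fracs_le (A := A) (M := 2 * Q) fun q hq => (mem_Ioc.mp hq).2
    rw [hA, Nat.card_Ioc, (by omega : 2 * Q - Q = Q)] at h1
    calc (#(fracs A) : ℝ) ≤ ((Q * (2 * Q) : ℕ) : ℝ) := by exact_mod_cast h1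
      _ = _ := by push_cast; ring
  have hmain : ∑ q ∈ A, sterm k s₀ q ≤ (4 / (N : ℝ)) ^ s₀ *
      (8 * (N : ℝ) ^ k * (C * (N : ℝ) ^ ((s₀ : ℝ) - k - c)) + 2 * (Q : ℝ) ^ 2 * (9 * Q) ^ s₀) := by
    have h2δ : 0 < 2 * δ := by positivity
    refine le_of_mul_le_mul_right (hsum.trans ?_) h2δ
    rw [mul_assoc _ _ (2 * δ)]
    refine mul_le_mul_of_nonneg_left ?_ (by positivity)
    have h1 : 8 * (N : ℝ) ^ k * (2 * δ) = 1 := by rw [← hδN]; ring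
    calc _ ≤ C * (N : ℝ) ^ ((s₀ : ℝ) - k - c) + 2 * (Q : ℝ) ^ 2 * ((9 * Q) ^ s₀ * (2 * δ)) := by
          gcongr
      _ = 8 * (N : ℝ) ^ k * (2 * δ) * (C * (N : ℝ) ^ ((s₀ : ℝ) - k - c)) +
          2 * (Q : ℝ) ^ 2 * ((9 * Q) ^ s₀ * (2 * δ)) := by rw [h1, one_mul]
      _ = _ := by ring
  refine hmain.trans ?_
  have hQ1 : (1 : ℝ) ≤ Q := by linarith
  have hA1 : (4 / (N : ℝ)) ^ s₀ * (8 * (N : ℝ) ^ k * (C * (N : ℝ) ^ ((s₀ : ℝ) - k - c))) ≤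
      8 * 4 ^ s₀ * C * (Q : ℝ) ^ (-min (6 * c) 1) := by
    have h1 : (N : ℝ) ^ ((s₀ : ℝ) - k - c) = (N : ℝ) ^ s₀ / (N : ℝ) ^ k * (N : ℝ) ^ (-c) := by
      rw [sub_eq_add_neg, Real.rpow_add hN0, Real.rpow_sub hN0, Real.rpow_natCast,
        Real.rpow_natCast]
    have h2 : (N : ℝ) ^ (-c) ≤ (Q : ℝ) ^ (-min (6 * c) 1) := by
      rw [hNR, ← Real.rpow_natCast, ← Real.rpow_mul hQ0.le]
      refine Real.rpow_le_rpow_of_exponent_le hQ1 ?_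
      push_cast
      linarith [min_le_left (6 * c) 1]
    calc _ = 8 * 4 ^ s₀ * C * (N : ℝ) ^ (-c) := by rw [h1, div_pow]; field_simp
      _ ≤ _ := by gcongr
  have hA2 : (4 / (N : ℝ)) ^ s₀ * (2 * (Q : ℝ) ^ 2 * (9 * Q) ^ s₀) ≤
      2 * 36 ^ s₀ * (Q : ℝ) ^ (-min (6 * c) 1) := by
    have h1 : (4 / (N : ℝ)) ^ s₀ * (2 * (Q : ℝ) ^ 2 * (9 * Q) ^ s₀) =
        2 * 36 ^ s₀ * ((Q : ℝ) ^ 2 * (1 / (Q : ℝ) ^ 5) ^ s₀) := by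
      have : 4 / (N : ℝ) * (9 * Q) = 36 * (1 / (Q : ℝ) ^ 5) := by rw [hNR]; field_simp; norm_num
      calc _ = 2 * (Q : ℝ) ^ 2 * (4 / (N : ℝ) * (9 * Q)) ^ s₀ := by
            rw [mul_pow (4 / (N : ℝ)) (9 * (Q : ℝ)), mul_left_comm]
        _ = _ := by rw [this, mul_pow]; ring
    rw [h1]
    have h2 : (1 / (Q : ℝ) ^ 5) ^ s₀ ≤ 1 / (Q : ℝ) ^ 5 :=
      pow_le_of_le_one (by positivity)
        (by rw [div_le_one (by positivity)]; exact one_le_pow₀ hQ1) (by omega)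
    have h3 : (Q : ℝ) ^ 2 * (1 / (Q : ℝ) ^ 5) ≤ (Q : ℝ) ^ (-1 : ℝ) := by
      rw [Real.rpow_neg_one, mul_one_div, inv_eq_one_div, div_le_div_iff₀ (by positivity) hQ0]
      have : (Q : ℝ) ^ 2 * Q = (Q : ℝ) ^ 3 := by ring
      rw [this, one_mul]
      exact pow_le_pow_right₀ hQ1 (by norm_num)
    have h4 : (Q : ℝ) ^ (-1 : ℝ) ≤ (Q : ℝ) ^ (-min (6 * c) 1) :=
      Real.rpow_le_rpow_of_exponent_le hQ1 (by linarith [min_le_right (6 * c) 1])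
    have h5 : (Q : ℝ) ^ 2 * (1 / (Q : ℝ) ^ 5) ^ s₀ ≤ (Q : ℝ) ^ 2 * (1 / (Q : ℝ) ^ 5) := by gcongr
    have h6 := h5.trans (h3.trans h4)
    gcongr
  rw [mul_add]
  linarith

lemma summable_sterm {k s₀ : ℕ} (hk : 2 ≤ k) (hs : 1 ≤ s₀) {c C : ℝ} (hc : 0 < c) (hC : 0 ≤ C)
    (H : ∀ N : ℕ, 1 ≤ N → ∀ S : Set ℝ, MeasurableSet S →
      S ⊆ Set.Ioc 0 1 → Disjoint S (majorSet k ((N : ℝ) ^ (1 / 6 : ℝ)) N) →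
      ∫ α in S, ‖fset k (Icc 1 N) α‖ ^ s₀ ≤ C * (N : ℝ) ^ ((s₀ : ℝ) - k - c)) :
    Summable (sterm k s₀) := by
  set m := min (6 * c) 1 with hm
  have hm0 : 0 < m := lt_min (by linarith) one_pos
  set K : ℝ := 8 * 4 ^ s₀ * C + 2 * 36 ^ s₀ with hK
  have hK0 : 0 ≤ K := by positivity
  set r : ℝ := (2 : ℝ) ^ (-m) with hr
  have hr0 : 0 ≤ r := by positivity
  have hr1 : r < 1 := Real.rpow_lt_one_of_one_lt_of_neg (by norm_num) (by linarith)
  have hind : ∀ j : ℕ, ∑ q ∈ range (2 ^ (j + 1) + 1), sterm k s₀ q ≤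
      ∑ q ∈ range 3, sterm k s₀ q + K * ∑ i ∈ range j, r ^ (i + 1) := by
    intro j
    induction j with
    | zero => simp
    | succ j ih =>
      have h2 : 2 ≤ 2 ^ (j + 1) := by
        calc 2 = 2 ^ 1 := rfl
          _ ≤ 2 ^ (j + 1) := Nat.pow_le_pow_right (by norm_num) (by omega)
      have h1 := sterm_dyadic hk hs hC H h2
      have h3 : ((2 ^ (j + 1) : ℕ) : ℝ) ^ (-m) = r ^ (j + 1) := by
        push_cast
        rw [hr, ← Real.rpow_natCast, ← Real.rpow_natCast, ← Real.rpow_mul (by norm_num),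
          ← Real.rpow_mul (by norm_num), mul_comm]
      rw [h3] at h1
      have h4 : Ioc (2 ^ (j + 1)) (2 * 2 ^ (j + 1)) =
          Ico (2 ^ (j + 1) + 1) (2 ^ (j + 1 + 1) + 1) := by
        ext x
        rw [mem_Ioc, mem_Ico, pow_succ 2 (j + 1)]
        omega
      rw [h4] at h1
      have h5 := sum_range_add_sum_Ico (sterm k s₀)
        (by rw [pow_succ 2 (j + 1)]; omega : 2 ^ (j + 1) + 1 ≤ 2 ^ (j + 1 + 1) + 1)
      rw [← h5, sum_range_succ _ j, mul_add]
      linarith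
  refine summable_of_sum_range_le (sterm_nonneg k s₀) (c := ∑ q ∈ range 3, sterm k s₀ q +
    K * (1 - r)⁻¹) fun n => ?_
  have hn : n ≤ 2 ^ (n + 1) + 1 := by
    have := (Nat.lt_two_pow_self : n + 1 < 2 ^ (n + 1))
    omega
  calc ∑ q ∈ range n, sterm k s₀ q ≤ ∑ q ∈ range (2 ^ (n + 1) + 1), sterm k s₀ q :=
        sum_le_sum_of_subset_of_nonneg (range_subset_range.mpr hn) fun _ _ _ => sterm_nonneg _ _ _
    _ ≤ _ := hind n
    _ ≤ _ := by
      gcongr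
      calc ∑ i ∈ range n, r ^ (i + 1) ≤ ∑ i ∈ range n, r ^ i :=
            sum_le_sum fun i _ => pow_le_pow_of_le_one hr0 hr1.le (by omega)
        _ ≤ ∑' i, r ^ i := (summable_geometric_of_lt_one hr0 hr1).sum_le_tsum _
            fun i _ => by positivity
        _ = _ := tsum_geometric_of_lt_one hr0 hr1

end

section

open Finset MeasureTheory

lemma R_eq_integral {k n N : ℕ} (s : ℕ) (hn : n < (N + 1) ^ k) :
    (R s k n : ℂ) = ∫ α in (0 : ℝ)..1, fset k (Icc 1 N) α ^ s * e (-(n * α)) := by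
  have h1 : ∀ α : ℝ, fset k (Icc 1 N) α ^ s * e (-(n * α)) =
      ∑ v ∈ Fintype.piFinset (fun _ : Fin s => Icc 1 N),
        e (((∑ i, v i ^ k : ℕ) - n : ℤ) * α) := by
    intro α
    rw [fset_pow, sum_mul]
    refine sum_congr rfl fun v _ => ?_
    rw [← e_add]
    congr 1
    push_cast
    ring
  simp_rw [h1]
  rw [intervalIntegral.integral_finsetSum]
  · simp_rw [integral_e]
    rw [sum_ite, sum_const_zero, add_zero, sum_const, nsmul_one, R, Nat.subtype_card]
    intro v
    rw [mem_filter, Fintype.mem_piFinset]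
    simp only [mem_Icc]
    constructor
    · rintro ⟨h, h'⟩
      exact ⟨fun i => (h i).1, by exact_mod_cast sub_eq_zero.mp h'⟩
    · rintro ⟨h, h'⟩
      refine ⟨fun i => ⟨h i, ?_⟩, sub_eq_zero.mpr (by exact_mod_cast h')⟩
      have h2 : v i ^ k ≤ n := by
        rw [← h']
        exact single_le_sum (f := fun i => v i ^ k) (fun _ _ => Nat.zero_le _) (mem_univ i)
      exact Nat.lt_succ_iff.mp (lt_of_pow_lt_pow_left₀ k (Nat.zero_le _) (h2.trans_lt hn))
  · intro v _
    exact (continuous_e.comp (continuous_const.mul continuous_id)).intervalIntegrable _ _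

lemma fset_add_one (k : ℕ) (A : Finset ℕ) (α : ℝ) : fset k A (α + 1) = fset k A α := by
  refine sum_congr rfl fun m _ => ?_
  have : (α + 1) * (m : ℝ) ^ k = α * (m : ℝ) ^ k + ((m ^ k : ℕ) : ℤ) := by push_cast; ring
  rw [this, e_add_int]

lemma norm_pow_sub_pow_succ_le {x y : ℂ} {B : ℝ} (hx : ‖x‖ ≤ B) (hy : ‖y‖ ≤ B) (s : ℕ) :
    ‖x ^ (s + 1) - y ^ (s + 1)‖ ≤ (s + 1) * B ^ s * ‖x - y‖ := by
  have hB : 0 ≤ B := (norm_nonneg _).trans hx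
  induction s with
  | zero => simp
  | succ s ih =>
    have h1 : x ^ (s + 1 + 1) - y ^ (s + 1 + 1) =
        x ^ (s + 1) * (x - y) + (x ^ (s + 1) - y ^ (s + 1)) * y := by ring
    rw [h1]
    calc _ ≤ ‖x‖ ^ (s + 1) * ‖x - y‖ + ‖x ^ (s + 1) - y ^ (s + 1)‖ * ‖y‖ := by
          refine (norm_add_le _ _).trans ?_
          rw [norm_mul, norm_mul, norm_pow]
      _ ≤ B ^ (s + 1) * ‖x - y‖ + (s + 1) * B ^ s * ‖x - y‖ * B := by gcongr
      _ = _ := by push_cast; ring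

lemma continuous_integrand (k n N s : ℕ) :
    Continuous fun α : ℝ => fset k (Icc 1 N) α ^ s * e (-(n * α)) :=
  ((continuous_fset _ _).pow s).mul (continuous_e.comp (continuous_const.mul continuous_id).neg)

lemma norm_dissection_le {k s₀ : ℕ} (hk : 2 ≤ k) {c C : ℝ}
    (H : ∀ N : ℕ, 1 ≤ N → ∀ S : Set ℝ, MeasurableSet S →
      S ⊆ Set.Ioc 0 1 → Disjoint S (majorSet k ((N : ℝ) ^ (1 / 6 : ℝ)) N) →
      ∫ α in S, ‖fset k (Icc 1 N) α‖ ^ s₀ ≤ C * (N : ℝ) ^ ((s₀ : ℝ) - k - c))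
    {N : ℕ} {Q : ℝ} (hQ : 2 ≤ Q) (hQN : Q ^ 6 = N) (n : ℕ) :
    ‖(∫ α in (0 : ℝ)..1, fset k (Icc 1 N) α ^ s₀ * e (-(n * α))) -
      ∑ p ∈ fracs (Icc 1 ⌊Q⌋₊), ∫ α in arc (Q / (N : ℝ) ^ k) p,
        fset k (Icc 1 N) α ^ s₀ * e (-(n * α))‖ ≤ C * (N : ℝ) ^ ((s₀ : ℝ) - k - c) := by
  have hQ0 : 0 < Q := by linarith
  have hN0 : (0 : ℝ) < N := by rw [← hQN]; positivity
  have hN1 : 1 ≤ N := by exact_mod_cast hN0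
  have hroot : (N : ℝ) ^ (1 / 6 : ℝ) = Q := by
    rw [← hQN, ← Real.rpow_natCast, ← Real.rpow_mul hQ0.le]; norm_num
  have hNk : Q ^ 12 ≤ (N : ℝ) ^ k := by
    rw [← hQN, ← pow_mul]
    exact pow_le_pow_right₀ (by linarith) (by omega)
  have hQ12 : 256 * Q ^ 4 ≤ Q ^ 12 := by
    have : (2 : ℝ) ^ 8 ≤ Q ^ 8 := pow_le_pow_left₀ (by norm_num) hQ 8
    nlinarith [sq_nonneg (Q ^ 2)]
  have hNk0 : (0 : ℝ) < (N : ℝ) ^ k := by positivity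
  set w := Q / (N : ℝ) ^ k with hw
  have hw0 : 0 < w := by positivity
  have hwN : w * (N : ℝ) ^ k = Q := by rw [hw]; field_simp
  have hwQ : 256 * (Q ^ 3 * w) ≤ 1 := by
    refine le_of_mul_le_mul_right ?_ hQ0
    calc 256 * (Q ^ 3 * w) * Q = w * (256 * Q ^ 4) := by ring
      _ ≤ w * (N : ℝ) ^ k := by gcongr; exact hQ12.trans hNk
      _ = 1 * Q := by rw [hwN, one_mul]
  have hwQ2 : 128 * (Q ^ 2 * w) ≤ 1 := by
    have : 2 * (Q ^ 2 * w) ≤ Q * (Q ^ 2 * w) := by gcongr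
    nlinarith
  have hwQ1 : 64 * (Q * w) ≤ 1 := by
    have : 2 * (Q * w) ≤ Q * (Q * w) := by gcongr
    nlinarith
  set A := Icc 1 ⌊Q⌋₊ with hA
  have hAM : ∀ q ∈ A, (q : ℝ) ≤ Q := fun q hq =>
    (Nat.le_floor_iff hQ0.le).mp (mem_Icc.mp hq).2
  have hdisj := arc_disjoint hAM (δ := w) (by nlinarith)
  set F : ℝ → ℂ := fun α => fset k (Icc 1 N) α ^ s₀ * e (-(n * α)) with hF
  have hFc : Continuous F := continuous_integrand k n N s₀
  have hFn : ∀ α, ‖F α‖ = ‖fset k (Icc 1 N) α‖ ^ s₀ := fun α => by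
    simp only [hF]; rw [norm_mul, norm_pow, norm_e, mul_one]
  have hper : Function.Periodic F 1 := by
    intro α
    simp only [hF]
    rw [fset_add_one]
    congr 1
    have : -((n : ℝ) * (α + 1)) = -(n * α) + ((-n : ℤ) : ℝ) := by push_cast; ring
    rw [this, e_add_int]
  have hshift : ∫ α in (0 : ℝ)..1, F α = ∫ α in Set.Ioc w (w + 1), F α := by
    rw [← intervalIntegral.integral_of_le (by linarith)]
    have := hper.intervalIntegral_add_eq 0 w
    rwa [zero_add] at this
  have hmeas : ∀ p, MeasurableSet (arc w p) := fun p => measurableSet_Icc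
  set U := ⋃ p ∈ fracs A, arc w p with hU
  have hUm : MeasurableSet U := Finset.measurableSet_biUnion _ fun p _ => hmeas p
  have hUI : U ⊆ Set.Ioc w (w + 1) := by
    intro α hα
    simp only [hU, Set.mem_iUnion] at hα
    obtain ⟨⟨q, a⟩, hp, hα⟩ := hα
    obtain ⟨h1, ⟨h2, h3⟩, h4⟩ := mem_fracs.mp hp
    rw [mem_arc, abs_le] at hα
    dsimp only at *
    have hq0 : (0 : ℝ) < q := by exact_mod_cast (by omega : 0 < q)
    have h5 : 1 / Q ≤ (a : ℝ) / q := by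
      gcongr
      · exact_mod_cast h2
      · exact hAM q h1
    have h6 : (a : ℝ) / q ≤ 1 := by rw [div_le_one hq0]; exact_mod_cast h3
    have h7 : 2 * w < 1 / Q := by
      rw [lt_div_iff₀ hQ0]
      nlinarith
    exact ⟨by linarith, by linarith⟩
  have hsum : ∑ p ∈ fracs A, ∫ α in arc w p, F α = ∫ α in U, F α := by
    rw [integral_biUnion_finset _ (fun p _ => hmeas p) hdisj]
    exact fun p _ => hFc.integrableOn_Icc
  have hdiff : (∫ α in Set.Ioc w (w + 1), F α) - ∫ α in U, F α =
      ∫ α in Set.Ioc w (w + 1) \ U, F α := by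
    rw [setIntegral_sdiff hUm hFc.integrableOn_Ioc hUI]
  rw [hshift, hsum, hdiff]
  refine (norm_integral_le_integral_norm _).trans ?_
  simp_rw [hFn]
  have hone : ∀ α, 1 < α → α ≤ w + 1 → α ∈ U := by
    intro α h1 h2
    simp only [hU, Set.mem_iUnion]
    refine ⟨⟨1, 1⟩, mem_fracs.mpr ⟨mem_Icc.mpr ⟨le_rfl, Nat.le_floor ?_⟩, by simp, by simp⟩, ?_⟩
    · push_cast; linarith
    · rw [mem_arc, abs_le]
      constructor <;> norm_num <;> linarith
  refine H N hN1 _ (measurableSet_Ioc.diff hUm) ?_ ?_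
  · rintro α ⟨⟨h1, h2⟩, h3⟩
    refine ⟨hw0.trans h1, ?_⟩
    by_contra h
    exact h3 (hone α (not_le.mp h) h2)
  · rw [hroot, Set.disjoint_left]
    rintro α ⟨⟨h1, h2⟩, h3⟩ ⟨q, hq1, hqQ, a, ha⟩
    have hα1 : α ≤ 1 := by
      by_contra h
      exact h3 (hone α (not_le.mp h) h2)
    have hq0 : (0 : ℝ) < q := by exact_mod_cast hq1
    have hq1' : (1 : ℝ) ≤ q := by exact_mod_cast hq1
    have h4 : |α - a / q| ≤ w := by
      have : (q : ℝ) * |α - a / q| = |q * α - a| := by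
        conv_lhs => rw [← abs_of_pos hq0, ← abs_mul, abs_of_pos hq0]
        congr 1
        field_simp
      have h5 : 1 * |α - a / q| ≤ (q : ℝ) * |α - a / q| := by gcongr
      linarith
    rw [abs_le] at h4
    have ha1 : 0 < a := by
      have h5 : (0 : ℝ) < a / q := by linarith
      have h6 := mul_pos h5 hq0
      rw [div_mul_cancel₀ _ hq0.ne'] at h6
      exact_mod_cast h6
    have haq : a ≤ q := by
      have h5 : (a : ℝ) / q ≤ 1 + w := by linarith
      rw [div_le_iff₀ hq0] at h5
      have h6 : w * q ≤ w * Q := by gcongr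
      have h7 : (a : ℝ) < q + 1 := by nlinarith
      have : a < q + 1 := by exact_mod_cast h7
      omega
    lift a to ℕ using ha1.le
    have ha1' : 0 < a := by exact_mod_cast ha1
    have haq' : a ≤ q := by exact_mod_cast haq
    have hg : 0 < Nat.gcd a q := Nat.gcd_pos_of_pos_left _ ha1'
    have hgR : (Nat.gcd a q : ℝ) ≠ 0 := by exact_mod_cast hg.ne'
    apply h3
    simp only [hU, Set.mem_iUnion]
    refine ⟨⟨q / Nat.gcd a q, a / Nat.gcd a q⟩, mem_fracs.mpr ⟨mem_Icc.mpr ⟨?_, ?_⟩, ⟨?_, ?_⟩, ?_⟩, ?_⟩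
    · exact Nat.div_pos (Nat.gcd_le_right _ hq1) hg
    · exact (Nat.div_le_self _ _).trans (Nat.le_floor hqQ)
    · exact Nat.div_pos (Nat.gcd_le_left _ ha1') hg
    · exact Nat.div_le_div_right haq'
    · exact Nat.coprime_div_gcd_div_gcd hg
    · rw [mem_arc, abs_le]
      dsimp only
      rw [Nat.cast_div (Nat.gcd_dvd_left _ _) hgR, Nat.cast_div (Nat.gcd_dvd_right _ _) hgR,
        div_div_div_cancel_right₀ hgR]
      simpa using h4

end

section

open Finset MeasureTheory

/-- The term of the singular series attached to a fraction. -/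
noncomputable def gterm (k s n : ℕ) (p : Σ _ : ℕ, ℕ) : ℂ :=
  ((p.1 : ℂ)⁻¹ * gaussSum k p.1 p.2) ^ s * e (-((n * p.2 : ℕ) : ℝ) / p.1)

lemma norm_gterm (k s n : ℕ) (p : Σ _ : ℕ, ℕ) :
    ‖gterm k s n p‖ = (‖gaussSum k p.1 p.2‖ / p.1) ^ s := by
  rw [gterm, norm_mul, norm_e, mul_one, norm_pow, norm_mul, norm_inv, Complex.norm_natCast,
    inv_mul_eq_div]

lemma continuous_vsum_pow (a : ℝ) (n s : ℕ) :
    Continuous fun β => vsum a n β ^ s * e (-(n * β)) :=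
  ((continuous_vsum a n).pow s).mul (continuous_e.comp (continuous_const.mul continuous_id).neg)

lemma norm_vsum_tail_le {a : ℝ} (ha : 0 < a) (ha1 : a ≤ 1) {s : ℕ} (hs : 1 < s * a) (n : ℕ)
    {w : ℝ} (hw : 0 < w) (hw2 : w ≤ 1 / 2) :
    ‖(∫ β in (0 : ℝ)..1, vsum a n β ^ s * e (-(n * β))) -
      ∫ β in (-w)..w, vsum a n β ^ s * e (-(n * β))‖ ≤
      2 * (2 ^ s / (s * a - 1)) * w ^ (1 - s * a) := by
  set g : ℝ → ℂ := fun β => vsum a n β ^ s * e (-(n * β)) with hg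
  have hgc : Continuous g := continuous_vsum_pow a n s
  have hgi : ∀ x y, IntervalIntegrable g volume x y := fun x y => hgc.intervalIntegrable x y
  have hper : Function.Periodic g 1 := by
    intro β
    simp only [hg]
    have h1 : β + 1 = β + ((1 : ℤ) : ℝ) := by push_cast; ring
    have h2 : -((n : ℝ) * (β + 1)) = -(n * β) + ((-n : ℤ) : ℝ) := by push_cast; ring
    rw [h2, e_add_int, h1, vsum_add_int]
  have hshift : ∫ β in (0 : ℝ)..1, g β = ∫ β in (-(1 / 2) : ℝ)..(1 / 2), g β := by
    have := hper.intervalIntegral_add_eq 0 (-(1 / 2))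
    rw [zero_add] at this
    rw [this]
    norm_num
  have hsplit : (∫ β in (-(1 / 2) : ℝ)..(1 / 2), g β) - ∫ β in (-w)..w, g β =
      (∫ β in w..(1 / 2), g (-β)) + ∫ β in w..(1 / 2), g β := by
    rw [intervalIntegral.integral_comp_neg,
      ← intervalIntegral.integral_add_adjacent_intervals (hgi (-(1 / 2)) (-w)) (hgi (-w) (1 / 2)),
      ← intervalIntegral.integral_add_adjacent_intervals (hgi (-w) w) (hgi w (1 / 2))]
    ring
  have hbound : ∀ β : ℝ, β ≠ 0 → |β| ≤ 1 / 2 → ‖g β‖ ≤ 2 ^ s * |β| ^ (-(s * a)) := by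
    intro β h0 h1
    simp only [hg]
    rw [norm_mul, norm_e, mul_one, norm_pow]
    calc _ ≤ (2 * |β| ^ (-a)) ^ s := by gcongr; exact norm_vsum_le_rpow ha ha1 n h0 h1
      _ = _ := by
        rw [mul_pow, ← Real.rpow_mul_natCast (abs_nonneg _)]
        congr 2
        ring
  have h0 : (0 : ℝ) ∉ Set.uIcc w (1 / 2) := by
    rw [Set.uIcc_of_le hw2, Set.mem_Icc]
    intro h
    linarith [h.1]
  have hrint : IntervalIntegrable (fun β : ℝ => 2 ^ s * β ^ (-(s * a))) volume w (1 / 2) :=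
    (intervalIntegral.intervalIntegrable_rpow (Or.inr h0)).const_mul _
  have hval : ∫ β in w..(1 / 2), (2 : ℝ) ^ s * β ^ (-(s * a)) ≤
      2 ^ s / (s * a - 1) * w ^ (1 - s * a) := by
    have h1 : 0 < s * a - 1 := by linarith
    have h2 : -(s * a) + 1 = 1 - s * a := by ring
    have h3 : ((1 / 2 : ℝ) ^ (1 - s * a) - w ^ (1 - s * a)) / (1 - s * a) =
        (w ^ (1 - s * a) - (1 / 2 : ℝ) ^ (1 - s * a)) / (s * a - 1) := by
      rw [← neg_div_neg_eq, neg_sub, neg_sub]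
    rw [intervalIntegral.integral_const_mul, integral_rpow (Or.inr ⟨by linarith, h0⟩), h2, h3,
      div_mul_eq_mul_div, mul_div_assoc]
    gcongr
    linarith [Real.rpow_nonneg (by norm_num : (0 : ℝ) ≤ 1 / 2) (1 - s * a)]
  have hA : ‖∫ β in w..(1 / 2), g (-β)‖ ≤ 2 ^ s / (s * a - 1) * w ^ (1 - s * a) := by
    refine (intervalIntegral.norm_integral_le_of_norm_le hw2 ?_ hrint).trans hval
    refine Filter.Eventually.of_forall fun β hβ => ?_
    have hβ0 : 0 < β := hw.trans hβ.1
    have := hbound (-β) (by linarith [hβ0] : -β < 0).ne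
      (by rw [abs_neg, abs_of_pos hβ0]; exact hβ.2)
    rwa [abs_neg, abs_of_pos hβ0] at this
  have hB : ‖∫ β in w..(1 / 2), g β‖ ≤ 2 ^ s / (s * a - 1) * w ^ (1 - s * a) := by
    refine (intervalIntegral.norm_integral_le_of_norm_le hw2 ?_ hrint).trans hval
    refine Filter.Eventually.of_forall fun β hβ => ?_
    have hβ0 : 0 < β := hw.trans hβ.1
    have := hbound β hβ0.ne' (by rw [abs_of_pos hβ0]; exact hβ.2)
    rwa [abs_of_pos hβ0] at this
  rw [hshift, hsplit]
  refine (norm_add_le _ _).trans ?_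
  linarith

lemma norm_arc_integral_sub_le {k t n N : ℕ} (hk : 1 ≤ k) (hn : n < (N + 1) ^ k)
    (hN : N ^ k ≤ n) (hN1 : 1 ≤ N) {Q : ℝ} (hQ : 1 ≤ Q) {p : Σ _ : ℕ, ℕ} (hp1 : 1 ≤ p.1)
    (hpQ : (p.1 : ℝ) ≤ Q) :
    ‖(∫ α in arc (Q / (N : ℝ) ^ k) p, fset k (Icc 1 N) α ^ (t + 1) * e (-(n * α))) -
      gterm k (t + 1) n p * ∫ β in (-(Q / (N : ℝ) ^ k))..(Q / (N : ℝ) ^ k),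
        vsum (1 / k) n β ^ (t + 1) * e (-(n * β))‖ ≤
      48 * 2 ^ k * 2 ^ t * (t + 1) * (Q ^ 3 * ((N : ℝ) ^ t / (N : ℝ) ^ k)) := by
  have hN0 : (1 : ℝ) ≤ N := by exact_mod_cast hN1
  have hk0 : (0 : ℝ) < k := by exact_mod_cast hk
  have hNk0 : (0 : ℝ) < (N : ℝ) ^ k := by positivity
  have hq0 : (0 : ℝ) < p.1 := by exact_mod_cast hp1
  set w := Q / (N : ℝ) ^ k with hw
  have hw0 : 0 < w := by positivity
  have hnw : (n : ℝ) * w ≤ 2 ^ k * Q := by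
    have h1 : (n : ℝ) ≤ (2 * N) ^ k := by
      calc (n : ℝ) ≤ ((N : ℝ) + 1) ^ k := by exact_mod_cast hn.le
        _ ≤ _ := by gcongr; linarith
    calc (n : ℝ) * w ≤ (2 * N) ^ k * w := by gcongr
      _ = _ := by rw [hw, mul_pow]; field_simp
  set G : ℝ → ℂ := fun α => (p.1 : ℂ)⁻¹ * gaussSum k p.1 p.2 *
    vsum (1 / k) n (α - (p.2 : ℝ) / p.1) with hG
  have hGc : Continuous G := continuous_const.mul ((continuous_vsum _ _).comp
    (continuous_id.sub continuous_const))
  have hec : Continuous fun α : ℝ => e (-(n * α)) :=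
    continuous_e.comp (continuous_const.mul continuous_id).neg
  have hGn : ∀ α, ‖G α‖ ≤ 2 * N := by
    intro α
    simp only [hG]
    rw [norm_mul, norm_mul, norm_inv, Complex.norm_natCast, inv_mul_eq_div]
    have h1 : ‖gaussSum k p.1 p.2‖ / p.1 ≤ 1 := (div_le_one hq0).mpr (norm_gaussSum_le _ _ _)
    have h2 : ‖vsum (1 / k) n (α - (p.2 : ℝ) / p.1)‖ ≤ 2 * N := by
      refine (norm_vsum_le (by positivity)
        (by rw [div_le_one hk0]; exact_mod_cast hk) _ _).trans ?_
      calc ((n : ℝ) + 1) ^ (1 / k : ℝ) ≤ (((N : ℝ) + 1) ^ k) ^ (1 / k : ℝ) := by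
            gcongr
            exact_mod_cast hn
        _ = N + 1 := by
            rw [← Real.rpow_natCast, ← Real.rpow_mul (by positivity),
              mul_one_div_cancel hk0.ne', Real.rpow_one]
        _ ≤ _ := by linarith
    calc _ ≤ 1 * (2 * (N : ℝ)) := by gcongr
      _ = _ := one_mul _
  have hpt : ∀ α ∈ arc w p, ‖fset k (Icc 1 N) α ^ (t + 1) * e (-(n * α)) -
      G α ^ (t + 1) * e (-(n * α))‖ ≤ (t + 1) * (2 * N) ^ t * (24 * 2 ^ k * Q ^ 2) := by
    intro α hα
    rw [mem_arc] at hα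
    rw [← sub_mul, norm_mul, norm_e, mul_one]
    have h1 := norm_fset_sub_le hk hp1 p.2 hn hN (α - (p.2 : ℝ) / p.1)
    rw [add_sub_cancel] at h1
    have h2 : ‖fset k (Icc 1 N) α - G α‖ ≤ 24 * 2 ^ k * Q ^ 2 := by
      refine h1.trans ?_
      have h3 : (n : ℝ) * |α - (p.2 : ℝ) / p.1| ≤ 2 ^ k * Q := by
        refine le_trans ?_ hnw
        gcongr
      have h4 : 1 ≤ 2 ^ k * Q := one_le_mul_of_one_le_of_one_le (one_le_pow₀ (by norm_num)) hQ
      calc _ ≤ 3 * Q * (8 * (2 ^ k * Q)) := by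
            gcongr
            linarith
        _ = _ := by ring
    refine (norm_pow_sub_pow_succ_le ?_ (hGn α) t).trans (by gcongr)
    exact (norm_fset_Icc_le k N α).trans (by linarith)
  have hint : ∫ α in arc w p, G α ^ (t + 1) * e (-(n * α)) =
      gterm k (t + 1) n p * ∫ β in (-w)..w, vsum (1 / k) n β ^ (t + 1) * e (-(n * β)) := by
    rw [arc, integral_Icc_eq_integral_Ioc, ← intervalIntegral.integral_of_le (by linarith)]
    have h1 : ∀ α, G α ^ (t + 1) * e (-(n * α)) = (fun β => gterm k (t + 1) n p *
        (vsum (1 / k) n β ^ (t + 1) * e (-(n * β)))) (α - (p.2 : ℝ) / p.1) := by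
      intro α
      have h2 : -((n : ℝ) * α) = -((n * p.2 : ℕ) : ℝ) / p.1 +
          -(n * (α - (p.2 : ℝ) / p.1)) := by
        push_cast
        field_simp
        ring
      simp only [hG, gterm]
      rw [h2, e_add, mul_pow]
      ring
    simp_rw [h1]
    rw [intervalIntegral.integral_comp_sub_right (fun β => gterm k (t + 1) n p *
        (vsum (1 / k) n β ^ (t + 1) * e (-(n * β)))), intervalIntegral.integral_const_mul]
    congr 3 <;> ring
  rw [← hint, ← integral_sub]
  · refine (norm_setIntegral_le_of_norm_le_const (by simp [arc]) hpt).trans ?_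
    rw [arc, Real.volume_real_Icc, max_eq_left (by linarith)]
    refine le_of_eq ?_
    rw [hw, mul_pow]
    field_simp
    ring
  · exact (continuous_integrand k n N (t + 1)).integrableOn_Icc
  · exact ((hGc.pow _).mul hec).integrableOn_Icc

end

section

open Finset MeasureTheory Filter Topology

lemma norm_R_sub_le {k s : ℕ} (hk : 2 ≤ k) (hsk : k < s) {c C : ℝ} (hc : 0 < c) (hC : 0 ≤ C)
    (H : ∀ N : ℕ, 1 ≤ N → ∀ S : Set ℝ, MeasurableSet S →
      S ⊆ Set.Ioc 0 1 → Disjoint S (majorSet k ((N : ℝ) ^ (1 / 6 : ℝ)) N) →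
      ∫ α in S, ‖fset k (Icc 1 N) α‖ ^ s ≤ C * (N : ℝ) ^ ((s : ℝ) - k - c))
    (hsum : Summable (sterm k s)) :
    ∃ K : ℝ, ∃ d : ℝ, 0 < d ∧ ∀ n N : ℕ, 64 ≤ N → N ^ k ≤ n → n < (N + 1) ^ k →
      ‖(R s k n : ℂ) - (∑ p ∈ fracs (Icc 1 ⌊(N : ℝ) ^ (1 / 6 : ℝ)⌋₊), gterm k s n p) *
        ((Real.Gamma (1 + 1 / k) ^ s * dcoef (s * (1 / k)) n : ℝ) : ℂ)‖ ≤
      K * (N : ℝ) ^ ((s : ℝ) - k - d) := by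
  obtain ⟨t, rfl⟩ : ∃ t, s = t + 1 := ⟨s - 1, by omega⟩
  have hk0 : (0 : ℝ) < k := by exact_mod_cast (by omega : 0 < k)
  have hskR : (k : ℝ) < (t + 1 : ℕ) := by exact_mod_cast hsk
  set s : ℕ := t + 1 with hs
  set T := ∑' q, sterm k s q with hT
  have hT0 : 0 ≤ T := tsum_nonneg (sterm_nonneg k s)
  have hb : 1 < s * (1 / k : ℝ) := by rw [mul_one_div, one_lt_div hk0]; exact hskR
  set b : ℝ := s * (1 / k : ℝ) with hbdef
  set K₁ : ℝ := 48 * 2 ^ k * 2 ^ t * (t + 1) with hK₁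
  set K₂ : ℝ := 2 * (2 ^ s / (b - 1)) with hK₂
  have hK₂0 : 0 ≤ K₂ := by
    have : 0 < b - 1 := by linarith
    positivity
  set d := min c (min (1 / 6) ((b - 1) / 6)) with hd
  have hd0 : 0 < d := by
    refine lt_min hc (lt_min (by norm_num) ?_)
    linarith
  refine ⟨C + K₁ + T * K₂, d, hd0, fun n N hN64 hN hn => ?_⟩
  have hN1 : 1 ≤ N := by omega
  have hNR : (64 : ℝ) ≤ N := by exact_mod_cast hN64
  have hN0 : (0 : ℝ) < N := by linarith
  have hN1R : (1 : ℝ) ≤ N := by linarith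
  set Q : ℝ := (N : ℝ) ^ (1 / 6 : ℝ) with hQ
  have hQ2 : 2 ≤ Q := by
    calc (2 : ℝ) = ((2 : ℝ) ^ (6 : ℝ)) ^ (1 / 6 : ℝ) := by
          rw [← Real.rpow_mul (by norm_num)]; norm_num
      _ ≤ Q := by
        rw [hQ]
        gcongr
        refine le_trans ?_ hNR
        norm_num
  have hQ0 : 0 < Q := by linarith
  have hQN : Q ^ 6 = N := by
    rw [hQ, ← Real.rpow_natCast, ← Real.rpow_mul hN0.le]; norm_num
  set w := Q / (N : ℝ) ^ k with hw
  have hw0 : 0 < w := by positivity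
  have hw2 : w ≤ 1 / 2 := by
    rw [hw, div_le_iff₀ (by positivity)]
    have h1 : (N : ℝ) ^ 1 ≤ (N : ℝ) ^ k := pow_le_pow_right₀ hN1R (by omega)
    have h2 : (2 : ℝ) ^ 5 ≤ Q ^ 5 := pow_le_pow_left₀ (by norm_num) hQ2 5
    rw [pow_one, ← hQN] at h1
    rw [← hQN]
    nlinarith
  set A := Icc 1 ⌊Q⌋₊ with hA
  have hAQ : ∀ q ∈ A, 1 ≤ q ∧ (q : ℝ) ≤ Q := fun q hq =>
    ⟨(mem_Icc.mp hq).1, (Nat.le_floor_iff hQ0.le).mp (mem_Icc.mp hq).2⟩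
  set J : ℂ := ((Real.Gamma (1 + 1 / k) ^ s * dcoef b n : ℝ) : ℂ) with hJ
  set Jw : ℂ := ∫ β in (-w)..w, vsum (1 / k) n β ^ s * e (-(n * β)) with hJw
  set P : (Σ _ : ℕ, ℕ) → ℂ := fun p => ∫ α in arc w p,
    fset k (Icc 1 N) α ^ s * e (-(n * α)) with hP
  have h1 : ‖(R s k n : ℂ) - ∑ p ∈ fracs A, P p‖ ≤ C * (N : ℝ) ^ ((s : ℝ) - k - d) := by
    rw [R_eq_integral s hn]
    refine (norm_dissection_le hk H hQ2 hQN n).trans ?_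
    gcongr
    exact min_le_left _ _
  have hcard : (#(fracs A) : ℝ) ≤ Q ^ 2 := by
    have h1 := card_fracs_le (A := A) (M := ⌊Q⌋₊) fun q hq => (mem_Icc.mp hq).2
    rw [hA, Nat.card_Icc, Nat.add_sub_cancel] at h1
    have h2 : (⌊Q⌋₊ : ℝ) ≤ Q := Nat.floor_le hQ0.le
    calc (#(fracs A) : ℝ) ≤ ((⌊Q⌋₊ * ⌊Q⌋₊ : ℕ) : ℝ) := by exact_mod_cast h1
      _ = (⌊Q⌋₊ : ℝ) * ⌊Q⌋₊ := by push_cast; rfl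
      _ ≤ Q * Q := by gcongr
      _ = _ := by ring
  have hexp : ∀ x : ℝ, d ≤ x → (N : ℝ) ^ ((s : ℝ) - k - x) ≤ (N : ℝ) ^ ((s : ℝ) - k - d) :=
    fun x hx => Real.rpow_le_rpow_of_exponent_le hN1R (by linarith)
  have h2 : ‖∑ p ∈ fracs A, P p - ∑ p ∈ fracs A, gterm k s n p * Jw‖ ≤
      K₁ * (N : ℝ) ^ ((s : ℝ) - k - d) := by
    rw [← sum_sub_distrib]
    have h3 : ∀ p ∈ fracs A, ‖P p - gterm k s n p * Jw‖ ≤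
        K₁ * (Q ^ 3 * ((N : ℝ) ^ t / (N : ℝ) ^ k)) := fun p hp => by
      obtain ⟨h4, h5⟩ := hAQ _ (mem_fracs.mp hp).1
      exact norm_arc_integral_sub_le (by omega) hn hN hN1 (by linarith) h4 h5
    refine (norm_sum_le_of_le _ h3).trans ?_
    rw [sum_const, nsmul_eq_mul]
    calc _ ≤ Q ^ 2 * (K₁ * (Q ^ 3 * ((N : ℝ) ^ t / (N : ℝ) ^ k))) := by gcongr
      _ = K₁ * (Q ^ 5 * ((N : ℝ) ^ t / (N : ℝ) ^ k)) := by ring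
      _ = K₁ * (N : ℝ) ^ ((s : ℝ) - k - 1 / 6) := by
        congr 1
        rw [hQ, ← Real.rpow_natCast, ← Real.rpow_mul hN0.le, ← Real.rpow_natCast,
          ← Real.rpow_natCast, ← Real.rpow_sub hN0, ← Real.rpow_add hN0]
        congr 1
        rw [hs]
        push_cast
        ring
      _ ≤ _ := by
        exact mul_le_mul_of_nonneg_left (hexp _ ((min_le_right _ _).trans (min_le_left _ _))) (by positivity)
  have hS : ‖∑ p ∈ fracs A, gterm k s n p‖ ≤ T := by
    refine (norm_sum_le _ _).trans ?_
    simp_rw [norm_gterm]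
    rw [sum_fracs_eq]
    exact hsum.sum_le_tsum _ fun i _ => sterm_nonneg k s i
  have h3 : ‖(∑ p ∈ fracs A, gterm k s n p) * (J - Jw)‖ ≤
      T * K₂ * (N : ℝ) ^ ((s : ℝ) - k - d) := by
    have h4 : ‖J - Jw‖ ≤ K₂ * w ^ (1 - b) := by
      have := norm_vsum_tail_le (a := 1 / k) (by positivity)
        (by rw [div_le_one hk0]; exact_mod_cast (by omega : 1 ≤ k)) hb n hw0 hw2
      rwa [integral_vsum_pow] at this
    have h5 : w ^ (1 - b) = (N : ℝ) ^ ((s : ℝ) - k - (b - 1) / 6) := by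
      rw [hw, hQ, ← Real.rpow_natCast, ← Real.rpow_sub hN0, ← Real.rpow_mul hN0.le]
      congr 1
      have : b * k = s := by rw [hbdef]; field_simp
      rw [← this]
      ring
    rw [norm_mul]
    calc _ ≤ T * (K₂ * w ^ (1 - b)) := by gcongr
      _ = T * K₂ * w ^ (1 - b) := by ring
      _ ≤ _ := by
        rw [h5]
        exact mul_le_mul_of_nonneg_left (hexp _ ((min_le_right _ _).trans (min_le_right _ _))) (mul_nonneg hT0 hK₂0)
  have hid : (R s k n : ℂ) - (∑ p ∈ fracs A, gterm k s n p) * J =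
      ((R s k n : ℂ) - ∑ p ∈ fracs A, P p) +
      (∑ p ∈ fracs A, P p - ∑ p ∈ fracs A, gterm k s n p * Jw) -
      (∑ p ∈ fracs A, gterm k s n p) * (J - Jw) := by
    rw [← sum_mul]
    ring
  rw [hid]
  calc _ ≤ _ := (norm_sub_le _ _).trans (add_le_add_left (norm_add_le _ _) _)
    _ ≤ _ := add_le_add (add_le_add h1 h2) h3
    _ = _ := by ring

lemma norm_singularSeries_le {k s : ℕ} (hsum : Summable (sterm k s)) (n : ℕ) :
    ‖singularSeries s k n‖ ≤ ∑' q, sterm k s q ∧ ∀ M : ℕ,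
      ‖(∑ p ∈ fracs (Icc 1 M), gterm k s n p) - singularSeries s k n‖ ≤
        ∑' q, sterm k s (q + (M + 1)) := by
  set g : ℕ → ℂ := fun q => ∑ a ∈ Icc 1 q with Nat.gcd a q = 1, gterm k s n ⟨q, a⟩ with hg
  have hgn : ∀ q, ‖g q‖ ≤ sterm k s q := fun q => by
    refine (norm_sum_le _ _).trans (le_of_eq ?_)
    exact sum_congr rfl fun a _ => norm_gterm _ _ _ _
  have hgs : Summable g := Summable.of_norm_bounded hsum hgn
  have heq : singularSeries s k n = ∑' q, g q := rfl
  refine ⟨?_, fun M => ?_⟩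
  · rw [heq]
    exact tsum_of_norm_bounded hsum.hasSum hgn
  · have h1 : ∑ p ∈ fracs (Icc 1 M), gterm k s n p = ∑ q ∈ range (M + 1), g q := by
      rw [fracs, sum_sigma, range_eq_Ico, sum_eq_sum_Ico_succ_bot (by omega)]
      have : g 0 = 0 := by simp [hg]
      rw [this, zero_add]
      rfl
    rw [h1, heq, ← hgs.sum_add_tsum_nat_add (M + 1), sub_add_cancel_left, norm_neg]
    exact tsum_of_norm_bounded ((summable_nat_add_iff (M + 1)).mpr hsum).hasSum
      fun q => hgn _

theorem asymptotic_of_minor {k s : ℕ} (hk : 2 ≤ k) (hsk : k < s) {c C : ℝ} (hc : 0 < c)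
    (hC : 0 ≤ C)
    (H : ∀ N : ℕ, 1 ≤ N → ∀ S : Set ℝ, MeasurableSet S →
      S ⊆ Set.Ioc 0 1 → Disjoint S (majorSet k ((N : ℝ) ^ (1 / 6 : ℝ)) N) →
      ∫ α in S, ‖fset k (Icc 1 N) α‖ ^ s ≤ C * (N : ℝ) ^ ((s : ℝ) - k - c)) :
    Asymptotics.IsLittleO atTop
      (fun n : ℕ => (R s k n : ℂ) -
        ((Real.Gamma (1 + 1 / k) ^ s / Real.Gamma ((s : ℝ) / k) : ℝ) : ℂ) *
          singularSeries s k n * ((n : ℝ) ^ ((s : ℝ) / k - 1) : ℝ))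
      (fun n : ℕ => (n : ℝ) ^ ((s : ℝ) / k - 1)) := by
  have hk0 : (0 : ℝ) < k := by exact_mod_cast (by omega : 0 < k)
  have hskR : (k : ℝ) < s := by exact_mod_cast hsk
  have hsum := summable_sterm hk (by omega) hc hC H
  obtain ⟨K, d, hd, hK⟩ := norm_R_sub_le hk hsk hc hC H hsum
  choose N hN hN' using exists_root (by omega : 1 ≤ k)
  have hb : (s : ℝ) * (1 / k) = s / k := mul_one_div _ _
  rw [hb] at hK
  set b : ℝ := (s : ℝ) / k with hbdef
  have hb1 : 1 < b := by rw [hbdef, one_lt_div hk0]; exact hskR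
  set γ : ℝ := Real.Gamma (1 + 1 / k) ^ s with hγ
  have hγ0 : 0 ≤ γ := by
    have := Real.Gamma_pos_of_pos (by positivity : (0 : ℝ) < 1 + 1 / k)
    positivity
  set T := ∑' q, sterm k s q with hT
  set D : ℕ → ℝ := fun n => dcoef b n / (n : ℝ) ^ (b - 1) with hD
  have hDlim : Tendsto D atTop (𝓝 (1 / Real.Gamma b)) := tendsto_dcoef (by linarith)
  have hNlim : Tendsto N atTop atTop := by
    refine tendsto_atTop.mpr fun B => ?_
    filter_upwards [eventually_ge_atTop (B ^ k)] with n hn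
    exact Nat.lt_succ_iff.mp (lt_of_pow_lt_pow_left₀ k (Nat.zero_le _) (hn.trans_lt (hN' n)))
  have hNR : Tendsto (fun n => (N n : ℝ)) atTop atTop := tendsto_natCast_atTop_atTop.comp hNlim
  set tail : ℕ → ℝ := fun M => ∑' q, sterm k s (q + (M + 1)) with htail
  have htl : Tendsto tail atTop (𝓝 0) :=
    (tendsto_sum_nat_add (sterm k s)).comp (tendsto_add_atTop_nat 1)
  set M : ℕ → ℕ := fun n => ⌊(N n : ℝ) ^ (1 / 6 : ℝ)⌋₊ with hM
  have hMlim : Tendsto M atTop atTop :=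
    tendsto_nat_floor_atTop.comp ((tendsto_rpow_atTop (by norm_num)).comp hNR)
  have hε : Tendsto (fun n => K * (N n : ℝ) ^ (-d) + tail (M n) * (γ * |D n|) +
      T * (γ * |D n - 1 / Real.Gamma b|)) atTop (𝓝 0) := by
    have h1 : Tendsto (fun n => K * (N n : ℝ) ^ (-d)) atTop (𝓝 (K * 0)) :=
      ((tendsto_rpow_neg_atTop hd).comp hNR).const_mul K
    have h2 : Tendsto (fun n => tail (M n) * (γ * |D n|)) atTop
        (𝓝 (0 * (γ * |1 / Real.Gamma b|))) :=
      (htl.comp hMlim).mul (hDlim.abs.const_mul γ)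
    have h3 : Tendsto (fun n => T * (γ * |D n - 1 / Real.Gamma b|)) atTop
        (𝓝 (T * (γ * |1 / Real.Gamma b - 1 / Real.Gamma b|))) :=
      ((hDlim.sub_const _).abs.const_mul γ).const_mul T
    have h4 := (h1.add h2).add h3
    simpa using h4
  rw [Asymptotics.isLittleO_iff]
  intro ε hε0
  filter_upwards [hε.eventually_le_const hε0, hNlim.eventually_ge_atTop 64,
    eventually_ge_atTop 1] with n h1 h2 h3
  have hn0 : (0 : ℝ) < n := by exact_mod_cast h3
  have hN0 : (0 : ℝ) < N n := by exact_mod_cast (by omega : 0 < N n)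
  set X : ℝ := (n : ℝ) ^ (b - 1) with hX
  have hX0 : 0 < X := Real.rpow_pos_of_pos hn0 _
  have hDX : dcoef b n = D n * X := by simp only [hD]; rw [div_mul_cancel₀ _ hX0.ne']
  have hA := hK n (N n) h2 (hN n) (hN' n)
  obtain ⟨hS1, hS2⟩ := norm_singularSeries_le hsum n
  have hS2 := hS2 (M n)
  set W := ∑ p ∈ fracs (Icc 1 (M n)), gterm k s n p with hW
  have hK0 : 0 ≤ K := by
    have h4 := (norm_nonneg _).trans hA
    exact nonneg_of_mul_nonneg_left h4 (Real.rpow_pos_of_pos hN0 _)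
  have hNX : (N n : ℝ) ^ ((s : ℝ) - k - d) ≤ X * (N n : ℝ) ^ (-d) := by
    rw [sub_eq_add_neg, Real.rpow_add hN0]
    gcongr
    have h4 : (N n : ℝ) ^ ((s : ℝ) - k) = ((N n : ℝ) ^ k) ^ (b - 1) := by
      rw [← Real.rpow_natCast, ← Real.rpow_mul hN0.le]
      congr 1
      rw [hbdef]
      field_simp
    rw [h4, hX]
    have h5 : (N n : ℝ) ^ k ≤ n := by exact_mod_cast hN n
    exact Real.rpow_le_rpow (by positivity) h5 (by linarith)
  have hid : (R s k n : ℂ) - ((γ / Real.Gamma b : ℝ) : ℂ) * singularSeries s k n * (X : ℂ) =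
      ((R s k n : ℂ) - W * ((γ * dcoef b n : ℝ) : ℂ)) +
      (W - singularSeries s k n) * ((γ * dcoef b n : ℝ) : ℂ) +
      singularSeries s k n * ((γ * (D n - 1 / Real.Gamma b) * X : ℝ) : ℂ) := by
    rw [hDX]
    push_cast
    ring
  rw [hid, Real.norm_of_nonneg hX0.le]
  calc _ ≤ _ := (norm_add_le _ _).trans (add_le_add_left (norm_add_le _ _) _)
    _ ≤ K * (X * (N n : ℝ) ^ (-d)) + tail (M n) * (γ * |D n| * X) +
        T * (γ * |D n - 1 / Real.Gamma b| * X) := by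
      refine add_le_add (add_le_add (hA.trans (by gcongr)) ?_) ?_
      · rw [norm_mul, Complex.norm_real, hDX, Real.norm_eq_abs, abs_mul, abs_mul, abs_of_pos hX0,
          abs_of_nonneg hγ0, mul_assoc]
        gcongr
      · rw [norm_mul, Complex.norm_real, Real.norm_eq_abs, abs_mul, abs_mul, abs_of_pos hX0,
          abs_of_nonneg hγ0]
        gcongr
    _ = (K * (N n : ℝ) ^ (-d) + tail (M n) * (γ * |D n|) +
      T * (γ * |D n - 1 / Real.Gamma b|)) * X := by ring
    _ ≤ ε * X := by gcongr

end

end Waring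

/-- The asymptotic formula in Waring's problem holds for
`s₀ ≥ k² + 1 - max_{1≤s≤k} ⌈s(k-s-1)/(k-s+1)⌉` (`k ≥ 2`). -/
theorem waring_asymptotic_improved_hua (k s₀ : ℕ) (hk : 2 ≤ k)
    (hs₀ : (k : ℤ) ^ 2 + 1 -
        (Finset.Icc 1 k).sup' (Finset.nonempty_Icc.mpr (by omega))
          (fun s : ℕ => ⌈(s : ℚ) * ((k : ℚ) - s - 1) / ((k : ℚ) - s + 1)⌉)
      ≤ (s₀ : ℤ)) :
    Asymptotics.IsLittleO Filter.atTop
      (fun n : ℕ => (R s₀ k n : ℂ) -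
        ((Real.Gamma (1 + 1 / k) ^ s₀ / Real.Gamma ((s₀ : ℝ) / k) : ℝ) : ℂ) *
          singularSeries s₀ k n * ((n : ℝ) ^ ((s₀ : ℝ) / k - 1) : ℝ))
      (fun n : ℕ => (n : ℝ) ^ ((s₀ : ℝ) / k - 1)) := by
  obtain ⟨⟨s, hs1, hsk, hs⟩, hs0⟩ := Waring.exponent_conditions hk _ hs₀
  obtain ⟨c, hc, C, hC, H⟩ := Waring.minor_power hk hs1 hsk hs hs0
  exact Waring.asymptotic_of_minor hk (by nlinarith) hc hC H
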